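/- Let n ≥ 3 and p > (n−1)/2, and let the exponents satisfy q > 2, 2 ≤ r < ∞, 2/q + (n−1)/r ≤ (n−1)/2, and σ = 1/q + n/r − (n−1)/2. There is a constant C > 0, depending only on n, p, q, r, such that for every measurable V : ℝ^n → ℂ with ‖V‖_{F^p} < ∞ and every function G : ℝ^n × ℝ → ℂ such that G(·,s) is a Schwartz function for each s, (x,s) ↦ G(x,s) is continuous, and G is compactly supported in s, ‖ (√−Δ)^{σ−1} ∫_t^∞ sin((t−s)√−Δ) G(·,s) ds ‖_{L²_{x,t}(|V|)} ≤ C ‖V‖_{F^p}^{1/2} ‖G‖_{L^{q'}_t L^{r'}_x}, where q', r' are the conjugate exponents of q, r. -/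

import Mathlib

noncomputable section

open MeasureTheory Metric Complex
open scoped ENNReal FourierTransform SchwartzMap

/-- The Fourier multiplier operator `m(√−Δ)` on `ℝⁿ`:
`m(√−Δ)h = 𝓕⁻¹(m(|ξ|) 𝓕h(ξ))`. -/
def mOp (n : ℕ) (m : ℝ → ℂ) (h : EuclideanSpace ℝ (Fin n) → ℂ) :
    EuclideanSpace ℝ (Fin n) → ℂ :=
  fun x => 𝓕⁻ (fun ξ : EuclideanSpace ℝ (Fin n) => m ‖ξ‖ * 𝓕 h ξ) x

/-- The multiplier of `e^{it√−Δ}`, i.e. `ρ ↦ e^{itρ}`. -/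
def expMult (t : ℝ) : ℝ → ℂ := fun ρ => Complex.exp (Complex.I * t * ρ)

/-- The multiplier of `cos(t√−Δ)`, i.e. `ρ ↦ cos (tρ)`. -/
def cosMult (t : ℝ) : ℝ → ℂ := fun ρ => ((Real.cos (t * ρ) : ℝ) : ℂ)

/-- The multiplier of `sin(t√−Δ)/√−Δ`, i.e. `ρ ↦ sin (tρ)/ρ`. -/
def sincMult (t : ℝ) : ℝ → ℂ := fun ρ => ((Real.sin (t * ρ) / ρ : ℝ) : ℂ)

/-- The multiplier of `sin(t√−Δ)`, i.e. `ρ ↦ sin (tρ)`. -/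
def sinMult (t : ℝ) : ℝ → ℂ := fun ρ => ((Real.sin (t * ρ) : ℝ) : ℂ)

/-- The multiplier of `(√−Δ)^γ`, i.e. `ρ ↦ ρ^γ`. -/
def powMult (γ : ℝ) : ℝ → ℂ := fun ρ => ((ρ ^ γ : ℝ) : ℂ)

/-- A function is Schwartz if it agrees pointwise with some Schwartz map. -/
def IsSchwartz {n : ℕ} (h : EuclideanSpace ℝ (Fin n) → ℂ) : Prop :=
  ∃ φ : 𝓢(EuclideanSpace ℝ (Fin n), ℂ), ∀ x, h x = φ x

/-- The Fefferman–Phong norm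
`‖V‖_{𝓕^p} = sup_{x, r>0} r^(2-n/p) (∫_{B_r(x)} |V|^p)^(1/p)`. -/
def fpNorm (n : ℕ) (p : ℝ) (V : EuclideanSpace ℝ (Fin n) → ℂ) : ℝ≥0∞ :=
  ⨆ (x : EuclideanSpace ℝ (Fin n)) (r : ℝ) (_ : 0 < r),
    ENNReal.ofReal (r ^ (2 - n / p)) *
      (∫⁻ y in ball x r, ENNReal.ofReal (‖V y‖ ^ p)) ^ (1 / p)

/-- The weak `L^{n/2}` quasinorm `sup_{λ>0} λ · |{|V| > λ}|^{2/n}`. -/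
def wkNorm (n : ℕ) (V : EuclideanSpace ℝ (Fin n) → ℂ) : ℝ≥0∞ :=
  ⨆ (l : ℝ) (_ : 0 < l),
    ENNReal.ofReal l * (volume {x : EuclideanSpace ℝ (Fin n) | l < ‖V x‖}) ^ ((2 : ℝ) / n)

/-- The mixed norm `‖F‖_{L^q_t L^r_x}` for `F : ℝⁿ × ℝ → ℂ`, curried as `F x t`. -/
def mixedNorm (n : ℕ) (q r : ℝ) (F : EuclideanSpace ℝ (Fin n) → ℝ → ℂ) : ℝ≥0∞ :=
  (∫⁻ t : ℝ, (∫⁻ x : EuclideanSpace ℝ (Fin n), (‖F x t‖₊ : ℝ≥0∞) ^ r) ^ (q / r)) ^ (1 / q)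

/-- The weighted norm `‖h‖_{L²_{x,t}(w)}` with weight `w : ℝⁿ → [0,∞]`. -/
def wtNorm (n : ℕ) (w : EuclideanSpace ℝ (Fin n) → ℝ≥0∞)
    (h : EuclideanSpace ℝ (Fin n) → ℝ → ℂ) : ℝ≥0∞ :=
  (∫⁻ t : ℝ, ∫⁻ x : EuclideanSpace ℝ (Fin n), (‖h x t‖₊ : ℝ≥0∞) ^ (2 : ℝ) * w x) ^ ((1 : ℝ) / 2)

/-- The homogeneous Sobolev norm `‖h‖_{Ḣ^γ} = ‖(√−Δ)^γ h‖_{L²}`. -/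
def sobNorm (n : ℕ) (γ : ℝ) (h : EuclideanSpace ℝ (Fin n) → ℂ) : ℝ≥0∞ :=
  eLpNorm (mOp n (powMult γ) h) 2 volume

/-- The point `x/|x|` of the unit sphere, for `x ≠ 0`. -/
def sphMap (n : ℕ) (x : EuclideanSpace ℝ (Fin n)) (hx : x ≠ 0) :
    Metric.sphere (0 : EuclideanSpace ℝ (Fin n)) 1 :=
  ⟨‖x‖⁻¹ • x, by
    rw [mem_sphere_zero_iff_norm, norm_smul, norm_inv, norm_norm,
      inv_mul_cancel₀ (norm_ne_zero_iff.mpr hx)]⟩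

/-! ### Tools -/

section tools

open Filter Topology

variable {V : Type*} [NormedAddCommGroup V] [InnerProductSpace ℝ V] [FiniteDimensional ℝ V]
  [MeasurableSpace V] [BorelSpace V]

lemma fourier_mul_flip {f g : V → ℂ} (hf : Integrable f) (hg : Integrable g) :
    ∫ ξ, 𝓕 f ξ * g ξ = ∫ x, f x * 𝓕 g x := by
  have := VectorFourier.integral_fourierIntegral_smul_eq_flip (μ := (volume : Measure V))
    (ν := (volume : Measure V)) (L := innerₗ V) (e := Real.fourierChar)
    (f := f) (g := g) Real.continuous_fourierChar (by exact continuous_inner) hf hg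
  simpa [smul_eq_mul, Real.fourier_eq, VectorFourier.fourierIntegral, real_inner_comm] using this

lemma continuous_fourier_of_integrable {f : V → ℂ} (hf : Integrable f) : Continuous (𝓕 f) :=
  VectorFourier.fourierIntegral_continuous Real.continuous_fourierChar
    (by exact continuous_inner) hf

lemma norm_fourier_le {f : V → ℂ} (ξ : V) : ‖𝓕 f ξ‖ ≤ ∫ x, ‖f x‖ :=
  VectorFourier.norm_fourierIntegral_le_integral_norm _ _ _ _ _

lemma fourier_ae_eq_L2 {f : V → ℂ} (hf : Integrable f) (h2 : MemLp f 2) :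
    (𝓕 (h2.toLp f) : Lp (α := V) ℂ 2) =ᵐ[volume] 𝓕 f := by
  refine ae_eq_of_integral_contDiff_smul_eq
    ((Lp.memLp _).locallyIntegrable (by norm_num))
    (continuous_fourier_of_integrable hf).locallyIntegrable ?_
  intro g hg hgc
  have hgc' : HasCompactSupport (fun x => (g x : ℂ)) := hgc.comp_left (g := fun r : ℝ => (r : ℂ)) (by simp)
  have hg' : ContDiff ℝ (⊤ : ℕ∞) (fun x => (g x : ℂ)) := Complex.ofRealCLM.contDiff.comp hg
  set φ : 𝓢(V, ℂ) := hgc'.toSchwartzMap hg' with hφ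
  have hφx : ∀ x, φ x = g x := fun x => rfl
  have h := congrArg (fun T : TemperedDistribution V ℂ => T φ) (Lp.fourier_toTemperedDistribution_eq (h2.toLp f))
  simp only [TemperedDistribution.fourier_apply, Lp.toTemperedDistribution_apply] at h
  have e1 : ∫ x, g x • (𝓕 (h2.toLp f) : Lp ℂ 2 (volume : Measure V)) x = ∫ x, φ x • (𝓕 (h2.toLp f) : Lp ℂ 2 (volume : Measure V)) x := by
    refine integral_congr_ae (ae_of_all _ fun x => ?_)
    simp [hφx]
  rw [e1, ← h]
  have e2 : ∫ x, (𝓕 φ) x • (h2.toLp f) x = ∫ x, f x * 𝓕 (φ : V → ℂ) x := by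
    refine integral_congr_ae ?_
    filter_upwards [h2.coeFn_toLp] with x hx
    rw [hx, SchwartzMap.fourier_coe, smul_eq_mul, mul_comm]
  rw [e2, ← fourier_mul_flip hf φ.integrable]
  refine integral_congr_ae (ae_of_all _ fun x => ?_)
  simp [hφx, mul_comm]

/-- Plancherel inequality for integrable functions -/
lemma plancherel_le {f : V → ℂ} (hf : Integrable f) :
    ∫⁻ ξ, ‖𝓕 f ξ‖ₑ ^ 2 ≤ ∫⁻ x, ‖f x‖ₑ ^ 2 := by
  by_cases h : ∫⁻ x, ‖f x‖ₑ ^ 2 = ⊤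
  · simp [h]
  have key : ∀ g : V → ℂ, ∫⁻ x, ‖g x‖ₑ ^ 2 = (eLpNorm g 2 volume) ^ 2 := by
    intro g
    rw [eLpNorm_eq_lintegral_rpow_enorm_toReal (by norm_num) (by norm_num)]
    simp only [ENNReal.toReal_ofNat, ENNReal.rpow_ofNat, one_div]
    rw [← ENNReal.rpow_natCast, ← ENNReal.rpow_mul]
    norm_num
  have h2 : MemLp f 2 := by
    refine ⟨hf.1, ?_⟩
    rw [key] at h
    by_contra hc
    simp only [not_lt, top_le_iff] at hc
    simp [hc] at h
  rw [key, key, ← eLpNorm_congr_ae (fourier_ae_eq_L2 hf h2), ← eLpNorm_congr_ae h2.coeFn_toLp]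
  have := Lp.norm_fourier_eq (h2.toLp f)
  rw [Lp.norm_def, Lp.norm_def, ENNReal.toReal_eq_toReal_iff' (Lp.eLpNorm_ne_top _) (Lp.eLpNorm_ne_top _)] at this
  rw [this]

lemma plancherel_inv_le {f : V → ℂ} (hf : Integrable f) :
    ∫⁻ ξ, ‖𝓕⁻ f ξ‖ₑ ^ 2 ≤ ∫⁻ x, ‖f x‖ₑ ^ 2 := by
  have h1 := plancherel_le hf
  calc ∫⁻ ξ, ‖𝓕⁻ f ξ‖ₑ ^ 2 = ∫⁻ ξ, ‖𝓕 f (-ξ)‖ₑ ^ 2 := by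
        simp_rw [Real.fourierInv_eq_fourier_neg]
    _ = ∫⁻ ξ, ‖𝓕 f ξ‖ₑ ^ 2 := by
        exact lintegral_neg_eq_self (fun ξ => ‖𝓕 f ξ‖ₑ ^ 2)
    _ ≤ _ := h1

/-- holomorphic dependence of integrals on a parameter -/
lemma differentiableOn_integral {α : Type*} [MeasurableSpace α] {μ : Measure α}
    {f : ℂ → α → ℂ} {U : Set ℂ} (hU : IsOpen U)
    (hmeas : ∀ z ∈ U, AEStronglyMeasurable (f z) μ)
    (hd : ∀ᵐ x ∂μ, DifferentiableOn ℂ (fun z => f z x) U)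
    (hb : ∀ z₀ ∈ U, ∃ r > 0, ∃ b : α → ℝ, Integrable b μ ∧
      ∀ᵐ x ∂μ, ∀ z ∈ ball z₀ r, z ∈ U → ‖f z x‖ ≤ b x) :
    DifferentiableOn ℂ (fun z => ∫ x, f z x ∂μ) U := by
  intro z₀ hz₀
  obtain ⟨r, hr, b, hbi, hbb⟩ := hb z₀ hz₀
  obtain ⟨r', hr', hrU⟩ := Metric.isOpen_iff.1 hU z₀ hz₀
  set ρ := min r r' / 2 with hρ
  have hρ0 : 0 < ρ := by positivity
  have hball : ∀ z ∈ ball z₀ ρ, closedBall z (ρ/2) ⊆ ball z₀ r ∩ U := by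
    intro z hz w hw
    have h1 : dist w z₀ < 2 * ρ := by
      have := dist_triangle w z z₀
      rw [mem_ball] at hz; rw [mem_closedBall] at hw
      linarith
    have h2 : 2 * ρ = min r r' := by rw [hρ]; ring
    rw [h2] at h1
    exact ⟨lt_of_lt_of_le h1 (min_le_left _ _), hrU (lt_of_lt_of_le h1 (min_le_right _ _))⟩
  have hsub : ball z₀ ρ ⊆ ball z₀ r ∩ U := fun z hz => hball z hz (mem_closedBall_self (by positivity))
  refine (hasDerivAt_integral_of_dominated_loc_of_deriv_le (F := f)
    (F' := fun z x => deriv (fun w => f w x) z) (x₀ := z₀) (s := ball z₀ ρ) (bound := fun x => b x / (ρ/2))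
    (ball_mem_nhds _ hρ0) ?_ ?_ ?_ ?_ ?_ ?_).2.differentiableAt.differentiableWithinAt
  · filter_upwards [hU.mem_nhds hz₀] with z hz using hmeas z hz
  · refine hbi.mono' (hmeas _ hz₀) ?_
    filter_upwards [hbb] with x hx using hx _ (mem_ball_self hr) hz₀
  · -- measurability of the derivative
    have hlim : Tendsto (fun n : ℕ => z₀ + ((ρ / (n + 2) : ℝ) : ℂ)) atTop (𝓝[≠] z₀) := by
      refine tendsto_nhdsWithin_iff.2 ⟨?_, ?_⟩
      · have : Tendsto (fun n : ℕ => (ρ / (n + 2) : ℝ)) atTop (𝓝 0) := by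
          refine tendsto_const_nhds.div_atTop ?_
          exact tendsto_atTop_add_const_right _ _ tendsto_natCast_atTop_atTop
        have h2 := (Complex.continuous_ofReal.tendsto 0).comp this
        have h3 := h2.const_add z₀
        simpa [Function.comp_def] using h3
      · refine Eventually.of_forall fun n => ?_
        simp only [Set.mem_compl_iff, Set.mem_singleton_iff, add_eq_left]
        have : (0:ℝ) < ρ / (n + 2) := by positivity
        exact_mod_cast this.ne'
    refine aestronglyMeasurable_of_tendsto_ae (u := atTop)
      (f := fun (n : ℕ) x => slope (fun w => f w x) z₀ (z₀ + ((ρ / (n + 2) : ℝ) : ℂ))) ?_ ?_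
    · intro n
      simp only [slope, vsub_eq_sub, smul_eq_mul]
      refine AEStronglyMeasurable.const_smul (c := (z₀ + ((ρ / (n + 2) : ℝ) : ℂ) - z₀)⁻¹) (AEStronglyMeasurable.sub (hmeas _ ?_) (hmeas _ hz₀))
      refine (hsub ?_).2
      simp only [mem_ball, dist_self_add_left, Complex.norm_real, Real.norm_eq_abs]
      rw [abs_of_nonneg (by positivity), div_lt_iff₀ (by positivity)]
      have : (0:ℝ) ≤ n := by positivity
      nlinarith
    · filter_upwards [hd] with x hx
      have := (hx.differentiableAt (hU.mem_nhds hz₀)).hasDerivAt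
      exact (hasDerivAt_iff_tendsto_slope.1 this).comp hlim
  · filter_upwards [hbb, hd] with x hx hdx z hz
    refine Complex.norm_deriv_le_of_forall_mem_sphere_norm_le (by positivity) ?_ ?_
    · refine DifferentiableOn.diffContOnCl ?_
      refine hdx.mono ?_
      rw [closure_ball _ (by positivity)]
      exact fun w hw => (hball z hz hw).2
    · intro w hw
      have := hball z hz (sphere_subset_closedBall hw)
      exact hx w this.1 this.2
  · exact hbi.div_const _
  · filter_upwards [hd] with x hx z hz
    exact (hx.differentiableAt (hU.mem_nhds (hsub hz).2)).hasDerivAt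

/-- three lines theorem, evaluated at a real point -/
lemma three_lines {f : ℂ → ℂ} {U : Set ℂ} (_hU : IsOpen U)
    (hsub : ∀ z : ℂ, 0 ≤ z.re → z.re ≤ 1 → z ∈ U) (hd : DifferentiableOn ℂ f U) {M a b : ℝ}
    (hM : ∀ z : ℂ, 0 ≤ z.re → z.re ≤ 1 → ‖f z‖ ≤ M)
    (ha : ∀ z : ℂ, z.re = 0 → ‖f z‖ ≤ a) (hb : ∀ z : ℂ, z.re = 1 → ‖f z‖ ≤ b)
    {θ : ℝ} (h0 : 0 ≤ θ) (h1 : θ ≤ 1) : ‖f θ‖ ≤ a ^ (1 - θ) * b ^ θ := by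
  have := Complex.HadamardThreeLines.norm_le_interp_of_mem_verticalClosedStrip₀₁' f (z := (θ : ℂ))
    (a := a) (b := b) ?_ ?_ ?_ ?_ ?_
  · simpa using this
  · simp [Complex.HadamardThreeLines.verticalClosedStrip, h0, h1]
  · refine DifferentiableOn.diffContOnCl (hd.mono ?_)
    intro z hz
    have hc : closure (Complex.HadamardThreeLines.verticalStrip 0 1) ⊆ Complex.HadamardThreeLines.verticalClosedStrip 0 1 := by
      refine closure_minimal ?_ ?_
      · intro w hw; exact ⟨hw.1.le, hw.2.le⟩
      · exact isClosed_Icc.preimage Complex.continuous_re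
    exact hsub z (hc hz).1 (hc hz).2
  · refine ⟨M, ?_⟩
    rintro _ ⟨z, hz, rfl⟩
    exact hM z hz.1 hz.2
  · intro z hz; exact ha z hz
  · intro z hz; exact hb z hz

end tools

/-! ### One-dimensional fractional integration and the Christ–Kiselev lemma -/

section hls

open Filter Topology

lemma lintegral_Ioc_rpow {a δ : ℝ} (ha : -1 < a) (hδ : 0 < δ) :
    ∫⁻ u in Set.Ioc 0 δ, ENNReal.ofReal (u ^ a) = ENNReal.ofReal (δ ^ (a + 1) / (a + 1)) := by
  rw [← ofReal_integral_eq_lintegral_ofReal]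
  · rw [← intervalIntegral.integral_of_le hδ.le, integral_rpow (Or.inl ha)]
    rw [Real.zero_rpow (by linarith), sub_zero]
  · exact (intervalIntegrable_iff_integrableOn_Ioc_of_le hδ.le).1
      (intervalIntegral.intervalIntegrable_rpow' ha)
  · filter_upwards [ae_restrict_mem measurableSet_Ioc] with u hu
    exact Real.rpow_nonneg hu.1.le _

lemma lintegral_Ioi_rpow {a δ : ℝ} (ha : a < -1) (hδ : 0 < δ) :
    ∫⁻ u in Set.Ioi δ, ENNReal.ofReal (u ^ a) = ENNReal.ofReal (-δ ^ (a + 1) / (a + 1)) := by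
  rw [← ofReal_integral_eq_lintegral_ofReal]
  · rw [integral_Ioi_rpow_of_lt ha hδ]
  · exact integrableOn_Ioi_rpow_of_lt ha hδ
  · filter_upwards [ae_restrict_mem measurableSet_Ioi] with u hu
    exact Real.rpow_nonneg (hδ.trans hu).le _

lemma lintegral_comp_abs' (g : ℝ → ℝ≥0∞) :
    ∫⁻ u, g |u| = 2 * ∫⁻ u in Set.Ioi 0, g u := by
  have h1 : ∫⁻ u in Set.Ioi (0:ℝ), g |u| = ∫⁻ u in Set.Ioi 0, g u := by
    refine setLIntegral_congr_fun measurableSet_Ioi fun u hu => ?_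
    simp only [abs_of_pos (Set.mem_Ioi.1 hu)]
  have h2 : ∫⁻ u in Set.Iio (0:ℝ), g |u| = ∫⁻ u in Set.Ioi 0, g u := by
    rw [← h1, ← lintegral_indicator measurableSet_Iio, ← lintegral_indicator measurableSet_Ioi,
      ← lintegral_neg_eq_self]
    congr 1 with u
    simp [Set.indicator]
  have h3 := lintegral_add_compl (μ := volume) (fun u : ℝ => g (abs u)) (measurableSet_Iio (a := (0:ℝ)))
  rw [← h3, Set.compl_Iio, h2, ← setLIntegral_congr Ioi_ae_eq_Ici, h1, two_mul]

/-- Hardy–Littlewood–Sobolev in one dimension (diagonal form) -/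
lemma hls {q p₀ : ℝ} (hq : 2 < q) (hp₀ : 1 / q + 1 / p₀ = 1) :
    ∃ C : ℝ, 0 < C ∧ ∀ f : ℝ → ℝ, Measurable f → (∀ s, 0 ≤ f s) →
      ∫⁻ s, ∫⁻ t, ENNReal.ofReal (|t - s| ^ (-(2 / q))) * (ENNReal.ofReal (f s) * ENNReal.ofReal (f t))
        ≤ ENNReal.ofReal C * (∫⁻ s, ENNReal.ofReal (f s ^ p₀)) ^ (2 / p₀) := by
  have hq0 : 0 < q := by linarith
  set γ := 2 / q with hγ
  have hγ1 : γ < 1 := by rw [hγ, div_lt_one hq0]; linarith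
  have hγ0 : 0 < γ := by positivity
  have hp₀' : 1 / p₀ = 1 - γ / 2 := by rw [hγ]; linarith [show 2 / q / 2 = 1 / q by ring]
  have hp0 : 0 < p₀ := by
    have : 0 < 1 / p₀ := by rw [hp₀']; linarith
    exact one_div_pos.1 this
  have h2p : 2 / p₀ = 2 - γ := by rw [show 2 / p₀ = 2 * (1 / p₀) by ring, hp₀']; ring
  have hconj : Real.HolderConjugate q p₀ := by
    rw [Real.holderConjugate_iff]
    refine ⟨by linarith, ?_⟩
    simpa using hp₀
  set K : ℝ := 2 / (1 - γ) + 2 ^ (1 / q) with hK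
  have hKpos : 0 < K := by
    have : 0 < 1 - γ := by linarith
    positivity
  refine ⟨2 * K, by positivity, fun f hf hf0 => ?_⟩
  set A := ∫⁻ s, ENNReal.ofReal (f s ^ p₀) with hA
  by_cases hAtop : A = ⊤
  · rw [hAtop, ENNReal.top_rpow_of_pos (by positivity), ENNReal.mul_top]
    · exact le_top
    · simp [hKpos]
  have hmp : Measurable fun s => ENNReal.ofReal (f s ^ p₀) := by fun_prop
  -- inner bound
  have inner : ∀ᵐ s, ENNReal.ofReal (f s) * ∫⁻ t, ENNReal.ofReal (|t - s| ^ (-γ)) * ENNReal.ofReal (min (f t) (f s))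
      ≤ ENNReal.ofReal K * A ^ (1 - γ) * ENNReal.ofReal (f s ^ p₀) := by
    by_cases hA0 : A = 0
    · have := (lintegral_eq_zero_iff hmp).1 hA0
      filter_upwards [this] with s hs
      have h1 : f s ^ p₀ ≤ 0 := by simpa using hs
      have h2 : f s = 0 := by
        by_contra hne
        have : 0 < f s ^ p₀ := Real.rpow_pos_of_pos (lt_of_le_of_ne (hf0 s) (Ne.symm hne)) _
        linarith
      simp [h2]
    refine ae_of_all _ fun s => ?_
    rcases (hf0 s).eq_or_lt with h0 | hpos
    · rw [← h0]; simp
    obtain ⟨a, ha, hAa⟩ : ∃ a : ℝ, 0 < a ∧ A = ENNReal.ofReal a :=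
      ⟨A.toReal, ENNReal.toReal_pos hA0 hAtop, (ENNReal.ofReal_toReal hAtop).symm⟩
    set δ := a / f s ^ p₀ with hδ
    have hfp : 0 < f s ^ p₀ := Real.rpow_pos_of_pos hpos _
    have hδ0 : 0 < δ := by positivity
    set φ : ℝ → ℝ≥0∞ := fun u => ENNReal.ofReal (u ^ (-γ)) with hφ
    have hmφ : Measurable φ := by fun_prop
    -- near part
    have near : ∫⁻ t, (Set.Ioc 0 δ).indicator φ |t - s| ≤ ENNReal.ofReal (2 / (1 - γ) * δ ^ (1 - γ)) := by
      rw [lintegral_sub_right_eq_self (fun t => (Set.Ioc 0 δ).indicator φ |t|) s, lintegral_comp_abs',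
        setLIntegral_indicator measurableSet_Ioc,
        Set.inter_eq_left.2 (fun u hu => hu.1), lintegral_Ioc_rpow (by linarith) hδ0,
        ← ENNReal.ofReal_ofNat, ← ENNReal.ofReal_mul (by norm_num)]
      refine ENNReal.ofReal_le_ofReal (le_of_eq ?_)
      rw [show -γ + 1 = 1 - γ by ring]; ring
    have far : ∫⁻ t, ((Set.Ioi δ).indicator φ |t - s|) ^ q ≤ ENNReal.ofReal (2 * δ⁻¹) := by
      rw [lintegral_sub_right_eq_self (fun t => ((Set.Ioi δ).indicator φ |t|) ^ q) s,
        lintegral_comp_abs' (fun u => ((Set.Ioi δ).indicator φ u) ^ q)]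
      have : ∀ u, ((Set.Ioi δ).indicator φ u) ^ q = (Set.Ioi δ).indicator (fun u => ENNReal.ofReal (u ^ (-2 : ℝ))) u := by
        intro u
        by_cases hu : u ∈ Set.Ioi δ
        · have hu0 : 0 < u := hδ0.trans hu
          simp only [Set.indicator_of_mem hu, hφ]
          rw [ENNReal.ofReal_rpow_of_pos (Real.rpow_pos_of_pos hu0 _), ← Real.rpow_mul hu0.le]
          congr 2
          rw [hγ]; field_simp
        · simp only [Set.indicator_of_notMem hu]
          exact ENNReal.zero_rpow_of_pos hq0
      simp_rw [this]
      rw [setLIntegral_indicator measurableSet_Ioi, Set.inter_eq_left.2 (Set.Ioi_subset_Ioi hδ0.le),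
        lintegral_Ioi_rpow (by norm_num) hδ0,
        ← ENNReal.ofReal_ofNat, ← ENNReal.ofReal_mul (by norm_num)]
      refine ENNReal.ofReal_le_ofReal (le_of_eq ?_)
      rw [show (-2:ℝ) + 1 = -1 by norm_num, Real.rpow_neg_one]; ring
    have split : ∫⁻ t, ENNReal.ofReal (|t - s| ^ (-γ)) * ENNReal.ofReal (min (f t) (f s)) ≤
        ENNReal.ofReal (f s) * (∫⁻ t, (Set.Ioc 0 δ).indicator φ |t - s|) +
        ∫⁻ t, (Set.Ioi δ).indicator φ |t - s| * ENNReal.ofReal (f t) := by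
      rw [← lintegral_const_mul _ (by
        exact (hmφ.indicator measurableSet_Ioc).comp (by fun_prop)), ← lintegral_add_left (by
        exact (((hmφ.indicator measurableSet_Ioc).comp (by fun_prop)).const_mul _))]
      refine lintegral_mono_ae ?_
      have : ∀ᵐ t : ℝ, t ≠ s := by
        simp [ae_iff]
      filter_upwards [this] with t ht
      have habs : 0 < |t - s| := abs_pos.2 (sub_ne_zero.2 ht)
      by_cases hc : |t - s| ≤ δ
      · rw [Set.indicator_of_mem (show |t - s| ∈ Set.Ioc 0 δ from ⟨habs, hc⟩), mul_comm]
        refine le_add_of_le_left ?_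
        gcongr
        exact min_le_right _ _
      · rw [Set.indicator_of_mem (show |t - s| ∈ Set.Ioi δ from not_le.1 hc)]
        refine le_add_of_le_right ?_
        gcongr
        exact min_le_left _ _
    have hold : ∫⁻ t, (Set.Ioi δ).indicator φ |t - s| * ENNReal.ofReal (f t) ≤
        ENNReal.ofReal ((2 * δ⁻¹) ^ (1 / q) * a ^ (1 / p₀)) := by
      refine (ENNReal.lintegral_mul_le_Lp_mul_Lq volume hconj
        (((hmφ.indicator measurableSet_Ioi).comp (by fun_prop)).aemeasurable)
        (by fun_prop)).trans ?_
      rw [ENNReal.ofReal_mul (by positivity), ← ENNReal.ofReal_rpow_of_pos (by positivity),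
        ← ENNReal.ofReal_rpow_of_pos ha, ← hAa]
      have : ∀ t, ENNReal.ofReal (f t) ^ p₀ = ENNReal.ofReal (f t ^ p₀) := fun t =>
        ENNReal.ofReal_rpow_of_nonneg (hf0 t) hp0.le
      simp_rw [this]
      gcongr
      exact far
    rw [hAa]
    calc _ ≤ ENNReal.ofReal (f s) * (ENNReal.ofReal (f s) * ENNReal.ofReal (2 / (1 - γ) * δ ^ (1 - γ)) +
          ENNReal.ofReal ((2 * δ⁻¹) ^ (1 / q) * a ^ (1 / p₀))) := by
          gcongr
          refine split.trans ?_
          gcongr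
      _ = ENNReal.ofReal (f s * (f s * (2 / (1 - γ) * δ ^ (1 - γ)) + (2 * δ⁻¹) ^ (1 / q) * a ^ (1 / p₀))) := by
          have : 0 < 1 - γ := by linarith
          rw [← ENNReal.ofReal_mul hpos.le, ← ENNReal.ofReal_add (by positivity) (by positivity),
            ← ENNReal.ofReal_mul hpos.le]
      _ = _ := by
          rw [ENNReal.ofReal_rpow_of_pos ha, ← ENNReal.ofReal_mul hKpos.le,
            ← ENNReal.ofReal_mul (by positivity)]
          congr 1
          have e1 : δ ^ (1 - γ) = a ^ (1 - γ) * (f s ^ (-(p₀ * (1 - γ)))) := by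
            rw [hδ, Real.div_rpow ha.le hfp.le, ← Real.rpow_mul hpos.le, Real.rpow_neg hpos.le]; rfl
          have e2 : (2 * δ⁻¹) ^ (1 / q) = 2 ^ (1/q) * (a ^ (-(1 / q)) * f s ^ (p₀ * (1/q))) := by
            rw [Real.mul_rpow (by norm_num) (by positivity), hδ, inv_div,
              Real.div_rpow hfp.le ha.le, ← Real.rpow_mul hpos.le, Real.rpow_neg ha.le]
            ring
          have hx : p₀ * (1 - γ / 2) = 1 := by rw [← hp₀']; field_simp
          have hq2 : 1 / q = γ / 2 := by rw [hγ]; ring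
          have e3 : f s * (f s * f s ^ (-(p₀ * (1 - γ)))) = f s ^ p₀ := by
            rw [← mul_assoc, ← sq, ← Real.rpow_natCast, ← Real.rpow_add hpos]
            congr 1; push_cast; linarith
          have e4 : f s * f s ^ (p₀ * (1/q)) = f s ^ p₀ := by
            nth_rw 1 [← Real.rpow_one (f s)]
            rw [← Real.rpow_add hpos]; congr 1; rw [hq2]; linarith
          have e5 : a ^ (-(1 / q)) * a ^ (1 / p₀) = a ^ (1 - γ) := by
            rw [← Real.rpow_add ha, hq2, hp₀']; congr 1; ring
          rw [e1, e2, hK]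
          calc _ = (2 / (1 - γ)) * a ^ (1 - γ) * (f s * (f s * f s ^ (-(p₀ * (1 - γ))))) +
              2 ^ (1/q) * (a ^ (-(1 / q)) * a ^ (1 / p₀)) * (f s * f s ^ (p₀ * (1/q))) := by ring
            _ = _ := by rw [e3, e4, e5]; ring
  -- symmetrization
  have hk : ∀ s t, ENNReal.ofReal (|t - s| ^ (-γ)) * (ENNReal.ofReal (f s) * ENNReal.ofReal (f t)) ≤
      ENNReal.ofReal (f s) * (ENNReal.ofReal (|t - s| ^ (-γ)) * ENNReal.ofReal (min (f t) (f s))) +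
      ENNReal.ofReal (f t) * (ENNReal.ofReal (|s - t| ^ (-γ)) * ENNReal.ofReal (min (f s) (f t))) := by
    intro s t
    rcases le_total (f t) (f s) with h | h
    · rw [min_eq_left h]; refine le_add_of_le_left (le_of_eq ?_); ring
    · rw [min_eq_left h, abs_sub_comm s t]; refine le_add_of_le_right (le_of_eq ?_); ring
  set Ψ : ℝ → ℝ → ℝ≥0∞ := fun s t => ENNReal.ofReal (f s) * (ENNReal.ofReal (|t - s| ^ (-γ)) * ENNReal.ofReal (min (f t) (f s))) with hΨ
  have hΨm : Measurable (Function.uncurry Ψ) := by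
    simp only [hΨ, Function.uncurry_def]
    fun_prop
  have hI : ∫⁻ s, ∫⁻ t, Ψ s t ≤ ENNReal.ofReal K * A ^ (2 - γ) := by
    calc ∫⁻ s, ∫⁻ t, Ψ s t ≤ ∫⁻ s, ENNReal.ofReal K * A ^ (1 - γ) * ENNReal.ofReal (f s ^ p₀) := by
          refine lintegral_mono_ae ?_
          filter_upwards [inner] with s hs
          refine le_trans (le_of_eq ?_) hs
          rw [hΨ, lintegral_const_mul _ (by fun_prop)]
      _ = ENNReal.ofReal K * A ^ (1 - γ) * A := by rw [lintegral_const_mul _ hmp]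
      _ = _ := by
          rw [mul_assoc]; congr 1
          rw [show (2 - γ) = (1 - γ) + 1 by ring, ENNReal.rpow_add_of_nonneg _ _ (by linarith) (by norm_num),
            ENNReal.rpow_one]
  calc _ ≤ ∫⁻ s, ∫⁻ t, (Ψ s t + Ψ t s) := lintegral_mono fun s => lintegral_mono fun t => hk s t
    _ = (∫⁻ s, ∫⁻ t, Ψ s t) + ∫⁻ s, ∫⁻ t, Ψ t s := by
        rw [← lintegral_add_left]
        · congr 1 with s
          rw [lintegral_add_left]
          exact hΨm.comp (measurable_prodMk_left)
        · exact hΨm.lintegral_prod_right'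
    _ = (∫⁻ s, ∫⁻ t, Ψ s t) + ∫⁻ s, ∫⁻ t, Ψ s t := by
        congr 1
        exact lintegral_lintegral_swap (f := fun s t => Ψ t s) (hΨm.comp measurable_swap).aemeasurable
    _ ≤ ENNReal.ofReal K * A ^ (2 - γ) + ENNReal.ofReal K * A ^ (2 - γ) := by gcongr
    _ = _ := by
        rw [h2p, ENNReal.ofReal_mul (by norm_num), ENNReal.ofReal_ofNat]; ring

end hls

section ck

open Filter Topology

/-- Whitney relation between two numbers in `[0,1)` -/
def whit (j : ℕ) (x y : ℝ) : Prop :=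
  ⌊y * 2 ^ (j + 1)⌋₊ = ⌊x * 2 ^ (j + 1)⌋₊ + 1 ∧ Even ⌊x * 2 ^ (j + 1)⌋₊

lemma floor_half {x : ℝ} (i : ℕ) : ⌊x * 2 ^ i⌋₊ = ⌊x * 2 ^ (i + 1)⌋₊ / 2 := by
  have := Nat.floor_div_natCast (x * 2 ^ (i+1)) 2
  rw [← this]
  congr 1
  push_cast
  rw [pow_succ]; ring

lemma whit_floor_eq {j : ℕ} {x y : ℝ} (h : whit j x y) :
    ∀ i, i ≤ j → ⌊x * 2 ^ i⌋₊ = ⌊y * 2 ^ i⌋₊ := by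
  intro i hi
  induction hi using Nat.decreasingInduction with
  | self => rw [floor_half, floor_half (x := y), h.1]; obtain ⟨k, hk⟩ := h.2; omega
  | of_succ k _ ih => rw [floor_half, floor_half (x := y), ih]

lemma whit_unique {i j : ℕ} {x y : ℝ} (h : whit i x y) (h' : whit j x y) : i = j := by
  by_contra hne
  wlog hlt : i < j generalizing i j
  · exact this h' h (Ne.symm hne) (by omega)
  have := whit_floor_eq h' (i + 1) hlt
  have h1 := h.1
  omega

lemma whit_lt {j : ℕ} {x y : ℝ} (h : whit j x y) : x < y := by
  by_contra hle
  have : ⌊y * 2 ^ (j+1)⌋₊ ≤ ⌊x * 2 ^ (j+1)⌋₊ := Nat.floor_mono (by gcongr; linarith)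
  have := h.1
  omega

lemma whit_exists {x y : ℝ} (hx : 0 ≤ x) (hxy : x < y) (hy : y < 1) : ∃ j, whit j x y := by
  have hex : ∃ i, ⌊x * 2 ^ i⌋₊ ≠ ⌊y * 2 ^ i⌋₊ := by
    obtain ⟨i, hi⟩ := pow_unbounded_of_one_lt (y - x)⁻¹ (one_lt_two : (1:ℝ) < 2)
    refine ⟨i, fun heq => ?_⟩
    have h1 : 1 < (y - x) * 2 ^ i := by
      rw [inv_lt_iff_one_lt_mul₀ (by linarith)] at hi
      linarith
    have h2 := Nat.floor_le (show 0 ≤ x * 2 ^ i by positivity)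
    have h3 := Nat.lt_floor_add_one (y * 2 ^ i)
    rw [heq] at h2
    nlinarith
  classical
  set i := Nat.find hex with hi
  have h1 : ⌊x * 2 ^ i⌋₊ ≠ ⌊y * 2 ^ i⌋₊ := Nat.find_spec hex
  have h0 : i ≠ 0 := by
    intro h0
    rw [h0] at h1
    apply h1
    rw [Nat.floor_eq_zero.2 (by simpa using hxy.trans hy), Nat.floor_eq_zero.2 (by simpa using hy)]
  obtain ⟨j, hj⟩ := Nat.exists_eq_succ_of_ne_zero h0
  have h2 : ⌊x * 2 ^ j⌋₊ = ⌊y * 2 ^ j⌋₊ := by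
    by_contra hne
    exact Nat.find_min hex (m := j) (by omega) hne
  rw [hj] at h1
  rw [floor_half, floor_half (x := y)] at h2
  have h3 : ⌊x * 2 ^ (j+1)⌋₊ ≤ ⌊y * 2 ^ (j+1)⌋₊ := Nat.floor_mono (by gcongr)
  simp only [Nat.succ_eq_add_one] at h1
  refine ⟨j, ?_, ?_⟩
  · omega
  · rw [Nat.even_iff]; omega

lemma measure_level_le {m : Measure ℝ} [IsFiniteMeasure m] [NullSingletonClass m] {F : ℝ → ℝ}
    (hF : ∀ s, ENNReal.ofReal (F s) = m (Set.Iic s)) (hF0 : ∀ s, 0 ≤ F s) {S : Set ℝ} (hS : MeasurableSet S) {a b : ℝ}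
    (hab : ∀ s ∈ S, a ≤ F s ∧ F s ≤ b) : m S ≤ ENNReal.ofReal (b - a) := by
  by_contra hlt
  push Not at hlt
  obtain ⟨K, hKS, hK, hlt⟩ := hS.exists_lt_isCompact_of_ne_top (measure_ne_top m S) hlt
  have hne : K.Nonempty := by
    by_contra h
    rw [Set.not_nonempty_iff_eq_empty] at h
    simp [h] at hlt
  obtain ⟨s1, hs1, hmin⟩ := hK.exists_isLeast hne
  obtain ⟨s2, hs2, hmax⟩ := hK.exists_isGreatest hne
  have hle : s1 ≤ s2 := hmin hs2
  have h1 : m K ≤ m (Set.Ioc s1 s2) := by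
    rw [measure_congr (Ioc_ae_eq_Icc (μ := m))]
    exact measure_mono fun s hs => ⟨hmin hs, hmax hs⟩
  have h2 : m (Set.Iic s1) + m (Set.Ioc s1 s2) = m (Set.Iic s2) := by
    rw [← measure_union _ measurableSet_Ioc, Set.Iic_union_Ioc_eq_Iic hle]
    rw [Set.disjoint_left]; intro x hx hx'; exact absurd hx'.1 (not_lt.2 hx)
  have h3 : m (Set.Ioc s1 s2) = ENNReal.ofReal (F s2 - F s1) := by
    rw [ENNReal.ofReal_sub _ (hF0 _), hF, hF, ← h2, ENNReal.add_sub_cancel_left (measure_ne_top _ _)]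
  have : ENNReal.ofReal (F s2 - F s1) ≤ ENNReal.ofReal (b - a) :=
    ENNReal.ofReal_le_ofReal (by linarith [(hab _ (hKS hs2)).2, (hab _ (hKS hs1)).1])
  exact absurd (hlt.trans_le (h1.trans (h3.le.trans this))) (lt_irrefl _)

lemma ennreal_tsum_sq_le (a b : ℕ → ℝ≥0∞) :
    (∑' j, a j * b j) ^ 2 ≤ (∑' j, a j ^ 2) * ∑' j, b j ^ 2 := by
  have := ENNReal.lintegral_mul_le_Lp_mul_Lq (Measure.count : Measure ℕ) Real.HolderConjugate.two_two
    (f := a) (g := b) (measurable_of_countable _).aemeasurable (measurable_of_countable _).aemeasurable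
  simp only [lintegral_count, Pi.mul_apply] at this
  calc _ ≤ ((∑' j, a j ^ (2:ℝ)) ^ (1 / (2:ℝ)) * (∑' j, b j ^ (2:ℝ)) ^ (1 / (2:ℝ))) ^ 2 := by gcongr
    _ = _ := by
      rw [mul_pow, ← ENNReal.rpow_natCast, ← ENNReal.rpow_mul, ← ENNReal.rpow_natCast, ← ENNReal.rpow_mul]
      norm_num

/-- the Christ–Kiselev lemma -/
lemma christ_kiselev {κ : ℝ} (hκ : 1 < κ) :
    ∃ C : ℝ, 0 < C ∧ ∀ {Y : Type} [MeasurableSpace Y] (ν : Measure Y) (τ : Y → ℝ) (Φ : Y → ℝ → ℂ)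
      (g : ℝ → ℝ≥0∞) (A : ℝ≥0∞), Measurable g → ∫⁻ s, g s ≠ ⊤ → (∀ y, Integrable (Φ y)) →
      (∀ y s, g s = 0 → Φ y s = 0) →
      (∀ S, MeasurableSet S → Measurable fun y => ∫ s in S, Φ y s) →
      (∀ S, MeasurableSet S → ∫⁻ y, ‖∫ s in S, Φ y s‖ₑ ^ 2 ∂ν ≤ A * (∫⁻ s in S, g s) ^ κ) →
      ∫⁻ y, ‖∫ s in Set.Ici (τ y), Φ y s‖ₑ ^ 2 ∂ν ≤ ENNReal.ofReal C * A * (∫⁻ s, g s) ^ κ := by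
  set ρ : ℝ := 2 ^ (-((κ - 1) / 4)) with hρ
  have hρ0 : 0 < ρ := by positivity
  have hρ1 : ρ ^ 2 < 1 := by
    rw [hρ, ← Real.rpow_natCast, ← Real.rpow_mul (by norm_num)]
    refine Real.rpow_lt_one_of_one_lt_of_neg (by norm_num) ?_
    push_cast; linarith
  set C1 : ℝ := (1 - ρ ^ 2)⁻¹ with hC1
  have hC1pos : 0 < C1 := by rw [hC1]; exact inv_pos.2 (by linarith)
  refine ⟨C1 * (2 * C1), by positivity, ?_⟩
  intro Y _ ν τ Φ g A hg hgtop hint hzero hmeas hS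
  set M := ∫⁻ s, g s with hM
  set m : Measure ℝ := volume.withDensity g with hm
  have : IsFiniteMeasure m := isFiniteMeasure_withDensity hgtop
  have hmS : ∀ S, MeasurableSet S → m S = ∫⁻ s in S, g s := fun S hS => withDensity_apply _ hS
  have hmM : m Set.univ = M := by rw [hmS _ MeasurableSet.univ]; simp [hM]
  have hgz : ∀ S, MeasurableSet S → m S = 0 → ∀ y, ∫ s in S, Φ y s = 0 := by
    intro S hSm h0 y
    rw [hmS S hSm, lintegral_eq_zero_iff hg] at h0
    refine integral_eq_zero_of_ae ?_
    filter_upwards [h0] with s hs using hzero y s hs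
  by_cases hM0 : M = 0
  · have : ∀ y, ∫ s in Set.Ici (τ y), Φ y s = 0 := by
      intro y
      refine hgz _ measurableSet_Ici ?_ y
      have : m (Set.Ici (τ y)) ≤ 0 := by rw [← hM0, ← hmM]; exact measure_mono (Set.subset_univ _)
      simpa using this
    simp [this]
  obtain ⟨M', hM'0, hMM'⟩ : ∃ a : ℝ, 0 < a ∧ M = ENNReal.ofReal a :=
    ⟨M.toReal, ENNReal.toReal_pos hM0 hgtop, (ENNReal.ofReal_toReal hgtop).symm⟩
  set F0 : ℝ → ℝ := fun s => (m (Set.Iic s)).toReal with hF0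
  have hF0eq : ∀ s, ENNReal.ofReal (F0 s) = m (Set.Iic s) := fun s => ENNReal.ofReal_toReal (measure_ne_top _ _)
  have hF0nn : ∀ s, 0 ≤ F0 s := fun s => ENNReal.toReal_nonneg
  have hF0mono : Monotone F0 := fun s t hst => ENNReal.toReal_mono (measure_ne_top _ _)
    (measure_mono (Set.Iic_subset_Iic.2 hst))
  have hF0le : ∀ s, F0 s ≤ M' := by
    intro s
    refine ENNReal.toReal_le_of_le_ofReal hM'0.le ?_
    rw [← hMM', ← hmM]; exact measure_mono (Set.subset_univ _)
  set F : ℝ → ℝ := fun s => F0 s / (2 * M') with hF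
  have hFmono : Monotone F := fun s t hst => by simp only [hF]; gcongr; exact hF0mono hst
  have hFm : Measurable F := hFmono.measurable
  have hFnn : ∀ s, 0 ≤ F s := fun s => by simp only [hF]; have := hF0nn s; positivity
  have hFlt : ∀ s, F s < 1 := fun s => by
    simp only [hF]; rw [div_lt_one (by positivity)]; linarith [hF0le s]
  -- level sets
  set L : ℕ → ℕ → Set ℝ := fun j k => {s | ⌊F s * 2 ^ (j + 1)⌋₊ = k} with hL
  have hLm : ∀ j k, MeasurableSet (L j k) := by
    intro j k
    have : Measurable fun s => ⌊F s * 2 ^ (j + 1)⌋₊ := Nat.measurable_floor.comp (hFm.mul_const _)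
    exact this (measurableSet_singleton k)
  have hLle : ∀ j k, m (L j k) ≤ ENNReal.ofReal (2 * M' / 2 ^ (j + 1)) := by
    intro j k
    have hlev : ∀ s ∈ L j k, k / 2 ^ (j+1) * (2 * M') ≤ F0 s ∧ F0 s ≤ (k + 1) / 2 ^ (j+1) * (2 * M') := by
      intro s hs
      have h1 := Nat.floor_le (show 0 ≤ F s * 2 ^ (j+1) from mul_nonneg (hFnn s) (by positivity))
      have h2 := (Nat.lt_floor_add_one (F s * 2 ^ (j+1))).le
      rw [show ⌊F s * 2 ^ (j + 1)⌋₊ = k from hs] at h1 h2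
      have e : F0 s = F s * (2 * M') := by simp only [hF]; field_simp
      rw [e]
      constructor
      · gcongr; rw [div_le_iff₀ (by positivity)]; exact h1
      · gcongr; rw [le_div_iff₀ (by positivity)]; exact h2
    refine (measure_level_le hF0eq hF0nn (hLm j k) hlev).trans (ENNReal.ofReal_le_ofReal (le_of_eq ?_))
    field_simp; ring
  -- decomposition
  set D : Y → ℕ → Set ℝ := fun y j => {s | whit j (F (τ y)) (F s)} with hD
  have hDL : ∀ y j, (D y j = ∅) ∨ ∃ k < 2 ^ (j + 1), D y j = L j (k + 1) := by
    intro y j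
    by_cases he : Even ⌊F (τ y) * 2 ^ (j + 1)⌋₊
    · right
      refine ⟨⌊F (τ y) * 2 ^ (j + 1)⌋₊, ?_, ?_⟩
      · rw [Nat.floor_lt (mul_nonneg (hFnn _) (by positivity))]
        push_cast
        have := hFlt (τ y)
        nlinarith [show (0:ℝ) < 2 ^ (j+1) by positivity]
      · ext s; simp [hD, hL, whit, he]
    · left
      ext s; simp [hD, whit, he]
  have hDm : ∀ y j, MeasurableSet (D y j) := by
    intro y j
    rcases hDL y j with h | ⟨k, _, h⟩
    · rw [h]; exact MeasurableSet.empty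
    · rw [h]; exact hLm _ _
  have hDdisj : ∀ y, Pairwise (Function.onFun Disjoint (D y)) := by
    intro y i j hij
    rw [Function.onFun, Set.disjoint_left]
    intro s h1 h2
    exact hij (whit_unique h1 h2)
  have hDU : ∀ y, ⋃ j, D y j = {s | F (τ y) < F s} := by
    intro y
    ext s
    simp only [Set.mem_iUnion, hD, Set.mem_ofPred_eq]
    exact ⟨fun ⟨j, h⟩ => whit_lt h, fun h => whit_exists (hFnn _) h (hFlt _)⟩
  have hIci : ∀ y, ∫ s in Set.Ici (τ y), Φ y s = ∫ s in ⋃ j, D y j, Φ y s := by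
    intro y
    rw [hDU y]
    have hUm : MeasurableSet {s | F (τ y) < F s} := measurableSet_lt measurable_const hFm
    have hsub : {s | F (τ y) < F s} ⊆ Set.Ici (τ y) := by
      intro s hs
      by_contra hlt
      exact absurd (hFmono (not_le.1 hlt).le) (not_le.2 hs)
    have hdm : MeasurableSet (Set.Ici (τ y) \ {s | F (τ y) < F s}) := measurableSet_Ici.diff hUm
    rw [← Set.sdiff_union_of_subset hsub, setIntegral_union Set.disjoint_sdiff_left hUm
      (hint y).integrableOn (hint y).integrableOn, hgz _ hdm, zero_add]
    have := measure_level_le hF0eq hF0nn hdm (a := F0 (τ y)) (b := F0 (τ y)) ?_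
    · simpa using this
    · intro s hs
      have h1 : F s ≤ F (τ y) := by simpa using hs.2
      simp only [hF] at h1
      rw [div_le_div_iff_of_pos_right (by positivity)] at h1
      exact ⟨hF0mono hs.1, h1⟩
  have hsum : ∀ y, ‖∫ s in Set.Ici (τ y), Φ y s‖ₑ ≤ ∑' j, ‖∫ s in D y j, Φ y s‖ₑ := by
    intro y
    rw [hIci y, integral_iUnion (hDm y) (hDdisj y) (hint y).integrableOn]
    exact enorm_tsum_le_tsum_enorm
  set B : ℕ → Y → ℝ≥0∞ := fun j y => ∑ k ∈ Finset.range (2 ^ (j + 1)), ‖∫ s in L j (k + 1), Φ y s‖ₑ ^ 2 with hB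
  have hBm : ∀ j, Measurable (B j) := by
    intro j
    refine Finset.measurable_sum _ fun k _ => ?_
    exact ((hmeas _ (hLm j (k+1))).enorm).pow_const 2
  have hDB : ∀ y j, ‖∫ s in D y j, Φ y s‖ₑ ^ 2 ≤ B j y := by
    intro y j
    rcases hDL y j with h | ⟨k, hk, h⟩
    · rw [h]; simp
    · rw [h]
      exact Finset.single_le_sum (f := fun k => ‖∫ s in L j (k + 1), Φ y s‖ₑ ^ 2) (fun _ _ => zero_le)
        (Finset.mem_range.2 hk)
  set r : ℝ≥0∞ := ENNReal.ofReal ρ with hr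
  have hr0 : r ≠ 0 := by simp [hr, hρ0]
  have hrt : r ≠ ⊤ := by simp [hr]
  have hpt : ∀ y, ‖∫ s in Set.Ici (τ y), Φ y s‖ₑ ^ 2 ≤ ENNReal.ofReal C1 * ∑' j, (r ^ j)⁻¹ ^ 2 * B j y := by
    intro y
    calc _ ≤ (∑' j, ‖∫ s in D y j, Φ y s‖ₑ) ^ 2 := by gcongr; exact hsum y
      _ = (∑' j, r ^ j * ((r ^ j)⁻¹ * ‖∫ s in D y j, Φ y s‖ₑ)) ^ 2 := by
          congr 2 with j
          rw [← mul_assoc, ENNReal.mul_inv_cancel (pow_ne_zero _ hr0) (ENNReal.pow_ne_top hrt), one_mul]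
      _ ≤ (∑' j, (r ^ j) ^ 2) * ∑' j, ((r ^ j)⁻¹ * ‖∫ s in D y j, Φ y s‖ₑ) ^ 2 := ennreal_tsum_sq_le _ _
      _ ≤ _ := by
          gcongr with j
          · refine le_of_eq ?_
            have : ∀ j : ℕ, (r ^ j) ^ 2 = ENNReal.ofReal ((ρ ^ 2) ^ j) := by
              intro j
              rw [hr, ← ENNReal.ofReal_pow hρ0.le, ← ENNReal.ofReal_pow (by positivity)]
              congr 1; ring
            simp_rw [this]
            rw [← ENNReal.ofReal_tsum_of_nonneg (fun j => by positivity)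
              (summable_geometric_of_lt_one (by positivity) hρ1),
              tsum_geometric_of_lt_one (by positivity) hρ1]
          · rw [mul_pow]
            gcongr
            exact hDB y j
  have hBj : ∀ j, (r ^ j)⁻¹ ^ 2 * ∫⁻ y, B j y ∂ν ≤ A * M ^ κ * (2 * ENNReal.ofReal ((ρ ^ 2) ^ j)) := by
    intro j
    have h1 : ∫⁻ y, B j y ∂ν ≤ 2 ^ (j + 1) * (A * ENNReal.ofReal ((2 * M' / 2 ^ (j + 1)) ^ κ)) := by
      simp only [hB]
      rw [lintegral_finsetSum _ fun k _ => ((hmeas _ (hLm j (k+1))).enorm).pow_const 2]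
      calc _ ≤ ∑ k ∈ Finset.range (2 ^ (j + 1)), A * ENNReal.ofReal ((2 * M' / 2 ^ (j + 1)) ^ κ) := by
            refine Finset.sum_le_sum fun k _ => (hS _ (hLm j (k+1))).trans ?_
            gcongr
            rw [← hmS _ (hLm _ _), ← ENNReal.ofReal_rpow_of_pos (by positivity)]
            gcongr
            exact hLle _ _
        _ = _ := by simp
    calc _ ≤ (r ^ j)⁻¹ ^ 2 * (2 ^ (j + 1) * (A * ENNReal.ofReal ((2 * M' / 2 ^ (j + 1)) ^ κ))) := by gcongr
      _ = A * ENNReal.ofReal (((ρ ^ j)⁻¹ ^ 2 * 2 ^ (j + 1)) * (2 * M' / 2 ^ (j + 1)) ^ κ) := by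
          rw [ENNReal.ofReal_mul (by positivity), ENNReal.ofReal_mul (by positivity), ENNReal.ofReal_pow (by positivity),
            ENNReal.ofReal_inv_of_pos (by positivity), ENNReal.ofReal_pow (by positivity), ENNReal.ofReal_pow (by positivity),
            ENNReal.ofReal_ofNat]
          ring
      _ ≤ _ := by
          rw [hMM', ENNReal.ofReal_rpow_of_pos hM'0, ← ENNReal.ofReal_ofNat, mul_assoc A,
            ← ENNReal.ofReal_mul (by positivity), ← ENNReal.ofReal_mul (by positivity)]
          refine le_of_eq ?_
          congr 2
          have e1 : (2 * M' / 2 ^ (j + 1)) = M' * (2:ℝ) ^ (-(j:ℝ)) := by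
            rw [Real.rpow_neg (by norm_num), Real.rpow_natCast, pow_succ]; field_simp
          have e2 : ρ ^ j = (2:ℝ) ^ (-((κ - 1) / 4) * j) := by
            rw [hρ, ← Real.rpow_natCast, ← Real.rpow_mul (by norm_num)]
          have e3 : (ρ ^ 2) ^ j = (2:ℝ) ^ (-((κ - 1) / 4) * j * 2) := by
            rw [← pow_mul, mul_comm, pow_mul, e2, ← Real.rpow_natCast, ← Real.rpow_mul (by norm_num)]; norm_num
          have e4 : ((ρ ^ j)⁻¹ ^ 2) = (2:ℝ) ^ (((κ - 1) / 4) * j * 2) := by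
            rw [e2, ← Real.rpow_neg (by norm_num), ← Real.rpow_natCast, ← Real.rpow_mul (by norm_num)]; congr 1
            push_cast; ring
          have e5 : (2:ℝ) ^ (j+1) = 2 * (2:ℝ) ^ (j:ℝ) := by rw [pow_succ, Real.rpow_natCast]; ring
          rw [e1, Real.mul_rpow hM'0.le (by positivity), ← Real.rpow_mul (by norm_num), e3, e4, e5]
          have : (2:ℝ) ^ (-((κ - 1) / 4) * j * 2) = (2:ℝ) ^ (((κ - 1) / 4) * j * 2) * (2:ℝ) ^ (j:ℝ) * (2:ℝ) ^ (-(j:ℝ) * κ) := by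
            rw [← Real.rpow_add (by norm_num), ← Real.rpow_add (by norm_num)]; congr 1; ring
          rw [this]; ring
  calc _ ≤ ∫⁻ y, ENNReal.ofReal C1 * ∑' j, (r ^ j)⁻¹ ^ 2 * B j y ∂ν := lintegral_mono hpt
    _ = ENNReal.ofReal C1 * ∑' j, (r ^ j)⁻¹ ^ 2 * ∫⁻ y, B j y ∂ν := by
        rw [lintegral_const_mul _ (Measurable.tsum fun j => (hBm j).const_mul _),
          lintegral_tsum fun j => ((hBm j).const_mul _).aemeasurable]
        congr 2 with j
        rw [lintegral_const_mul _ (hBm j)]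
    _ ≤ ENNReal.ofReal C1 * ∑' j, A * M ^ κ * (2 * ENNReal.ofReal ((ρ ^ 2) ^ j)) := by
        gcongr ENNReal.ofReal C1 * ?_
        exact ENNReal.tsum_le_tsum hBj
    _ = _ := by
        rw [ENNReal.tsum_mul_left, ENNReal.tsum_mul_left, ← ENNReal.ofReal_tsum_of_nonneg (fun j => by positivity)
              (summable_geometric_of_lt_one (by positivity) hρ1),
              tsum_geometric_of_lt_one (by positivity) hρ1, ENNReal.ofReal_mul (by positivity), ENNReal.ofReal_mul (by positivity),
              ENNReal.ofReal_ofNat]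
        ring

end ck

/-! ### The sphere measure and polar coordinates -/

section sphere

open Filter Topology

/-- surface measure of the unit sphere, as a measure on the whole space -/
def sph (n : ℕ) : Measure (EuclideanSpace ℝ (Fin n)) :=
  (volume : Measure (EuclideanSpace ℝ (Fin n))).toSphere.map Subtype.val

instance (n : ℕ) : IsFiniteMeasure (sph n) := by
  unfold sph; infer_instance

lemma ae_sph_norm (n : ℕ) : ∀ᵐ ω ∂(sph n), ‖ω‖ = 1 := by
  unfold sph
  rw [ae_map_iff measurable_subtype_coe.aemeasurable (measurableSet_eq_fun (by fun_prop) (by fun_prop))]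
  refine ae_of_all _ fun ω => ?_
  simpa using ω.2

/-- radial measure `ρ^{n-1} dρ` -/
def radM (n : ℕ) : Measure ℝ :=
  (volume.restrict (Set.Ioi 0)).withDensity fun ρ => ENNReal.ofReal (ρ ^ (n - 1))

instance (n : ℕ) : SFinite (radM n) := by unfold radM; infer_instance

lemma lintegral_radM (n : ℕ) (f : ℝ → ℝ≥0∞) (hf : Measurable f) :
    ∫⁻ ρ, f ρ ∂(radM n) = ∫⁻ ρ in Set.Ioi 0, ENNReal.ofReal (ρ ^ (n - 1)) * f ρ := by
  unfold radM
  rw [lintegral_withDensity_eq_lintegral_mul _ (by fun_prop) hf]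
  rfl

lemma integral_radM (n : ℕ) (f : ℝ → ℂ) :
    ∫ ρ, f ρ ∂(radM n) = ∫ ρ in Set.Ioi 0, ((ρ ^ (n - 1) : ℝ) : ℂ) * f ρ := by
  unfold radM
  rw [integral_withDensity_eq_integral_toReal_smul (by fun_prop) (by simp)]
  refine setIntegral_congr_fun measurableSet_Ioi fun ρ hρ => ?_
  simp only [Complex.real_smul]
  rw [ENNReal.toReal_ofReal (pow_nonneg (le_of_lt hρ) _)]

lemma lintegral_polar {n : ℕ} (hn : 0 < n) (f : EuclideanSpace ℝ (Fin n) → ℝ≥0∞) (hf : Measurable f) :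
    ∫⁻ x, f x = ∫⁻ ρ, ∫⁻ ω, f (ρ • ω) ∂(sph n) ∂(radM n) := by
  have : Nonempty (Fin n) := ⟨⟨0, hn⟩⟩
  have hmp := (volume : Measure (EuclideanSpace ℝ (Fin n))).measurePreserving_homeomorphUnitSphereProd
  have hfin : Module.finrank ℝ (EuclideanSpace ℝ (Fin n)) = n := by simp
  rw [hfin] at hmp
  have h1 : ∫⁻ x, f x = ∫⁻ x : ({(0)}ᶜ : Set (EuclideanSpace ℝ (Fin n))), f x.1 ∂(volume.comap Subtype.val) := by
    rw [lintegral_subtype_comap (measurableSet_singleton _).compl, restrict_compl_singleton]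
  have h2 := hmp.lintegral_comp_emb (Homeomorph.measurableEmbedding _)
    (fun p => f (p.2.1 • p.1.1))
  have h3 : ∀ x : ({(0)}ᶜ : Set (EuclideanSpace ℝ (Fin n))),
      ((homeomorphUnitSphereProd (EuclideanSpace ℝ (Fin n))) x).2.1 • ((homeomorphUnitSphereProd (EuclideanSpace ℝ (Fin n))) x).1.1 = x.1 := by
    intro x
    have : ‖x.1‖ ≠ 0 := norm_ne_zero_iff.2 x.2
    simp [smul_smul, this]
  simp_rw [h3] at h2
  have hm : Measurable fun p : (sphere (0 : EuclideanSpace ℝ (Fin n)) 1) × Set.Ioi (0:ℝ) => f (p.2.1 • p.1.1) :=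
    hf.comp (by fun_prop)
  have hm2 : Measurable fun ρ : ℝ => ∫⁻ ω : sphere (0 : EuclideanSpace ℝ (Fin n)) 1, f (ρ • ω.1) ∂volume.toSphere := by
    have : Measurable fun p : ℝ × (sphere (0 : EuclideanSpace ℝ (Fin n)) 1) => f (p.1 • p.2.1) := hf.comp (by fun_prop)
    exact this.lintegral_prod_right'
  have h4 : ∀ ρ : ℝ, ∫⁻ ω, f (ρ • ω) ∂(sph n) = ∫⁻ ω : sphere (0 : EuclideanSpace ℝ (Fin n)) 1, f (ρ • ω.1) ∂volume.toSphere := by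
    intro ρ
    unfold sph
    exact lintegral_map (f := fun ω => f (ρ • ω)) (hf.comp (by fun_prop)) measurable_subtype_coe
  simp_rw [h4]
  rw [h1, h2, lintegral_prod_symm _ hm.aemeasurable, Measure.volumeIoiPow, lintegral_radM _ _ hm2,
    ← lintegral_subtype_comap measurableSet_Ioi]
  exact lintegral_withDensity_eq_lintegral_mul _ (by fun_prop) (hm2.comp measurable_subtype_coe)

lemma measurePreserving_polar {n : ℕ} (hn : 0 < n) :
    MeasurePreserving (fun p : ℝ × EuclideanSpace ℝ (Fin n) => p.1 • p.2) ((radM n).prod (sph n)) volume := by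
  refine ⟨by fun_prop, ?_⟩
  ext S hS
  rw [Measure.map_apply (by fun_prop) hS, ← lintegral_indicator_one hS, lintegral_polar hn _ (measurable_one.indicator hS),
    ← lintegral_indicator_one ((by fun_prop : Measurable fun p : ℝ × EuclideanSpace ℝ (Fin n) => p.1 • p.2) hS),
    lintegral_prod]
  · rfl
  · exact (measurable_one.indicator ((by fun_prop : Measurable fun p : ℝ × EuclideanSpace ℝ (Fin n) => p.1 • p.2) hS)).aemeasurable

lemma integrable_polar {n : ℕ} (hn : 0 < n) {f : EuclideanSpace ℝ (Fin n) → ℂ} (hf : Integrable f) :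
    Integrable (fun p : ℝ × EuclideanSpace ℝ (Fin n) => f (p.1 • p.2)) ((radM n).prod (sph n)) :=
  (measurePreserving_polar hn).integrable_comp_of_integrable hf

lemma integral_polar {n : ℕ} (hn : 0 < n) {f : EuclideanSpace ℝ (Fin n) → ℂ} (hf : Integrable f) :
    ∫ x, f x = ∫ ρ in Set.Ioi (0:ℝ), ((ρ ^ (n - 1) : ℝ) : ℂ) * ∫ ω, f (ρ • ω) ∂(sph n) := by
  rw [← integral_radM, ← integral_prod _ (integrable_polar hn hf), ← (measurePreserving_polar hn).map_eq,
    integral_map (measurePreserving_polar hn).measurable.aemeasurable]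
  rw [(measurePreserving_polar hn).map_eq]; exact hf.1

lemma lintegral_sph {n : ℕ} (hn : 0 < n) (g : EuclideanSpace ℝ (Fin n) → ℝ≥0∞) (hg : Measurable g) :
    ∫⁻ x in ball 0 1, g (‖x‖⁻¹ • x) = ENNReal.ofReal (1 / n) * ∫⁻ ω, g ω ∂(sph n) := by
  rw [← lintegral_indicator measurableSet_ball, lintegral_polar hn]
  · have h0 : ∀ ρ ∈ Set.Ioi (0:ℝ), ENNReal.ofReal (ρ ^ (n - 1)) * ∫⁻ ω, (ball (0 : EuclideanSpace ℝ (Fin n)) 1).indicator (fun x => g (‖x‖⁻¹ • x)) (ρ • ω) ∂(sph n)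
      = (Set.Ioo 0 1).indicator (fun ρ : ℝ => ENNReal.ofReal (ρ ^ (n - 1)) * ∫⁻ ω, g ω ∂(sph n)) ρ := by
      intro ρ hρ
      have hρ' : 0 < ρ := hρ
      by_cases h1 : ρ < 1
      · rw [Set.indicator_of_mem (show ρ ∈ Set.Ioo 0 1 from ⟨hρ, h1⟩)]
        congr 1
        refine lintegral_congr_ae ?_
        filter_upwards [ae_sph_norm n] with ω hω
        rw [Set.indicator_of_mem]
        · rw [norm_smul, hω, smul_smul]
          congr 1
          simp [abs_of_pos hρ', hρ'.ne']
        · simp [norm_smul, hω, abs_of_pos hρ', h1]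
      · rw [Set.indicator_of_notMem (fun h => h1 h.2)]
        rw [lintegral_eq_zero_of_ae_eq_zero, mul_zero]
        filter_upwards [ae_sph_norm n] with ω hω
        rw [Set.indicator_of_notMem]
        · rfl
        · simp [norm_smul, hω, abs_of_pos hρ']; linarith
    rw [lintegral_radM, setLIntegral_congr_fun measurableSet_Ioi h0, setLIntegral_indicator measurableSet_Ioo,
      Set.inter_eq_left.2 (fun x hx => hx.1), lintegral_mul_const _ (by fun_prop)]
    · congr 1
      have := lintegral_Ioc_rpow (a := (n : ℝ) - 1) (δ := 1) (by
        have : (0:ℝ) < n := by exact_mod_cast hn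
        linarith) one_pos
      rw [setLIntegral_congr Ioo_ae_eq_Ioc]
      simp only [Real.one_rpow, sub_add_cancel] at this
      rw [← this]
      refine setLIntegral_congr_fun measurableSet_Ioc fun ρ hρ => ?_
      rw [← Real.rpow_natCast, Nat.cast_sub hn, Nat.cast_one]
    · have : Measurable fun p : ℝ × EuclideanSpace ℝ (Fin n) => (ball (0 : EuclideanSpace ℝ (Fin n)) 1).indicator (fun x => g (‖x‖⁻¹ • x)) (p.1 • p.2) :=
        (Measurable.indicator (hg.comp (by fun_prop)) measurableSet_ball).comp (by fun_prop)
      exact this.lintegral_prod_right'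
  · exact Measurable.indicator (hg.comp (by fun_prop)) measurableSet_ball

lemma sph_rot {n : ℕ} (hn : 0 < n) (U : EuclideanSpace ℝ (Fin n) ≃ₗᵢ[ℝ] EuclideanSpace ℝ (Fin n)) :
    MeasurePreserving U (sph n) (sph n) := by
  refine ⟨U.continuous.measurable, ?_⟩
  have hc : ENNReal.ofReal (1 / n) ≠ 0 := by
    have : (0:ℝ) < n := by exact_mod_cast hn
    simp [this]
  have key : ∀ g : EuclideanSpace ℝ (Fin n) → ℝ≥0∞, Measurable g → ∫⁻ ω, g (U ω) ∂(sph n) = ∫⁻ ω, g ω ∂(sph n) := by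
    intro g hg
    rw [← ENNReal.mul_right_inj hc ENNReal.ofReal_ne_top, ← lintegral_sph hn g hg,
      ← lintegral_sph hn (fun ω => g (U ω)) (hg.comp U.continuous.measurable)]
    rw [← U.measurePreserving.setLIntegral_comp_preimage (f := fun x => g (‖x‖⁻¹ • x)) measurableSet_ball (hg.comp (by fun_prop))]
    have : U ⁻¹' ball 0 1 = ball 0 1 := by ext x; simp
    rw [this]
    simp
  ext S hS
  rw [Measure.map_apply U.continuous.measurable hS, ← lintegral_indicator_one hS, ← key _ (measurable_one.indicator hS),
    ← lintegral_indicator_one (U.continuous.measurable hS)]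
  rfl

lemma sph_pos {n : ℕ} (hn : 0 < n) : 0 < (sph n).real Set.univ := by
  have : Nonempty (Fin n) := ⟨⟨0, hn⟩⟩
  unfold sph
  rw [Measure.real, Measure.map_apply measurable_subtype_coe MeasurableSet.univ]
  refine ENNReal.toReal_pos ?_ (measure_ne_top _ _)
  rw [Set.preimage_univ]
  simp only [ne_eq, Measure.measure_univ_eq_zero]
  exact Measure.toSphere_ne_zero _

end sphere

section sphdecay

open Filter Topology

variable {n : ℕ}

lemma abs_coord_le_sph (n : ℕ) : ∀ᵐ ω ∂(sph n), ∀ i, |ω i| ≤ 1 := by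
  filter_upwards [ae_sph_norm n] with ω hω i
  rw [← hω]
  exact PiLp.norm_apply_le ω i

lemma integrable_sph_of_bdd {f : EuclideanSpace ℝ (Fin n) → ℝ} (hf : Continuous f) (C : ℝ)
    (hb : ∀ᵐ ω ∂(sph n), |f ω| ≤ C) : Integrable f (sph n) :=
  Integrable.of_bound hf.aestronglyMeasurable C hb

lemma hasDerivAt_sph_sin {a b c : EuclideanSpace ℝ (Fin n) → ℝ} (ha : Continuous a) (hb : Continuous b) (hc : Continuous c)
    (ha1 : ∀ᵐ ω ∂(sph n), |a ω| ≤ 1) (hc1 : ∀ᵐ ω ∂(sph n), |c ω| ≤ 1) (s : ℝ) :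
    HasDerivAt (fun s => ∫ ω, a ω * Real.sin (b ω + s * c ω) ∂(sph n))
      (∫ ω, a ω * c ω * Real.cos (b ω + s * c ω) ∂(sph n)) s := by
  refine (hasDerivAt_integral_of_dominated_loc_of_deriv_le (bound := fun _ => 1)
    (F' := fun s ω => a ω * c ω * Real.cos (b ω + s * c ω)) (s := Set.univ) Filter.univ_mem ?_ ?_ ?_ ?_ ?_ ?_).2
  · exact Filter.Eventually.of_forall fun s => Continuous.aestronglyMeasurable (by fun_prop)
  · refine integrable_sph_of_bdd (by fun_prop) 1 ?_
    filter_upwards [ha1] with ω h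
    rw [abs_mul]
    exact mul_le_one₀ h (abs_nonneg _) (Real.abs_sin_le_one _)
  · exact Continuous.aestronglyMeasurable (by fun_prop)
  · filter_upwards [ha1, hc1] with ω h h' s _
    rw [Real.norm_eq_abs, abs_mul, abs_mul]
    exact mul_le_one₀ (mul_le_one₀ h (abs_nonneg _) h') (abs_nonneg _) (Real.abs_cos_le_one _)
  · exact integrable_const _
  · refine ae_of_all _ fun ω s _ => ?_
    have h1 : HasDerivAt (fun s => b ω + s * c ω) (c ω) s := by
      simpa using ((hasDerivAt_id s).mul_const (c ω)).const_add (b ω)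
    have h2 := (h1.sin).const_mul (a ω)
    exact h2.congr_deriv (by ring)

lemma hasDerivAt_sph_cos {a b c : EuclideanSpace ℝ (Fin n) → ℝ} (ha : Continuous a) (hb : Continuous b) (hc : Continuous c)
    (ha1 : ∀ᵐ ω ∂(sph n), |a ω| ≤ 1) (hc1 : ∀ᵐ ω ∂(sph n), |c ω| ≤ 1) (s : ℝ) :
    HasDerivAt (fun s => ∫ ω, a ω * Real.cos (b ω + s * c ω) ∂(sph n))
      (-∫ ω, a ω * c ω * Real.sin (b ω + s * c ω) ∂(sph n)) s := by
  have h := hasDerivAt_sph_sin ha (hb.add_const (Real.pi / 2)) hc ha1 hc1 s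
  have e1 : ∀ s ω, Real.sin (b ω + Real.pi / 2 + s * c ω) = Real.cos (b ω + s * c ω) := by
    intro s ω; rw [← Real.sin_add_pi_div_two]; congr 1; ring
  have e2 : ∀ s ω, Real.cos (b ω + Real.pi / 2 + s * c ω) = -Real.sin (b ω + s * c ω) := by
    intro s ω; rw [← Real.cos_add_pi_div_two]; congr 1; ring
  simp_rw [e1, e2, mul_neg, integral_neg] at h
  exact h

lemma integral_sph_inner (hn : 0 < n) (h : ℝ → ℂ) (i : Fin n) (x : EuclideanSpace ℝ (Fin n)) :
    ∫ ω, h (inner ℝ x ω) ∂(sph n) = ∫ ω, h (‖x‖ * ω i) ∂(sph n) := by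
  set y : EuclideanSpace ℝ (Fin n) := EuclideanSpace.single i ‖x‖ with hy
  have hxy : ‖y‖ = ‖x‖ := by simp [hy]
  set U := (ℝ ∙ (y - x))ᗮ.reflection with hU
  have hUy : U y = x := Submodule.reflection_sub hxy
  rw [← (sph_rot hn U).integral_comp U.toHomeomorph.measurableEmbedding]
  congr 1 with ω
  rw [← hUy, LinearIsometryEquiv.inner_map_map]
  congr 1
  rw [hUy, hy, EuclideanSpace.inner_single_left]
  simp

/-- spherical average of the cosine -/
def phi (n : ℕ) (i : Fin n) (r : ℝ) : ℝ := ∫ ω, Real.cos (r * ω i) ∂(sph n)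
/-- its first derivative -/
def phi1 (n : ℕ) (i : Fin n) (r : ℝ) : ℝ := -∫ ω, ω i * Real.sin (r * ω i) ∂(sph n)
/-- its second derivative -/
def phi2 (n : ℕ) (i : Fin n) (r : ℝ) : ℝ := -∫ ω, ω i * ω i * Real.cos (r * ω i) ∂(sph n)

lemma hasDerivAt_phi (i : Fin n) (r : ℝ) : HasDerivAt (phi n i) (phi1 n i r) r := by
  have h := hasDerivAt_sph_cos (n := n) (a := fun _ => 1) (b := fun _ => 0) (c := fun ω => ω i)
    (by fun_prop) (by fun_prop) (by fun_prop) (by simp) ((abs_coord_le_sph n).mono fun ω h => h i) r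
  simp only [one_mul, zero_add] at h
  exact h

lemma hasDerivAt_phi1 (i : Fin n) (r : ℝ) : HasDerivAt (phi1 n i) (phi2 n i r) r := by
  have h := hasDerivAt_sph_sin (n := n) (a := fun ω => ω i) (b := fun _ => 0) (c := fun ω => ω i)
    (by fun_prop) (by fun_prop) (by fun_prop) ((abs_coord_le_sph n).mono fun ω h => h i) ((abs_coord_le_sph n).mono fun ω h => h i) r
  simp only [zero_add] at h
  exact h.neg

lemma abs_phi_le (i : Fin n) (r : ℝ) : |phi n i r| ≤ (sph n).real Set.univ := by
  have := norm_integral_le_of_norm_le_const (μ := sph n) (C := 1) (f := fun ω => Real.cos (r * ω i))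
    (ae_of_all _ fun ω => Real.abs_cos_le_one _)
  simpa [phi] using this

lemma abs_phi1_le (i : Fin n) (r : ℝ) : |phi1 n i r| ≤ (sph n).real Set.univ := by
  have := norm_integral_le_of_norm_le_const (μ := sph n) (C := 1) (f := fun ω => ω i * Real.sin (r * ω i))
    ((abs_coord_le_sph n).mono fun ω h => by
      rw [Real.norm_eq_abs, abs_mul]
      exact mul_le_one₀ (h i) (abs_nonneg _) (Real.abs_sin_le_one _))
  simpa [phi1] using this

/-- key identity -/
lemma phi1_eq (i j : Fin n) (hij : j ≠ i) (r : ℝ) (hr : 0 < r) :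
    phi1 n i r / r = -∫ ω, ω j * ω j * Real.cos (r * ω i) ∂(sph n) := by
  have hn : 0 < n := i.pos
  -- phi (sqrt (r^2+s^2)) = ∫ cos (r ω_i + s ω_j)
  have h0 : ∀ s : ℝ, phi n i (√(r ^ 2 + s ^ 2)) = ∫ ω, 1 * Real.cos (r * ω i + s * ω j) ∂(sph n) := by
    intro s
    set x : EuclideanSpace ℝ (Fin n) := EuclideanSpace.single i r + EuclideanSpace.single j s with hx
    have hnx : ‖x‖ = √(r ^ 2 + s ^ 2) := by
      rw [eq_comm, Real.sqrt_eq_iff_mul_self_eq (by positivity) (norm_nonneg _)]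
      rw [hx, norm_add_mul_self_real, EuclideanSpace.inner_single_left]
      simp [Pi.single_apply, hij, hij.symm]
      ring
    have hin : ∀ ω : EuclideanSpace ℝ (Fin n), inner ℝ x ω = r * ω i + s * ω j := by
      intro ω
      rw [hx, inner_add_left, EuclideanSpace.inner_single_left, EuclideanSpace.inner_single_left]; simp
    have := integral_sph_inner hn (fun u => ((Real.cos u : ℝ) : ℂ)) i x
    simp_rw [hin, hnx] at this
    rw [integral_complex_ofReal, integral_complex_ofReal] at this
    simp only [one_mul]
    rw [phi]
    exact (Complex.ofReal_injective this).symm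
  have h1 : ∀ s : ℝ, phi1 n i (√(r ^ 2 + s ^ 2)) * (s / √(r ^ 2 + s ^ 2)) =
      -∫ ω, ω j * Real.sin (r * ω i + s * ω j) ∂(sph n) := by
    intro s
    have hd1 := hasDerivAt_sph_cos (n := n) (a := fun _ => 1) (b := fun ω => r * ω i) (c := fun ω => ω j)
      (by fun_prop) (by fun_prop) (by fun_prop) (by simp) ((abs_coord_le_sph n).mono fun ω h => h j) s
    simp_rw [← h0] at hd1
    have hpos : 0 < r ^ 2 + s ^ 2 := by positivity
    have hd2 : HasDerivAt (fun s : ℝ => √(r ^ 2 + s ^ 2)) (s / √(r ^ 2 + s ^ 2)) s := by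
      have := (((hasDerivAt_id s).pow 2).const_add (r ^ 2)).sqrt (by simpa using hpos.ne')
      refine this.congr_deriv ?_
      simp only [id]; field_simp; simp
      rw [mul_div_assoc, div_self (Real.sqrt_pos.2 hpos).ne', mul_one]
    have hd3 := (hasDerivAt_phi i (√(r ^ 2 + s ^ 2))).comp s hd2
    have := hd3.unique hd1
    simpa using this
  have hd := (hasDerivAt_sph_sin (n := n) (a := fun ω => ω j) (b := fun ω => r * ω i) (c := fun ω => ω j)
      (by fun_prop) (by fun_prop) (by fun_prop) ((abs_coord_le_sph n).mono fun ω h => h j)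
      ((abs_coord_le_sph n).mono fun ω h => h j) 0).neg
  have e : (fun s => -∫ ω, ω j * Real.sin (r * ω i + s * ω j) ∂(sph n)) =
      fun s => phi1 n i (√(r ^ 2 + s ^ 2)) / √(r ^ 2 + s ^ 2) * s := by
    ext s; rw [← h1 s]; ring
  have hc : ContinuousAt (fun s : ℝ => phi1 n i (√(r ^ 2 + s ^ 2)) / √(r ^ 2 + s ^ 2)) 0 := by
    have hcp : Continuous (phi1 n i) := continuous_iff_continuousAt.2 fun r => (hasDerivAt_phi1 i r).continuousAt
    refine ContinuousAt.div (Continuous.continuousAt (by fun_prop)) (Continuous.continuousAt (by fun_prop)) ?_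
    simp [Real.sqrt_sq hr.le, hr.ne']
  have hd' : HasDerivAt (fun s : ℝ => phi1 n i (√(r ^ 2 + s ^ 2)) / √(r ^ 2 + s ^ 2) * s)
      (phi1 n i r / r) 0 := by
    rw [hasDerivAt_iff_tendsto_slope]
    have h2 : Tendsto (fun s : ℝ => phi1 n i (√(r ^ 2 + s ^ 2)) / √(r ^ 2 + s ^ 2)) (𝓝[≠] 0) (𝓝 (phi1 n i r / r)) := by
      have := hc.tendsto.mono_left (nhdsWithin_le_nhds (s := {0}ᶜ))
      simpa [Real.sqrt_sq hr.le] using this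
    refine h2.congr' ?_
    filter_upwards [self_mem_nhdsWithin] with s hs
    have hs : s ≠ 0 := hs
    simp [slope, hs]
    field_simp
  have := hd'.unique (by
    have h3 := hd
    simp only [Pi.neg_def] at h3
    rw [e] at h3
    exact h3)
  simpa using this

lemma phi_ode (i : Fin n) (r : ℝ) (hr : 0 ≤ r) :
    r * phi2 n i r + ((n : ℝ) - 1) * phi1 n i r + r * phi n i r = 0 := by
  rcases hr.eq_or_lt with h0 | hr
  · subst h0; simp [phi1]
  have hint : ∀ j : Fin n, Integrable (fun ω : EuclideanSpace ℝ (Fin n) => ω j * ω j * Real.cos (r * ω i)) (sph n) := by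
    intro j
    refine integrable_sph_of_bdd (by fun_prop) 1 ?_
    filter_upwards [abs_coord_le_sph n] with ω h
    rw [abs_mul, abs_mul]
    exact mul_le_one₀ (mul_le_one₀ (h j) (abs_nonneg _) (h j)) (abs_nonneg _) (Real.abs_cos_le_one _)
  have hsum : ∑ j, ∫ ω, ω j * ω j * Real.cos (r * ω i) ∂(sph n) = phi n i r := by
    rw [← integral_finsetSum _ fun j _ => hint j, phi]
    refine integral_congr_ae ?_
    filter_upwards [ae_sph_norm n] with ω hω
    rw [← Finset.sum_mul]
    have : ∑ j, ω j * ω j = 1 := by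
      have h2 := EuclideanSpace.real_norm_sq_eq ω
      rw [hω] at h2
      simp only [← sq]; rw [← h2]; norm_num
    rw [this, one_mul]
  rw [← Finset.add_sum_erase _ _ (Finset.mem_univ i)] at hsum
  have h2 : ∑ j ∈ Finset.univ.erase i, ∫ ω, ω j * ω j * Real.cos (r * ω i) ∂(sph n) =
      ((n : ℝ) - 1) * (-(phi1 n i r / r)) := by
    rw [Finset.sum_congr rfl (g := fun _ => -(phi1 n i r / r))]
    · rw [Finset.sum_const, Finset.card_erase_of_mem (Finset.mem_univ i), nsmul_eq_mul]
      simp [Nat.cast_sub i.pos]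
    · intro j hj
      rw [phi1_eq i j (Finset.ne_of_mem_erase hj) r hr, neg_neg]
  rw [h2] at hsum
  have h3 : ∫ ω, ω i * ω i * Real.cos (r * ω i) ∂(sph n) = -phi2 n i r := by simp [phi2]
  rw [h3] at hsum
  rw [← hsum]
  field_simp
  ring

/-- decay of the spherical average -/
lemma phi_decay (hn : 3 ≤ n) (i : Fin n) : ∃ C : ℝ, 0 < C ∧ ∀ r : ℝ, 0 < r →
    |phi n i r| ≤ C * r ^ (-(((n:ℝ) - 1) / 2)) := by
  set ν : ℝ := ((n:ℝ) - 1) / 2 with hν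
  have hn' : (3:ℝ) ≤ n := by exact_mod_cast hn
  have hν1 : 1 ≤ ν := by rw [hν]; linarith
  set c0 := ν * (ν - 1) with hc0
  have hc00 : 0 ≤ c0 := mul_nonneg (by linarith) (by linarith)
  set P : ℝ → ℝ := fun r => phi1 n i r + ν * phi n i r / r with hP
  set H : ℝ → ℝ := fun r => r ^ (2 * ν) * (phi n i r ^ 2 + P r ^ 2) with hH
  have hHd : ∀ r, 0 < r → HasDerivAt H (r ^ (2 * ν) * (2 * c0 * phi n i r * P r / r ^ 2)) r := by
    intro r hr
    have hPd : HasDerivAt P (phi2 n i r + (ν * phi1 n i r * r - ν * phi n i r * 1) / r ^ 2) r :=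
      (hasDerivAt_phi1 i r).add (((hasDerivAt_phi i r).const_mul ν).div (hasDerivAt_id r) hr.ne')
    have h1 := (Real.hasDerivAt_rpow_const (x := r) (p := 2 * ν) (Or.inl hr.ne')).mul
      (((hasDerivAt_phi i r).pow 2).add (hPd.pow 2))
    refine h1.congr_deriv ?_
    have hode := phi_ode i r hr.le
    have e2 : phi2 n i r = -phi n i r - 2 * ν / r * phi1 n i r := by
      rw [hν]; field_simp; linarith
    have e3 : phi1 n i r = P r - ν * phi n i r / r := by simp [hP]
    have e4 : r ^ (2 * ν - 1) = r ^ (2 * ν) / r := by rw [Real.rpow_sub_one hr.ne']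
    change 2 * ν * r ^ (2 * ν - 1) * (phi n i r ^ 2 + P r ^ 2) + r ^ (2 * ν) * (((2:ℕ):ℝ) * phi n i r ^ (2-1) * phi1 n i r + ((2:ℕ):ℝ) * P r ^ (2 - 1) * (phi2 n i r + (ν * phi1 n i r * r - ν * phi n i r * 1) / r ^ 2)) = _
    rw [e4, e2, e3, hc0]
    generalize P r = p
    field_simp
    push_cast
    ring
  set J : ℝ → ℝ := fun r => H r * Real.exp (c0 / r) with hJ
  have hJd : ∀ r, 0 < r → HasDerivAt J (r ^ (2 * ν) * (2 * c0 * phi n i r * P r / r ^ 2) * Real.exp (c0 / r) +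
      H r * (Real.exp (c0 / r) * (-c0 / r ^ 2))) r := by
    intro r hr
    refine (hHd r hr).mul ?_
    refine HasDerivAt.exp ?_
    refine ((hasDerivAt_const r c0).div (hasDerivAt_id r) hr.ne').congr_deriv ?_
    simp
  have hJanti : AntitoneOn J (Set.Ici 1) := by
    refine antitoneOn_of_deriv_nonpos (convex_Ici 1) ?_ ?_ ?_
    · intro r hr
      exact (hJd r (lt_of_lt_of_le one_pos hr)).continuousAt.continuousWithinAt
    · intro r hr
      rw [interior_Ici] at hr
      exact (hJd r (one_pos.trans hr)).differentiableAt.differentiableWithinAt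
    · intro r hr
      rw [interior_Ici] at hr
      have hr0 : 0 < r := one_pos.trans hr
      rw [(hJd r hr0).deriv]
      have : r ^ (2 * ν) * (2 * c0 * phi n i r * P r / r ^ 2) * Real.exp (c0 / r) +
        H r * (Real.exp (c0 / r) * (-c0 / r ^ 2)) =
        -(r ^ (2 * ν) * Real.exp (c0 / r) * c0 / r ^ 2 * (phi n i r - P r) ^ 2) := by
        simp only [hH]; field_simp; ring
      rw [this]
      have : 0 ≤ r ^ (2 * ν) := Real.rpow_nonneg hr0.le _
      simp only [Left.neg_nonpos_iff]
      positivity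
  set S := (sph n).real Set.univ with hS
  have hS0 : 0 < S := sph_pos (by omega)
  have hJ1 : 0 ≤ J 1 := by simp only [hJ, hH]; positivity
  refine ⟨S + √(J 1), by positivity, fun r hr => ?_⟩
  have hrp : 0 < r ^ (-ν) := Real.rpow_pos_of_pos hr _
  rcases le_total r 1 with h1 | h1
  · have : 1 ≤ r ^ (-ν) := Real.one_le_rpow_of_pos_of_le_one_of_nonpos hr h1 (by linarith)
    have h2 := abs_phi_le i r
    nlinarith [Real.sqrt_nonneg (J 1)]
  · have h2 : J r ≤ J 1 := hJanti (by simp) (by simpa using h1) h1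
    have h3 : r ^ (2 * ν) * phi n i r ^ 2 ≤ J r := by
      simp only [hJ, hH]
      have : 1 ≤ Real.exp (c0 / r) := Real.one_le_exp (by positivity)
      have h4 : 0 ≤ r ^ (2 * ν) := Real.rpow_nonneg hr.le _
      have h5 : r ^ (2 * ν) * phi n i r ^ 2 ≤ r ^ (2 * ν) * (phi n i r ^ 2 + P r ^ 2) := by
        gcongr; nlinarith [sq_nonneg (P r)]
      nlinarith [show 0 ≤ r ^ (2 * ν) * (phi n i r ^ 2 + P r ^ 2) by positivity]
    have h4 : r ^ ν * |phi n i r| ≤ √(J 1) := by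
      refine Real.le_sqrt_of_sq_le ?_
      rw [mul_pow, sq_abs, ← Real.rpow_natCast, ← Real.rpow_mul hr.le]
      refine le_trans ?_ h2
      rwa [show ν * ((2:ℕ):ℝ) = 2 * ν by push_cast; ring]
    have h5 : |phi n i r| = r ^ (-ν) * (r ^ ν * |phi n i r|) := by
      rw [← mul_assoc, ← Real.rpow_add hr]; simp
    rw [h5, mul_comm]
    gcongr
    linarith

end sphdecay

section poisson

open Filter Topology

variable {n : ℕ}

lemma integral_add3 {α : Type*} [MeasurableSpace α] {μ : Measure α} {f g h : α → ℂ}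
    (hf : Integrable f μ) (hg : Integrable g μ) (hh : Integrable h μ) :
    ∫ x, (f x + g x + h x) ∂μ = ∫ x, f x ∂μ + ∫ x, g x ∂μ + ∫ x, h x ∂μ := by
  rw [← integral_add hf hg]
  exact integral_add (hf.add hg) hh

/-- Laplace-type integral -/
def lap (m : ℕ) (g : ℝ → ℝ) (w : ℂ) : ℂ :=
  ∫ ρ in Set.Ioi (0:ℝ), Complex.exp (-w * ρ) * (ρ:ℂ) ^ m * (g ρ : ℂ)

lemma integrableOn_pow_exp (m : ℕ) {a : ℝ} (ha : 0 < a) :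
    IntegrableOn (fun x : ℝ => x ^ m * Real.exp (-a * x)) (Set.Ioi 0) := by
  have := integrableOn_rpow_mul_exp_neg_mul_rpow (p := 1) (s := m) (b := a)
    (by have : (0:ℝ) ≤ m := Nat.cast_nonneg m; linarith) one_pos ha
  simpa using this

lemma norm_lap_integrand {m : ℕ} {g : ℝ → ℝ} {C : ℝ} (hg : ∀ x, |g x| ≤ C) {w : ℂ} {a : ℝ}
    (hw : a ≤ w.re) {x : ℝ} (hx : 0 < x) :
    ‖Complex.exp (-w * x) * (x:ℂ) ^ m * (g x : ℂ)‖ ≤ C * (x ^ m * Real.exp (-a * x)) := by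
  rw [norm_mul, norm_mul, norm_pow, Complex.norm_exp, Complex.norm_real, Complex.norm_real,
    Real.norm_eq_abs, Real.norm_eq_abs, abs_of_pos hx]
  have h1 : (-w * (x:ℂ)).re = -w.re * x := by simp
  rw [h1]
  have h2 : Real.exp (-w.re * x) ≤ Real.exp (-a * x) := by
    apply Real.exp_le_exp.2; nlinarith
  calc Real.exp (-w.re * x) * x ^ m * |g x| ≤ Real.exp (-a * x) * x ^ m * C := by
        gcongr; exact hg x
    _ = _ := by ring

lemma lap_integrable {m : ℕ} {g : ℝ → ℝ} (hc : Continuous g) {C : ℝ} (hg : ∀ x, |g x| ≤ C) {w : ℂ}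
    (hw : 0 < w.re) :
    IntegrableOn (fun ρ : ℝ => Complex.exp (-w * ρ) * (ρ:ℂ) ^ m * (g ρ : ℂ)) (Set.Ioi 0) := by
  refine Integrable.mono' ((integrableOn_pow_exp m hw).const_mul C) ?_ ?_
  · exact Continuous.aestronglyMeasurable (by fun_prop)
  · filter_upwards [ae_restrict_mem measurableSet_Ioi] with x hx
    exact norm_lap_integrand hg le_rfl hx

lemma lap_ibp {m : ℕ} (hm : 1 ≤ m) {g g' : ℝ → ℝ} (hd : ∀ x, HasDerivAt g (g' x) x)
    (hc' : Continuous g') {C : ℝ} (hg : ∀ x, |g x| ≤ C) (hg' : ∀ x, |g' x| ≤ C) {w : ℂ}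
    (hw : 0 < w.re) : -w * lap m g w + m * lap (m - 1) g w + lap m g' w = 0 := by
  have hc : Continuous g := continuous_iff_continuousAt.2 fun x => (hd x).continuousAt
  have i1 := lap_integrable (m := m) hc hg hw
  have i2 := lap_integrable (m := m - 1) hc hg hw
  have i3 := lap_integrable (m := m) hc' hg' hw
  have key := integral_Ioi_of_hasDerivAt_of_tendsto (a := 0) (m := 0)
    (f := fun ρ : ℝ => Complex.exp (-w * ρ) * (ρ:ℂ) ^ m * (g ρ : ℂ))
    (f' := fun ρ : ℝ => -w * (Complex.exp (-w * ρ) * (ρ:ℂ) ^ m * (g ρ : ℂ)) +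
      m * (Complex.exp (-w * ρ) * (ρ:ℂ) ^ (m - 1) * (g ρ : ℂ)) +
      Complex.exp (-w * ρ) * (ρ:ℂ) ^ m * (g' ρ : ℂ)) ?_ ?_ ?_ ?_
  · rw [integral_add3 (i1.const_mul _) (i2.const_mul _) i3,
      integral_const_mul, integral_const_mul] at key
    have hm0 : m ≠ 0 := by omega
    simpa [lap, hm0] using key
  · exact Continuous.continuousWithinAt (by fun_prop)
  · intro x _
    have h1 : HasDerivAt (fun ρ : ℝ => Complex.exp (-w * ρ)) (Complex.exp (-w * x) * (-w)) x := by
      have := ((hasDerivAt_id x).ofReal_comp.const_mul (-w)).cexp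
      simpa using this
    have h2 : HasDerivAt (fun ρ : ℝ => (ρ:ℂ) ^ m) (m * (x:ℂ) ^ (m - 1)) x := by
      exact ((hasDerivAt_id x).ofReal_comp.pow m).congr_deriv (by simp)
    have h3 := (hd x).ofReal_comp
    refine ((h1.mul h2).mul h3).congr_deriv ?_
    simp only [Pi.mul_apply]
    ring
  · exact ((i1.const_mul _).add (i2.const_mul _)).add i3
  · rw [tendsto_zero_iff_norm_tendsto_zero]
    have := (tendsto_rpow_mul_exp_neg_mul_atTop_nhds_zero m w.re hw).const_mul C
    rw [mul_zero] at this
    refine squeeze_zero' (Eventually.of_forall fun _ => norm_nonneg _) ?_ this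
    filter_upwards [eventually_gt_atTop 0] with x hx
    rw [Real.rpow_natCast]
    exact norm_lap_integrand hg le_rfl hx

lemma lap_deriv {m : ℕ} {g : ℝ → ℝ} (hc : Continuous g) {C : ℝ} (hg : ∀ x, |g x| ≤ C) {w : ℂ}
    (hw : 0 < w.re) : HasDerivAt (lap m g) (-lap (m + 1) g w) w := by
  have hs : {z : ℂ | w.re / 2 < z.re} ∈ 𝓝 w :=
    (isOpen_lt continuous_const Complex.continuous_re).mem_nhds (by simpa using hw)
  have := (hasDerivAt_integral_of_dominated_loc_of_deriv_le (μ := volume.restrict (Set.Ioi (0:ℝ)))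
    (F := fun w (ρ:ℝ) => Complex.exp (-w * ρ) * (ρ:ℂ) ^ m * (g ρ : ℂ))
    (F' := fun w (ρ:ℝ) => -(Complex.exp (-w * ρ) * (ρ:ℂ) ^ (m + 1) * (g ρ : ℂ)))
    (bound := fun x => C * (x ^ (m + 1) * Real.exp (-(w.re / 2) * x))) hs ?_ ?_ ?_ ?_ ?_ ?_).2
  · rw [integral_neg] at this
    exact this
  · exact Eventually.of_forall fun z => Continuous.aestronglyMeasurable (by fun_prop)
  · exact lap_integrable hc hg hw
  · exact Continuous.aestronglyMeasurable (by fun_prop)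
  · filter_upwards [ae_restrict_mem measurableSet_Ioi] with x hx z hz
    rw [norm_neg]
    exact norm_lap_integrand hg (le_of_lt hz) hx
  · exact (integrableOn_pow_exp (m + 1) (half_pos hw)).const_mul C
  · refine ae_of_all _ fun x z _ => ?_
    have h1 : HasDerivAt (fun z : ℂ => Complex.exp (-z * x)) (Complex.exp (-z * x) * (-x)) z := by
      have := (((hasDerivAt_id z).neg).mul_const (x:ℂ)).cexp
      simpa using this
    refine ((h1.mul_const ((x:ℂ) ^ m)).mul_const (g x : ℂ)).congr_deriv ?_
    ring

lemma slit_of_re_pos {w : ℂ} (k : ℝ) (hw : 0 < w.re) : w + k * I ∈ Complex.slitPlane := by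
  left; simpa using hw

/-- radial Poisson formula -/
lemma lap_phi (hn : 3 ≤ n) (i : Fin n) : ∃ C > (0:ℝ), ∀ k : ℝ, 0 ≤ k → ∃ c : ℂ, ‖c‖ ≤ C ∧
    ∀ w : ℂ, 0 < w.re → lap (n - 1) (fun ρ => phi n i (k * ρ)) w =
      c * w * (w + k * I) ^ (-(((n:ℂ) + 1) / 2)) * (w + (-k : ℝ) * I) ^ (-(((n:ℂ) + 1) / 2)) := by
  set S := (sph n).real Set.univ with hS
  have hS0 : 0 < S := sph_pos (by omega)
  have hG : 0 < Real.Gamma n := Real.Gamma_pos_of_pos (by exact_mod_cast (by omega : 0 < n))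
  refine ⟨S * Real.Gamma n * 2 ^ ((n:ℝ) + 1), by positivity, fun k hk => ?_⟩
  set μ : ℂ := ((n:ℂ) + 1) / 2 with hμ
  set y : ℝ → ℝ := fun ρ => phi n i (k * ρ) with hy
  set y1 : ℝ → ℝ := fun ρ => k * phi1 n i (k * ρ) with hy1
  set y2 : ℝ → ℝ := fun ρ => k * (k * phi2 n i (k * ρ)) with hy2
  have hlin : ∀ x : ℝ, HasDerivAt (fun ρ => k * ρ) k x := fun x => by
    simpa using (hasDerivAt_id x).const_mul k
  have hd : ∀ x, HasDerivAt y (y1 x) x := fun x => by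
    refine ((hasDerivAt_phi i (k * x)).comp x (hlin x)).congr_deriv ?_
    simp only [hy1]; ring
  have hd1 : ∀ x, HasDerivAt y1 (y2 x) x := fun x => by
    refine (((hasDerivAt_phi1 i (k * x)).comp x (hlin x)).const_mul k).congr_deriv ?_
    simp only [hy2]; ring
  have hphi2c : Continuous (phi2 n i) := by
    unfold phi2
    refine Continuous.neg ?_
    refine continuous_of_dominated (bound := fun _ => 1) ?_ ?_ (integrable_const _) ?_
    · intro x; exact Continuous.aestronglyMeasurable (by fun_prop)
    · intro x
      filter_upwards [abs_coord_le_sph n] with ω h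
      rw [Real.norm_eq_abs, abs_mul, abs_mul]
      exact mul_le_one₀ (mul_le_one₀ (h i) (abs_nonneg _) (h i)) (abs_nonneg _) (Real.abs_cos_le_one _)
    · exact ae_of_all _ fun ω => by fun_prop
  have hphi2b : ∀ r, |phi2 n i r| ≤ S := by
    intro r
    have := norm_integral_le_of_norm_le_const (μ := sph n) (C := 1) (f := fun ω => ω i * ω i * Real.cos (r * ω i))
      ((abs_coord_le_sph n).mono fun ω h => by
        rw [Real.norm_eq_abs, abs_mul, abs_mul]
        exact mul_le_one₀ (mul_le_one₀ (h i) (abs_nonneg _) (h i)) (abs_nonneg _) (Real.abs_cos_le_one _))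
    simpa [phi2] using this
  have hc0 : Continuous y := continuous_iff_continuousAt.2 fun x => (hd x).continuousAt
  have hc1 : Continuous y1 := continuous_iff_continuousAt.2 fun x => (hd1 x).continuousAt
  have hc2 : Continuous y2 := by simp only [hy2]; fun_prop
  set K := S * (1 + k + k * k) with hK
  have hb0' : ∀ x, |y x| ≤ S := fun x => abs_phi_le i _
  have hb0 : ∀ x, |y x| ≤ K := fun x => (hb0' x).trans (by rw [hK]; nlinarith [mul_nonneg hk hk, mul_nonneg hS0.le hk, mul_nonneg hS0.le (mul_nonneg hk hk)])
  have hb1 : ∀ x, |y1 x| ≤ K := fun x => by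
    simp only [hy1]; rw [abs_mul, abs_of_nonneg hk]
    have := mul_le_mul_of_nonneg_left (abs_phi1_le i (k * x)) hk
    rw [hK]; nlinarith [mul_nonneg hk hk, mul_nonneg hS0.le hk, mul_nonneg hS0.le (mul_nonneg hk hk)]
  have hb2 : ∀ x, |y2 x| ≤ K := fun x => by
    simp only [hy2]; rw [abs_mul, abs_mul, abs_of_nonneg hk, ← mul_assoc]
    have := mul_le_mul_of_nonneg_left (hphi2b (k * x)) (mul_nonneg hk hk)
    rw [hK]; nlinarith [mul_nonneg hk hk, mul_nonneg hS0.le hk, mul_nonneg hS0.le (mul_nonneg hk hk)]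
  have hode : ∀ x : ℝ, 0 ≤ x → x * y2 x + ((n:ℝ) - 1) * y1 x + k ^ 2 * (x * y x) = 0 := by
    intro x hx
    have h := phi_ode i (k * x) (mul_nonneg hk hx)
    simp only [hy, hy1, hy2]
    linear_combination k * h
  have hodeL : ∀ (m : ℕ) (w : ℂ), 0 < w.re → lap (m + 1) y2 w + ((n:ℂ) - 1) * lap m y1 w + (k:ℂ) ^ 2 * lap (m + 1) y w = 0 := by
    intro m w hw
    unfold lap
    rw [← integral_const_mul, ← integral_const_mul,
      ← integral_add3 (lap_integrable hc2 hb2 hw) ((lap_integrable hc1 hb1 hw).const_mul _) ((lap_integrable hc0 hb0 hw).const_mul _)]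
    refine (setIntegral_congr_fun measurableSet_Ioi (g := fun _ => (0:ℂ)) ?_).trans (by simp)
    intro x hx
    have h : ((x * y2 x + ((n:ℝ) - 1) * y1 x + k ^ 2 * (x * y x) : ℝ) : ℂ) = 0 := by
      rw [hode x (le_of_lt hx)]; simp
    push_cast at h
    simp only
    linear_combination Complex.exp (-w * x) * (x:ℂ) ^ m * h
  have hrel : ∀ w : ℂ, 0 < w.re → w * (w ^ 2 + k ^ 2) * lap n y w = (n * w ^ 2 - k ^ 2) * lap (n - 1) y w := by
    intro w hw
    have e1 := lap_ibp (m := n - 1) (by omega) hd1 hc2 hb1 hb2 hw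
    have e2 := lap_ibp (m := n) (by omega) hd hc1 hb0 hb1 hw
    have e3 := lap_ibp (m := n) (by omega) hd1 hc2 hb1 hb2 hw
    have o1 := hodeL (n - 2) w hw
    have o2 := hodeL (n - 1) w hw
    rw [show n - 1 - 1 = n - 2 by omega] at e1
    rw [show n - 2 + 1 = n - 1 by omega] at o1
    rw [show n - 1 + 1 = n by omega] at o2
    rw [Nat.cast_sub (by omega)] at e1
    push_cast at e1
    linear_combination (-w^2) * e2 - w * e3 + w * o2 + o1 - e1
  set Ω : Set ℂ := {w : ℂ | 0 < w.re} with hΩ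
  have hΩo : IsOpen Ω := isOpen_lt continuous_const Complex.continuous_re
  set Q : ℂ → ℂ := fun w => lap (n - 1) y w * w⁻¹ * (w + k * I) ^ μ * (w + (-k : ℝ) * I) ^ μ with hQ
  have hQd : ∀ w ∈ Ω, HasDerivAt Q 0 w := by
    intro w hw
    have hw : 0 < w.re := hw
    have hw0 : w ≠ 0 := by rintro rfl; simp at hw
    have hs1 := slit_of_re_pos k hw
    have hs2 := slit_of_re_pos (-k) hw
    have h1 := lap_deriv (m := n - 1) hc0 hb0 hw
    rw [show n - 1 + 1 = n by omega] at h1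
    have h2 := hasDerivAt_inv hw0
    have h3 := ((hasDerivAt_id w).add_const ((k:ℂ) * I)).cpow_const (c := μ) hs1
    have h4 := ((hasDerivAt_id w).add_const (((-k:ℝ):ℂ) * I)).cpow_const (c := μ) hs2
    refine (((h1.mul h2).mul h3).mul h4).congr_deriv ?_
    simp only [id, Pi.mul_apply, Pi.inv_apply]
    have n1 : w + k * I ≠ 0 := Complex.slitPlane_ne_zero hs1
    have n2 : w + (-k:ℝ) * I ≠ 0 := Complex.slitPlane_ne_zero hs2
    rw [Complex.cpow_sub _ _ n1, Complex.cpow_sub _ _ n2, Complex.cpow_one, Complex.cpow_one]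
    generalize (w + k * I) ^ μ = X
    generalize (w + (-k:ℝ) * I) ^ μ = Y
    have hr := hrel w hw
    have hfac : w ^ 2 + (k:ℂ) ^ 2 = (w + k * I) * (w + (-k:ℝ) * I) := by
      push_cast; linear_combination ((k:ℂ) ^ 2) * I_sq
    have hsum : (w + k * I) + (w + (-k:ℝ) * I) = 2 * w := by push_cast; ring
    have hnum : (n:ℂ) * w ^ 2 - k ^ 2 = 2 * μ * w ^ 2 - (w ^ 2 + k ^ 2) := by rw [hμ]; ring
    rw [hnum, hfac] at hr
    generalize w + k * I = a at *
    generalize w + (-k:ℝ) * I = b at *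
    field_simp
    linear_combination (-X * Y) * hr + μ * X * Y * w * lap (n - 1) y w * hsum
  refine ⟨Q ((k + 1 : ℝ) : ℂ), ?_, fun w hw => ?_⟩
  · set u : ℝ := k + 1 with hu
    have hu0 : 0 < u := by rw [hu]; linarith
    have hure : 0 < ((u:ℝ):ℂ).re := by simpa using hu0
    have hL : ‖lap (n - 1) y u‖ ≤ S * ((1 / u) ^ (n:ℝ) * Real.Gamma n) := by
      rw [← Real.integral_rpow_mul_exp_neg_mul_Ioi (by exact_mod_cast (by omega : 0 < n)) hu0, ← integral_const_mul]
      refine norm_integral_le_of_norm_le ?_ ?_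
      · have := (integrableOn_pow_exp (n - 1) hu0).const_mul S
        refine IntegrableOn.congr_fun this ?_ measurableSet_Ioi
        intro x hx
        simp only
        rw [show ((n:ℝ) - 1) = ((n - 1 : ℕ) : ℝ) by rw [Nat.cast_sub (by omega)]; simp, Real.rpow_natCast, neg_mul]
      · filter_upwards [ae_restrict_mem measurableSet_Ioi] with x hx
        have := norm_lap_integrand (m := n - 1) hb0' (w := u) (a := u) (by simp) hx
        refine this.trans (le_of_eq ?_)
        rw [show ((n:ℝ) - 1) = ((n - 1 : ℕ) : ℝ) by rw [Nat.cast_sub (by omega)]; simp, Real.rpow_natCast, neg_mul]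
    have hP : ∀ k' : ℝ, |k'| ≤ u → ‖((u:ℂ) + k' * I) ^ μ‖ ≤ (2 * u) ^ (((n:ℝ) + 1) / 2) := by
      intro k' hk'
      have hne : (u:ℂ) + k' * I ≠ 0 := Complex.slitPlane_ne_zero (slit_of_re_pos k' hure)
      have e : μ = (((((n:ℝ) + 1) / 2 : ℝ)) : ℂ) := by rw [hμ]; push_cast; ring
      rw [e, Complex.norm_cpow_real]
      refine Real.rpow_le_rpow (norm_nonneg _) ?_ (by positivity)
      refine (norm_add_le _ _).trans ?_
      rw [norm_mul, Complex.norm_real, Complex.norm_real, Complex.norm_I, Real.norm_eq_abs, Real.norm_eq_abs, abs_of_pos hu0]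
      linarith
    simp only [hQ]
    rw [norm_mul, norm_mul, norm_mul, norm_inv, Complex.norm_real, Real.norm_eq_abs, abs_of_pos hu0]
    have q1 := hP k (by rw [abs_of_nonneg hk, hu]; linarith)
    have q2 := hP (-k) (by rw [abs_neg, abs_of_nonneg hk, hu]; linarith)
    calc _ ≤ S * ((1 / u) ^ (n:ℝ) * Real.Gamma n) * u⁻¹ * (2 * u) ^ (((n:ℝ) + 1) / 2) * (2 * u) ^ (((n:ℝ) + 1) / 2) := by
          gcongr
      _ = S * Real.Gamma n * 2 ^ ((n:ℝ) + 1) := by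
          rw [mul_assoc _ (_ ^ _) (_ ^ _), ← Real.rpow_add (by positivity), add_halves, Real.mul_rpow (by norm_num) hu0.le,
            Real.rpow_add_one hu0.ne', Real.div_rpow (by norm_num) hu0.le, Real.one_rpow]
          have : u ^ (n:ℝ) ≠ 0 := (Real.rpow_pos_of_pos hu0 _).ne'
          field_simp
  · have hconst : Q w = Q ((k + 1 : ℝ) : ℂ) := by
      refine hΩo.is_const_of_deriv_eq_zero (convex_halfSpace_re_gt 0).isPreconnected ?_ ?_ hw ?_
      · intro z hz; exact (hQd z hz).differentiableAt.differentiableWithinAt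
      · intro z hz; exact (hQd z hz).deriv
      · simp only [hΩ, Set.mem_setOf_eq, Complex.ofReal_re]; linarith
    rw [← hconst]
    simp only [hQ]
    have hw0 : w ≠ 0 := by rintro rfl; simp at hw
    have n1 : w + k * I ≠ 0 := Complex.slitPlane_ne_zero (slit_of_re_pos k hw)
    have n2 : w + (-k:ℝ) * I ≠ 0 := Complex.slitPlane_ne_zero (slit_of_re_pos (-k) hw)
    rw [Complex.cpow_neg, Complex.cpow_neg]
    have m1 : (w + k * I) ^ μ ≠ 0 := by rw [Ne, Complex.cpow_eq_zero_iff]; tauto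
    have m2 : (w + (-k:ℝ) * I) ^ μ ≠ 0 := by rw [Ne, Complex.cpow_eq_zero_iff]; tauto
    generalize (w + k * I) ^ μ = X at *
    generalize (w + (-k:ℝ) * I) ^ μ = Y at *
    field_simp

/-- Fourier transform of the surface measure is real and given by phi -/
lemma sph_fourier (i : Fin n) (x : EuclideanSpace ℝ (Fin n)) :
    ∫ ω, Complex.exp (2 * Real.pi * (inner ℝ x ω : ℝ) * I) ∂(sph n) = (phi n i (2 * Real.pi * ‖x‖) : ℂ) := by
  have hn : 0 < n := i.pos
  rw [integral_sph_inner hn (fun u => Complex.exp (2 * Real.pi * (u : ℝ) * I)) i x]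
  have hint : ∀ s : ℝ, Integrable (fun ω : EuclideanSpace ℝ (Fin n) => Complex.exp (2 * Real.pi * ((s * (‖x‖ * ω i) : ℝ) : ℂ) * I)) (sph n) := by
    intro s
    refine Integrable.of_bound (C := 1) (Continuous.aestronglyMeasurable (by fun_prop)) (ae_of_all _ fun ω => ?_)
    rw [show (2 * Real.pi * ((s * (‖x‖ * ω i) : ℝ) : ℂ) * I) = ((2 * Real.pi * (s * (‖x‖ * ω i)) : ℝ) : ℂ) * I by push_cast; ring]
    rw [Complex.norm_exp_ofReal_mul_I]
  have hneg : ∫ ω, Complex.exp (2 * Real.pi * ((‖x‖ * ω i : ℝ) : ℂ) * I) ∂(sph n) =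
      ∫ ω, Complex.exp (2 * Real.pi * (((-1) * (‖x‖ * ω i) : ℝ) : ℂ) * I) ∂(sph n) := by
    set U := LinearIsometryEquiv.neg ℝ (E := EuclideanSpace ℝ (Fin n))
    rw [← (sph_rot hn U).integral_comp U.toHomeomorph.measurableEmbedding]
    congr 1 with ω
    simp [U]
  have h2 : ((phi n i (2 * Real.pi * ‖x‖) : ℝ) : ℂ) = ∫ ω, (1/2 : ℂ) * (Complex.exp (2 * Real.pi * ((1 * (‖x‖ * ω i) : ℝ) : ℂ) * I) +
      Complex.exp (2 * Real.pi * (((-1) * (‖x‖ * ω i) : ℝ) : ℂ) * I)) ∂(sph n) := by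
    rw [phi, ← integral_complex_ofReal]
    congr 1 with ω
    rw [Complex.ofReal_cos, Complex.cos]
    push_cast
    rw [show 2 * Real.pi * (1 * ((‖x‖:ℂ) * (ω i : ℂ))) * I = 2 * Real.pi * (‖x‖:ℂ) * (ω i : ℂ) * I by ring,
      show 2 * Real.pi * (-1 * ((‖x‖:ℂ) * (ω i : ℂ))) * I = -(2 * Real.pi * (‖x‖:ℂ) * (ω i : ℂ)) * I by ring]
    ring
  rw [h2, integral_const_mul, integral_add (hint 1) (hint (-1)), ← hneg]
  simp only [one_mul]
  ring

lemma integrable_pow_norm_exp (hn : 0 < n) {a : ℝ} (ha : 0 < a) {γ : ℝ} (hγ : -(n:ℝ) < γ) :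
    Integrable (fun ξ : EuclideanSpace ℝ (Fin n) => ‖ξ‖ ^ γ * Real.exp (-a * ‖ξ‖)) := by
  have := Fin.pos_iff_nonempty.1 hn
  rw [integrable_fun_norm_addHaar volume (f := fun y => y ^ γ * Real.exp (-a * y))]
  have h := integrableOn_rpow_mul_exp_neg_mul_rpow (p := 1) (s := n - 1 + γ) (b := a) (by linarith) one_pos ha
  refine h.congr_fun ?_ measurableSet_Ioi
  intro x hx
  have hx : 0 < x := hx
  simp only [smul_eq_mul, finrank_euclideanSpace, Fintype.card_fin, Real.rpow_one]
  rw [Real.rpow_add hx, show ((n:ℝ) - 1) = ((n - 1 : ℕ) : ℝ) by rw [Nat.cast_sub (by omega)]; simp, Real.rpow_natCast]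
  ring

lemma integrable_exp_norm (hn : 0 < n) {w : ℂ} (hw : 0 < w.re) :
    Integrable (fun ξ : EuclideanSpace ℝ (Fin n) => Complex.exp (-w * ‖ξ‖)) := by
  have h := integrable_pow_norm_exp hn hw (γ := 0) (by simpa using hn)
  refine h.mono' (Continuous.aestronglyMeasurable (by fun_prop)) (ae_of_all _ fun ξ => ?_)
  rw [Complex.norm_exp]; simp

/-- Poisson formula -/
lemma poisson (hn : 3 ≤ n) : ∃ C > (0:ℝ), ∀ x : EuclideanSpace ℝ (Fin n), ∃ c : ℂ, ‖c‖ ≤ C ∧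
    ∀ w : ℂ, 0 < w.re → 𝓕⁻ (fun ξ : EuclideanSpace ℝ (Fin n) => Complex.exp (-w * ‖ξ‖)) x =
      c * w * (w + (2 * Real.pi * ‖x‖ : ℝ) * I) ^ (-(((n:ℂ) + 1) / 2)) *
        (w + (-(2 * Real.pi * ‖x‖) : ℝ) * I) ^ (-(((n:ℂ) + 1) / 2)) := by
  obtain ⟨C, hC, h⟩ := lap_phi hn ⟨0, by omega⟩
  refine ⟨C, hC, fun x => ?_⟩
  obtain ⟨c, hc, h⟩ := h (2 * Real.pi * ‖x‖) (by positivity)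
  refine ⟨c, hc, fun w hw => ?_⟩
  rw [← h w hw, Real.fourierInv_eq', integral_polar (by omega)]
  · unfold lap
    refine setIntegral_congr_fun measurableSet_Ioi fun ρ hρ => ?_
    have hρ : 0 < ρ := hρ
    have e : ∫ ω, Complex.exp (↑(2 * Real.pi * inner ℝ (ρ • ω) x) * I) • Complex.exp (-w * ‖ρ • ω‖) ∂(sph n) =
        ∫ ω, Complex.exp (2 * Real.pi * (inner ℝ (ρ • x) ω : ℝ) * I) * Complex.exp (-w * ρ) ∂(sph n) := by
      refine integral_congr_ae ?_
      filter_upwards [ae_sph_norm n] with ω hω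
      rw [norm_smul, hω, mul_one, Real.norm_eq_abs, abs_of_pos hρ, inner_smul_left, inner_smul_left, real_inner_comm, smul_eq_mul]
      push_cast
      simp
    simp only
    rw [e, integral_mul_const, sph_fourier ⟨0, by omega⟩, norm_smul, Real.norm_eq_abs, abs_of_pos hρ]
    rw [show 2 * Real.pi * ‖x‖ * ρ = 2 * Real.pi * (ρ * ‖x‖) by ring]
    push_cast
    ring
  · refine (integrable_exp_norm (by omega) hw).bdd_mul (c := 1) (Continuous.aestronglyMeasurable (by fun_prop)) (ae_of_all _ fun ξ => ?_)
    rw [Complex.norm_exp_ofReal_mul_I]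

end poisson

section kernelbound

open Filter Topology

lemma lint_max {γ δ T : ℝ} (hγ : -1 < γ) (hδ : γ - δ < -1) (hT : 0 < T) :
    ∫⁻ l in Set.Ioi (0:ℝ), ENNReal.ofReal (l ^ γ * (max l T) ^ (-δ)) ≤
      ENNReal.ofReal ((1 / (γ + 1) + 1 / (δ - γ - 1)) * T ^ (γ - δ + 1)) := by
  rw [← Set.Ioc_union_Ioi_eq_Ioi hT.le]
  refine (lintegral_union_le _ _ _).trans ?_
  have h1 : ∫⁻ l in Set.Ioc 0 T, ENNReal.ofReal (l ^ γ * (max l T) ^ (-δ)) =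
      ENNReal.ofReal (1 / (γ + 1) * T ^ (γ - δ + 1)) := by
    have : ∫⁻ l in Set.Ioc 0 T, ENNReal.ofReal (l ^ γ * (max l T) ^ (-δ)) =
        ∫⁻ l in Set.Ioc 0 T, ENNReal.ofReal (T ^ (-δ)) * ENNReal.ofReal (l ^ γ) := by
      refine setLIntegral_congr_fun measurableSet_Ioc fun l hl => ?_
      rw [max_eq_right hl.2, mul_comm, ENNReal.ofReal_mul (by positivity)]
    rw [this, lintegral_const_mul' _ _ ENNReal.ofReal_ne_top, lintegral_Ioc_rpow hγ hT, ← ENNReal.ofReal_mul (by positivity)]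
    congr 1
    rw [show γ - δ + 1 = -δ + (γ + 1) by ring, Real.rpow_add hT (-δ)]
    ring
  have h2 : ∫⁻ l in Set.Ioi T, ENNReal.ofReal (l ^ γ * (max l T) ^ (-δ)) =
      ENNReal.ofReal (1 / (δ - γ - 1) * T ^ (γ - δ + 1)) := by
    have : ∫⁻ l in Set.Ioi T, ENNReal.ofReal (l ^ γ * (max l T) ^ (-δ)) =
        ∫⁻ l in Set.Ioi T, ENNReal.ofReal (l ^ (γ - δ)) := by
      refine setLIntegral_congr_fun measurableSet_Ioi fun l hl => ?_
      have hl : T < l := hl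
      rw [max_eq_left hl.le, ← Real.rpow_add (hT.trans hl)]
      rfl
    rw [this, lintegral_Ioi_rpow hδ hT]
    congr 1
    have : δ - γ - 1 ≠ 0 := by linarith
    have : γ - δ + 1 ≠ 0 := by linarith
    rw [show δ - γ - 1 = -(γ - δ + 1) by ring]
    field_simp
  rw [h1, h2, ← ENNReal.ofReal_add, add_mul]
  · have : 0 < γ + 1 := by linarith
    positivity
  · have : 0 < δ - γ - 1 := by linarith
    positivity

lemma kr1 {l A B T β μ : ℝ} (hl : 0 < l) (hA : l ≤ A) (hB : l ≤ B) (hT : T ≤ B) (hT0 : 0 < T) (hμ : 1 ≤ μ) :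
    l ^ (β - 1) * (A ^ (-μ) * B ^ (1 - μ)) ≤ l ^ (β - μ - 1) * (max l T) ^ (-(μ - 1)) := by
  have h1 : A ^ (-μ) ≤ l ^ (-μ) := Real.rpow_le_rpow_of_nonpos hl hA (by linarith)
  have h2 : B ^ (1 - μ) ≤ (max l T) ^ (1 - μ) := Real.rpow_le_rpow_of_nonpos (by positivity) (max_le hB hT) (by linarith)
  have hA0 : 0 < A := hl.trans_le hA
  have hB0 : 0 < B := hl.trans_le hB
  calc l ^ (β - 1) * (A ^ (-μ) * B ^ (1 - μ)) ≤ l ^ (β - 1) * (l ^ (-μ) * (max l T) ^ (1 - μ)) := by gcongr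
    _ = _ := by
      rw [← mul_assoc, ← Real.rpow_add hl]; congr 2 <;> ring

lemma kr2 {l A B T β μ a0 : ℝ} (hl : 0 < l) (hA : l ≤ A) (ha : a0 ≤ A) (hB : l ≤ B) (hT : T ≤ B) (hT0 : 0 < T) (hμ : 1 ≤ μ)
    (hβ : μ ≤ β) (hn : β < 2 * μ - 1) :
    l ^ (β - 1) * (A ^ (-μ - 1) * B ^ (1 - μ)) ≤ T ^ (β - (2 * μ - 1)) * (l ^ (0:ℝ) * (max l a0) ^ (-(2:ℝ))) := by
  have hA0 : 0 < A := hl.trans_le hA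
  have hB0 : 0 < B := hl.trans_le hB
  have h1 : l ^ (β - 1) ≤ A ^ (μ - 1) * B ^ (β - μ) := by
    rw [show β - 1 = (μ - 1) + (β - μ) by ring, Real.rpow_add hl]
    gcongr
  have h2 : B ^ (β - (2 * μ - 1)) ≤ T ^ (β - (2 * μ - 1)) := Real.rpow_le_rpow_of_nonpos hT0 hT (by linarith)
  have h3 : A ^ (-(2:ℝ)) ≤ (max l a0) ^ (-(2:ℝ)) :=
    Real.rpow_le_rpow_of_nonpos (lt_max_of_lt_left hl) (max_le hA ha) (by norm_num)
  calc l ^ (β - 1) * (A ^ (-μ - 1) * B ^ (1 - μ)) ≤ (A ^ (μ - 1) * B ^ (β - μ)) * (A ^ (-μ - 1) * B ^ (1 - μ)) := by gcongr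
    _ = B ^ (β - (2 * μ - 1)) * A ^ (-(2:ℝ)) := by
      rw [show β - (2 * μ - 1) = (β - μ) + (1 - μ) by ring, show (-(2:ℝ)) = (μ - 1) + (-μ - 1) by ring,
        Real.rpow_add hA0, Real.rpow_add hB0]; ring
    _ ≤ _ := by rw [Real.rpow_zero, one_mul]; gcongr

lemma kr3 {l A B T β μ : ℝ} (hl : 0 < l) (hA : l ≤ A) (hB : l ≤ B) (hT : T ≤ B) (hT0 : 0 < T) (hμ : 1 ≤ μ) :
    l ^ (β - 1) * (l * (A ^ (-μ) * B ^ (-μ))) ≤ l ^ (β - μ) * (max l T) ^ (-μ) := by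
  have h1 : A ^ (-μ) ≤ l ^ (-μ) := Real.rpow_le_rpow_of_nonpos hl hA (by linarith)
  have h2 : B ^ (-μ) ≤ (max l T) ^ (-μ) := Real.rpow_le_rpow_of_nonpos (by positivity) (max_le hB hT) (by linarith)
  have hA0 : 0 < A := hl.trans_le hA
  have hB0 : 0 < B := hl.trans_le hB
  calc l ^ (β - 1) * (l * (A ^ (-μ) * B ^ (-μ))) ≤ l ^ (β - 1) * (l * (l ^ (-μ) * (max l T) ^ (-μ))) := by gcongr
    _ = l ^ (β - 1) * l ^ (1:ℝ) * l ^ (-μ) * (max l T) ^ (-μ) := by rw [Real.rpow_one]; ring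
    _ = _ := by
      rw [← Real.rpow_add hl, ← Real.rpow_add hl]; congr 2; ring

/-- the profile -/
def kprof (μ : ℝ) (w : ℂ) (κ : ℝ) : ℂ := w * (w + κ * I) ^ (-(μ:ℂ)) * (w + (-κ : ℝ) * I) ^ (-(μ:ℂ))

lemma kprof_symm (μ : ℝ) (w : ℂ) (κ : ℝ) : kprof μ w (-κ) = kprof μ w κ := by
  unfold kprof; rw [neg_neg]; ring

lemma norm_im_mono {u v : ℂ} (h : u.re = v.re) (h2 : |u.im| ≤ |v.im|) : ‖u‖ ≤ ‖v‖ := by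
  rw [Complex.norm_def, Complex.norm_def]
  refine Real.sqrt_le_sqrt ?_
  rw [Complex.normSq_apply, Complex.normSq_apply, h]
  have := abs_le_abs_of_sq_le_sq' h2
  nlinarith [abs_mul_abs_self u.im, abs_mul_abs_self v.im, abs_nonneg u.im, abs_nonneg v.im]
where abs_le_abs_of_sq_le_sq' {a b : ℝ} (h : |a| ≤ |b|) : a * a ≤ b * b := by
        nlinarith [abs_mul_abs_self a, abs_mul_abs_self b, abs_nonneg a, abs_nonneg b]

lemma kprof_hasDerivAt (μ : ℝ) {w : ℂ} (hw : 0 < w.re) (κ : ℝ) {l : ℝ} (hl : 0 ≤ l) :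
    HasDerivAt (fun l : ℝ => kprof μ (l + w) κ)
      ((l + w + κ * I) ^ (-(μ:ℂ)) * (l + w + (-κ : ℝ) * I) ^ (-(μ:ℂ)) - μ * kprof μ (l + w) κ / (l + w + κ * I)
        - μ * kprof μ (l + w) κ / (l + w + (-κ:ℝ) * I)) l := by
  have hre : 0 < ((l:ℂ) + w).re := by simp; linarith
  have hs1 := slit_of_re_pos κ hre
  have hs2 := slit_of_re_pos (-κ) hre
  have n1 := Complex.slitPlane_ne_zero hs1
  have n2 := Complex.slitPlane_ne_zero hs2
  have h0 : HasDerivAt (fun z : ℂ => z + w) 1 (l:ℂ) := (hasDerivAt_id _).add_const w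
  have h1 := (h0.add_const ((κ:ℂ) * I)).cpow_const (c := -(μ:ℂ)) hs1
  have h2 := (h0.add_const (((-κ:ℝ):ℂ) * I)).cpow_const (c := -(μ:ℂ)) hs2
  have h3 := ((h0.mul h1).mul h2).comp_ofReal
  refine h3.congr_deriv ?_
  unfold kprof
  simp only [Pi.mul_apply]
  rw [Complex.cpow_sub _ _ n1, Complex.cpow_sub _ _ n2, Complex.cpow_one, Complex.cpow_one]
  field_simp
  ring

lemma kern_pt {μ β : ℝ} (hμ : 1 ≤ μ) (hβ : μ ≤ β) (hn : β < 2 * μ - 1) {w : ℂ} (hw : 0 < w.re) (hw' : w.im ≠ 0)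
    {κ : ℝ} (hκ : |w.im + κ| ≤ |w.im - κ|) {l : ℝ} (hl : 0 < l) {z : ℂ} (hz : z.re = β) :
    ‖β * (l:ℂ) ^ (z - 1) * kprof μ (l + w) κ + (l:ℂ) ^ z * ((l + w + κ * I) ^ (-(μ:ℂ)) * (l + w + (-κ : ℝ) * I) ^ (-(μ:ℂ)) - μ * kprof μ (l + w) κ / (l + w + κ * I)
        - μ * kprof μ (l + w) κ / (l + w + (-κ:ℝ) * I))‖ ≤
      (β - μ) * (l ^ (β - μ - 1) * (max l |w.im|) ^ (-(μ - 1))) +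
      (μ * ‖w + κ * I‖) * (|w.im| ^ (β - (2 * μ - 1)) * (l ^ (0:ℝ) * (max l ‖w + κ * I‖) ^ (-(2:ℝ)))) +
      (1 + μ) * (l ^ (β - μ) * (max l |w.im|) ^ (-μ)) := by
  set X : ℂ := l + w + κ * I with hX
  set Y : ℂ := l + w + (-κ:ℝ) * I with hY
  set a : ℂ := w + κ * I with ha
  have hXre : X.re = l + w.re := by simp [hX]
  have hYre : Y.re = l + w.re := by simp [hY]
  have hXim : X.im = w.im + κ := by simp [hX]
  have hYim : Y.im = w.im - κ := by simp [hY]; ring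
  have hX0 : X ≠ 0 := fun h => by rw [h] at hXre; simp at hXre; linarith
  have hY0 : Y ≠ 0 := fun h => by rw [h] at hYre; simp at hYre; linarith
  have hlX : l ≤ ‖X‖ := by
    have := Complex.abs_re_le_norm X; rw [hXre, abs_of_pos (by linarith)] at this; linarith
  have hXY : ‖X‖ ≤ ‖Y‖ := norm_im_mono (by rw [hXre, hYre]) (by rw [hXim, hYim]; exact hκ)
  have hTY : |w.im| ≤ ‖Y‖ := by
    have := Complex.abs_im_le_norm Y
    rw [hYim] at this
    have h2 : |w.im| * 2 ≤ |w.im + κ| + |w.im - κ| := by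
      have := abs_add_le (w.im + κ) (w.im - κ)
      rw [show w.im + κ + (w.im - κ) = w.im * 2 by ring, abs_mul] at this
      simpa using this
    linarith
  have hwY : ‖(l:ℂ) + w‖ ≤ ‖Y‖ := by
    have : ((l:ℂ) + w) = (1/2 : ℝ) * X + (1/2 : ℝ) * Y := by rw [hX, hY]; push_cast; ring
    rw [this]
    refine (norm_add_le _ _).trans ?_
    rw [norm_mul, norm_mul, Complex.norm_real]
    norm_num
    linarith
  have haX : ‖a‖ ≤ ‖X‖ := by
    rw [Complex.norm_def, Complex.norm_def]
    refine Real.sqrt_le_sqrt ?_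
    rw [Complex.normSq_apply, Complex.normSq_apply, hXre, hXim]
    have e1 : a.re = w.re := by simp [ha]
    have e2 : a.im = w.im + κ := by simp [ha]
    rw [e1, e2]
    nlinarith
  have hA0 : 0 < ‖X‖ := norm_pos_iff.2 hX0
  have hB0 : 0 < ‖Y‖ := norm_pos_iff.2 hY0
  have hT0 : 0 < |w.im| := abs_pos.2 hw'
  have hl0 : (l:ℂ) ≠ 0 := by exact_mod_cast hl.ne'
  have hid : β * (l:ℂ) ^ (z - 1) * kprof μ (l + w) κ + (l:ℂ) ^ z * (X ^ (-(μ:ℂ)) * Y ^ (-(μ:ℂ)) - μ * kprof μ (l + w) κ / X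
        - μ * kprof μ (l + w) κ / Y) =
      (l:ℂ) ^ (z - 1) * (((β:ℂ) - μ) * kprof μ (l + w) κ) + (l:ℂ) ^ (z - 1) * (μ * (kprof μ (l + w) κ * a / X)) +
      ((l:ℂ) ^ (z - 1) * (l * (X ^ (-(μ:ℂ)) * Y ^ (-(μ:ℂ)))) - (l:ℂ) ^ (z - 1) * (μ * (l * (kprof μ (l + w) κ / Y)))) := by
    have e : (l:ℂ) ^ z = (l:ℂ) ^ (z - 1) * l := by rw [Complex.cpow_sub _ _ hl0, Complex.cpow_one]; field_simp
    have e2 : a = X - l := by rw [ha, hX]; ring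
    rw [e, e2]
    generalize (l:ℂ) ^ (z - 1) = L
    field_simp
    ring
  rw [hid]
  have hzn : ‖(l:ℂ) ^ (z - 1)‖ = l ^ (β - 1) := by
    rw [Complex.norm_cpow_eq_rpow_re_of_pos hl]; simp [hz]
  have hXn : ‖X ^ (-(μ:ℂ))‖ = ‖X‖ ^ (-μ) := by
    rw [← Complex.ofReal_neg, Complex.norm_cpow_real]
  have hYn : ‖Y ^ (-(μ:ℂ))‖ = ‖Y‖ ^ (-μ) := by
    rw [← Complex.ofReal_neg, Complex.norm_cpow_real]
  have hk : ‖kprof μ (l + w) κ‖ ≤ ‖X‖ ^ (-μ) * ‖Y‖ ^ (1 - μ) := by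
    unfold kprof
    rw [← hX, ← hY, norm_mul, norm_mul, hXn, hYn]
    calc _ ≤ ‖Y‖ * ‖X‖ ^ (-μ) * ‖Y‖ ^ (-μ) := by gcongr
      _ = _ := by rw [show 1 - μ = 1 + -μ by ring, Real.rpow_add hB0, Real.rpow_one]; ring
  have k1 := kr1 (β := β) hl hlX (hlX.trans hXY) hTY hT0 hμ
  have k2 := kr2 (β := β) hl hlX haX (hlX.trans hXY) hTY hT0 hμ hβ hn
  have k3 := kr3 (β := β) hl hlX (hlX.trans hXY) hTY hT0 hμ
  have hl1 : 0 ≤ l ^ (β - 1) := by positivity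
  have hbm : 0 ≤ β - μ := by linarith
  have hμ0 : 0 ≤ μ := by linarith
  have hnμ : ‖(μ:ℂ)‖ = μ := by rw [Complex.norm_real, Real.norm_eq_abs, abs_of_nonneg hμ0]
  have hnl : ‖(l:ℂ)‖ = l := by rw [Complex.norm_real, Real.norm_eq_abs, abs_of_pos hl]
  have t1 : ‖(l:ℂ) ^ (z - 1) * (((β:ℂ) - μ) * kprof μ (l + w) κ)‖ ≤ (β - μ) * (l ^ (β - μ - 1) * (max l |w.im|) ^ (-(μ - 1))) := by
    rw [norm_mul, norm_mul, hzn, ← Complex.ofReal_sub, Complex.norm_real, Real.norm_eq_abs, abs_of_nonneg hbm]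
    calc _ ≤ l ^ (β - 1) * ((β - μ) * (‖X‖ ^ (-μ) * ‖Y‖ ^ (1 - μ))) := by gcongr
      _ = (β - μ) * (l ^ (β - 1) * (‖X‖ ^ (-μ) * ‖Y‖ ^ (1 - μ))) := by ring
      _ ≤ _ := by gcongr
  have t2 : ‖(l:ℂ) ^ (z - 1) * (μ * (kprof μ (l + w) κ * a / X))‖ ≤ (μ * ‖a‖) * (|w.im| ^ (β - (2 * μ - 1)) * (l ^ (0:ℝ) * (max l ‖a‖) ^ (-(2:ℝ)))) := by
    rw [norm_mul, norm_mul, norm_div, norm_mul, hzn, hnμ]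
    calc _ ≤ l ^ (β - 1) * (μ * ((‖X‖ ^ (-μ) * ‖Y‖ ^ (1 - μ)) * ‖a‖ / ‖X‖)) := by gcongr
      _ = (μ * ‖a‖) * (l ^ (β - 1) * (‖X‖ ^ (-μ - 1) * ‖Y‖ ^ (1 - μ))) := by
        rw [Real.rpow_sub_one hA0.ne']; ring
      _ ≤ _ := by gcongr
  have t3 : ‖(l:ℂ) ^ (z - 1) * (l * (X ^ (-(μ:ℂ)) * Y ^ (-(μ:ℂ))))‖ ≤ l ^ (β - μ) * (max l |w.im|) ^ (-μ) := by
    rw [norm_mul, norm_mul, norm_mul, hzn, hnl, hXn, hYn]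
    exact k3
  have t4 : ‖(l:ℂ) ^ (z - 1) * (μ * (l * (kprof μ (l + w) κ / Y)))‖ ≤ μ * (l ^ (β - μ) * (max l |w.im|) ^ (-μ)) := by
    rw [norm_mul, norm_mul, norm_mul, norm_div, hzn, hnl, hnμ]
    calc _ ≤ l ^ (β - 1) * (μ * (l * ((‖X‖ ^ (-μ) * ‖Y‖ ^ (1 - μ)) / ‖Y‖))) := by gcongr
      _ = μ * (l ^ (β - 1) * (l * (‖X‖ ^ (-μ) * ‖Y‖ ^ (-μ)))) := by
        rw [show 1 - μ = -μ + 1 by ring, Real.rpow_add_one hB0.ne']; field_simp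
      _ ≤ _ := by gcongr
  have := norm_add_le_of_le (norm_add_le_of_le t1 t2) (norm_sub_le_of_le t3 t4)
  linarith

/-- scalar kernel bound -/
lemma kern_scalar {μ β : ℝ} (hμ : 1 ≤ μ) (hβ : μ ≤ β) (hn : β < 2 * μ - 1) :
    ∃ C > (0:ℝ), ∀ (w : ℂ) (κ : ℝ), 0 < w.re → w.im ≠ 0 → ∀ z : ℂ, z.re = β →
      IntegrableOn (fun l : ℝ => (l:ℂ) ^ (z - 1) * kprof μ (l + w) κ) (Set.Ioi 0) →
      ‖(z - β) * ∫ l in Set.Ioi (0:ℝ), (l:ℂ) ^ (z - 1) * kprof μ (l + w) κ‖ ≤ C * |w.im| ^ (β - (2 * μ - 1)) := by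
  set c1 : ℝ := (1 / (β - μ - 1 + 1) + 1 / (μ - 1 - (β - μ - 1) - 1)) with hc1
  set c2 : ℝ := (1 / ((0:ℝ) + 1) + 1 / (2 - 0 - 1)) with hc2
  set c3 : ℝ := (1 / (β - μ + 1) + 1 / (μ - (β - μ) - 1)) with hc3
  have hc2' : 0 ≤ c2 := by rw [hc2]; norm_num
  have hc1' : 0 ≤ c1 := by
    rw [hc1]
    exact add_nonneg (one_div_nonneg.2 (by linarith)) (one_div_nonneg.2 (by linarith))
  have hc3' : 0 ≤ c3 := by
    rw [hc3]
    exact add_nonneg (one_div_nonneg.2 (by linarith)) (one_div_nonneg.2 (by linarith))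
  have hbm : 0 ≤ β - μ := by linarith
  set C := (β - μ) * c1 + μ * c2 + (1 + μ) * c3 with hC
  have hC0 : 0 ≤ C := by positivity
  have main : ∀ (w : ℂ) (κ : ℝ), |w.im + κ| ≤ |w.im - κ| → 0 < w.re → w.im ≠ 0 → ∀ z : ℂ, z.re = β →
      IntegrableOn (fun l : ℝ => (l:ℂ) ^ (z - 1) * kprof μ (l + w) κ) (Set.Ioi 0) →
      ‖(z - β) * ∫ l in Set.Ioi (0:ℝ), (l:ℂ) ^ (z - 1) * kprof μ (l + w) κ‖ ≤ C * |w.im| ^ (β - (2 * μ - 1)) := by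
    intro w κ hκ hw hw' z hz hint
    set T := |w.im| with hT
    have hT0 : 0 < T := abs_pos.2 hw'
    set a0 := ‖w + κ * I‖ with ha0
    have ha0' : 0 < a0 := norm_pos_iff.2 (Complex.slitPlane_ne_zero (slit_of_re_pos κ hw))
    set g : ℝ → ℂ := fun l => β * (l:ℂ) ^ (z - 1) * kprof μ (l + w) κ + (l:ℂ) ^ z * ((l + w + κ * I) ^ (-(μ:ℂ)) * (l + w + (-κ : ℝ) * I) ^ (-(μ:ℂ)) - μ * kprof μ (l + w) κ / (l + w + κ * I)
        - μ * kprof μ (l + w) κ / (l + w + (-κ:ℝ) * I)) with hg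
    have hgl : ∫⁻ l in Set.Ioi (0:ℝ), ‖g l‖ₑ ≤ ENNReal.ofReal (C * T ^ (β - (2 * μ - 1))) := by
      have hb : ∀ l ∈ Set.Ioi (0:ℝ), ‖g l‖ₑ ≤
          ENNReal.ofReal (β - μ) * ENNReal.ofReal (l ^ (β - μ - 1) * (max l T) ^ (-(μ - 1))) +
          ENNReal.ofReal (μ * a0 * T ^ (β - (2 * μ - 1))) * ENNReal.ofReal (l ^ (0:ℝ) * (max l a0) ^ (-(2:ℝ))) +
          ENNReal.ofReal (1 + μ) * ENNReal.ofReal (l ^ (β - μ) * (max l T) ^ (-μ)) := by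
        intro l hl
        have hl : 0 < l := hl
        have := kern_pt hμ hβ hn hw hw' hκ hl hz
        have e1 : 0 < max l T := lt_max_of_lt_left hl
        have e2 : 0 < max l a0 := lt_max_of_lt_left hl
        rw [← ENNReal.ofReal_mul hbm, ← ENNReal.ofReal_mul (by positivity), ← ENNReal.ofReal_mul (by positivity),
          ← ENNReal.ofReal_add (by positivity) (by positivity), ← ENNReal.ofReal_add (by positivity) (by positivity),
          ← ofReal_norm]
        refine ENNReal.ofReal_le_ofReal (this.trans (le_of_eq ?_))
        ring
      refine (setLIntegral_mono' measurableSet_Ioi hb).trans ?_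
      rw [lintegral_add_right _ (by fun_prop), lintegral_add_right _ (by fun_prop), lintegral_const_mul' _ _ ENNReal.ofReal_ne_top,
        lintegral_const_mul' _ _ ENNReal.ofReal_ne_top, lintegral_const_mul' _ _ ENNReal.ofReal_ne_top]
      have e1 : ENNReal.ofReal (β - μ) * ∫⁻ l in Set.Ioi (0:ℝ), ENNReal.ofReal (l ^ (β - μ - 1) * (max l T) ^ (-(μ - 1))) ≤
          ENNReal.ofReal ((β - μ) * (c1 * T ^ (β - (2 * μ - 1)))) := by
        rcases hbm.eq_or_lt with h | h
        · rw [← h]; simp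
        · rw [ENNReal.ofReal_mul hbm]
          gcongr
          refine (lint_max (by linarith) (by linarith) hT0).trans (le_of_eq ?_)
          rw [hc1]; congr 3; ring
      have e2 : ENNReal.ofReal (μ * a0 * T ^ (β - (2 * μ - 1))) * ∫⁻ l in Set.Ioi (0:ℝ), ENNReal.ofReal (l ^ (0:ℝ) * (max l a0) ^ (-(2:ℝ))) ≤
          ENNReal.ofReal (μ * c2 * T ^ (β - (2 * μ - 1))) := by
        calc _ ≤ ENNReal.ofReal (μ * a0 * T ^ (β - (2 * μ - 1))) * ENNReal.ofReal (c2 * a0 ^ ((0:ℝ) - 2 + 1)) := by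
              gcongr
              exact lint_max (by norm_num) (by norm_num) ha0'
          _ = _ := by
              rw [← ENNReal.ofReal_mul (by positivity)]
              congr 1
              rw [show (0:ℝ) - 2 + 1 = -1 by norm_num, Real.rpow_neg_one]
              field_simp
      have e3 : ENNReal.ofReal (1 + μ) * ∫⁻ l in Set.Ioi (0:ℝ), ENNReal.ofReal (l ^ (β - μ) * (max l T) ^ (-μ)) ≤
          ENNReal.ofReal ((1 + μ) * (c3 * T ^ (β - (2 * μ - 1)))) := by
        rw [ENNReal.ofReal_mul (by positivity)]
        gcongr
        refine (lint_max (by linarith) (by linarith) hT0).trans (le_of_eq ?_)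
        rw [hc3]; congr 3; ring
      refine (add_le_add (add_le_add e1 e2) e3).trans (le_of_eq ?_)
      rw [← ENNReal.ofReal_add (by positivity) (by positivity), ← ENNReal.ofReal_add (by positivity) (by positivity)]
      congr 1
      rw [hC]; ring
    have hcont : ContinuousOn (fun l : ℝ => kprof μ (l + w) κ) (Set.Ioi 0) := fun l hl =>
      (kprof_hasDerivAt μ hw κ (le_of_lt hl)).continuousAt.continuousWithinAt
    have hF : ∀ l ∈ Set.Ioi (0:ℝ), HasDerivAt (fun l : ℝ => (l:ℂ) ^ z * kprof μ (l + w) κ)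
        ((z - β) * ((l:ℂ) ^ (z - 1) * kprof μ (l + w) κ) + g l) l := by
      intro l hl
      have hl : 0 < l := hl
      have hz0 : z ≠ 0 := fun h => by rw [h] at hz; simp at hz; linarith
      refine ((hasDerivAt_ofReal_cpow_const hl.ne' hz0).mul (kprof_hasDerivAt μ hw κ hl.le)).congr_deriv ?_
      simp only [hg]
      ring
    have hgm : AEStronglyMeasurable g (volume.restrict (Set.Ioi 0)) := by
      have hm : Measurable (fun l : ℝ => kprof μ (l + w) κ) := by unfold kprof; fun_prop
      refine Measurable.aestronglyMeasurable ?_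
      simp only [hg]
      fun_prop
    have hgi : IntegrableOn g (Set.Ioi 0) := ⟨hgm, lt_of_le_of_lt hgl ENNReal.ofReal_lt_top⟩
    have key := integral_Ioi_of_hasDerivAt_of_tendsto (a := 0) (m := 0)
      (f := fun l : ℝ => (l:ℂ) ^ z * kprof μ (l + w) κ)
      (f' := fun l : ℝ => (z - β) * ((l:ℂ) ^ (z - 1) * kprof μ (l + w) κ) + g l) ?_ hF ((hint.const_mul _).add hgi) ?_
    · have hz0 : z ≠ 0 := fun h => by rw [h] at hz; simp at hz; linarith
      rw [integral_add (hint.const_mul _) hgi, integral_const_mul] at key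
      simp only [Complex.ofReal_zero, Complex.zero_cpow hz0, zero_mul, sub_zero] at key
      rw [eq_neg_of_add_eq_zero_left key, norm_neg]
      have h1 := norm_integral_le_lintegral_norm (μ := volume.restrict (Set.Ioi 0)) g
      refine h1.trans ?_
      simp_rw [ofReal_norm]
      exact ENNReal.toReal_le_of_le_ofReal (by positivity) hgl
    · refine ContinuousAt.continuousWithinAt ?_
      refine (Complex.continuousAt_ofReal_cpow_const 0 z (Or.inl (by rw [hz]; linarith))).mul ?_
      exact (kprof_hasDerivAt μ hw κ le_rfl).continuousAt
    · rw [tendsto_zero_iff_norm_tendsto_zero]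
      have h0 : Tendsto (fun l : ℝ => l ^ (-(2 * μ - 1 - β))) atTop (𝓝 0) := tendsto_rpow_neg_atTop (by linarith)
      refine squeeze_zero' (Eventually.of_forall fun _ => norm_nonneg _) ?_ h0
      filter_upwards [eventually_gt_atTop 0] with l hl
      have hre : 0 < ((l:ℂ) + w).re := by simp; linarith
      have hYre : ((l:ℂ) + w + (-κ:ℝ) * I).re = l + w.re := by simp
      have hXre : ((l:ℂ) + w + κ * I).re = l + w.re := by simp
      have hX : l ≤ ‖(l:ℂ) + w + κ * I‖ := by
        have := Complex.abs_re_le_norm ((l:ℂ) + w + κ * I); rw [hXre, abs_of_pos (by linarith)] at this; linarith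
      have hXY : ‖(l:ℂ) + w + κ * I‖ ≤ ‖(l:ℂ) + w + (-κ:ℝ) * I‖ := norm_im_mono (by rw [hXre, hYre]) (by
        have e1 : ((l:ℂ) + w + κ * I).im = w.im + κ := by simp
        have e2 : ((l:ℂ) + w + (-κ:ℝ) * I).im = w.im - κ := by simp; ring
        rw [e1, e2]; exact hκ)
      have hwY : ‖(l:ℂ) + w‖ ≤ ‖(l:ℂ) + w + (-κ:ℝ) * I‖ := by
        have : ((l:ℂ) + w) = (1/2 : ℝ) * ((l:ℂ) + w + κ * I) + (1/2 : ℝ) * ((l:ℂ) + w + (-κ:ℝ) * I) := by push_cast; ring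
        have h2 := norm_add_le (((1/2 : ℝ):ℂ) * ((l:ℂ) + w + κ * I)) (((1/2 : ℝ):ℂ) * ((l:ℂ) + w + (-κ:ℝ) * I))
        rw [← this, norm_mul, norm_mul, Complex.norm_real, Real.norm_eq_abs, abs_of_pos (by norm_num)] at h2
        linarith
      rw [norm_mul, Complex.norm_cpow_eq_rpow_re_of_pos hl, hz]
      unfold kprof
      rw [norm_mul, norm_mul, ← Complex.ofReal_neg, Complex.norm_cpow_real, Complex.norm_cpow_real]
      generalize hA : ‖(l:ℂ) + w + κ * I‖ = A at *
      generalize hB : ‖(l:ℂ) + w + (-κ:ℝ) * I‖ = B at *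
      have hA0 : 0 < A := hl.trans_le hX
      have hB0 : 0 < B := hA0.trans_le hXY
      have hAl : A ^ (-μ) ≤ l ^ (-μ) := Real.rpow_le_rpow_of_nonpos hl hX (by linarith)
      have hBl : B ^ (1 - μ) ≤ l ^ (1 - μ) := Real.rpow_le_rpow_of_nonpos hl (hX.trans hXY) (by linarith)
      calc l ^ β * (‖(l:ℂ) + w‖ * A ^ (-μ) * B ^ (-μ)) ≤ l ^ β * (B * A ^ (-μ) * B ^ (-μ)) := by gcongr
        _ = l ^ β * (A ^ (-μ) * B ^ (1 - μ)) := by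
            rw [show 1 - μ = 1 + -μ by ring, Real.rpow_add hB0, Real.rpow_one]; ring
        _ ≤ l ^ β * (l ^ (-μ) * l ^ (1 - μ)) := by gcongr
        _ = _ := by rw [← Real.rpow_add hl, ← Real.rpow_add hl]; congr 1; ring
  refine ⟨C + 1, by positivity, fun w κ hw hw' z hz hint => ?_⟩
  have hT0 : 0 ≤ |w.im| ^ (β - (2 * μ - 1)) := by positivity
  rcases le_total (|w.im + κ|) (|w.im - κ|) with h | h
  · exact (main w κ h hw hw' z hz hint).trans (by nlinarith)
  · have := main w (-κ) (by simpa [sub_eq_add_neg] using h) hw hw' z hz (by simpa only [kprof_symm] using hint)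
    simp only [kprof_symm] at this
    exact this.trans (by nlinarith)

end kernelbound

section kernelz

open Filter Topology

variable {n : ℕ}

lemma norm_Gamma_le {s : ℂ} (hs : 0 < s.re) : ‖Complex.Gamma s‖ ≤ Real.Gamma s.re := by
  rw [Complex.Gamma_eq_integral hs, Real.Gamma_eq_integral hs, Complex.GammaIntegral]
  refine norm_integral_le_of_norm_le (Real.GammaIntegral_convergent hs) ?_
  filter_upwards [ae_restrict_mem measurableSet_Ioi] with x hx
  have hx : 0 < x := hx
  rw [norm_mul, Complex.norm_cpow_eq_rpow_re_of_pos hx, Complex.norm_real, Real.norm_eq_abs, abs_of_pos (Real.exp_pos _)]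
  simp

lemma gamma_fubini (hn : 0 < n) {z w : ℂ} (hz : 0 < z.re) (hzn : z.re < n) (hw : 0 < w.re)
    {Φ : EuclideanSpace ℝ (Fin n) → ℂ} (hΦ : Measurable Φ) (hΦb : ∀ ξ, ‖Φ ξ‖ ≤ 1) :
    IntegrableOn (fun l : ℝ => (l:ℂ) ^ (z - 1) * ∫ ξ, Complex.exp (-(l + w) * ‖ξ‖) * Φ ξ) (Set.Ioi 0) ∧
    ∫ l in Set.Ioi (0:ℝ), (l:ℂ) ^ (z - 1) * ∫ ξ, Complex.exp (-(l + w) * ‖ξ‖) * Φ ξ =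
      Complex.Gamma z * ∫ ξ, ((‖ξ‖:ℂ) ^ (-z) * Complex.exp (-w * ‖ξ‖)) * Φ ξ := by
  have := Fin.pos_iff_nonempty.1 hn
  set f : EuclideanSpace ℝ (Fin n) × ℝ → ℂ := fun p => ((p.2:ℂ) ^ (z - 1) * Complex.exp (-(‖p.1‖ * p.2))) * (Complex.exp (-w * ‖p.1‖) * Φ p.1) with hf
  have hfm : Measurable f := by simp only [hf]; fun_prop
  have hne : ∀ᵐ ξ : EuclideanSpace ℝ (Fin n), ξ ≠ 0 := by
    have : (volume : Measure (EuclideanSpace ℝ (Fin n))) {0} = 0 := by simp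
    exact compl_mem_ae_iff.2 this
  have hnorm : ∀ ξ : EuclideanSpace ℝ (Fin n), ∀ l ∈ Set.Ioi (0:ℝ), ‖f (ξ, l)‖ = (l ^ (z.re - 1) * Real.exp (-(‖ξ‖ * l))) * (Real.exp (-w.re * ‖ξ‖) * ‖Φ ξ‖) := by
    intro ξ l hl
    have hl : 0 < l := hl
    simp only [hf]
    rw [norm_mul, norm_mul, norm_mul, Complex.norm_cpow_eq_rpow_re_of_pos hl, Complex.norm_exp, Complex.norm_exp]
    simp
  have hnormI : ∀ ξ : EuclideanSpace ℝ (Fin n), ξ ≠ 0 → ∫ l in Set.Ioi (0:ℝ), ‖f (ξ, l)‖ = (‖ξ‖ ^ (-z.re) * Real.Gamma z.re) * (Real.exp (-w.re * ‖ξ‖) * ‖Φ ξ‖) := by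
    intro ξ hξ
    have hx : 0 < ‖ξ‖ := norm_pos_iff.2 hξ
    rw [setIntegral_congr_fun measurableSet_Ioi (hnorm ξ), integral_mul_const, Real.integral_rpow_mul_exp_neg_mul_Ioi hz hx]
    rw [one_div, Real.inv_rpow hx.le, Real.rpow_neg hx.le]
  have hfi : Integrable f (volume.prod (volume.restrict (Set.Ioi (0:ℝ)))) := by
    rw [integrable_prod_iff hfm.aestronglyMeasurable]
    constructor
    · filter_upwards [hne] with ξ hξ
      have hx : 0 < ‖ξ‖ := norm_pos_iff.2 hξ
      have h1 : IntegrableOn (fun l : ℝ => l ^ (z.re - 1) * Real.exp (-‖ξ‖ * l ^ (1:ℝ))) (Set.Ioi 0) :=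
        integrableOn_rpow_mul_exp_neg_mul_rpow (by linarith) one_pos hx
      refine Integrable.mono' (h1.mul_const (Real.exp (-w.re * ‖ξ‖) * ‖Φ ξ‖)) ?_ ?_
      · exact (hfm.comp measurable_prodMk_left).aestronglyMeasurable
      · filter_upwards [ae_restrict_mem measurableSet_Ioi] with l hl
        rw [hnorm ξ l hl]; simp
    · have h2 := (integrable_pow_norm_exp hn hw (γ := -z.re) (by linarith)).const_mul (Real.Gamma z.re)
      refine h2.mono' ?_ ?_
      · exact hfm.norm.stronglyMeasurable.integral_prod_right.aestronglyMeasurable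
      · filter_upwards [hne] with ξ hξ
        have hG := Real.Gamma_pos_of_pos hz
        rw [hnormI ξ hξ, Real.norm_of_nonneg (by positivity)]
        calc _ ≤ (‖ξ‖ ^ (-z.re) * Real.Gamma z.re) * (Real.exp (-w.re * ‖ξ‖) * 1) := by
              gcongr; exact hΦb ξ
          _ = _ := by ring
  have hfl : ∀ l : ℝ, ∫ ξ, f (ξ, l) = (l:ℂ) ^ (z - 1) * ∫ ξ, Complex.exp (-(l + w) * ‖ξ‖) * Φ ξ := by
    intro l
    rw [← integral_const_mul]
    congr 1 with ξ
    simp only [hf]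
    rw [show -((l:ℂ) + w) * ‖ξ‖ = -(‖ξ‖ * l) + (-w * ‖ξ‖) by ring, Complex.exp_add]
    ring
  constructor
  · have := hfi.integral_prod_right
    simp only [hfl] at this
    exact this
  · rw [← integral_const_mul]
    simp only [← hfl]
    rw [← integral_integral_swap (f := fun ξ l => f (ξ, l)) hfi]
    refine integral_congr_ae ?_
    filter_upwards [hne] with ξ hξ
    have hx : 0 < ‖ξ‖ := norm_pos_iff.2 hξ
    simp only [hf]
    rw [integral_mul_const, Complex.integral_cpow_mul_exp_neg_mul_Ioi hz hx]
    rw [one_div, Complex.inv_cpow _ _ (by rw [Complex.arg_ofReal_of_nonneg hx.le]; exact Real.pi_pos.ne), Complex.cpow_neg]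
    ring

/-- kernel bound for the analytic family -/
lemma kz_bound (hn : 3 ≤ n) {β : ℝ} (hβ : ((n:ℝ) + 1) / 2 ≤ β) (hβn : β < n) : ∃ C > (0:ℝ),
    ∀ w : ℂ, 0 < w.re → w.im ≠ 0 → ∀ z : ℂ, z.re = β → ∀ x : EuclideanSpace ℝ (Fin n),
      ‖(z - β) * Complex.Gamma z * 𝓕⁻ (fun ξ : EuclideanSpace ℝ (Fin n) => (‖ξ‖:ℂ) ^ (-z) * Complex.exp (-w * ‖ξ‖)) x‖
        ≤ C * |w.im| ^ (β - n) := by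
  have hn' : (3:ℝ) ≤ n := by exact_mod_cast hn
  obtain ⟨C1, hC1, hP⟩ := poisson hn
  obtain ⟨C2, hC2, hK⟩ := kern_scalar (μ := ((n:ℝ) + 1) / 2) (β := β) (by linarith) hβ (by linarith)
  refine ⟨C1 * C2, by positivity, fun w hw hw' z hz x => ?_⟩
  obtain ⟨c, hc, hP⟩ := hP x
  have hz0 : 0 < z.re := by rw [hz]; linarith
  set Φ : EuclideanSpace ℝ (Fin n) → ℂ := fun ξ => Complex.exp (↑(2 * Real.pi * inner ℝ ξ x) * I) with hΦ
  have hΦm : Measurable Φ := by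
    have : Continuous Φ := by simp only [hΦ]; fun_prop
    exact this.measurable
  have hΦb : ∀ ξ, ‖Φ ξ‖ ≤ 1 := fun ξ => by simp only [hΦ]; rw [Complex.norm_exp_ofReal_mul_I]
  obtain ⟨hi, he⟩ := gamma_fubini (by omega) hz0 (by rw [hz]; exact hβn) hw hΦm hΦb
  have hKK : ∀ l : ℝ, l ∈ Set.Ioi (0:ℝ) → (l:ℂ) ^ (z - 1) * ∫ ξ, Complex.exp (-(l + w) * ‖ξ‖) * Φ ξ =
      c * ((l:ℂ) ^ (z - 1) * kprof (((n:ℝ) + 1) / 2) (l + w) (2 * Real.pi * ‖x‖)) := by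
    intro l hl
    have hl : 0 < l := hl
    have h1 := hP (l + w) (by simp; linarith)
    rw [Real.fourierInv_eq'] at h1
    have h2 : ∫ ξ, Complex.exp (-(l + w) * ‖ξ‖) * Φ ξ = ∫ v : EuclideanSpace ℝ (Fin n), Complex.exp (↑(2 * Real.pi * inner ℝ v x) * I) • Complex.exp (-(↑l + w) * ↑‖v‖) := by
      congr 1 with ξ
      rw [smul_eq_mul, mul_comm]
    rw [h2, h1]
    unfold kprof
    push_cast
    ring
  have e2 : 𝓕⁻ (fun ξ : EuclideanSpace ℝ (Fin n) => (‖ξ‖:ℂ) ^ (-z) * Complex.exp (-w * ‖ξ‖)) x =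
      ∫ ξ, ((‖ξ‖:ℂ) ^ (-z) * Complex.exp (-w * ‖ξ‖)) * Φ ξ := by
    rw [Real.fourierInv_eq']
    congr 1 with ξ
    rw [smul_eq_mul, mul_comm]
  rw [mul_assoc, e2, ← he, setIntegral_congr_fun measurableSet_Ioi hKK, integral_const_mul, mul_left_comm, norm_mul]
  by_cases hc0 : c = 0
  · rw [hc0, norm_zero, zero_mul]; positivity
  · have hint : IntegrableOn (fun l : ℝ => (l:ℂ) ^ (z - 1) * kprof (((n:ℝ) + 1) / 2) (l + w) (2 * Real.pi * ‖x‖)) (Set.Ioi 0) := by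
      have := (hi.congr_fun hKK measurableSet_Ioi).const_mul c⁻¹
      refine this.congr ?_
      filter_upwards with l
      field_simp
    have := hK w (2 * Real.pi * ‖x‖) hw hw' z hz hint
    rw [show β - (2 * (((n:ℝ) + 1) / 2) - 1) = β - n by ring] at this
    calc _ ≤ C1 * (C2 * |w.im| ^ (β - n)) := by gcongr
      _ = _ := by ring

/-- bilinear bound by the kernel -/
lemma mult_bilin {m g h : EuclideanSpace ℝ (Fin n) → ℂ} (hm : Integrable m) (hg : Integrable g) (hh : Integrable h)
    {B : ℝ} (hB : ∀ x, ‖𝓕⁻ m x‖ ≤ B) :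
    ‖∫ ξ, m ξ * 𝓕 g ξ * 𝓕⁻ h ξ‖ ≤ B * (∫ x, ‖g x‖) * ∫ x, ‖h x‖ := by
  have hB0 : 0 ≤ B := (norm_nonneg _).trans (hB 0)
  have hhc : Continuous (𝓕⁻ h) := by
    have := continuous_fourier_of_integrable hh
    have e : 𝓕⁻ h = fun x => 𝓕 h (-x) := by
      ext x; exact Real.fourierInv_eq_fourier_neg h x
    rw [e]; fun_prop
  have hhb : ∀ ξ, ‖𝓕⁻ h ξ‖ ≤ ∫ x, ‖h x‖ := fun ξ => by
    rw [Real.fourierInv_eq_fourier_neg]; exact norm_fourier_le _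
  have hmh : Integrable (fun ξ => m ξ * 𝓕⁻ h ξ) := by
    exact hm.mul_bdd (c := ∫ x, ‖h x‖) hhc.aestronglyMeasurable (ae_of_all _ hhb)
  have h1 : ∫ ξ, m ξ * 𝓕 g ξ * 𝓕⁻ h ξ = ∫ x, g x * 𝓕 (fun ξ => m ξ * 𝓕⁻ h ξ) x := by
    rw [← fourier_mul_flip hg hmh]
    congr 1 with ξ
    ring
  have h2 : ∀ x, ‖𝓕 (fun ξ => m ξ * 𝓕⁻ h ξ) x‖ ≤ B * ∫ x, ‖h x‖ := by
    intro x
    set m' : EuclideanSpace ℝ (Fin n) → ℂ := fun ξ => Complex.exp (↑(-2 * Real.pi * inner ℝ ξ (-x)) * I) * m (-ξ) with hm'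
    have hm'i : Integrable m' := by
      refine hm.comp_neg.bdd_mul (c := 1) (Continuous.aestronglyMeasurable (by fun_prop)) (ae_of_all _ fun ξ => ?_)
      rw [Complex.norm_exp_ofReal_mul_I]
    have e1 : 𝓕 (fun ξ => m ξ * 𝓕⁻ h ξ) x = ∫ ξ, 𝓕 h ξ * m' ξ := by
      rw [Real.fourier_eq', ← integral_neg_eq_self]
      congr 1 with ξ
      rw [Real.fourierInv_eq_fourier_neg, neg_neg, smul_eq_mul]
      simp only [hm', inner_neg_left, inner_neg_right]
      ring
    rw [e1, fourier_mul_flip hh hm'i]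
    have e2 : ∀ y, ‖𝓕 m' y‖ ≤ B := by
      intro y
      have : 𝓕 m' y = 𝓕⁻ m (y - x) := by
        rw [Real.fourier_eq', Real.fourierInv_eq', ← integral_neg_eq_self]
        congr 1 with ξ
        simp only [hm', smul_eq_mul, neg_neg, ← mul_assoc, ← Complex.exp_add]
        congr 2
        simp only [inner_neg_left, inner_neg_right, inner_sub_right]
        push_cast
        ring
      rw [this]; exact hB _
    rw [← integral_const_mul]
    refine norm_integral_le_of_norm_le (hh.norm.const_mul B) (ae_of_all _ fun y => ?_)
    rw [norm_mul, mul_comm]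
    gcongr
    exact e2 y
  rw [h1]
  calc _ ≤ ∫ x, ‖g x‖ * (B * ∫ x, ‖h x‖) := by
        refine norm_integral_le_of_norm_le (hg.norm.mul_const _) (ae_of_all _ fun y => ?_)
        rw [norm_mul]
        gcongr
        exact h2 y
    _ = _ := by rw [integral_mul_const]; ring

lemma mz_integrable (hn : 0 < n) {z w : ℂ} (hzn : z.re < n) (hw : 0 < w.re) :
    Integrable (fun ξ : EuclideanSpace ℝ (Fin n) => (‖ξ‖:ℂ) ^ (-z) * Complex.exp (-w * ‖ξ‖)) := by
  have := Fin.pos_iff_nonempty.1 hn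
  refine (integrable_pow_norm_exp hn hw (γ := -z.re) (by linarith)).mono' (Measurable.aestronglyMeasurable (by fun_prop)) ?_
  have hne : ∀ᵐ ξ : EuclideanSpace ℝ (Fin n), ξ ≠ 0 := by
    have : (volume : Measure (EuclideanSpace ℝ (Fin n))) {0} = 0 := by simp
    exact compl_mem_ae_iff.2 this
  filter_upwards [hne] with ξ hξ
  rw [norm_mul, Complex.norm_cpow_eq_rpow_re_of_pos (norm_pos_iff.2 hξ), Complex.norm_exp]
  simp

end kernelz

section stein

open Filter Topology

variable {n : ℕ}

/-- analytic family through `g` -/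
def twf (ρ : ℝ) (g : EuclideanSpace ℝ (Fin n) → ℂ) (ζ : ℂ) (x : EuclideanSpace ℝ (Fin n)) : ℂ :=
  if g x = 0 then 0 else Complex.exp ((ρ * (1 + ζ) / 2 - 1) * (Real.log ‖g x‖ : ℂ)) * g x

lemma twf_norm {ρ : ℝ} {g : EuclideanSpace ℝ (Fin n) → ℂ} {ζ : ℂ} (h : ρ * (1 + ζ.re) / 2 ≠ 0)
    (x : EuclideanSpace ℝ (Fin n)) : ‖twf ρ g ζ x‖ = ‖g x‖ ^ (ρ * (1 + ζ.re) / 2) := by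
  unfold twf
  split_ifs with h0
  · rw [h0, norm_zero, Real.zero_rpow h]
  · have hp : 0 < ‖g x‖ := norm_pos_iff.2 h0
    have e : ((ρ * (1 + ζ) / 2 - 1) * (Real.log ‖g x‖ : ℂ)).re = Real.log ‖g x‖ * (ρ * (1 + ζ.re) / 2 - 1) := by
      rw [Complex.re_mul_ofReal]
      simp only [Complex.sub_re, Complex.div_ofNat_re, Complex.re_ofReal_mul, Complex.add_re, Complex.one_re]
      ring
    rw [norm_mul, Complex.norm_exp, e, ← Real.rpow_def_of_pos hp, Real.rpow_sub_one hp.ne',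
      div_mul_cancel₀ _ hp.ne']

lemma twf_diff (ρ : ℝ) (g : EuclideanSpace ℝ (Fin n) → ℂ) (x : EuclideanSpace ℝ (Fin n)) :
    Differentiable ℂ (fun ζ => twf ρ g ζ x) := by
  unfold twf
  split_ifs with h0
  · fun_prop
  · fun_prop

lemma twf_meas (ρ : ℝ) {g : EuclideanSpace ℝ (Fin n) → ℂ} (hg : Continuous g) (ζ : ℂ) :
    Measurable (twf ρ g ζ) := by
  unfold twf
  have := hg.measurable
  refine Measurable.ite (hg.measurable (measurableSet_singleton 0)) measurable_const ?_
  fun_prop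

lemma twf_self {ρ θ : ℝ} (hρ : ρ * (1 + θ) = 2) (g : EuclideanSpace ℝ (Fin n) → ℂ) :
    twf ρ g θ = g := by
  ext x
  unfold twf
  split_ifs with h0
  · exact h0.symm
  · have : ((ρ:ℂ) * (1 + θ) / 2 - 1) = 0 := by
      have : ((ρ * (1 + θ) : ℝ) : ℂ) = (2:ℝ) := by rw [hρ]
      push_cast at this
      rw [this]; norm_num
    rw [this]; simp

lemma twf_bound {ρ : ℝ} (hρ : 0 < ρ) {g : EuclideanSpace ℝ (Fin n) → ℂ} (hg : Continuous g)
    (hc : HasCompactSupport g) : ∃ b : EuclideanSpace ℝ (Fin n) → ℝ, Integrable b ∧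
      ∀ ζ : ℂ, -1 < ζ.re → ζ.re < 2 → ∀ x, ‖twf ρ g ζ x‖ ≤ b x := by
  obtain ⟨M, hM⟩ := hg.bounded_above_of_compact_support hc
  have hM0 : 0 ≤ M := (norm_nonneg _).trans (hM 0)
  refine ⟨(tsupport g).indicator (fun _ => (1 + M) ^ (2 * ρ)), ?_, ?_⟩
  · exact (integrableOn_const (hs := hc.isCompact.measure_lt_top.ne)).integrable_indicator hc.isCompact.measurableSet
  · intro ζ h1 h2 x
    by_cases hx : x ∈ tsupport g
    · rw [Set.indicator_of_mem hx, twf_norm (by nlinarith)]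
      calc _ ≤ (1 + M) ^ (ρ * (1 + ζ.re) / 2) := by
            refine Real.rpow_le_rpow (norm_nonneg _) ?_ (by nlinarith)
            linarith [hM x]
        _ ≤ _ := Real.rpow_le_rpow_of_exponent_le (by linarith) (by nlinarith)
    · rw [Set.indicator_of_notMem hx]
      have : g x = 0 := image_eq_zero_of_notMem_tsupport hx
      simp [twf, this]

lemma fourier_family {U : Set ℂ} (hU : IsOpen U) {f : ℂ → EuclideanSpace ℝ (Fin n) → ℂ}
    (hm : ∀ ζ, Measurable (f ζ)) (hd : ∀ x, Differentiable ℂ (fun ζ => f ζ x))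
    {b : EuclideanSpace ℝ (Fin n) → ℝ} (hb : Integrable b) (hfb : ∀ ζ ∈ U, ∀ x, ‖f ζ x‖ ≤ b x)
    (ξ : EuclideanSpace ℝ (Fin n)) : DifferentiableOn ℂ (fun ζ => 𝓕 (f ζ) ξ) U := by
  simp only [Real.fourier_eq']
  refine differentiableOn_integral hU (fun z hz => ?_) (ae_of_all _ fun x => ?_) ?_
  · have := hm z
    exact Measurable.aestronglyMeasurable (by fun_prop)
  · exact ((hd x).const_mul _).differentiableOn
  · intro z hz
    refine ⟨1, one_pos, b, hb, ae_of_all _ fun x z' _ hz' => ?_⟩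
    rw [smul_eq_mul, norm_mul, Complex.norm_exp_ofReal_mul_I, one_mul]
    exact hfb z' hz' x

lemma stein_hol (hn : 0 < n) {β δ : ℝ} (hβ : 0 < β) (hδ : 0 < δ) (hδn : β * (1 + δ) < n) {w : ℂ} (hw : 0 < w.re)
    {U : Set ℂ} (hU : IsOpen U) (hUs : ∀ ζ ∈ U, -δ < ζ.re ∧ ζ.re < 1 + δ)
    {f h : ℂ → EuclideanSpace ℝ (Fin n) → ℂ}
    (hfm : ∀ ζ, Measurable (f ζ)) (hfd : ∀ x, Differentiable ℂ (fun ζ => f ζ x))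
    {b : EuclideanSpace ℝ (Fin n) → ℝ} (hb : Integrable b) (hfb : ∀ ζ ∈ U, ∀ x, ‖f ζ x‖ ≤ b x)
    (hhm : ∀ ζ, Measurable (h ζ)) (hhd : ∀ x, Differentiable ℂ (fun ζ => h ζ x))
    {b' : EuclideanSpace ℝ (Fin n) → ℝ} (hb' : Integrable b') (hhb : ∀ ζ ∈ U, ∀ x, ‖h ζ x‖ ≤ b' x) :
    DifferentiableOn ℂ (fun ζ : ℂ => ∫ ξ, (‖ξ‖:ℂ) ^ (-(β * ζ)) * Complex.exp (-w * ‖ξ‖) * 𝓕 (f ζ) ξ * 𝓕⁻ (h ζ) ξ) U ∧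
    ∃ M, ∀ ζ ∈ U, ‖∫ ξ, (‖ξ‖:ℂ) ^ (-(β * ζ)) * Complex.exp (-w * ‖ξ‖) * 𝓕 (f ζ) ξ * 𝓕⁻ (h ζ) ξ‖ ≤ M := by
  have := Fin.pos_iff_nonempty.1 hn
  have hne : ∀ᵐ ξ : EuclideanSpace ℝ (Fin n), ξ ≠ 0 := by
    have : (volume : Measure (EuclideanSpace ℝ (Fin n))) {0} = 0 := by simp
    exact compl_mem_ae_iff.2 this
  have hfi : ∀ ζ ∈ U, Integrable (f ζ) := fun ζ hζ => hb.mono' (hfm ζ).aestronglyMeasurable (ae_of_all _ (hfb ζ hζ))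
  have hhi : ∀ ζ ∈ U, Integrable (h ζ) := fun ζ hζ => hb'.mono' (hhm ζ).aestronglyMeasurable (ae_of_all _ (hhb ζ hζ))
  have hFb : ∀ ζ ∈ U, ∀ ξ, ‖𝓕 (f ζ) ξ‖ ≤ ∫ x, b x := fun ζ hζ ξ =>
    (norm_fourier_le ξ).trans (integral_mono_of_nonneg (ae_of_all _ fun _ => norm_nonneg _) hb (ae_of_all _ (hfb ζ hζ)))
  have hHb : ∀ ζ ∈ U, ∀ ξ, ‖𝓕⁻ (h ζ) ξ‖ ≤ ∫ x, b' x := fun ζ hζ ξ => by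
    rw [Real.fourierInv_eq_fourier_neg]
    exact (norm_fourier_le _).trans (integral_mono_of_nonneg (ae_of_all _ fun _ => norm_nonneg _) hb' (ae_of_all _ (hhb ζ hζ)))
  set B : EuclideanSpace ℝ (Fin n) → ℝ := fun ξ => (‖ξ‖ ^ (β * δ) * Real.exp (-w.re * ‖ξ‖) + ‖ξ‖ ^ (-(β * (1 + δ))) * Real.exp (-w.re * ‖ξ‖)) * ((∫ x, b x) * ∫ x, b' x) with hB
  have hBi : Integrable B := by
    refine Integrable.mul_const (Integrable.add ?_ ?_) _
    · exact integrable_pow_norm_exp hn hw (by have : 0 < β * δ := by positivity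
                                              have : (0:ℝ) ≤ n := by positivity
                                              linarith)
    · exact integrable_pow_norm_exp hn hw (by linarith)
  have key : ∀ᵐ ξ : EuclideanSpace ℝ (Fin n), ∀ ζ ∈ U,
      ‖(‖ξ‖:ℂ) ^ (-(β * ζ)) * Complex.exp (-w * ‖ξ‖) * 𝓕 (f ζ) ξ * 𝓕⁻ (h ζ) ξ‖ ≤ B ξ := by
    filter_upwards [hne] with ξ hξ ζ hζ
    have hp : 0 < ‖ξ‖ := norm_pos_iff.2 hξ
    rw [norm_mul, norm_mul, norm_mul, Complex.norm_cpow_eq_rpow_re_of_pos hp, Complex.norm_exp, mul_assoc _ _ (‖𝓕⁻ (h ζ) ξ‖)]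
    have e1 : (-w * (‖ξ‖:ℂ)).re = -w.re * ‖ξ‖ := by simp
    have e2 : (-((β:ℂ) * ζ)).re = -(β * ζ.re) := by simp
    rw [e1, e2, hB]
    simp only [← add_mul]
    obtain ⟨h1, h2⟩ := hUs ζ hζ
    have : ‖ξ‖ ^ (-(β * ζ.re)) ≤ ‖ξ‖ ^ (β * δ) + ‖ξ‖ ^ (-(β * (1 + δ))) := by
      rcases le_total 1 ‖ξ‖ with h | h
      · have := Real.rpow_le_rpow_of_exponent_le h (show -(β * ζ.re) ≤ β * δ by nlinarith)
        have := Real.rpow_nonneg hp.le (-(β * (1 + δ)))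
        linarith
      · have := Real.rpow_le_rpow_of_exponent_ge hp h (show -(β * (1 + δ)) ≤ -(β * ζ.re) by nlinarith)
        have := Real.rpow_nonneg hp.le (β * δ)
        linarith
    have hb0 : 0 ≤ ∫ x, b x := (norm_nonneg _).trans (hFb ζ hζ 0)
    gcongr
    · exact hFb ζ hζ ξ
    · exact hHb ζ hζ ξ
  constructor
  · refine differentiableOn_integral hU (fun ζ hζ => ?_) ?_ ?_
    · have h1 := continuous_fourier_of_integrable (hfi ζ hζ)
      have h2 : Continuous (𝓕⁻ (h ζ)) := by
        have h3 := continuous_fourier_of_integrable (hhi ζ hζ)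
        have : 𝓕⁻ (h ζ) = fun ξ => 𝓕 (h ζ) (-ξ) := by ext ξ; exact Real.fourierInv_eq_fourier_neg _ _
        rw [this]; fun_prop
      have h1 := h1.measurable
      have h2 := h2.measurable
      exact Measurable.aestronglyMeasurable (by fun_prop)
    · filter_upwards [hne] with ξ hξ
      have hp : (‖ξ‖:ℂ) ≠ 0 := by simpa using hξ
      refine DifferentiableOn.mul (DifferentiableOn.mul (Differentiable.differentiableOn ?_) (fourier_family hU hfm hfd hb hfb ξ)) ?_
      · refine Differentiable.mul_const ?_ _
        intro ζ
        refine DifferentiableAt.const_cpow (by fun_prop) (Or.inl hp)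
      · simp only [Real.fourierInv_eq_fourier_neg]
        exact fourier_family hU hhm hhd hb' hhb (-ξ)
    · intro z hz
      refine ⟨1, one_pos, B, hBi, ?_⟩
      filter_upwards [key] with ξ hξ z _ hz using hξ z hz
  · refine ⟨∫ ξ, B ξ, fun ζ hζ => norm_integral_le_of_norm_le hBi ?_⟩
    filter_upwards [key] with ξ hξ using hξ ζ hζ

lemma stein_exp {ζ : ℂ} (h0 : 0 ≤ ζ.re) (h1 : ζ.re ≤ 1) {v : ℂ} (hv : ‖v‖ ≤ 1 + |ζ.im|) :
    ‖v * Complex.exp (ζ ^ 2)‖ ≤ 2 * Real.exp 1 := by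
  rw [norm_mul, Complex.norm_exp]
  have e : (ζ ^ 2).re = ζ.re ^ 2 - ζ.im ^ 2 := by simp [pow_two]
  rw [e]
  have h2 : 1 + |ζ.im| ≤ 2 * Real.exp (ζ.im ^ 2) := by
    have := Real.add_one_le_exp (ζ.im ^ 2)
    nlinarith [sq_abs ζ.im, sq_nonneg (|ζ.im| - 1)]
  have h3 : Real.exp (ζ.re ^ 2) ≤ Real.exp 1 := Real.exp_le_exp.2 (by nlinarith)
  rw [Real.exp_sub]
  have := Real.exp_pos (ζ.im ^ 2)
  calc ‖v‖ * (Real.exp (ζ.re ^ 2) / Real.exp (ζ.im ^ 2)) ≤ (2 * Real.exp (ζ.im ^ 2)) * (Real.exp 1 / Real.exp (ζ.im ^ 2)) := by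
        gcongr
        linarith
    _ = _ := by field_simp

lemma bilin_L2 {g h m : EuclideanSpace ℝ (Fin n) → ℂ} (hg : Integrable g) (hh : Integrable h)
    (hm : ∀ᵐ ξ, ‖m ξ‖ ≤ 1) :
    ‖∫ ξ, m ξ * 𝓕 g ξ * 𝓕⁻ h ξ‖ₑ ≤ (∫⁻ x, ‖g x‖ₑ ^ 2) ^ (1/2:ℝ) * (∫⁻ x, ‖h x‖ₑ ^ 2) ^ (1/2:ℝ) := by
  have h1 := continuous_fourier_of_integrable hg
  have h2 : Continuous (𝓕⁻ h) := by
    have h3 := continuous_fourier_of_integrable hh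
    have : 𝓕⁻ h = fun ξ => 𝓕 h (-ξ) := by ext ξ; exact Real.fourierInv_eq_fourier_neg _ _
    rw [this]; fun_prop
  calc _ ≤ ∫⁻ ξ, ‖m ξ * 𝓕 g ξ * 𝓕⁻ h ξ‖ₑ := enorm_integral_le_lintegral_enorm _
    _ ≤ ∫⁻ ξ, ‖𝓕 g ξ‖ₑ * ‖𝓕⁻ h ξ‖ₑ := by
        refine lintegral_mono_ae ?_
        filter_upwards [hm] with ξ hξ
        rw [enorm_mul, enorm_mul]
        gcongr
        calc _ ≤ 1 * ‖𝓕 g ξ‖ₑ := by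
              gcongr
              rw [← ofReal_norm_eq_enorm]
              exact ENNReal.ofReal_le_one.2 hξ
          _ = _ := one_mul _
    _ ≤ (∫⁻ ξ, ‖𝓕 g ξ‖ₑ ^ (2:ℝ)) ^ (1/2:ℝ) * (∫⁻ ξ, ‖𝓕⁻ h ξ‖ₑ ^ (2:ℝ)) ^ (1/2:ℝ) := by
        refine ENNReal.lintegral_mul_le_Lp_mul_Lq volume (Real.HolderConjugate.two_two) ?_ ?_
        · exact h1.enorm.measurable.aemeasurable
        · exact h2.enorm.measurable.aemeasurable
    _ ≤ _ := by
        simp only [ENNReal.rpow_two]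
        gcongr ?_ ^ _ * ?_ ^ _
        · exact plancherel_le hg
        · exact plancherel_inv_le hh

theorem stein_interp (hn : 3 ≤ n) {β θ ρ : ℝ} (hβ : ((n:ℝ)+1)/2 ≤ β) (hβn : β < n) (hθ0 : 0 < θ) (hθ1 : θ < 1)
    (hρ : ρ * (1 + θ) = 2) : ∃ C : ℝ, 0 < C ∧ ∀ w : ℂ, 0 < w.re → w.im ≠ 0 →
      ∀ g h : EuclideanSpace ℝ (Fin n) → ℂ, Continuous g → HasCompactSupport g → Continuous h → HasCompactSupport h →
      ‖∫ ξ : EuclideanSpace ℝ (Fin n), (‖ξ‖:ℂ) ^ (-((β * θ : ℝ):ℂ)) * Complex.exp (-w * ‖ξ‖) * 𝓕 g ξ * 𝓕⁻ h ξ‖ ≤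
        C * |w.im| ^ ((β - n) * θ) * ((∫ x, ‖g x‖ ^ ρ) ^ ((1 + θ) / 2) * (∫ x, ‖h x‖ ^ ρ) ^ ((1 + θ) / 2)) := by
  obtain ⟨C, hC, hk⟩ := kz_bound hn hβ hβn
  have hn0 : 0 < n := by omega
  have hβ0 : 0 < β := by
    have : (0:ℝ) ≤ n := by positivity
    linarith
  have hρ0 : 0 < ρ := by
    by_contra hh
    push Not at hh
    nlinarith
  obtain ⟨δ, hδ, hδ1, hδ2, hδ3⟩ : ∃ δ : ℝ, 0 < δ ∧ δ < 1 ∧ β * δ < 1 ∧ β * (1 + δ) < n := by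
    refine ⟨min (1/2) (min (1/(2*β)) ((n - β)/(2*β))), ?_, ?_, ?_, ?_⟩
    · have : 0 < n - β := by linarith
      positivity
    · exact (min_le_left _ _).trans_lt (by norm_num)
    · have : min (1/2) (min (1/(2*β)) ((n - β)/(2*β))) ≤ 1/(2*β) := (min_le_right _ _).trans (min_le_left _ _)
      calc _ ≤ β * (1/(2*β)) := by gcongr
        _ = 1/2 := by field_simp
        _ < 1 := by norm_num
    · have : min (1/2) (min (1/(2*β)) ((n - β)/(2*β))) ≤ (n - β)/(2*β) := (min_le_right _ _).trans (min_le_right _ _)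
      calc _ ≤ β * (1 + (n - β)/(2*β)) := by gcongr
        _ = (n + β)/2 := by field_simp; ring
        _ < n := by linarith
  set c0 : ℝ := ‖Complex.Gamma (β * θ + 1) * ((θ - 1) * Complex.exp ((θ:ℂ) ^ 2))‖ with hc0
  have hc0p : 0 < c0 := by
    rw [hc0, norm_pos_iff]
    refine mul_ne_zero ?_ (mul_ne_zero ?_ (Complex.exp_ne_zero _))
    · refine Complex.Gamma_ne_zero_of_re_pos ?_
      have : 0 < β * θ := by positivity
      simp; linarith
    · rw [sub_ne_zero]
      intro hh
      exact hθ1.ne (by exact_mod_cast hh)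
  refine ⟨(2 * Real.exp 1) ^ (1 - θ) * (2 * Real.exp 1 * C) ^ θ / c0, by positivity, ?_⟩
  intro w hw hwi g h hg hgc hh hhc
  set A := ∫ x, ‖g x‖ ^ ρ with hA
  set B := ∫ x, ‖h x‖ ^ ρ with hB
  have hA0 : 0 ≤ A := integral_nonneg fun x => by positivity
  have hB0 : 0 ≤ B := integral_nonneg fun x => by positivity
  set U : Set ℂ := {ζ | -δ < ζ.re ∧ ζ.re < 1 + δ} with hU
  have hUo : IsOpen U := (isOpen_lt continuous_const Complex.continuous_re).inter (isOpen_lt Complex.continuous_re continuous_const)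
  obtain ⟨b, hb, hgb⟩ := twf_bound hρ0 hg hgc
  obtain ⟨b', hb', hhb⟩ := twf_bound hρ0 hh hhc
  obtain ⟨hD, M, hM⟩ := stein_hol hn0 hβ0 hδ hδ3 hw hUo (fun ζ hζ => hζ) (twf_meas ρ hg) (twf_diff ρ g) hb
    (fun ζ hζ => hgb ζ (by linarith [hζ.1]) (by linarith [hζ.2])) (twf_meas ρ hh) (twf_diff ρ h) hb'
    (fun ζ hζ => hhb ζ (by linarith [hζ.1]) (by linarith [hζ.2]))
  set J : ℂ → ℂ := fun ζ : ℂ => ∫ ξ, (‖ξ‖:ℂ) ^ (-(β * ζ)) * Complex.exp (-w * ‖ξ‖) * 𝓕 (twf ρ g ζ) ξ * 𝓕⁻ (twf ρ h ζ) ξ with hJ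
  set F : ℂ → ℂ := fun ζ => Complex.Gamma (β * ζ + 1) * ((ζ - 1) * Complex.exp (ζ ^ 2)) * J ζ with hF
  have hint : ∀ (f : EuclideanSpace ℝ (Fin n) → ℂ), Continuous f → HasCompactSupport f → ∀ ζ : ℂ, 0 ≤ ζ.re → ζ.re ≤ 1 → Integrable (twf ρ f ζ) := by
    intro f hf hfc ζ h0 h1
    obtain ⟨b, hb, hfb⟩ := twf_bound hρ0 hf hfc
    exact hb.mono' (twf_meas ρ hf ζ).aestronglyMeasurable (ae_of_all _ (hfb ζ (by linarith) (by linarith)))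
  have hne : ∀ᵐ ξ : EuclideanSpace ℝ (Fin n), ξ ≠ 0 := by
    have := Fin.pos_iff_nonempty.1 hn0
    have : (volume : Measure (EuclideanSpace ℝ (Fin n))) {0} = 0 := by simp
    exact compl_mem_ae_iff.2 this
  have hgam : ∀ ζ : ℂ, 0 ≤ ζ.re → ‖Complex.Gamma (β * ζ + 1)‖ ≤ Real.Gamma (β * ζ.re + 1) := by
    intro ζ h0
    have e : (β * ζ + 1 : ℂ).re = β * ζ.re + 1 := by simp
    rw [← e]
    exact norm_Gamma_le (by rw [e]; positivity)
  have hexp : ∀ ζ : ℂ, 0 ≤ ζ.re → ζ.re ≤ 1 → ‖(ζ - 1) * Complex.exp (ζ ^ 2)‖ ≤ 2 * Real.exp 1 := by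
    intro ζ h0 h1
    refine stein_exp h0 h1 ?_
    refine (Complex.norm_le_abs_re_add_abs_im _).trans ?_
    simp only [Complex.sub_re, Complex.one_re, Complex.sub_im, Complex.one_im, sub_zero]
    gcongr
    rw [abs_le]; constructor <;> linarith
  have hsub : ∀ z : ℂ, 0 ≤ z.re → z.re ≤ 1 → z ∈ U := fun z h0 h1 => ⟨by linarith, by linarith⟩
  have h3 := three_lines (f := F) (U := U) hUo hsub
    (M := max (Real.Gamma 1) (Real.Gamma (β + 1)) * (2 * Real.exp 1) * M)
    (a := 2 * Real.exp 1 * (A ^ (1/2:ℝ) * B ^ (1/2:ℝ)))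
    (b := 2 * Real.exp 1 * C * |w.im| ^ (β - n) * (A * B))
    ?_ ?_ ?_ ?_ hθ0.le hθ1.le
  · have e : F θ = (Complex.Gamma (β * θ + 1) * ((θ - 1) * Complex.exp ((θ:ℂ) ^ 2))) *
        ∫ ξ : EuclideanSpace ℝ (Fin n), (‖ξ‖:ℂ) ^ (-((β * θ : ℝ):ℂ)) * Complex.exp (-w * ‖ξ‖) * 𝓕 g ξ * 𝓕⁻ h ξ := by
      simp only [hF, hJ, twf_self hρ]
      push_cast
      rfl
    rw [e, norm_mul, ← hc0, mul_comm, ← le_div_iff₀ hc0p] at h3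
    refine h3.trans (le_of_eq ?_)
    have hAe : A ^ ((1 + θ)/2) = (A ^ (1/2:ℝ)) ^ (1 - θ) * A ^ θ := by
      rw [← Real.rpow_mul hA0, ← Real.rpow_add_of_nonneg hA0 (by nlinarith) hθ0.le]
      congr 1; ring
    have hBe : B ^ ((1 + θ)/2) = (B ^ (1/2:ℝ)) ^ (1 - θ) * B ^ θ := by
      rw [← Real.rpow_mul hB0, ← Real.rpow_add_of_nonneg hB0 (by nlinarith) hθ0.le]
      congr 1; ring
    rw [hAe, hBe, Real.mul_rpow (x := 2 * Real.exp 1) (z := 1 - θ) (by positivity) (by positivity), Real.mul_rpow (x := A ^ (1/2:ℝ)) (by positivity) (by positivity),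
      Real.mul_rpow (x := 2 * Real.exp 1 * C * |w.im| ^ (β - n)) (by positivity) (by positivity), Real.mul_rpow (x := 2 * Real.exp 1 * C) (by positivity) (by positivity),
      Real.mul_rpow hA0 hB0, ← Real.rpow_mul (abs_nonneg _)]
    ring
  · refine DifferentiableOn.mul (DifferentiableOn.mul ?_ (Differentiable.differentiableOn (by fun_prop))) hD
    intro ζ hζ
    refine DifferentiableAt.differentiableWithinAt ?_
    refine DifferentiableAt.comp (g := Complex.Gamma) ζ ?_ (by fun_prop)
    refine Complex.differentiableAt_Gamma _ fun m hm => ?_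
    have := congrArg Complex.re hm
    simp at this
    have h1 := hζ.1
    have : (0:ℝ) ≤ m := by positivity
    nlinarith
  · intro ζ h0 h1
    simp only [hF, norm_mul (_ * _) (J ζ), norm_mul (Complex.Gamma _)]
    have hg1 : Real.Gamma (β * ζ.re + 1) ≤ max (Real.Gamma 1) (Real.Gamma (β + 1)) := by
      refine Real.convexOn_Gamma.le_max_of_mem_Icc (x := 1) (y := β + 1) (by simp) (by simp; linarith) ⟨by nlinarith, by nlinarith⟩
    have hM0 : 0 ≤ M := (norm_nonneg _).trans (hM ζ (hsub ζ h0 h1))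
    gcongr
    · exact (hgam ζ h0).trans hg1
    · exact hexp ζ h0 h1
    · exact hM ζ (hsub ζ h0 h1)
  · intro ζ h0
    simp only [hF, norm_mul (_ * _) (J ζ), norm_mul (Complex.Gamma _)]
    have hg1 := hgam ζ h0.ge
    rw [h0, mul_zero, zero_add, Real.Gamma_one] at hg1
    have hJb : ‖J ζ‖ ≤ A ^ (1/2:ℝ) * B ^ (1/2:ℝ) := by
      have hb2 := bilin_L2 (m := fun ξ => (‖ξ‖:ℂ) ^ (-(β * ζ)) * Complex.exp (-w * ‖ξ‖)) (hint g hg hgc ζ h0.ge (by linarith)) (hint h hh hhc ζ h0.ge (by linarith)) ?_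
      · have key : ∀ f : EuclideanSpace ℝ (Fin n) → ℂ, Continuous f → HasCompactSupport f →
            ∫⁻ x, ‖twf ρ f ζ x‖ₑ ^ 2 = ENNReal.ofReal (∫ x, ‖f x‖ ^ ρ) := by
          intro f hf hfc
          rw [ofReal_integral_eq_lintegral_ofReal]
          · refine lintegral_congr fun x => ?_
            rw [← ofReal_norm_eq_enorm, twf_norm (by rw [h0]; linarith), ← ENNReal.ofReal_pow (by positivity), ← Real.rpow_natCast, ← Real.rpow_mul (norm_nonneg _), h0]
            congr 2; push_cast; ring
          · refine Continuous.integrable_of_hasCompactSupport (hf.norm.rpow_const fun _ => Or.inr hρ0.le) ?_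
            refine hfc.comp_left (g := fun z : ℂ => ‖z‖ ^ ρ) ?_
            simp [hρ0.ne']
          · exact ae_of_all _ fun x => by positivity
        rw [key g hg hgc, key h hh hhc, ENNReal.ofReal_rpow_of_nonneg hA0 (by norm_num), ENNReal.ofReal_rpow_of_nonneg hB0 (by norm_num), ← ENNReal.ofReal_mul (by positivity), ← ofReal_norm_eq_enorm] at hb2
        exact (ENNReal.ofReal_le_ofReal_iff (by positivity)).1 hb2
      · filter_upwards [hne] with ξ hξ
        rw [norm_mul, Complex.norm_cpow_eq_rpow_re_of_pos (norm_pos_iff.2 hξ), Complex.norm_exp]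
        have e1 : (-w * (‖ξ‖:ℂ)).re = -w.re * ‖ξ‖ := by simp
        have e2 : (-((β:ℂ) * ζ)).re = 0 := by simp [h0]
        rw [e1, e2, Real.rpow_zero, one_mul, Real.exp_le_one_iff]
        have := mul_nonneg hw.le (norm_nonneg ξ)
        linarith
    calc _ ≤ 1 * (2 * Real.exp 1) * (A ^ (1/2:ℝ) * B ^ (1/2:ℝ)) := by
          gcongr
          exact hexp ζ h0.ge (by linarith)
      _ = _ := by ring
  · intro ζ h1
    have h0 : 0 ≤ ζ.re := by linarith
    have hζ0 : (β * ζ : ℂ) ≠ 0 := by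
      intro hh
      have := congrArg Complex.re hh
      simp [h1] at this
      exact hβ0.ne' this
    set c : ℂ := (β * ζ - β) * Complex.Gamma (β * ζ) with hc
    have e : F ζ = (ζ * Complex.exp (ζ ^ 2)) * ∫ ξ, (c * ((‖ξ‖:ℂ) ^ (-(β * ζ)) * Complex.exp (-w * ‖ξ‖))) * 𝓕 (twf ρ g ζ) ξ * 𝓕⁻ (twf ρ h ζ) ξ := by
      have : ∫ ξ, (c * ((‖ξ‖:ℂ) ^ (-(β * ζ)) * Complex.exp (-w * ‖ξ‖))) * 𝓕 (twf ρ g ζ) ξ * 𝓕⁻ (twf ρ h ζ) ξ = c * J ζ := by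
        rw [hJ, ← integral_const_mul]
        congr 1 with ξ
        ring
      rw [this, hF, hc]
      simp only
      rw [Complex.Gamma_add_one _ hζ0]
      ring
    have hre : (β * ζ : ℂ).re = β := by simp [h1]
    have hmb := mult_bilin (m := fun ξ => c * ((‖ξ‖:ℂ) ^ (-(β * ζ)) * Complex.exp (-w * ‖ξ‖))) (B := C * |w.im| ^ (β - n))
      ((mz_integrable hn0 (by rw [hre]; exact hβn) hw).const_mul c) (hint g hg hgc ζ h0 h1.le) (hint h hh hhc ζ h0 h1.le) ?_
    · have key : ∀ f : EuclideanSpace ℝ (Fin n) → ℂ, ∫ x, ‖twf ρ f ζ x‖ = ∫ x, ‖f x‖ ^ ρ := by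
        intro f
        congr 1 with x
        rw [twf_norm (by rw [h1]; linarith), h1]
        congr 1; ring
      rw [key, key] at hmb
      rw [e, norm_mul]
      calc _ ≤ (2 * Real.exp 1) * (C * |w.im| ^ (β - n) * A * B) := by
            gcongr
            refine stein_exp h0 h1.le ((Complex.norm_le_abs_re_add_abs_im _).trans ?_)
            rw [h1, abs_one]
        _ = _ := by ring
    · intro x
      have := hk w hw hwi (β * ζ) hre x
      refine le_trans (le_of_eq ?_) this
      congr 1
      rw [← hc, Real.fourierInv_eq', Real.fourierInv_eq', ← integral_const_mul]
      congr 1 with ξ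
      simp only [smul_eq_mul]
      ring

end stein

section strich

open Filter Topology

variable {n : ℕ}

/-- continuous, compactly supported in space-time -/
def NiceG (G : EuclideanSpace ℝ (Fin n) → ℝ → ℂ) : Prop :=
  Continuous (fun z : EuclideanSpace ℝ (Fin n) × ℝ => G z.1 z.2) ∧
    ∃ R : ℝ, ∀ x, ∀ s : ℝ, (R < ‖x‖ ∨ R < |s|) → G x s = 0

lemma NiceG.cont {G : EuclideanSpace ℝ (Fin n) → ℝ → ℂ} (hG : NiceG G) (s : ℝ) :
    Continuous (fun x => G x s) := hG.1.comp (by fun_prop : Continuous fun x : EuclideanSpace ℝ (Fin n) => (x, s))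

lemma NiceG.supp {G : EuclideanSpace ℝ (Fin n) → ℝ → ℂ} (hG : NiceG G) (s : ℝ) :
    HasCompactSupport (fun x => G x s) := by
  obtain ⟨R, hR⟩ := hG.2
  refine HasCompactSupport.intro (isCompact_closedBall 0 R) fun x hx => hR x s (Or.inl ?_)
  simpa using hx

lemma NiceG.integrable {G : EuclideanSpace ℝ (Fin n) → ℝ → ℂ} (hG : NiceG G) (s : ℝ) :
    Integrable (fun x => G x s) := (hG.cont s).integrable_of_hasCompactSupport (hG.supp s)

lemma NiceG.bdd {G : EuclideanSpace ℝ (Fin n) → ℝ → ℂ} (hG : NiceG G) :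
    ∃ b : EuclideanSpace ℝ (Fin n) → ℝ, Integrable b ∧ ∀ x s, ‖G x s‖ ≤ b x := by
  obtain ⟨R, hR⟩ := hG.2
  have hc : HasCompactSupport (fun z : EuclideanSpace ℝ (Fin n) × ℝ => G z.1 z.2) := by
    refine HasCompactSupport.intro ((isCompact_closedBall (0:EuclideanSpace ℝ (Fin n)) R).prod (isCompact_closedBall (0:ℝ) R)) fun z hz => hR _ _ ?_
    by_contra hh
    push Not at hh
    exact hz ⟨by simpa using hh.1, by simpa using hh.2⟩
  obtain ⟨M, hM⟩ := hG.1.bounded_above_of_compact_support hc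
  refine ⟨(closedBall (0:EuclideanSpace ℝ (Fin n)) R).indicator (fun _ => M), ?_, ?_⟩
  · exact (integrableOn_const (hs := (isCompact_closedBall _ _).measure_lt_top.ne)).integrable_indicator measurableSet_closedBall
  · intro x s
    by_cases hx : x ∈ closedBall (0:EuclideanSpace ℝ (Fin n)) R
    · rw [Set.indicator_of_mem hx]; exact hM (x, s)
    · rw [Set.indicator_of_notMem hx, hR x s (Or.inl (by simpa using hx)), norm_zero]

/-- measurability of the partial Fourier transform -/
lemma meas_fourier {G : EuclideanSpace ℝ (Fin n) → ℝ → ℂ}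
    (hG : Continuous (fun z : EuclideanSpace ℝ (Fin n) × ℝ => G z.1 z.2)) :
    StronglyMeasurable (fun z : EuclideanSpace ℝ (Fin n) × ℝ => 𝓕 (fun x => G x z.2) z.1) := by
  simp only [Real.fourier_eq']
  refine StronglyMeasurable.integral_prod_right' (ν := volume) (f := fun z : (EuclideanSpace ℝ (Fin n) × ℝ) × EuclideanSpace ℝ (Fin n) =>
    Complex.exp (↑(-2 * Real.pi * inner ℝ z.2 z.1.1) * I) • G z.2 z.1.2) ?_
  refine Continuous.stronglyMeasurable ?_
  have : Continuous fun z : (EuclideanSpace ℝ (Fin n) × ℝ) × EuclideanSpace ℝ (Fin n) => G z.2 z.1.2 :=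
    hG.comp (by fun_prop : Continuous fun z : (EuclideanSpace ℝ (Fin n) × ℝ) × EuclideanSpace ℝ (Fin n) => (z.2, z.1.2))
  fun_prop

lemma conj_fourier (g : EuclideanSpace ℝ (Fin n) → ℂ) (ξ : EuclideanSpace ℝ (Fin n)) :
    (starRingEnd ℂ) (𝓕 g ξ) = 𝓕⁻ (fun x => (starRingEnd ℂ) (g x)) ξ := by
  rw [Real.fourier_eq', Real.fourierInv_eq', ← integral_conj]
  congr 1 with x
  simp only [smul_eq_mul, map_mul, ← Complex.exp_conj, Complex.conj_ofReal, Complex.conj_I]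
  congr 2
  push_cast
  ring

/-- half-wave superposition of the data -/
def AS (G : EuclideanSpace ℝ (Fin n) → ℝ → ℂ) (e : ℝ) (S : Set ℝ) (ξ : EuclideanSpace ℝ (Fin n)) : ℂ :=
  ∫ s in S, Complex.exp ((e * s * ‖ξ‖ : ℝ) * I) * 𝓕 (fun x => G x s) ξ

theorem strichartz_dual (hn : 3 ≤ n) {β θ ρ q q' : ℝ} (hβ : ((n:ℝ)+1)/2 ≤ β) (hβn : β < n) (hθ0 : 0 < θ) (hθ1 : θ < 1)
    (hρ : ρ * (1 + θ) = 2) (hq : 2 < q) (hq' : 1 / q + 1 / q' = 1) (hβq : (β - n) * θ = -(2 / q)) :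
    ∃ C : ℝ, 0 < C ∧ ∀ G : EuclideanSpace ℝ (Fin n) → ℝ → ℂ, NiceG G → ∀ e : ℝ, |e| = 1 → ∀ S : Set ℝ, MeasurableSet S →
      ∫⁻ ξ, ENNReal.ofReal (‖ξ‖ ^ (-(β * θ))) * ‖AS G e S ξ‖ₑ ^ 2 ≤
        ENNReal.ofReal C * (∫⁻ s in S, (∫⁻ x, ‖G x s‖ₑ ^ ρ) ^ (q' / ρ)) ^ (2 / q') := by
  obtain ⟨C1, hC1, hst⟩ := stein_interp hn hβ hβn hθ0 hθ1 hρ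
  obtain ⟨C2, hC2, hh⟩ := hls hq hq'
  refine ⟨C1 * C2, by positivity, ?_⟩
  intro G hG e he S hS
  have hn0 : 0 < n := by omega
  have hρ0 : 0 < ρ := by
    by_contra hh
    push Not at hh
    nlinarith
  have hq'0 : 0 < q' := by
    have h1 : 1 / q < 1 := by rw [div_lt_one (by linarith)]; linarith
    have h2 : 0 < 1 / q' := by linarith
    exact one_div_pos.1 h2
  have hβθ : β * θ < n := by nlinarith
  obtain ⟨b, hb, hGb⟩ := hG.bdd
  set K := ∫ x, b x with hK
  obtain ⟨R, hR⟩ := hG.2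
  have hFb : ∀ ξ s, ‖𝓕 (fun x => G x s) ξ‖ ≤ (Set.Icc (-R) R).indicator (fun _ => K) s := by
    intro ξ s
    by_cases hs : s ∈ Set.Icc (-R) R
    · rw [Set.indicator_of_mem hs]
      exact (norm_fourier_le ξ).trans (integral_mono_of_nonneg (ae_of_all _ fun _ => norm_nonneg _) hb (ae_of_all _ fun x => hGb x s))
    · rw [Set.indicator_of_notMem hs]
      have : (fun x => G x s) = fun _ => 0 := by
        ext x
        refine hR x s (Or.inr ?_)
        by_contra h3
        push Not at h3
        exact hs (abs_le.1 h3)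
      rw [this, Real.fourier_eq']
      simp
  have hFm := meas_fourier hG.1
  set a : EuclideanSpace ℝ (Fin n) → ℝ → ℂ := fun ξ s => Complex.exp ((e * s * ‖ξ‖ : ℝ) * I) * 𝓕 (fun x => G x s) ξ with ha
  have ham : StronglyMeasurable (fun z : EuclideanSpace ℝ (Fin n) × ℝ => a z.1 z.2) := by
    refine StronglyMeasurable.mul (Continuous.stronglyMeasurable (by fun_prop)) hFm
  have hab : ∀ ξ s, ‖a ξ s‖ ≤ (Set.Icc (-R) R).indicator (fun _ => K) s := by
    intro ξ s
    rw [ha]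
    simp only [norm_mul, Complex.norm_exp_ofReal_mul_I, one_mul]
    exact hFb ξ s
  have hKi : Integrable ((Set.Icc (-R) R).indicator (fun _ => K)) (volume.restrict S) :=
    ((integrableOn_const (hs := isCompact_Icc.measure_lt_top.ne)).integrable_indicator measurableSet_Icc).restrict
  have hai : ∀ ξ, Integrable (a ξ) (volume.restrict S) := fun ξ =>
    hKi.mono' (ham.comp_measurable (by fun_prop : Measurable fun s : ℝ => (ξ, s))).aestronglyMeasurable (ae_of_all _ (hab ξ))
  have hAm : StronglyMeasurable (AS G e S) := by
    exact ham.integral_prod_right (ν := volume.restrict S)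
  set f : ℝ → ℝ := S.indicator (fun s => (∫ x, ‖G x s‖ ^ ρ) ^ ((1 + θ) / 2)) with hf
  have hGρ : ∀ s, Integrable (fun x => ‖G x s‖ ^ ρ) := by
    intro s
    refine Continuous.integrable_of_hasCompactSupport ((hG.cont s).norm.rpow_const fun _ => Or.inr hρ0.le) ?_
    refine (hG.supp s).comp_left (g := fun z : ℂ => ‖z‖ ^ ρ) ?_
    simp [hρ0.ne']
  have hfm : Measurable f := by
    refine Measurable.indicator ?_ hS
    refine Measurable.pow_const ?_ _
    have : StronglyMeasurable (fun z : ℝ × EuclideanSpace ℝ (Fin n) => ‖G z.2 z.1‖ ^ ρ) := by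
      have h1 : Continuous (fun z : ℝ × EuclideanSpace ℝ (Fin n) => G z.2 z.1) := hG.1.comp (by fun_prop : Continuous fun z : ℝ × EuclideanSpace ℝ (Fin n) => (z.2, z.1))
      exact (h1.norm.rpow_const fun _ => Or.inr hρ0.le).stronglyMeasurable
    exact this.integral_prod_right.measurable
  have hf0 : ∀ s, 0 ≤ f s := fun s => Set.indicator_nonneg (fun s _ => Real.rpow_nonneg (integral_nonneg fun x => by positivity) _) s
  have hfq : ∫⁻ s, ENNReal.ofReal (f s ^ q') = ∫⁻ s in S, (∫⁻ x, ‖G x s‖ₑ ^ ρ) ^ (q' / ρ) := by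
    rw [← lintegral_indicator hS]
    refine lintegral_congr fun s => ?_
    by_cases hs : s ∈ S
    · rw [Set.indicator_of_mem hs, hf, Set.indicator_of_mem hs, ← Real.rpow_mul (integral_nonneg fun x => by positivity)]
      have e1 : (1 + θ) / 2 * q' = q' / ρ := by
        have : (1 + θ) / 2 = 1 / ρ := by rw [div_eq_div_iff (by norm_num) hρ0.ne']; linarith
        rw [this]; ring
      rw [e1, ← ENNReal.ofReal_rpow_of_nonneg (integral_nonneg fun x => by positivity) (by positivity),
        ofReal_integral_eq_lintegral_ofReal (hGρ s) (ae_of_all _ fun x => by positivity)]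
      congr 1
      refine lintegral_congr fun x => ?_
      rw [← ofReal_norm_eq_enorm, ENNReal.ofReal_rpow_of_nonneg (norm_nonneg _) hρ0.le]
    · rw [Set.indicator_of_notMem hs, hf, Set.indicator_of_notMem hs, Real.zero_rpow hq'0.ne', ENNReal.ofReal_zero]
  have hfin := hh f hfm hf0
  rw [hfq] at hfin
  set W := (∫⁻ s in S, (∫⁻ x, ‖G x s‖ₑ ^ ρ) ^ (q' / ρ)) ^ (2 / q') with hW
  -- regularized bound
  have hreg : ∀ ε : ℝ, 0 < ε → ∫⁻ ξ, ENNReal.ofReal (‖ξ‖ ^ (-(β * θ)) * Real.exp (-ε * ‖ξ‖)) * ‖AS G e S ξ‖ₑ ^ 2 ≤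
      ENNReal.ofReal (C1 * C2) * W := by
    intro ε hε
    have hmi := integrable_pow_norm_exp (n := n) hn0 hε (γ := -(β * θ)) (by linarith)
    set m : EuclideanSpace ℝ (Fin n) → ℝ := fun ξ => ‖ξ‖ ^ (-(β * θ)) * Real.exp (-ε * ‖ξ‖) with hm
    have hm0 : ∀ ξ, 0 ≤ m ξ := fun ξ => by positivity
    have hKi2 : Integrable (fun z : ℝ × ℝ => (Set.Icc (-R) R).indicator (fun _ => K) z.1 * (Set.Icc (-R) R).indicator (fun _ => K) z.2)
      ((volume.restrict S).prod (volume.restrict S)) := hKi.mul_prod hKi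
    have hint : Integrable (fun z : EuclideanSpace ℝ (Fin n) × (ℝ × ℝ) => (m z.1 : ℂ) * (a z.1 z.2.1 * (starRingEnd ℂ) (a z.1 z.2.2)))
        (volume.prod ((volume.restrict S).prod (volume.restrict S))) := by
      refine (hmi.mul_prod hKi2).mono' ?_ (ae_of_all _ fun z => ?_)
      · refine AEStronglyMeasurable.mul ?_ (AEStronglyMeasurable.mul ?_ ?_)
        · have : Measurable m := by fun_prop
          exact Measurable.aestronglyMeasurable (by fun_prop)
        · exact (ham.comp_measurable (by fun_prop : Measurable fun z : EuclideanSpace ℝ (Fin n) × (ℝ × ℝ) => (z.1, z.2.1))).aestronglyMeasurable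
        · exact Complex.continuous_conj.comp_aestronglyMeasurable (ham.comp_measurable (by fun_prop : Measurable fun z : EuclideanSpace ℝ (Fin n) × (ℝ × ℝ) => (z.1, z.2.2))).aestronglyMeasurable
      · rw [norm_mul, norm_mul, Complex.norm_real, Real.norm_of_nonneg (hm0 _), RCLike.norm_conj]
        gcongr
        · exact (norm_nonneg _).trans (hab z.1 z.2.1)
        · exact hab _ _
        · exact hab _ _
    have hswap := integral_integral_swap (f := fun (ξ : EuclideanSpace ℝ (Fin n)) (z : ℝ × ℝ) => (m ξ : ℂ) * (a ξ z.1 * (starRingEnd ℂ) (a ξ z.2))) hint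
    have hin : ∀ ξ, ∫ z : ℝ × ℝ, (m ξ : ℂ) * (a ξ z.1 * (starRingEnd ℂ) (a ξ z.2)) ∂((volume.restrict S).prod (volume.restrict S)) =
        ((m ξ * ‖AS G e S ξ‖ ^ 2 : ℝ) : ℂ) := by
      intro ξ
      rw [integral_const_mul, integral_prod_mul (a ξ) (fun t => (starRingEnd ℂ) (a ξ t)), integral_conj, Complex.mul_conj, Complex.normSq_eq_norm_sq]
      push_cast
      rfl
    have hAb : ∀ ξ, ‖AS G e S ξ‖ ≤ ∫ s in S, (Set.Icc (-R) R).indicator (fun _ => K) s := fun ξ =>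
      norm_integral_le_of_norm_le hKi (ae_of_all _ (hab ξ))
    have hmA : Integrable (fun ξ => m ξ * ‖AS G e S ξ‖ ^ 2) := by
      refine hmi.mul_bdd (c := (∫ s in S, (Set.Icc (-R) R).indicator (fun _ => K) s) ^ 2) (hAm.norm.pow 2).aestronglyMeasurable (ae_of_all _ fun ξ => ?_)
      rw [norm_pow, norm_norm]
      gcongr
      exact hAb ξ
    have e1 : ∫⁻ ξ, ENNReal.ofReal (m ξ) * ‖AS G e S ξ‖ₑ ^ 2 = ‖∫ ξ, ∫ z : ℝ × ℝ, (m ξ : ℂ) * (a ξ z.1 * (starRingEnd ℂ) (a ξ z.2)) ∂((volume.restrict S).prod (volume.restrict S))‖ₑ := by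
      simp only [hin]
      rw [integral_complex_ofReal, ← ofReal_norm_eq_enorm, Complex.norm_real, Real.norm_of_nonneg (integral_nonneg fun ξ => by have := hm0 ξ; positivity),
        ofReal_integral_eq_lintegral_ofReal hmA (ae_of_all _ fun ξ => by have := hm0 ξ; positivity)]
      refine lintegral_congr fun ξ => ?_
      rw [ENNReal.ofReal_mul (hm0 ξ), ENNReal.ofReal_pow (norm_nonneg _), ofReal_norm_eq_enorm]
    have hker : ∀ s t : ℝ, s ≠ t → s ∈ S → t ∈ S → ‖∫ ξ, (m ξ : ℂ) * (a ξ s * (starRingEnd ℂ) (a ξ t))‖ ≤ C1 * (|t - s| ^ (-(2 / q)) * (f s * f t)) := by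
      intro s t hst' hs ht
      have he0 : e ≠ 0 := by intro h0; rw [h0] at he; simp at he
      have hb := hst (ε + (e * (t - s) : ℝ) * I) (by simpa using hε) (by simpa using ⟨he0, sub_ne_zero.2 hst'.symm⟩)
        (fun x => G x s) (fun x => (starRingEnd ℂ) (G x t)) (hG.cont s) (hG.supp s) (Complex.continuous_conj.comp (hG.cont t))
        ((hG.supp t).comp_left (g := starRingEnd ℂ) (map_zero _))
      have e2 : ((ε:ℂ) + (e * (t - s) : ℝ) * I).im = e * (t - s) := by simp
      rw [e2, abs_mul, he, one_mul, hβq] at hb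
      simp only [RCLike.norm_conj] at hb
      refine le_trans (le_of_eq ?_) (hb.trans (le_of_eq ?_))
      · congr 1
        refine integral_congr_ae ?_
        have hne : ∀ᵐ ξ : EuclideanSpace ℝ (Fin n), ξ ≠ 0 := by
          have := Fin.pos_iff_nonempty.1 hn0
          have : (volume : Measure (EuclideanSpace ℝ (Fin n))) {0} = 0 := by simp
          exact compl_mem_ae_iff.2 this
        refine ae_of_all _ fun ξ => ?_
        simp only [ha, hm, map_mul, conj_fourier, ← Complex.exp_conj, Complex.conj_ofReal, Complex.conj_I]
        have e3 : -((ε:ℂ) + (e * (t - s) : ℝ) * I) * ‖ξ‖ = ((-ε * ‖ξ‖ : ℝ) : ℂ) + ((e * s * ‖ξ‖ : ℝ) * I + (e * t * ‖ξ‖ : ℝ) * -I) := by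
          push_cast; ring
        rw [e3, Complex.exp_add, Complex.exp_add, ← Complex.ofReal_exp, Complex.ofReal_mul, Complex.ofReal_cpow (norm_nonneg _)]
        push_cast
        ring
      · rw [hf, Set.indicator_of_mem hs, Set.indicator_of_mem ht]
        ring
    rw [e1, hswap]
    have hdiag : ∀ᵐ z : ℝ × ℝ ∂((volume.restrict S).prod (volume.restrict S)), z.1 ≠ z.2 := by
      refine Measure.ae_prod_iff_ae_ae (measurableSet_eq_fun measurable_fst measurable_snd).compl |>.2 (ae_of_all _ fun s => ?_)
      refine ae_restrict_of_ae ?_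
      have : (volume : Measure ℝ) {s} = 0 := by simp
      filter_upwards [compl_mem_ae_iff.2 this] with t ht h
      exact ht h.symm
    have hinS : ∀ᵐ z : ℝ × ℝ ∂((volume.restrict S).prod (volume.restrict S)), z.1 ∈ S ∧ z.2 ∈ S := by
      rw [Measure.prod_restrict]
      filter_upwards [ae_restrict_mem (hS.prod hS)] with z hz using hz
    calc _ ≤ ∫⁻ z : ℝ × ℝ, ‖∫ ξ, (m ξ : ℂ) * (a ξ z.1 * (starRingEnd ℂ) (a ξ z.2))‖ₑ ∂((volume.restrict S).prod (volume.restrict S)) := enorm_integral_le_lintegral_enorm _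
      _ ≤ ∫⁻ z : ℝ × ℝ, ENNReal.ofReal C1 * (ENNReal.ofReal (|z.2 - z.1| ^ (-(2 / q))) * (ENNReal.ofReal (f z.1) * ENNReal.ofReal (f z.2))) ∂((volume.restrict S).prod (volume.restrict S)) := by
          refine lintegral_mono_ae ?_
          filter_upwards [hdiag, hinS] with z hz1 hz2
          rw [← ofReal_norm_eq_enorm, ← ENNReal.ofReal_mul (hf0 _), ← ENNReal.ofReal_mul (by positivity), ← ENNReal.ofReal_mul hC1.le]
          exact ENNReal.ofReal_le_ofReal (hker z.1 z.2 hz1 hz2.1 hz2.2)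
      _ ≤ ∫⁻ z : ℝ × ℝ, ENNReal.ofReal C1 * (ENNReal.ofReal (|z.2 - z.1| ^ (-(2 / q))) * (ENNReal.ofReal (f z.1) * ENNReal.ofReal (f z.2))) ∂(volume.prod volume) := by
          refine lintegral_mono' ?_ le_rfl
          rw [Measure.prod_restrict]
          exact Measure.restrict_le_self
      _ = ENNReal.ofReal C1 * ∫⁻ s, ∫⁻ t, ENNReal.ofReal (|t - s| ^ (-(2 / q))) * (ENNReal.ofReal (f s) * ENNReal.ofReal (f t)) := by
          rw [lintegral_const_mul _ (by fun_prop), lintegral_prod _ (by fun_prop)]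
      _ ≤ ENNReal.ofReal C1 * (ENNReal.ofReal C2 * W) := by gcongr
      _ = _ := by rw [ENNReal.ofReal_mul hC1.le, mul_assoc]
  have hlim : ∀ ξ, ENNReal.ofReal (‖ξ‖ ^ (-(β * θ))) * ‖AS G e S ξ‖ₑ ^ 2 =
      liminf (fun k : ℕ => ENNReal.ofReal (‖ξ‖ ^ (-(β * θ)) * Real.exp (-(1 / ((k:ℝ) + 1)) * ‖ξ‖)) * ‖AS G e S ξ‖ₑ ^ 2) atTop := by
    intro ξ
    refine (Tendsto.liminf_eq ?_).symm
    refine ENNReal.Tendsto.mul_const ?_ (Or.inr (by simp))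
    refine ENNReal.tendsto_ofReal ?_
    have h1 : Tendsto (fun k : ℕ => -(1 / ((k:ℝ) + 1)) * ‖ξ‖) atTop (𝓝 (-0 * ‖ξ‖)) :=
      (tendsto_one_div_add_atTop_nhds_zero_nat.neg).mul_const _
    have h2 := ((Real.continuous_exp.tendsto _).comp h1).const_mul (‖ξ‖ ^ (-(β * θ)))
    simpa using h2
  simp only [hlim]
  refine (lintegral_liminf_le fun k => ?_).trans ?_
  · have := hAm.measurable
    fun_prop
  · refine liminf_le_of_le (by isBoundedDefault) fun b hb => ?_
    obtain ⟨k, hk⟩ := hb.exists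
    exact hk.trans (hreg _ (by positivity))

end strich

section ext1

open Filter Topology

variable {n : ℕ}

lemma mult_kernel {m g h : EuclideanSpace ℝ (Fin n) → ℂ} (hm : Integrable m) (hg : Integrable g) (hh : Integrable h) :
    ∫ ξ, m ξ * 𝓕 g ξ * 𝓕⁻ h ξ = ∫ x, g x * ∫ y, h y * 𝓕⁻ m (y - x) := by
  have hhc : Continuous (𝓕⁻ h) := by
    have h1 := continuous_fourier_of_integrable hh
    have e : 𝓕⁻ h = fun ξ => 𝓕 h (-ξ) := by ext ξ; exact Real.fourierInv_eq_fourier_neg _ _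
    rw [e]; fun_prop
  have hhb : ∀ ξ, ‖𝓕⁻ h ξ‖ ≤ ∫ x, ‖h x‖ := fun ξ => by
    rw [Real.fourierInv_eq_fourier_neg]; exact norm_fourier_le _
  have hmh : Integrable (fun ξ => m ξ * 𝓕⁻ h ξ) := by
    exact hm.mul_bdd (c := ∫ x, ‖h x‖) hhc.aestronglyMeasurable (ae_of_all _ hhb)
  have h1 : ∫ ξ, m ξ * 𝓕 g ξ * 𝓕⁻ h ξ = ∫ x, g x * 𝓕 (fun ξ => m ξ * 𝓕⁻ h ξ) x := by
    rw [← fourier_mul_flip hg hmh]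
    congr 1 with ξ
    ring
  rw [h1]
  congr 1 with x
  congr 1
  set m' : EuclideanSpace ℝ (Fin n) → ℂ := fun ξ => Complex.exp (↑(-2 * Real.pi * inner ℝ ξ (-x)) * I) * m (-ξ) with hm'
  have hm'i : Integrable m' := by
    refine hm.comp_neg.bdd_mul (c := 1) (Continuous.aestronglyMeasurable (by fun_prop)) (ae_of_all _ fun ξ => ?_)
    rw [Complex.norm_exp_ofReal_mul_I]
  have e1 : 𝓕 (fun ξ => m ξ * 𝓕⁻ h ξ) x = ∫ ξ, 𝓕 h ξ * m' ξ := by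
    rw [Real.fourier_eq', ← integral_neg_eq_self]
    congr 1 with ξ
    rw [Real.fourierInv_eq_fourier_neg, neg_neg, smul_eq_mul]
    simp only [hm', inner_neg_left, inner_neg_right]
    ring
  rw [e1, fourier_mul_flip hh hm'i]
  congr 1 with y
  congr 1
  rw [Real.fourier_eq', Real.fourierInv_eq', ← integral_neg_eq_self]
  congr 1 with ξ
  simp only [hm', smul_eq_mul, neg_neg, ← mul_assoc, ← Complex.exp_add]
  congr 2
  simp only [inner_neg_left, inner_neg_right, inner_sub_right]
  push_cast
  ring

/-- Fourier transform of the sphere -/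
def sgh (n : ℕ) (x : EuclideanSpace ℝ (Fin n)) : ℂ :=
  ∫ ω, Complex.exp (2 * Real.pi * (inner ℝ x ω : ℝ) * I) ∂(sph n)

lemma shell_est (hn : 0 < n) : ∃ c : ℝ, 0 < c ∧ ∀ R : ℝ, 1 ≤ R → ∀ ζ : EuclideanSpace ℝ (Fin n),
    ∫⁻ ω, ENNReal.ofReal ((1 + R * ‖ζ - ω‖) ^ (-((n:ℝ) + 1))) ∂(sph n) ≤ ENNReal.ofReal (c * (R * R ^ (-(n:ℝ)))) := by
  set c1 := ∫ x : EuclideanSpace ℝ (Fin n), (1 + ‖x‖) ^ (-((n:ℝ) + 1)) with hc1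
  have hint : Integrable (fun x : EuclideanSpace ℝ (Fin n) => (1 + ‖x‖) ^ (-((n:ℝ) + 1))) :=
    integrable_one_add_norm (by simp)
  have hc10 : 0 ≤ c1 := integral_nonneg fun x => by positivity
  refine ⟨2 ^ ((n:ℝ) + 1) * (c1 + 1), by positivity, ?_⟩
  intro R hR ζ
  have hR0 : 0 < R := by linarith
  have hfull : ∫⁻ x : EuclideanSpace ℝ (Fin n), ENNReal.ofReal ((1 + R * ‖ζ - x‖) ^ (-((n:ℝ) + 1))) = ENNReal.ofReal (R ^ (-(n:ℝ)) * c1) := by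
    rw [lintegral_sub_left_eq_self (fun x : EuclideanSpace ℝ (Fin n) => ENNReal.ofReal ((1 + R * ‖x‖) ^ (-((n:ℝ) + 1)))) ζ]
    have e : ∀ x : EuclideanSpace ℝ (Fin n), R * ‖x‖ = ‖R • x‖ := fun x => by rw [norm_smul, Real.norm_of_nonneg hR0.le]
    simp only [e]
    rw [← ofReal_integral_eq_lintegral_ofReal (hint.comp_smul hR0.ne') (ae_of_all _ fun x => by positivity),
      Measure.integral_comp_smul volume (fun x : EuclideanSpace ℝ (Fin n) => (1 + ‖x‖) ^ (-((n:ℝ) + 1))) R]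
    rw [finrank_euclideanSpace_fin, smul_eq_mul, abs_of_pos (by positivity), Real.rpow_neg hR0.le, Real.rpow_natCast]
  set L := ∫⁻ ω, ENNReal.ofReal ((1 + R * ‖ζ - ω‖) ^ (-((n:ℝ) + 1))) ∂(sph n) with hL
  have hmain : L * ENNReal.ofReal (1 / R) ≤ ENNReal.ofReal (2 ^ ((n:ℝ) + 1)) * ENNReal.ofReal (R ^ (-(n:ℝ)) * c1) := by
    rw [← hfull, lintegral_polar hn _ (by fun_prop), lintegral_radM n _ (by
      refine Measurable.lintegral_prod_right' (ν := sph n) (f := fun z : ℝ × EuclideanSpace ℝ (Fin n) => ENNReal.ofReal ((1 + R * ‖ζ - z.1 • z.2‖) ^ (-((n:ℝ) + 1)))) ?_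
      fun_prop)]
    have hsub : Set.Icc 1 (1 + 1 / R) ⊆ Set.Ioi (0:ℝ) := fun u hu => lt_of_lt_of_le one_pos hu.1
    calc L * ENNReal.ofReal (1 / R) = ∫⁻ u in Set.Icc 1 (1 + 1 / R), L := by
          rw [setLIntegral_const, Real.volume_Icc]; congr 2; ring
      _ ≤ ∫⁻ u in Set.Icc 1 (1 + 1 / R), ENNReal.ofReal (2 ^ ((n:ℝ) + 1)) * (ENNReal.ofReal (u ^ (n - 1)) * ∫⁻ ω, ENNReal.ofReal ((1 + R * ‖ζ - u • ω‖) ^ (-((n:ℝ) + 1))) ∂(sph n)) := by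
          refine setLIntegral_mono' measurableSet_Icc fun u hu => ?_
          have h1 : (1:ℝ≥0∞) ≤ ENNReal.ofReal (u ^ (n - 1)) := by
            rw [← ENNReal.ofReal_one]
            exact ENNReal.ofReal_le_ofReal (one_le_pow₀ hu.1)
          calc L ≤ ∫⁻ ω, ENNReal.ofReal (2 ^ ((n:ℝ) + 1)) * ENNReal.ofReal ((1 + R * ‖ζ - u • ω‖) ^ (-((n:ℝ) + 1))) ∂(sph n) := by
                refine lintegral_mono_ae ?_
                filter_upwards [ae_sph_norm n] with ω hω
                rw [← ENNReal.ofReal_mul (by positivity)]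
                refine ENNReal.ofReal_le_ofReal ?_
                have h2 : ‖ζ - u • ω‖ ≤ ‖ζ - ω‖ + 1 / R := by
                  have : ζ - u • ω = (ζ - ω) + (1 - u) • ω := by module
                  rw [this]
                  refine (norm_add_le _ _).trans ?_
                  rw [norm_smul, hω, mul_one, Real.norm_eq_abs, abs_sub_comm, abs_of_nonneg (by linarith [hu.1])]
                  linarith [hu.2]
                have h3 : (1 + R * ‖ζ - u • ω‖) / 2 ≤ 1 + R * ‖ζ - ω‖ := by
                  have h4 : R * ‖ζ - u • ω‖ ≤ R * (‖ζ - ω‖ + 1 / R) := by gcongr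
                  have h5 : R * (‖ζ - ω‖ + 1 / R) = R * ‖ζ - ω‖ + 1 := by field_simp
                  have : 0 ≤ R * ‖ζ - ω‖ := by positivity
                  linarith
                calc _ ≤ ((1 + R * ‖ζ - u • ω‖) / 2) ^ (-((n:ℝ) + 1)) := by
                      refine Real.rpow_le_rpow_of_nonpos (by positivity) h3 (by linarith [(Nat.cast_nonneg n : (0:ℝ) ≤ n)])
                  _ = _ := by
                      rw [Real.div_rpow (by positivity) (by norm_num), Real.rpow_neg (x := 2) (by norm_num)]
                      field_simp
            _ = ENNReal.ofReal (2 ^ ((n:ℝ) + 1)) * (1 * ∫⁻ ω, ENNReal.ofReal ((1 + R * ‖ζ - u • ω‖) ^ (-((n:ℝ) + 1))) ∂(sph n)) := by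
                rw [lintegral_const_mul _ (by fun_prop), one_mul]
            _ ≤ _ := by gcongr
      _ ≤ ∫⁻ u in Set.Ioi 0, ENNReal.ofReal (2 ^ ((n:ℝ) + 1)) * (ENNReal.ofReal (u ^ (n - 1)) * ∫⁻ ω, ENNReal.ofReal ((1 + R * ‖ζ - u • ω‖) ^ (-((n:ℝ) + 1))) ∂(sph n)) :=
          lintegral_mono_set hsub
      _ = _ := by
          rw [lintegral_const_mul' _ _ ENNReal.ofReal_ne_top]
  rw [← ENNReal.ofReal_mul (by positivity)] at hmain
  have hne : ENNReal.ofReal (1 / R) ≠ 0 := by simp [hR0]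
  have : L = L * ENNReal.ofReal (1 / R) * ENNReal.ofReal R := by
    rw [mul_assoc, ← ENNReal.ofReal_mul (by positivity), one_div_mul_cancel hR0.ne', ENNReal.ofReal_one, mul_one]
  rw [this]
  refine (mul_le_mul_left hmain _).trans ?_
  rw [← ENNReal.ofReal_mul (by positivity)]
  refine ENNReal.ofReal_le_ofReal ?_
  have : 0 ≤ R ^ (-(n:ℝ)) := by positivity
  calc _ = 2 ^ ((n:ℝ) + 1) * c1 * (R * R ^ (-(n:ℝ))) := by ring
    _ ≤ _ := by gcongr; linarith

lemma fourier_scale (ψ : EuclideanSpace ℝ (Fin n) → ℂ) {R : ℝ} (hR : 0 < R) (η : EuclideanSpace ℝ (Fin n)) :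
    𝓕 (fun x => ψ (R⁻¹ • x)) η = (R ^ n : ℝ) * 𝓕 ψ (R • η) := by
  rw [Real.fourier_eq', Real.fourier_eq']
  have := Measure.integral_comp_smul (volume : Measure (EuclideanSpace ℝ (Fin n)))
    (fun v : EuclideanSpace ℝ (Fin n) => Complex.exp (↑(-2 * Real.pi * inner ℝ v (R • η)) * I) • ψ v) R⁻¹
  simp only [finrank_euclideanSpace_fin] at this
  rw [abs_of_pos (by positivity), inv_pow, inv_inv] at this
  rw [Complex.real_smul] at this
  rw [← this]
  congr 1 with v
  congr 4
  rw [inner_smul_left, inner_smul_right]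
  simp only [map_inv₀, conj_trivial]
  field_simp

lemma fourier_decay (ψ : 𝓢(EuclideanSpace ℝ (Fin n), ℂ)) : ∃ c : ℝ, 0 < c ∧ ∀ R : ℝ, 0 < R → ∀ η : EuclideanSpace ℝ (Fin n),
    ‖𝓕 (fun x => ψ (R⁻¹ • x)) η‖ ≤ c * R ^ n * (1 + R * ‖η‖) ^ (-((n:ℝ) + 1)) := by
  set c := 2 ^ (n+1) * (Finset.Iic ((n+1, 0) : ℕ × ℕ)).sup (fun m => SchwartzMap.seminorm ℝ m.1 m.2) (𝓕 ψ) with hc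
  have h := fun x => SchwartzMap.one_add_le_sup_seminorm_apply (𝕜 := ℝ) (m := (n+1, 0)) (k := n+1) (n := 0) le_rfl le_rfl (𝓕 ψ) x
  have hc0 : 0 ≤ c := le_trans (by positivity) (h 0)
  refine ⟨c + 1, by positivity, fun R hR η => ?_⟩
  rw [fourier_scale _ hR, norm_mul, Complex.norm_real, Real.norm_of_nonneg (by positivity)]
  have h1 := h (R • η)
  rw [norm_iteratedFDeriv_zero, norm_smul, Real.norm_of_nonneg hR.le, ← hc] at h1
  have h2 : ‖𝓕 (ψ : EuclideanSpace ℝ (Fin n) → ℂ) (R • η)‖ ≤ c * (1 + R * ‖η‖) ^ (-((n:ℝ) + 1)) := by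
    rw [Real.rpow_neg (by positivity), ← div_eq_mul_inv, le_div_iff₀ (by positivity), mul_comm]
    have e : ((n:ℝ) + 1) = ((n + 1 : ℕ) : ℝ) := by push_cast; ring
    rw [e, Real.rpow_natCast]
    exact h1
  calc _ ≤ R ^ n * (c * (1 + R * ‖η‖) ^ (-((n:ℝ) + 1))) := by gcongr
    _ = c * R ^ n * (1 + R * ‖η‖) ^ (-((n:ℝ) + 1)) := by ring
    _ ≤ _ := by gcongr ?_ * _ * _; linarith

lemma kernel_L2 (hn : 0 < n) (ψ : 𝓢(EuclideanSpace ℝ (Fin n), ℂ)) : ∃ c : ℝ, 0 < c ∧ ∀ R : ℝ, 1 ≤ R →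
    ∀ f h : EuclideanSpace ℝ (Fin n) → ℂ, Integrable f → Integrable h →
    ‖∫ x, f x * ∫ y, h y * (ψ (R⁻¹ • (y - x)) * sgh n (y - x))‖ₑ ≤
      ENNReal.ofReal (c * R) * ((∫⁻ x, ‖f x‖ₑ ^ 2) ^ (1/2:ℝ) * (∫⁻ x, ‖h x‖ₑ ^ 2) ^ (1/2:ℝ)) := by
  obtain ⟨c1, hc1, hsh⟩ := shell_est hn
  obtain ⟨c2, hc2, hd⟩ := fourier_decay ψ
  refine ⟨c2 * c1, by positivity, fun R hR f h hf hh => ?_⟩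
  have hR0 : 0 < R := by linarith
  set ψR : EuclideanSpace ℝ (Fin n) → ℂ := fun x => ψ (R⁻¹ • x) with hψR
  have hψi : Integrable ψR := ψ.integrable.comp_smul (inv_ne_zero hR0.ne')
  have hψc : Continuous ψR := ψ.continuous.comp (by fun_prop)
  set P := 𝓕 ψR with hP
  have hPc : Continuous P := continuous_fourier_of_integrable hψi
  have hdom : Integrable (fun η : EuclideanSpace ℝ (Fin n) => c2 * R ^ n * (1 + R * ‖η‖) ^ (-((n:ℝ) + 1))) := by
    refine Integrable.const_mul ?_ _
    have hint : Integrable (fun x : EuclideanSpace ℝ (Fin n) => (1 + ‖x‖) ^ (-((n:ℝ) + 1))) :=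
      integrable_one_add_norm (by simp)
    have := hint.comp_smul hR0.ne'
    refine this.congr (ae_of_all _ fun x => ?_)
    simp only [norm_smul, Real.norm_of_nonneg hR0.le]
  have hPi : Integrable P := hdom.mono' hPc.aestronglyMeasurable (ae_of_all _ (hd R hR0))
  have hinv : ∀ x, 𝓕⁻ P x = ψR x := fun x => by rw [hP, hψc.fourierInv_fourier_eq hψi hPi]
  set m : EuclideanSpace ℝ (Fin n) → ℂ := fun ζ => ∫ ω, P (ζ - ω) ∂(sph n) with hm
  have hprod : Integrable (fun z : EuclideanSpace ℝ (Fin n) × EuclideanSpace ℝ (Fin n) => P (z.1 - z.2)) (volume.prod (sph n)) := by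
    have hcm : Continuous (fun z : EuclideanSpace ℝ (Fin n) × EuclideanSpace ℝ (Fin n) => P (z.1 - z.2)) := hPc.comp (by fun_prop)
    rw [integrable_prod_iff' hcm.aestronglyMeasurable]
    refine ⟨ae_of_all _ fun ω => hPi.comp_sub_right ω, ?_⟩
    have : ∀ ω : EuclideanSpace ℝ (Fin n), ∫ x, ‖P (x - ω)‖ = ∫ x, ‖P x‖ := fun ω => integral_sub_right_eq_self (fun x => ‖P x‖) ω
    simp only [this]
    exact integrable_const _
  have hmi : Integrable m := hprod.integral_prod_left
  have hmF : ∀ x, 𝓕⁻ m x = ψ (R⁻¹ • x) * sgh n x := by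
    intro x
    rw [Real.fourierInv_eq']
    have e1 : ∀ ζ, Complex.exp (↑(2 * Real.pi * inner ℝ ζ x) * I) • m ζ = ∫ ω, Complex.exp (↑(2 * Real.pi * inner ℝ ζ x) * I) * P (ζ - ω) ∂(sph n) := by
      intro ζ
      rw [smul_eq_mul, hm, integral_const_mul]
    simp only [e1]
    rw [integral_integral_swap (f := fun ζ ω => Complex.exp (↑(2 * Real.pi * inner ℝ ζ x) * I) * P (ζ - ω))]
    · have e2 : ∀ ω : EuclideanSpace ℝ (Fin n), ∫ ζ, Complex.exp (↑(2 * Real.pi * inner ℝ ζ x) * I) * P (ζ - ω) =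
          Complex.exp (2 * Real.pi * (inner ℝ x ω : ℝ) * I) * ψ (R⁻¹ • x) := by
        intro ω
        have := integral_add_right_eq_self (μ := volume) (fun ζ => Complex.exp (↑(2 * Real.pi * inner ℝ ζ x) * I) * P (ζ - ω)) ω
        rw [← this]
        have e3 : ψ (R⁻¹ • x) = 𝓕⁻ P x := (hinv x).symm
        rw [e3, Real.fourierInv_eq', ← integral_const_mul]
        congr 1 with ζ
        rw [add_sub_cancel_right, smul_eq_mul, ← mul_assoc, ← Complex.exp_add]
        congr 2
        rw [inner_add_left, real_inner_comm ω x]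
        push_cast
        ring
      simp only [e2]
      rw [integral_mul_const, sgh, mul_comm]
    · refine hprod.bdd_mul (c := 1) (Continuous.aestronglyMeasurable (by fun_prop)) (ae_of_all _ fun z => ?_)
      rw [Complex.norm_exp_ofReal_mul_I]
  have hmb : ∀ ζ, ‖m ζ‖ ≤ c2 * c1 * R := by
    intro ζ
    have h1 : ‖m ζ‖ₑ ≤ ENNReal.ofReal (c2 * c1 * R) := by
      calc ‖m ζ‖ₑ ≤ ∫⁻ ω, ‖P (ζ - ω)‖ₑ ∂(sph n) := enorm_integral_le_lintegral_enorm _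
        _ ≤ ∫⁻ ω, ENNReal.ofReal (c2 * R ^ n) * ENNReal.ofReal ((1 + R * ‖ζ - ω‖) ^ (-((n:ℝ) + 1))) ∂(sph n) := by
            refine lintegral_mono fun ω => ?_
            rw [← ENNReal.ofReal_mul (by positivity), ← ofReal_norm_eq_enorm]
            exact ENNReal.ofReal_le_ofReal (hd R hR0 _)
        _ ≤ ENNReal.ofReal (c2 * R ^ n) * ENNReal.ofReal (c1 * (R * R ^ (-(n:ℝ)))) := by
            rw [lintegral_const_mul _ (by fun_prop)]
            gcongr
            exact hsh R hR ζ
        _ = _ := by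
            rw [← ENNReal.ofReal_mul (by positivity), Real.rpow_neg hR0.le, Real.rpow_natCast]
            congr 1
            field_simp
    rw [← ofReal_norm_eq_enorm] at h1
    exact (ENNReal.ofReal_le_ofReal_iff (by positivity)).1 h1
  have hk := mult_kernel hmi hf hh
  simp only [hmF] at hk
  rw [← hk]
  have hcR : 0 < c2 * c1 * R := by positivity
  have hb := bilin_L2 (m := fun ξ => ((c2 * c1 * R)⁻¹ : ℝ) * m ξ) hf hh (ae_of_all _ fun ξ => by
    rw [norm_mul, Complex.norm_real, Real.norm_of_nonneg (by positivity), inv_mul_le_iff₀ hcR, mul_one]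
    exact hmb ξ)
  have e : ∫ ξ, m ξ * 𝓕 f ξ * 𝓕⁻ h ξ = ((c2 * c1 * R : ℝ):ℂ) * ∫ ξ, ((c2 * c1 * R)⁻¹ : ℝ) * m ξ * 𝓕 f ξ * 𝓕⁻ h ξ := by
    rw [← integral_const_mul]
    congr 1 with ξ
    have : ((c2 * c1 * R : ℝ):ℂ) ≠ 0 := by exact_mod_cast hcR.ne'
    rw [mul_assoc c2] at this
    simp only [Complex.ofReal_inv, mul_assoc]
    rw [mul_inv_cancel_left₀ this]
  rw [e, enorm_mul]
  gcongr
  rw [← ofReal_norm_eq_enorm, Complex.norm_real, Real.norm_of_nonneg hcR.le]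

end ext1

section ext2

open Filter Topology

variable {n : ℕ}

/-- complex powers of a truncated weight -/
def vzf (p : ℝ) (v : EuclideanSpace ℝ (Fin n) → ℝ) (ζ : ℂ) (x : EuclideanSpace ℝ (Fin n)) : ℂ :=
  if v x = 0 then 0 else Complex.exp ((p * ζ / 2) * (Real.log (v x) : ℂ))

/-- truncated weights -/
def TrV (k : ℝ) (v : EuclideanSpace ℝ (Fin n) → ℝ) : Prop :=
  Measurable v ∧ 1 ≤ k ∧ ∀ x, v x = 0 ∨ (1 / k ≤ v x ∧ v x ≤ k ∧ ‖x‖ ≤ k)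

lemma vzf_norm {p k : ℝ} {v : EuclideanSpace ℝ (Fin n) → ℝ} (hv : TrV k v) {ζ : ℂ} (x : EuclideanSpace ℝ (Fin n)) (hx : v x ≠ 0) :
    ‖vzf p v ζ x‖ = v x ^ (p * ζ.re / 2) := by
  have hk : 0 < k := lt_of_lt_of_le one_pos hv.2.1
  have hp : 0 < v x := by
    rcases hv.2.2 x with h | h
    · exact absurd h hx
    · exact lt_of_lt_of_le (by positivity) h.1
  unfold vzf
  rw [if_neg hx, Complex.norm_exp, Complex.re_mul_ofReal, Real.rpow_def_of_pos hp]
  congr 1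
  simp only [Complex.div_ofNat_re, Complex.re_ofReal_mul]
  ring

lemma vzf_bound {p k : ℝ} (hp : 0 < p) {v : EuclideanSpace ℝ (Fin n) → ℝ} (hv : TrV k v) {ζ : ℂ} (h1 : -2 < ζ.re) (h2 : ζ.re < 2)
    (x : EuclideanSpace ℝ (Fin n)) : ‖vzf p v ζ x‖ ≤ k ^ p := by
  have hk : 0 < k := lt_of_lt_of_le one_pos hv.2.1
  by_cases hx : v x = 0
  · simp only [vzf, hx, if_true, norm_zero]; positivity
  rw [vzf_norm hv x hx]
  obtain h | ⟨h3, h4, -⟩ := hv.2.2 x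
  · exact absurd h hx
  have hvp : 0 < v x := lt_of_lt_of_le (by positivity) h3
  rcases le_total 0 (p * ζ.re / 2) with h0 | h0
  · calc _ ≤ k ^ (p * ζ.re / 2) := Real.rpow_le_rpow hvp.le h4 h0
      _ ≤ _ := Real.rpow_le_rpow_of_exponent_le hv.2.1 (by nlinarith)
  · calc _ ≤ (1 / k) ^ (p * ζ.re / 2) := Real.rpow_le_rpow_of_nonpos (by positivity) h3 h0
      _ = k ^ (-(p * ζ.re / 2)) := by rw [one_div, Real.inv_rpow hk.le, Real.rpow_neg hk.le]
      _ ≤ _ := Real.rpow_le_rpow_of_exponent_le hv.2.1 (by nlinarith)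

lemma vzf_diff (p : ℝ) (v : EuclideanSpace ℝ (Fin n) → ℝ) (x : EuclideanSpace ℝ (Fin n)) :
    Differentiable ℂ (fun ζ => vzf p v ζ x) := by
  unfold vzf
  split_ifs with h0
  · fun_prop
  · fun_prop

lemma vzf_meas (p : ℝ) {v : EuclideanSpace ℝ (Fin n) → ℝ} (hv : Measurable v) (ζ : ℂ) :
    Measurable (vzf p v ζ) := by
  unfold vzf
  refine Measurable.ite (hv (measurableSet_singleton 0)) measurable_const ?_
  fun_prop

lemma vzf_half {p k : ℝ} (hp : 0 < p) {v : EuclideanSpace ℝ (Fin n) → ℝ} (hv : TrV k v) (x : EuclideanSpace ℝ (Fin n)) :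
    vzf p v (1 / p : ℝ) x = (Real.sqrt (v x) : ℂ) := by
  have hk : 0 < k := lt_of_lt_of_le one_pos hv.2.1
  by_cases hx : v x = 0
  · simp [vzf, hx]
  obtain h | ⟨h3, -, -⟩ := hv.2.2 x
  · exact absurd h hx
  have hvp : 0 < v x := lt_of_lt_of_le (by positivity) h3
  rw [vzf, if_neg hx, Real.sqrt_eq_rpow, Real.rpow_def_of_pos hvp, Complex.ofReal_exp]
  congr 1
  have : (p:ℂ) ≠ 0 := by exact_mod_cast hp.ne'
  push_cast
  field_simp

lemma weight_interp {p k : ℝ} (hp : 1 ≤ p) {v : EuclideanSpace ℝ (Fin n) → ℝ} (hv : TrV k v)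
    {K : EuclideanSpace ℝ (Fin n) → ℂ} (hK : Continuous K) {CK B0 B1 : ℝ} (hKb : ∀ x, ‖K x‖ ≤ CK) (hB0 : 0 ≤ B0) (hB1 : 0 ≤ B1)
    (H0 : ∀ f h : EuclideanSpace ℝ (Fin n) → ℂ, Integrable f → Integrable h → ‖∫ x, f x * ∫ y, h y * K (y - x)‖ₑ ≤
      ENNReal.ofReal B0 * ((∫⁻ x, ‖f x‖ₑ ^ 2) ^ (1/2:ℝ) * (∫⁻ x, ‖h x‖ₑ ^ 2) ^ (1/2:ℝ)))
    (H1 : ∀ x, ∫⁻ y, ‖K (y - x)‖ₑ * ENNReal.ofReal (v y ^ p) ≤ ENNReal.ofReal B1)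
    (H2 : ∀ y, ∫⁻ x, ‖K (y - x)‖ₑ * ENNReal.ofReal (v x ^ p) ≤ ENNReal.ofReal B1)
    {f : EuclideanSpace ℝ (Fin n) → ℂ} (hfm : Measurable f) (hfi : Integrable f) (hf2 : Integrable (fun x => ‖f x‖ ^ 2)) :
    ‖∫ z : EuclideanSpace ℝ (Fin n) × EuclideanSpace ℝ (Fin n), (Real.sqrt (v z.1) * f z.1) *
      ((Real.sqrt (v z.2) * (starRingEnd ℂ) (f z.2)) * K (z.2 - z.1))‖ ≤ B0 ^ (1 - 1/p) * B1 ^ (1/p) * ∫ x, ‖f x‖ ^ 2 := by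
  have hp0 : 0 < p := by linarith
  have hk : 0 < k := lt_of_lt_of_le one_pos hv.2.1
  have hCK : 0 ≤ CK := (norm_nonneg _).trans (hKb 0)
  set A := ∫ x, ‖f x‖ ^ 2 with hA
  have hA0 : 0 ≤ A := integral_nonneg fun x => by positivity
  have hAe : ∫⁻ x, ‖f x‖ₑ ^ 2 = ENNReal.ofReal A := by
    rw [hA, ofReal_integral_eq_lintegral_ofReal hf2 (ae_of_all _ fun x => by positivity)]
    refine lintegral_congr fun x => ?_
    rw [← ofReal_norm_eq_enorm, ENNReal.ofReal_pow (norm_nonneg _)]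
  have hv0 : ∀ x, 0 ≤ v x := fun x => by
    rcases hv.2.2 x with h | h
    · exact h.ge
    · exact le_trans (by positivity) h.1
  set Q : ℂ → EuclideanSpace ℝ (Fin n) × EuclideanSpace ℝ (Fin n) → ℂ := fun ζ z =>
    (vzf p v ζ z.1 * f z.1) * ((vzf p v ζ z.2 * (starRingEnd ℂ) (f z.2)) * K (z.2 - z.1)) with hQ
  set U : Set ℂ := {ζ | -2 < ζ.re ∧ ζ.re < 2} with hU
  have hUo : IsOpen U := (isOpen_lt continuous_const Complex.continuous_re).inter (isOpen_lt Complex.continuous_re continuous_const)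
  have hQm : ∀ ζ, Measurable (Q ζ) := by
    intro ζ
    have h1 := vzf_meas p hv.1 ζ
    have h2 := hK.measurable
    have h3 := Complex.continuous_conj.measurable
    refine Measurable.mul (by fun_prop) (Measurable.mul (Measurable.mul (by fun_prop) (h3.comp (by fun_prop))) (by fun_prop))
  set b : EuclideanSpace ℝ (Fin n) × EuclideanSpace ℝ (Fin n) → ℝ := fun z => (k ^ p * ‖f z.1‖) * (k ^ p * ‖f z.2‖ * CK) with hb
  have hbi : Integrable b := by
    exact (hfi.norm.const_mul _).mul_prod ((hfi.norm.const_mul _).mul_const _)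
  have hQb : ∀ ζ ∈ U, ∀ z, ‖Q ζ z‖ ≤ b z := by
    intro ζ hζ z
    simp only [hQ, hb, norm_mul, RCLike.norm_conj]
    gcongr
    · exact vzf_bound hp0 hv hζ.1 hζ.2 _
    · exact vzf_bound hp0 hv hζ.1 hζ.2 _
    · exact hKb _
  have hsub : ∀ z : ℂ, 0 ≤ z.re → z.re ≤ 1 → z ∈ U := fun z h0 h1 => ⟨by linarith, by linarith⟩
  have hQi : ∀ ζ ∈ U, Integrable (Q ζ) := fun ζ hζ => hbi.mono' (hQm ζ).aestronglyMeasurable (ae_of_all _ (hQb ζ hζ))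
  have h3 := three_lines (f := fun ζ => ∫ z, Q ζ z) (U := U) hUo hsub ?_ (M := ∫ z, b z) (a := B0 * A) (b := B1 * A) ?_ ?_ ?_
    (θ := 1/p) (by positivity) (by rw [div_le_one hp0]; exact hp)
  · simp only [hQ, vzf_half hp0 hv] at h3
    refine h3.trans (le_of_eq ?_)
    have hθ : 1 / p ≤ 1 := by rw [div_le_one hp0]; exact hp
    rw [Real.mul_rpow hB0 hA0, Real.mul_rpow hB1 hA0]
    have : A ^ (1 - 1/p) * A ^ (1/p) = A := by
      rw [← Real.rpow_add_of_nonneg hA0 (by linarith) (by positivity)]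
      simp
    calc _ = B0 ^ (1 - 1/p) * B1 ^ (1/p) * (A ^ (1 - 1/p) * A ^ (1/p)) := by ring
      _ = _ := by rw [this]
  · refine differentiableOn_integral hUo (fun ζ _ => (hQm ζ).aestronglyMeasurable) (ae_of_all _ fun z => ?_) ?_
    · have h1 := vzf_diff p v z.1
      have h2 := vzf_diff p v z.2
      exact Differentiable.differentiableOn (by fun_prop)
    · intro ζ hζ
      exact ⟨1, one_pos, b, hbi, ae_of_all _ fun z ζ _ hζ => hQb ζ hζ z⟩
  · intro ζ h0 h1
    exact norm_integral_le_of_norm_le hbi (ae_of_all _ (hQb ζ (hsub ζ h0 h1)))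
  · intro ζ h0
    have hζU := hsub ζ h0.ge (by linarith)
    have hle : ∀ x, ‖vzf p v ζ x‖ ≤ 1 := by
      intro x
      by_cases hx : v x = 0
      · simp [vzf, hx]
      · rw [vzf_norm hv x hx, h0]; simp
    have hm := vzf_meas p hv.1 ζ
    have hi1 : Integrable (fun x => vzf p v ζ x * f x) := hfi.bdd_mul (c := 1) hm.aestronglyMeasurable (ae_of_all _ hle)
    have hi2 : Integrable (fun x => vzf p v ζ x * (starRingEnd ℂ) (f x)) := by
      have : Integrable (fun x => (starRingEnd ℂ) (f x)) :=
        hfi.norm.mono' (Complex.continuous_conj.comp_aestronglyMeasurable hfi.1) (ae_of_all _ fun x => by simp)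
      exact this.bdd_mul (c := 1) hm.aestronglyMeasurable (ae_of_all _ hle)
    have h4 := H0 _ _ hi1 hi2
    have e : ∫ z, Q ζ z = ∫ x, (vzf p v ζ x * f x) * ∫ y, (vzf p v ζ y * (starRingEnd ℂ) (f y)) * K (y - x) := by
      rw [Measure.volume_eq_prod, integral_prod _ (hQi ζ hζU)]
      congr 1 with x
      simp only [hQ, integral_const_mul]
    rw [← e] at h4
    have h5 : ∫⁻ x, ‖vzf p v ζ x * f x‖ₑ ^ 2 ≤ ENNReal.ofReal A := by
      rw [← hAe]
      refine lintegral_mono fun x => ?_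
      gcongr
      rw [← ofReal_norm_eq_enorm, ← ofReal_norm_eq_enorm, norm_mul]
      refine ENNReal.ofReal_le_ofReal ?_
      nlinarith [hle x, norm_nonneg (f x)]
    have h6 : ∫⁻ x, ‖vzf p v ζ x * (starRingEnd ℂ) (f x)‖ₑ ^ 2 ≤ ENNReal.ofReal A := by
      refine le_trans (le_of_eq (lintegral_congr fun x => ?_)) h5
      rw [← ofReal_norm_eq_enorm, ← ofReal_norm_eq_enorm, norm_mul, norm_mul, RCLike.norm_conj]
    have h7 : ‖∫ z, Q ζ z‖ₑ ≤ ENNReal.ofReal (B0 * A) := by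
      refine h4.trans ?_
      calc _ ≤ ENNReal.ofReal B0 * (ENNReal.ofReal A ^ (1/2:ℝ) * ENNReal.ofReal A ^ (1/2:ℝ)) := by gcongr
        _ = _ := by
          rw [← ENNReal.rpow_add_of_nonneg _ _ (by norm_num) (by norm_num), ENNReal.ofReal_mul hB0]
          norm_num
    rw [← ofReal_norm_eq_enorm] at h7
    exact (ENNReal.ofReal_le_ofReal_iff (by positivity)).1 h7
  · intro ζ h1
    have hm := hv.1
    have hKm := hK.measurable
    have key : ‖∫ z, Q ζ z‖ₑ ≤ ENNReal.ofReal (B1 * A) := by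
      calc ‖∫ z, Q ζ z‖ₑ ≤ ∫⁻ z, ‖Q ζ z‖ₑ := enorm_integral_le_lintegral_enorm _
        _ ≤ ∫⁻ z : EuclideanSpace ℝ (Fin n) × EuclideanSpace ℝ (Fin n), ENNReal.ofReal (1/2) * (‖f z.1‖ₑ ^ 2 * (‖K (z.2 - z.1)‖ₑ * ENNReal.ofReal (v z.2 ^ p)) +
              ‖f z.2‖ₑ ^ 2 * (‖K (z.2 - z.1)‖ₑ * ENNReal.ofReal (v z.1 ^ p))) := by
            refine lintegral_mono fun z => ?_
            simp only [← ofReal_norm_eq_enorm]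
            rw [← ENNReal.ofReal_pow (norm_nonneg _), ← ENNReal.ofReal_pow (norm_nonneg _), ← ENNReal.ofReal_mul (norm_nonneg _),
              ← ENNReal.ofReal_mul (norm_nonneg _), ← ENNReal.ofReal_mul (by positivity), ← ENNReal.ofReal_mul (by positivity),
              ← ENNReal.ofReal_add (by have := hv0 z.2; positivity) (by have := hv0 z.1; positivity), ← ENNReal.ofReal_mul (by norm_num)]
            refine ENNReal.ofReal_le_ofReal ?_
            have hn' : ∀ x, ‖vzf p v ζ x‖ ^ 2 ≤ v x ^ p := by
              intro x
              by_cases hx : v x = 0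
              · simp [vzf, hx, Real.zero_rpow hp0.ne']
              · rw [vzf_norm hv x hx, h1, ← Real.rpow_natCast, ← Real.rpow_mul (hv0 x)]
                refine le_of_eq ?_
                congr 1
                push_cast
                ring
            simp only [hQ, norm_mul, RCLike.norm_conj]
            have g1 := hn' z.1
            have g2 := hn' z.2
            set α := ‖vzf p v ζ z.1‖
            set β := ‖vzf p v ζ z.2‖
            set F := ‖f z.1‖
            set H := ‖f z.2‖
            have hk0 := norm_nonneg (K (z.2 - z.1))
            set κ := ‖K (z.2 - z.1)‖
            have g3 : F ^ 2 * β ^ 2 ≤ F ^ 2 * v z.2 ^ p := by gcongr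
            have g4 : H ^ 2 * α ^ 2 ≤ H ^ 2 * v z.1 ^ p := by gcongr
            have g5 : α * F * (β * H) ≤ 1/2 * (F ^ 2 * v z.2 ^ p + H ^ 2 * v z.1 ^ p) := by nlinarith [sq_nonneg (F * β - H * α)]
            calc α * F * (β * H * κ) = α * F * (β * H) * κ := by ring
              _ ≤ 1/2 * (F ^ 2 * v z.2 ^ p + H ^ 2 * v z.1 ^ p) * κ := by gcongr
              _ = _ := by ring
        _ = ENNReal.ofReal (1/2) * ((∫⁻ x, ‖f x‖ₑ ^ 2 * ∫⁻ y, ‖K (y - x)‖ₑ * ENNReal.ofReal (v y ^ p)) +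
              ∫⁻ y, ‖f y‖ₑ ^ 2 * ∫⁻ x, ‖K (y - x)‖ₑ * ENNReal.ofReal (v x ^ p)) := by
            rw [lintegral_const_mul _ (by fun_prop), lintegral_add_left (by fun_prop)]
            congr 2
            · rw [Measure.volume_eq_prod, lintegral_prod _ (by fun_prop)]
              refine lintegral_congr fun x => ?_
              dsimp only; rw [lintegral_const_mul _ (by fun_prop)]
            · rw [Measure.volume_eq_prod, lintegral_prod_symm _ (by fun_prop)]
              refine lintegral_congr fun x => ?_
              dsimp only; rw [lintegral_const_mul _ (by fun_prop)]
        _ ≤ ENNReal.ofReal (1/2) * ((∫⁻ x, ‖f x‖ₑ ^ 2 * ENNReal.ofReal B1) + ∫⁻ y, ‖f y‖ₑ ^ 2 * ENNReal.ofReal B1) := by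
            gcongr with x y
            · exact H1 x
            · exact H2 y
        _ = _ := by
            rw [lintegral_mul_const _ (by fun_prop), hAe, ← ENNReal.ofReal_mul hA0, ← ENNReal.ofReal_add (by positivity) (by positivity), ← ENNReal.ofReal_mul (by norm_num)]
            congr 1
            ring
    rw [← ofReal_norm_eq_enorm] at key
    exact (ENNReal.ofReal_le_ofReal_iff (by positivity)).1 key

end ext2

section ext3

open Filter Topology

variable {n : ℕ}

/-- Morrey bound -/
def Mor (p N : ℝ) (v : EuclideanSpace ℝ (Fin n) → ℝ) : Prop :=
  ∀ (x : EuclideanSpace ℝ (Fin n)) (r : ℝ), 0 < r →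
    ∫⁻ y in ball x r, ENNReal.ofReal (v y ^ p) ≤ ENNReal.ofReal (N ^ p * r ^ ((n:ℝ) - 2 * p))

/-- quadratic form -/
def QF (v : EuclideanSpace ℝ (Fin n) → ℝ) (f : EuclideanSpace ℝ (Fin n) → ℂ) (K : EuclideanSpace ℝ (Fin n) → ℂ) : ℂ :=
  ∫ z : EuclideanSpace ℝ (Fin n) × EuclideanSpace ℝ (Fin n), (Real.sqrt (v z.1) * f z.1) *
      ((Real.sqrt (v z.2) * (starRingEnd ℂ) (f z.2)) * K (z.2 - z.1))

lemma sgh_cont : Continuous (sgh n) := by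
  unfold sgh
  refine continuous_of_dominated (bound := fun _ => 1) ?_ ?_ (integrable_const _) ?_
  · intro x
    exact (by fun_prop : Continuous _).aestronglyMeasurable
  · intro x
    filter_upwards with ω
    rw [Complex.norm_exp]
    simp
  · filter_upwards with ω
    fun_prop

lemma sgh_bdd (x : EuclideanSpace ℝ (Fin n)) : ‖sgh n x‖ ≤ (sph n).real Set.univ := by
  unfold sgh
  refine (norm_integral_le_integral_norm _).trans ?_
  have : ∀ ω : EuclideanSpace ℝ (Fin n), ‖Complex.exp (2 * Real.pi * (inner ℝ x ω : ℝ) * I)‖ = 1 := by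
    intro ω
    rw [Complex.norm_exp]
    simp
  simp [this]

lemma sgh_decay (hn : 3 ≤ n) : ∃ C : ℝ, 0 < C ∧ ∀ x : EuclideanSpace ℝ (Fin n), x ≠ 0 →
    ‖sgh n x‖ ≤ C * ‖x‖ ^ (-(((n:ℝ) - 1) / 2)) := by
  obtain ⟨C, hC, h⟩ := phi_decay hn ⟨0, by omega⟩
  refine ⟨C * (2 * Real.pi) ^ (-(((n:ℝ) - 1) / 2)), by positivity, fun x hx => ?_⟩
  have hx' : 0 < ‖x‖ := norm_pos_iff.2 hx
  unfold sgh
  rw [sph_fourier ⟨0, by omega⟩ x, Complex.norm_real, Real.norm_eq_abs]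
  refine (h _ (by positivity)).trans (le_of_eq ?_)
  rw [Real.mul_rpow (by positivity) (by positivity), mul_assoc]

lemma TrV.sqrt_le {k : ℝ} {v : EuclideanSpace ℝ (Fin n) → ℝ} (hv : TrV k v) (x) : ‖(Real.sqrt (v x) : ℂ)‖ ≤ Real.sqrt k := by
  rw [Complex.norm_real, Real.norm_eq_abs, abs_of_nonneg (Real.sqrt_nonneg _)]
  apply Real.sqrt_le_sqrt
  rcases hv.2.2 x with h | h
  · rw [h]; linarith [hv.2.1]
  · exact h.2.1

lemma TrV.int_mul {k : ℝ} {v : EuclideanSpace ℝ (Fin n) → ℝ} (hv : TrV k v) {f : EuclideanSpace ℝ (Fin n) → ℂ} (hf : Integrable f) :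
    Integrable (fun x => (Real.sqrt (v x) : ℂ) * f x) := by
  refine hf.bdd_mul (c := Real.sqrt k) ?_ ?_
  · have := hv.1
    exact (by fun_prop : Measurable _).aestronglyMeasurable
  · filter_upwards with x using hv.sqrt_le x

lemma QF_int {k : ℝ} {v : EuclideanSpace ℝ (Fin n) → ℝ} (hv : TrV k v) {f : EuclideanSpace ℝ (Fin n) → ℂ}
    (hfi : Integrable f) {K : EuclideanSpace ℝ (Fin n) → ℂ} (hK : Continuous K) {CK : ℝ} (hKb : ∀ x, ‖K x‖ ≤ CK) :
    Integrable (fun z : EuclideanSpace ℝ (Fin n) × EuclideanSpace ℝ (Fin n) => (Real.sqrt (v z.1) * f z.1) *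
      ((Real.sqrt (v z.2) * (starRingEnd ℂ) (f z.2)) * K (z.2 - z.1))) := by
  have hc : Integrable (fun x => (starRingEnd ℂ) (f x)) := by
    refine hfi.congr' ?_ ?_
    · exact Complex.continuous_conj.comp_aestronglyMeasurable hfi.1
    · filter_upwards with x
      simp
  have h1 := (hv.int_mul hfi).mul_prod (hv.int_mul hc)
  have h2 := h1.mul_bdd (c := CK) (g := fun z => K (z.2 - z.1)) (by exact (by fun_prop : Continuous _).aestronglyMeasurable)
    (by filter_upwards with z using hKb _)
  refine h2.congr ?_
  filter_upwards with z
  ring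

lemma QF_piece {p k N : ℝ} (hp : 1 ≤ p) {v : EuclideanSpace ℝ (Fin n) → ℝ} (hv : TrV k v) (hN : 0 ≤ N) (hM : Mor p N v)
    (ψ : 𝓢(EuclideanSpace ℝ (Fin n), ℂ)) (hψ : ∀ x, 2 ≤ ‖x‖ → ψ x = 0) {R D c : ℝ} (hR : 0 < R) (hc : 0 ≤ c) (hD0 : 0 ≤ D)
    (hD : ∀ x, ‖ψ (R⁻¹ • x) * sgh n x‖ ≤ D)
    (H0 : ∀ f h : EuclideanSpace ℝ (Fin n) → ℂ, Integrable f → Integrable h →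
    ‖∫ x, f x * ∫ y, h y * (ψ (R⁻¹ • (y - x)) * sgh n (y - x))‖ₑ ≤
      ENNReal.ofReal (c * R) * ((∫⁻ x, ‖f x‖ₑ ^ 2) ^ (1/2:ℝ) * (∫⁻ x, ‖h x‖ₑ ^ 2) ^ (1/2:ℝ)))
    {f : EuclideanSpace ℝ (Fin n) → ℂ} (hfm : Measurable f) (hfi : Integrable f) (hf2 : Integrable (fun x => ‖f x‖ ^ 2)) :
    ‖QF v f (fun x => ψ (R⁻¹ • x) * sgh n x)‖ ≤ (c * R) ^ (1 - 1/p) * (D * (N ^ p * (2 * R) ^ ((n:ℝ) - 2 * p))) ^ (1/p) * ∫ x, ‖f x‖ ^ 2 := by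
  have hsupp : ∀ x, 2 * R ≤ ‖x‖ → ψ (R⁻¹ • x) = 0 := by
    intro x hx
    apply hψ
    rw [norm_smul, norm_inv, Real.norm_eq_abs, abs_of_pos hR, inv_mul_eq_div, le_div_iff₀ hR]
    exact hx
  have key : ∀ (K : EuclideanSpace ℝ (Fin n) → EuclideanSpace ℝ (Fin n)) (a : EuclideanSpace ℝ (Fin n)), (∀ y, ‖K y‖ = dist y a) →
      ∫⁻ y, ‖ψ (R⁻¹ • K y) * sgh n (K y)‖ₑ * ENNReal.ofReal (v y ^ p) ≤ ENNReal.ofReal (D * (N ^ p * (2 * R) ^ ((n:ℝ) - 2 * p))) := by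
    intro K a hKa
    have hmv := hv.1
    calc ∫⁻ y, ‖ψ (R⁻¹ • K y) * sgh n (K y)‖ₑ * ENNReal.ofReal (v y ^ p)
        ≤ ∫⁻ y, (ball a (2 * R)).indicator (fun y => ENNReal.ofReal D * ENNReal.ofReal (v y ^ p)) y := by
          refine lintegral_mono fun y => ?_
          by_cases hy : y ∈ ball a (2 * R)
          · rw [Set.indicator_of_mem hy]
            gcongr
            rw [← ofReal_norm_eq_enorm]
            exact ENNReal.ofReal_le_ofReal (hD _)
          · have : ψ (R⁻¹ • K y) = 0 := by
              apply hsupp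
              rw [hKa]
              simpa using hy
            rw [this]
            simp
      _ = ENNReal.ofReal D * ∫⁻ y in ball a (2 * R), ENNReal.ofReal (v y ^ p) := by
          rw [lintegral_indicator measurableSet_ball, lintegral_const_mul _ (by fun_prop)]
      _ ≤ ENNReal.ofReal D * ENNReal.ofReal (N ^ p * (2 * R) ^ ((n:ℝ) - 2 * p)) := by
          gcongr
          exact hM a (2 * R) (by positivity)
      _ = _ := by rw [← ENNReal.ofReal_mul hD0]
  have hcont : Continuous (fun x => ψ (R⁻¹ • x) * sgh n x) := by
    have := sgh_cont (n := n)
    have := ψ.continuous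
    fun_prop
  refine weight_interp hp hv hcont hD (by positivity) (by positivity) H0 ?_ ?_ hfm hfi hf2
  · intro x
    exact key (fun y => y - x) x (fun y => by rw [dist_eq_norm])
  · intro y
    exact key (fun x => y - x) y (fun x => by rw [dist_comm, dist_eq_norm])

end ext3

section ext4

open Filter Topology

variable {n : ℕ}

lemma QF_alg {p c C N R d : ℝ} (hp : 0 < p) (hc : 0 ≤ c) (hC : 0 ≤ C) (hN : 0 ≤ N) (hR : 0 < R) :
    (c * R) ^ (1 - 1/p) * (C * R ^ (-((d - 1) / 2)) * (N ^ p * (2 * R) ^ (d - 2 * p))) ^ (1/p) =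
      c ^ (1 - 1/p) * C ^ (1/p) * (2 ^ (d - 2 * p)) ^ (1/p) * N * R ^ (-1 + (d - 1) / (2 * p)) := by
  rw [Real.mul_rpow hc hR.le, Real.mul_rpow (by positivity) (by positivity), Real.mul_rpow hC (by positivity),
    Real.mul_rpow (by positivity) (by positivity), Real.mul_rpow (by norm_num) hR.le, Real.mul_rpow (by positivity) (by positivity),
    ← Real.rpow_mul hN, mul_one_div_cancel hp.ne', Real.rpow_one, ← Real.rpow_mul hR.le, ← Real.rpow_mul hR.le]
  have e : R ^ (-1 + (d - 1) / (2 * p)) = R ^ (1 - 1/p) * R ^ (-((d - 1) / 2) * (1/p)) * R ^ ((d - 2 * p) * (1/p)) := by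
    rw [← Real.rpow_add hR, ← Real.rpow_add hR]
    congr 1
    field_simp
    ring
  rw [e]
  ring

lemma exists_bump : ∃ χ ψ : 𝓢(EuclideanSpace ℝ (Fin n), ℂ), (∀ x, ‖x‖ ≤ 1 → χ x = 1) ∧ (∀ x, 2 ≤ ‖x‖ → χ x = 0) ∧ (∀ x, ‖χ x‖ ≤ 1) ∧
    (∀ x, ψ x = χ x - χ ((2:ℝ) • x)) := by
  let b : ContDiffBump (0 : EuclideanSpace ℝ (Fin n)) := ⟨1, 2, by norm_num, by norm_num⟩
  have h1 : HasCompactSupport (fun x => (b x : ℂ)) := b.hasCompactSupport.comp_left (g := fun x : ℝ => (x:ℂ)) (by simp)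
  have h2 : ContDiff ℝ (⊤ : ℕ∞) (fun x => (b x : ℂ)) := Complex.ofRealCLM.contDiff.comp b.contDiff
  have h3 : HasCompactSupport (fun x => (b x : ℂ) - (b ((2:ℝ) • x) : ℂ)) := h1.sub (h1.comp_smul (c := (2:ℝ)) (by norm_num))
  have h4 : ContDiff ℝ (⊤ : ℕ∞) (fun x => (b x : ℂ) - (b ((2:ℝ) • x) : ℂ)) := h2.sub (h2.comp (contDiff_const_smul (2:ℝ)))
  refine ⟨h1.toSchwartzMap h2, h3.toSchwartzMap h4, ?_, ?_, ?_, ?_⟩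
  · intro x hx
    show (b x : ℂ) = 1
    rw [b.one_of_mem_closedBall (by simpa using hx)]
    simp
  · intro x hx
    show (b x : ℂ) = 0
    rw [b.zero_of_le_dist (by simpa using hx)]
    simp
  · intro x
    show ‖(b x : ℂ)‖ ≤ 1
    rw [Complex.norm_real, Real.norm_eq_abs, abs_of_nonneg b.nonneg]
    exact b.le_one
  · intro x
    rfl

lemma QF_bound (hn : 3 ≤ n) {p : ℝ} (hp : ((n:ℝ) - 1) / 2 < p) : ∃ C : ℝ, 0 < C ∧ ∀ (v : EuclideanSpace ℝ (Fin n) → ℝ) (k N : ℝ),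
    TrV k v → 0 ≤ N → Mor p N v → ∀ f : EuclideanSpace ℝ (Fin n) → ℂ, Measurable f → Integrable f → Integrable (fun x => ‖f x‖ ^ 2) →
    ‖QF v f (sgh n)‖ ≤ C * N * ∫ x, ‖f x‖ ^ 2 := by
  have hn' : (3:ℝ) ≤ n := by exact_mod_cast hn
  have hp1 : 1 ≤ p := by linarith
  have hp0 : 0 < p := by linarith
  obtain ⟨χ, ψ, hχ1, hχ2, hχb, hψ⟩ := exists_bump (n := n)
  obtain ⟨c1, hc1, H1⟩ := kernel_L2 (by omega : 0 < n) χ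
  obtain ⟨c2, hc2, H2⟩ := kernel_L2 (by omega : 0 < n) ψ
  obtain ⟨C0, hC0, hdec⟩ := sgh_decay hn
  set S := (sph n).real Set.univ with hS
  have hS0 : 0 ≤ S := measureReal_nonneg
  set δ : ℝ := -1 + ((n:ℝ) - 1) / (2 * p) with hδ
  have hδ0 : δ < 0 := by
    have : ((n:ℝ) - 1) / (2 * p) < 1 := by rw [div_lt_one (by positivity)]; linarith
    linarith
  set C2 : ℝ := 2 * C0 * 2 ^ (((n:ℝ) - 1) / 2) with hC2
  set A1 : ℝ := c1 ^ (1 - 1/p) * S ^ (1/p) * (2 ^ ((n:ℝ) - 2 * p)) ^ (1/p) with hA1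
  set A2 : ℝ := c2 ^ (1 - 1/p) * C2 ^ (1/p) * (2 ^ ((n:ℝ) - 2 * p)) ^ (1/p) with hA2
  have hA10 : 0 ≤ A1 := by positivity
  have hA20 : 0 ≤ A2 := by positivity
  set g : ℝ := (2:ℝ) ^ δ with hg
  have hg0 : 0 < g := by positivity
  have hg1 : g < 1 := Real.rpow_lt_one_of_one_lt_of_neg (by norm_num) hδ0
  refine ⟨A1 + A2 * (1 - g)⁻¹ + 1, by have : 0 < 1 - g := by linarith
                                      positivity, ?_⟩
  intro v k N hv hN hM f hfm hfi hf2
  set X := ∫ x, ‖f x‖ ^ 2 with hX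
  have hX0 : 0 ≤ X := integral_nonneg fun x => by positivity
  have hψs : ∀ x, 2 ≤ ‖x‖ → ψ x = 0 := by
    intro x hx
    rw [hψ, hχ2 x hx, hχ2 _ (by rw [norm_smul]; norm_num; linarith)]
    simp
  have hψ0 : ∀ x, ‖x‖ ≤ 1/2 → ψ x = 0 := by
    intro x hx
    rw [hψ, hχ1 x (by linarith), hχ1 _ (by rw [norm_smul]; norm_num; linarith)]
    simp
  have hψb : ∀ x, ‖ψ x‖ ≤ 2 := by
    intro x
    rw [hψ]
    exact (norm_sub_le _ _).trans (by linarith [hχb x, hχb ((2:ℝ) • x)])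
  -- first piece
  have P1 : ‖QF v f (fun x => χ ((1:ℝ)⁻¹ • x) * sgh n x)‖ ≤ A1 * N * X := by
    have := QF_piece hp1 hv hN hM χ hχ2 (R := 1) (D := S * 1 ^ (-(((n:ℝ) - 1) / 2))) (c := c1) one_pos hc1.le (by positivity) (by
      intro x
      rw [norm_mul, Real.one_rpow, mul_one]
      calc _ ≤ 1 * S := by
            gcongr
            · exact hχb _
            · exact sgh_bdd _
        _ = S := one_mul _) (H1 1 le_rfl) hfm hfi hf2
    rw [QF_alg hp0 hc1.le hS0 hN one_pos, Real.one_rpow, mul_one] at this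
    exact this
  have P2 : ∀ j : ℕ, ‖QF v f (fun x => ψ (((2:ℝ) ^ (j+1))⁻¹ • x) * sgh n x)‖ ≤ A2 * N * X * g ^ (j+1) := by
    intro j
    set R : ℝ := 2 ^ (j+1) with hR
    have hR1 : 1 ≤ R := one_le_pow₀ (by norm_num)
    have hR0 : 0 < R := by positivity
    have := QF_piece hp1 hv hN hM ψ hψs (R := R) (D := C2 * R ^ (-(((n:ℝ) - 1) / 2))) (c := c2) hR0 hc2.le (by positivity) (by
      intro x
      rw [norm_mul]
      by_cases hx : ‖x‖ ≤ R / 2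
      · rw [hψ0 _ (by rw [norm_smul, norm_inv, Real.norm_eq_abs, abs_of_pos hR0, inv_mul_eq_div, div_le_iff₀ hR0]; linarith)]
        simp only [norm_zero, zero_mul]
        positivity
      · push Not at hx
        have hx0 : 0 < ‖x‖ := by linarith [half_pos hR0]
        calc _ ≤ 2 * (C0 * (R / 2) ^ (-(((n:ℝ) - 1) / 2))) := by
              gcongr
              · exact hψb _
              · refine (hdec x (norm_pos_iff.1 hx0)).trans ?_
                gcongr 1
                exact Real.rpow_le_rpow_of_nonpos (by positivity) hx.le (by linarith)
          _ = _ := by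
              rw [Real.div_rpow hR0.le (by norm_num), Real.rpow_neg (by norm_num : (0:ℝ) ≤ 2), div_inv_eq_mul, hC2]
              ring) (H2 R hR1) hfm hfi hf2
    rw [QF_alg hp0 hc2.le (by positivity) hN hR0] at this
    refine this.trans (le_of_eq ?_)
    have : R ^ δ = g ^ (j+1) := by
      rw [hR, hg, ← Real.rpow_natCast, ← Real.rpow_natCast, ← Real.rpow_mul (by norm_num), ← Real.rpow_mul (by norm_num), mul_comm]
    rw [this]
    ring
  -- choose J
  obtain ⟨J, hJ⟩ := pow_unbounded_of_one_lt (2 * k) (by norm_num : (1:ℝ) < 2)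
  have htel : ∀ x, χ (((2:ℝ) ^ J)⁻¹ • x) = χ ((1:ℝ)⁻¹ • x) + ∑ j ∈ Finset.range J, ψ (((2:ℝ) ^ (j+1))⁻¹ • x) := by
    intro x
    have : ∀ j : ℕ, ψ (((2:ℝ) ^ (j+1))⁻¹ • x) = χ (((2:ℝ) ^ (j+1))⁻¹ • x) - χ (((2:ℝ) ^ j)⁻¹ • x) := by
      intro j
      rw [hψ, smul_smul]
      congr 4
      rw [pow_succ]
      field_simp
    simp_rw [this]
    rw [Finset.sum_range_sub (fun j => χ (((2:ℝ) ^ j)⁻¹ • x))]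
    simp
  have hsplit : QF v f (sgh n) = QF v f (fun x => χ ((1:ℝ)⁻¹ • x) * sgh n x) +
      ∑ j ∈ Finset.range J, QF v f (fun x => ψ (((2:ℝ) ^ (j+1))⁻¹ • x) * sgh n x) := by
    have hi : ∀ (φ : 𝓢(EuclideanSpace ℝ (Fin n), ℂ)) (R : ℝ), (∀ x, ‖φ x‖ ≤ 2) →
      Integrable (fun z : EuclideanSpace ℝ (Fin n) × EuclideanSpace ℝ (Fin n) => (Real.sqrt (v z.1) * f z.1) *
      ((Real.sqrt (v z.2) * (starRingEnd ℂ) (f z.2)) * (φ (R⁻¹ • (z.2 - z.1)) * sgh n (z.2 - z.1)))) := by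
      intro φ R hφ
      refine QF_int hv hfi (K := fun x => φ (R⁻¹ • x) * sgh n x) (CK := 2 * S) ?_ ?_
      · have := sgh_cont (n := n)
        have := φ.continuous
        fun_prop
      · intro x
        rw [norm_mul]
        gcongr
        · exact hφ _
        · exact sgh_bdd _
    unfold QF
    rw [← integral_finsetSum _ (fun j _ => hi ψ _ hψb), ← integral_add (hi χ 1 fun x => (hχb x).trans (by norm_num))
      (integrable_finsetSum _ (fun j _ => hi ψ _ hψb))]
    refine integral_congr_ae ?_
    filter_upwards with z
    rw [← Finset.mul_sum, ← Finset.mul_sum, ← mul_add, ← mul_add, ← Finset.sum_mul, ← add_mul, ← htel]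
    rcases hv.2.2 z.1 with h | h
    · simp [h]
    rcases hv.2.2 z.2 with h' | h'
    · simp [h']
    rw [hχ1, one_mul]
    rw [norm_smul, norm_inv, Real.norm_eq_abs, abs_of_pos (by positivity), inv_mul_eq_div, div_le_one (by positivity)]
    exact (norm_sub_le _ _).trans (by linarith [h.2.2, h'.2.2])
  rw [hsplit]
  calc _ ≤ A1 * N * X + ∑ j ∈ Finset.range J, A2 * N * X * g ^ (j+1) := by
        refine (norm_add_le _ _).trans ?_
        gcongr
        exact (norm_sum_le _ _).trans (Finset.sum_le_sum fun j _ => P2 j)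
    _ ≤ A1 * N * X + A2 * N * X * (1 - g)⁻¹ := by
        rw [← Finset.mul_sum]
        gcongr
        calc _ ≤ ∑ j ∈ Finset.range J, g ^ j := by
              refine Finset.sum_le_sum fun j _ => ?_
              exact pow_le_pow_of_le_one hg0.le hg1.le (by omega)
          _ ≤ ∑' j, g ^ j := Summable.sum_le_tsum _ (fun j _ => by positivity) (summable_geometric_of_lt_one hg0.le hg1)
          _ = _ := tsum_geometric_of_lt_one hg0.le hg1
    _ ≤ _ := by nlinarith [mul_nonneg hN hX0]

end ext4

section ext5

open Filter Topology

variable {n : ℕ}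

lemma cs_enorm {α : Type*} [MeasurableSpace α] {μ : Measure α} {f g : α → ℂ} (hf : AEStronglyMeasurable f μ)
    (hg : AEStronglyMeasurable g μ) : ‖∫ x, f x * g x ∂μ‖ₑ ^ 2 ≤ (∫⁻ x, ‖f x‖ₑ ^ 2 ∂μ) * ∫⁻ x, ‖g x‖ₑ ^ 2 ∂μ := by
  have h1 : ‖∫ x, f x * g x ∂μ‖ₑ ≤ (∫⁻ x, ‖f x‖ₑ ^ 2 ∂μ) ^ (1/2:ℝ) * (∫⁻ x, ‖g x‖ₑ ^ 2 ∂μ) ^ (1/2:ℝ) := by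
    refine (enorm_integral_le_lintegral_enorm _).trans ?_
    have := ENNReal.lintegral_mul_le_Lp_mul_Lq μ Real.HolderConjugate.two_two hf.enorm hg.enorm
    simpa [enorm_mul, ENNReal.rpow_two] using this
  calc _ ≤ ((∫⁻ x, ‖f x‖ₑ ^ 2 ∂μ) ^ (1/2:ℝ) * (∫⁻ x, ‖g x‖ₑ ^ 2 ∂μ) ^ (1/2:ℝ)) ^ 2 := by gcongr
    _ = _ := by
      rw [mul_pow, ← ENNReal.rpow_two, ← ENNReal.rpow_two, ← ENNReal.rpow_mul, ← ENNReal.rpow_mul]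
      norm_num

lemma fatou_le {α : Type*} [MeasurableSpace α] {μ : Measure α} {f : ℕ → α → ℝ≥0∞} {g : α → ℝ≥0∞} {B : ℝ≥0∞}
    (hf : ∀ k, AEMeasurable (f k) μ) (hl : ∀ᵐ x ∂μ, Tendsto (fun k => f k x) atTop (𝓝 (g x)))
    (hb : ∀ k, ∫⁻ x, f k x ∂μ ≤ B) : ∫⁻ x, g x ∂μ ≤ B := by
  have : ∫⁻ x, g x ∂μ = ∫⁻ x, liminf (fun k => f k x) atTop ∂μ := by
    refine lintegral_congr_ae ?_
    filter_upwards [hl] with x hx using hx.liminf_eq.symm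
  rw [this]
  refine (lintegral_liminf_le' hf).trans ?_
  refine liminf_le_of_le (by isBoundedDefault) fun b hb' => ?_
  obtain ⟨k, hk⟩ := hb'.exists
  exact hk.trans (hb k)

lemma sgh_even (hn : 3 ≤ n) (x : EuclideanSpace ℝ (Fin n)) : sgh n (-x) = sgh n x := by
  unfold sgh
  rw [sph_fourier ⟨0, by omega⟩, sph_fourier ⟨0, by omega⟩, norm_neg]

/-- extension operator -/
def extE (n : ℕ) (b : EuclideanSpace ℝ (Fin n) → ℂ) (x : EuclideanSpace ℝ (Fin n)) : ℂ :=
  ∫ ω, Complex.exp (2 * Real.pi * (inner ℝ x ω : ℝ) * I) * b ω ∂(sph n)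

lemma norm_e (x ω : EuclideanSpace ℝ (Fin n)) : ‖Complex.exp (2 * Real.pi * (inner ℝ x ω : ℝ) * I)‖ = 1 := by
  rw [Complex.norm_exp]
  simp

lemma ext_cont {b : EuclideanSpace ℝ (Fin n) → ℂ} (hb : Integrable b (sph n)) : Continuous (extE n b) := by
  unfold extE
  refine continuous_of_dominated (bound := fun ω => ‖b ω‖) ?_ ?_ hb.norm ?_
  · intro x
    exact (by fun_prop : Continuous _).aestronglyMeasurable.mul hb.1
  · intro x
    filter_upwards with ω
    rw [norm_mul, norm_e, one_mul]
  · filter_upwards with ω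
    fun_prop

lemma ext_bdd {b : EuclideanSpace ℝ (Fin n) → ℂ} (x : EuclideanSpace ℝ (Fin n)) : ‖extE n b x‖ ≤ ∫ ω, ‖b ω‖ ∂(sph n) := by
  unfold extE
  refine (norm_integral_le_integral_norm _).trans (le_of_eq ?_)
  refine integral_congr_ae ?_
  filter_upwards with ω
  rw [norm_mul, norm_e, one_mul]

lemma ext_TT (hn : 3 ≤ n) {v : EuclideanSpace ℝ (Fin n) → ℝ} {k : ℝ} (hv : TrV k v) {f : EuclideanSpace ℝ (Fin n) → ℂ}
    (hfi : Integrable f) : ((∫ ω, ‖∫ x, Complex.exp (2 * Real.pi * (inner ℝ x ω : ℝ) * I) * (Real.sqrt (v x) * f x)‖ ^ 2 ∂(sph n) : ℝ) : ℂ)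
      = QF v f (sgh n) := by
  have hc : Integrable (fun x => (starRingEnd ℂ) (f x)) := by
    refine hfi.congr' ?_ ?_
    · exact Complex.continuous_conj.comp_aestronglyMeasurable hfi.1
    · filter_upwards with x
      simp
  have hi1 := hv.int_mul hfi
  have hi2 := hv.int_mul hc
  rw [← integral_complex_ofReal]
  have step : ∀ ω : EuclideanSpace ℝ (Fin n), ((‖∫ x, Complex.exp (2 * Real.pi * (inner ℝ x ω : ℝ) * I) * (Real.sqrt (v x) * f x)‖ ^ 2 : ℝ) : ℂ)
      = ∫ z : EuclideanSpace ℝ (Fin n) × EuclideanSpace ℝ (Fin n), (Real.sqrt (v z.1) * f z.1) *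
      ((Real.sqrt (v z.2) * (starRingEnd ℂ) (f z.2)) * Complex.exp (2 * Real.pi * (inner ℝ (z.1 - z.2) ω : ℝ) * I)) := by
    intro ω
    rw [Complex.ofReal_pow, ← Complex.mul_conj', ← integral_conj, Measure.volume_eq_prod, ← integral_prod_mul]
    refine integral_congr_ae ?_
    filter_upwards with z
    have : Complex.exp (2 * Real.pi * (inner ℝ (z.1 - z.2) ω : ℝ) * I) = Complex.exp (2 * Real.pi * (inner ℝ z.1 ω : ℝ) * I) *
       (starRingEnd ℂ) (Complex.exp (2 * Real.pi * (inner ℝ z.2 ω : ℝ) * I)) := by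
      rw [← Complex.exp_conj, ← Complex.exp_add]
      congr 1
      simp only [map_mul, Complex.conj_ofReal, Complex.conj_I, map_ofNat, inner_sub_left]
      push_cast
      ring
    rw [this]
    simp only [map_mul, Complex.conj_ofReal]
    ring
  simp_rw [step]
  rw [integral_integral_swap (f := fun ω (z : EuclideanSpace ℝ (Fin n) × EuclideanSpace ℝ (Fin n)) => (Real.sqrt (v z.1) * f z.1) *
      ((Real.sqrt (v z.2) * (starRingEnd ℂ) (f z.2)) * Complex.exp (2 * Real.pi * (inner ℝ (z.1 - z.2) ω : ℝ) * I)))]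
  · unfold QF
    refine integral_congr_ae ?_
    filter_upwards with z
    rw [integral_const_mul, integral_const_mul, ← sgh_even hn, neg_sub]
    rfl
  · have h1 : Integrable (fun z : EuclideanSpace ℝ (Fin n) × EuclideanSpace ℝ (Fin n) => (Real.sqrt (v z.1) * f z.1) *
      (Real.sqrt (v z.2) * (starRingEnd ℂ) (f z.2))) := hi1.mul_prod hi2
    have h2 := (integrable_const (1:ℂ) (μ := sph n)).mul_prod h1
    have h3 := h2.mul_bdd (c := 1) (g := fun u => Complex.exp (2 * Real.pi * (inner ℝ (u.2.1 - u.2.2) u.1 : ℝ) * I))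
       (by exact (by fun_prop : Continuous _).aestronglyMeasurable) (by filter_upwards with u; rw [norm_e])
    refine h3.congr ?_
    filter_upwards with u
    simp only [Function.uncurry]
    ring

lemma ext_TrV (hn : 3 ≤ n) {p C : ℝ} (hC : 0 ≤ C) (H : ∀ (v : EuclideanSpace ℝ (Fin n) → ℝ) (k N : ℝ),
    TrV k v → 0 ≤ N → Mor p N v → ∀ f : EuclideanSpace ℝ (Fin n) → ℂ, Measurable f → Integrable f → Integrable (fun x => ‖f x‖ ^ 2) →
    ‖QF v f (sgh n)‖ ≤ C * N * ∫ x, ‖f x‖ ^ 2) {v : EuclideanSpace ℝ (Fin n) → ℝ} {k N : ℝ} (hv : TrV k v) (hN : 0 ≤ N) (hM : Mor p N v)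
    {b : EuclideanSpace ℝ (Fin n) → ℂ} (hb : Integrable b (sph n)) :
    ∫⁻ x, ENNReal.ofReal (v x) * ‖extE n b x‖ₑ ^ 2 ≤ ENNReal.ofReal (C * N) * ∫⁻ ω, ‖b ω‖ₑ ^ 2 ∂(sph n) := by
  set F := extE n b with hF
  have hFc : Continuous F := ext_cont hb
  set M := ∫ ω, ‖b ω‖ ∂(sph n)
  have hM0 : 0 ≤ M := integral_nonneg fun _ => norm_nonneg _
  have hk : 0 < k := lt_of_lt_of_le one_pos hv.2.1
  have hvm := hv.1
  have hv0 : ∀ x, 0 ≤ v x := by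
    intro x
    rcases hv.2.2 x with h | h
    · rw [h]
    · exact le_trans (by positivity) h.1
  set f : EuclideanSpace ℝ (Fin n) → ℂ := fun x => Real.sqrt (v x) * (starRingEnd ℂ) (F x) with hf
  have hfm : Measurable f := by
    have := hFc.measurable
    have h2 : Measurable (fun x => (starRingEnd ℂ) (F x)) := Complex.continuous_conj.measurable.comp this
    fun_prop
  have hfb : ∀ x, ‖f x‖ ≤ Real.sqrt k * M := by
    intro x
    rw [hf]
    simp only [norm_mul, RCLike.norm_conj]
    gcongr
    · exact hv.sqrt_le x
    · exact ext_bdd x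
  have hfs : ∀ x, x ∉ closedBall (0 : EuclideanSpace ℝ (Fin n)) k → f x = 0 := by
    intro x hx
    rcases hv.2.2 x with h | h
    · simp [hf, h]
    · simp at hx; linarith [h.2.2]
  have hfi : Integrable f := by
    rw [← integrableOn_iff_integrable_of_support_subset (s := closedBall (0 : EuclideanSpace ℝ (Fin n)) k)]
    · refine Measure.integrableOn_of_bounded (M := Real.sqrt k * M) (measure_closedBall_lt_top).ne hfm.aestronglyMeasurable ?_
      filter_upwards with x using hfb x
    · intro x hx
      by_contra h
      exact hx (hfs x h)
  have hf2 : Integrable (fun x => ‖f x‖ ^ 2) := by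
    have := hfi.norm.mul_bdd (c := Real.sqrt k * M) (g := fun x => ‖f x‖) hfm.norm.aestronglyMeasurable (by
      filter_upwards with x; rw [norm_norm]; exact hfb x)
    simpa [sq] using this
  have hq := H v k N hv hN hM f hfm hfi hf2
  rw [← ext_TT hn hv hfi, Complex.norm_real, Real.norm_eq_abs] at hq
  set Hh : EuclideanSpace ℝ (Fin n) → ℂ := fun ω => ∫ x, Complex.exp (2 * Real.pi * (inner ℝ x ω : ℝ) * I) * (Real.sqrt (v x) * f x) with hHh
  have hgi := hv.int_mul hfi
  have hHc : Continuous Hh := by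
    refine continuous_of_dominated (bound := fun x => ‖Real.sqrt (v x) * f x‖) ?_ ?_ hgi.norm ?_
    · intro x
      exact (by fun_prop : Continuous _).aestronglyMeasurable.mul hgi.1
    · intro x
      filter_upwards with ω
      rw [norm_mul, norm_e, one_mul]
    · filter_upwards with ω
      fun_prop
  have hHb : ∀ ω, ‖Hh ω‖ ≤ ∫ x, ‖Real.sqrt (v x) * f x‖ := by
    intro ω
    refine (norm_integral_le_integral_norm _).trans (le_of_eq ?_)
    refine integral_congr_ae ?_
    filter_upwards with x
    rw [norm_mul, norm_e, one_mul]
  have hX : ∀ x, ‖f x‖ ^ 2 = v x * ‖F x‖ ^ 2 := by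
    intro x
    rw [hf]
    simp only [norm_mul, RCLike.norm_conj, mul_pow]
    rw [Complex.norm_real, Real.norm_eq_abs, sq_abs, Real.sq_sqrt (hv0 x)]
  set X := ∫ x, ‖f x‖ ^ 2 with hXd
  have hX0 : 0 ≤ X := integral_nonneg fun x => by positivity
  have hXe : ∫⁻ x, ENNReal.ofReal (v x) * ‖F x‖ₑ ^ 2 = ENNReal.ofReal X := by
    rw [hXd, ofReal_integral_eq_lintegral_ofReal hf2 (by filter_upwards with x; positivity)]
    refine lintegral_congr fun x => ?_
    rw [hX, ENNReal.ofReal_mul (hv0 x), ENNReal.ofReal_pow (norm_nonneg _), ofReal_norm_eq_enorm]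
  have hXb : (X : ℂ) = ∫ ω, b ω * Hh ω ∂(sph n) := by
    rw [hXd, ← integral_complex_ofReal]
    have e1 : ∀ x, ((‖f x‖ ^ 2 : ℝ) : ℂ) = ∫ ω, (Real.sqrt (v x) * f x) * (Complex.exp (2 * Real.pi * (inner ℝ x ω : ℝ) * I) * b ω) ∂(sph n) := by
      intro x
      rw [integral_const_mul]
      change _ = _ * F x
      rw [hX, hf]
      push_cast
      rw [← Complex.mul_conj']
      have : (v x : ℂ) = (Real.sqrt (v x) : ℂ) * Real.sqrt (v x) := by
        rw [← Complex.ofReal_mul, Real.mul_self_sqrt (hv0 x)]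
      rw [this]
      ring
    simp_rw [e1]
    rw [integral_integral_swap (f := fun x ω => (Real.sqrt (v x) * f x) * (Complex.exp (2 * Real.pi * (inner ℝ x ω : ℝ) * I) * b ω))]
    · refine integral_congr_ae ?_
      filter_upwards with ω
      rw [hHh]
      simp only []
      rw [← integral_const_mul]
      refine integral_congr_ae ?_
      filter_upwards with x
      ring
    · have h2 := hgi.mul_prod hb
      have h3 := h2.mul_bdd (c := 1) (g := fun u => Complex.exp (2 * Real.pi * (inner ℝ u.1 u.2 : ℝ) * I))
         (by exact (by fun_prop : Continuous _).aestronglyMeasurable) (by filter_upwards with u; rw [norm_e])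
      refine h3.congr ?_
      filter_upwards with u
      simp only [Function.uncurry]
      ring
  have hH2 : ∫⁻ ω, ‖Hh ω‖ₑ ^ 2 ∂(sph n) ≤ ENNReal.ofReal (C * N * X) := by
    have hHi : Integrable (fun ω => ‖Hh ω‖ ^ 2) (sph n) := by
      refine Integrable.of_bound (C := (∫ x, ‖Real.sqrt (v x) * f x‖) ^ 2) (by fun_prop : Continuous _).aestronglyMeasurable ?_
      filter_upwards with ω
      rw [norm_pow, norm_norm]
      gcongr
      exact hHb ω
    have : ∫⁻ ω, ‖Hh ω‖ₑ ^ 2 ∂(sph n) = ENNReal.ofReal (∫ ω, ‖Hh ω‖ ^ 2 ∂(sph n)) := by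
      rw [ofReal_integral_eq_lintegral_ofReal hHi (by filter_upwards with x; positivity)]
      refine lintegral_congr fun x => ?_
      rw [ENNReal.ofReal_pow (norm_nonneg _), ofReal_norm_eq_enorm]
    rw [this]
    exact ENNReal.ofReal_le_ofReal ((le_abs_self _).trans hq)
  have hcs := cs_enorm (μ := sph n) hb.1 hHc.aestronglyMeasurable
  rw [← hXb] at hcs
  rw [hXe]
  have hx2 : ‖(X:ℂ)‖ₑ = ENNReal.ofReal X := by
    rw [← ofReal_norm_eq_enorm, Complex.norm_real, Real.norm_eq_abs, abs_of_nonneg hX0]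
  rw [hx2] at hcs
  set Bb := ∫⁻ ω, ‖b ω‖ₑ ^ 2 ∂(sph n)
  rcases hX0.eq_or_lt with h0 | h0
  · rw [← h0]; simp
  have h4 : ENNReal.ofReal X * ENNReal.ofReal X ≤ (ENNReal.ofReal (C * N) * Bb) * ENNReal.ofReal X := by
    rw [← sq]
    refine hcs.trans ?_
    calc _ ≤ Bb * ENNReal.ofReal (C * N * X) := by gcongr
      _ = _ := by rw [ENNReal.ofReal_mul (by positivity)]; ring
  exact (ENNReal.mul_le_mul_iff_left (ENNReal.ofReal_pos.2 h0).ne' ENNReal.ofReal_ne_top).1 h4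

lemma extension (hn : 3 ≤ n) {p : ℝ} (hp : ((n:ℝ) - 1) / 2 < p) : ∃ C : ℝ, 0 < C ∧ ∀ (v : EuclideanSpace ℝ (Fin n) → ℝ) (N : ℝ),
    Measurable v → (∀ x, 0 ≤ v x) → 0 ≤ N → Mor p N v → ∀ b : EuclideanSpace ℝ (Fin n) → ℂ, Integrable b (sph n) →
    ∫⁻ x, ENNReal.ofReal (v x) * ‖extE n b x‖ₑ ^ 2 ≤ ENNReal.ofReal (C * N) * ∫⁻ ω, ‖b ω‖ₑ ^ 2 ∂(sph n) := by
  obtain ⟨C, hC, H⟩ := QF_bound hn hp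
  have hn' : (3:ℝ) ≤ n := by exact_mod_cast hn
  have hp0 : 0 < p := by linarith
  refine ⟨C, hC, fun v N hvm hv0 hN hM b hb => ?_⟩
  set T : ℕ → Set (EuclideanSpace ℝ (Fin n)) := fun k => {x | 1 / ((k:ℝ) + 1) ≤ v x ∧ v x ≤ (k:ℝ) + 1 ∧ ‖x‖ ≤ (k:ℝ) + 1} with hT
  have hTm : ∀ k, MeasurableSet (T k) := by
    intro k
    exact (measurableSet_le measurable_const hvm).inter ((measurableSet_le hvm measurable_const).inter (measurableSet_le measurable_norm measurable_const))
  set w : ℕ → EuclideanSpace ℝ (Fin n) → ℝ := fun k => (T k).indicator v with hw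
  have hwT : ∀ k : ℕ, TrV ((k:ℝ) + 1) (w k) := by
    intro k
    refine ⟨hvm.indicator (hTm k), by linarith [(Nat.cast_nonneg k : (0:ℝ) ≤ k)], fun x => ?_⟩
    by_cases hx : x ∈ T k
    · right
      simp only [hw, Set.indicator_of_mem hx]
      exact hx
    · left
      simp only [hw, Set.indicator_of_notMem hx]
  have hwM : ∀ k, Mor p N (w k) := by
    intro k x r hr
    refine (lintegral_mono fun y => ?_).trans (hM x r hr)
    apply ENNReal.ofReal_le_ofReal
    refine Real.rpow_le_rpow (Set.indicator_nonneg (fun y _ => hv0 y) _) (Set.indicator_le_self' (fun y _ => hv0 y) _) hp0.le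
  have hFc := (ext_cont hb).measurable
  refine fatou_le (f := fun k x => ENNReal.ofReal (w k x) * ‖extE n b x‖ₑ ^ 2) ?_ ?_ (fun k => ext_TrV hn hC.le H (hwT k) hN (hwM k) hb)
  · intro k
    have := (hwT k).1
    exact (by fun_prop : Measurable _).aemeasurable
  · filter_upwards with x
    refine tendsto_const_nhds.congr' ?_
    rcases (hv0 x).eq_or_lt with h | h
    · filter_upwards with k
      have : w k x = v x := by
        by_cases hx : x ∈ T k
        · simp only [hw, Set.indicator_of_mem hx]
        · simp only [hw, Set.indicator_of_notMem hx, ← h]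
      rw [this]
    · obtain ⟨k0, hk0⟩ := exists_nat_ge (max (max (1 / v x) (v x)) ‖x‖)
      filter_upwards [eventually_ge_atTop k0] with k hk
      have hk' : (k0:ℝ) ≤ k := by exact_mod_cast hk
      have g1 : 1 / v x ≤ (k:ℝ) + 1 := by linarith [((le_max_left _ _).trans (le_max_left _ _)).trans hk0]
      have g2 : v x ≤ (k:ℝ) + 1 := by linarith [((le_max_right _ _).trans (le_max_left _ _)).trans hk0]
      have g3 : ‖x‖ ≤ (k:ℝ) + 1 := by linarith [(le_max_right _ _).trans hk0]
      have hx : x ∈ T k := ⟨(one_div_le (by positivity) h).2 g1, g2, g3⟩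
      simp only [hw, Set.indicator_of_mem hx]

end ext5

section ext6

open Filter Topology

variable {n : ℕ}

lemma lint_smul {V : Type*} [NormedAddCommGroup V] [NormedSpace ℝ V] [FiniteDimensional ℝ V] [MeasurableSpace V] [BorelSpace V]
    (μ : Measure V) [μ.IsAddHaarMeasure] {f : V → ℝ≥0∞} (hf : Measurable f) {c : ℝ} (hc : c ≠ 0) :
    ∫⁻ x, f (c • x) ∂μ = ENNReal.ofReal (|c| ^ Module.finrank ℝ V)⁻¹ * ∫⁻ x, f x ∂μ := by
  rw [← lintegral_map (g := fun x : V => c • x) hf (by fun_prop), Measure.map_addHaar_smul μ hc, lintegral_smul_measure]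
  rw [smul_eq_mul, abs_inv, abs_pow]

lemma Mor.scale {p N : ℝ} (hp : 0 < p) {v : EuclideanSpace ℝ (Fin n) → ℝ} (hvm : Measurable v) (hN : 0 ≤ N) (hM : Mor p N v) {ρ : ℝ} (hρ : 0 < ρ) :
    Mor p (ρ ^ 2 * N) (fun x => v (ρ⁻¹ • x)) := by
  intro x r hr
  have h := hM (ρ⁻¹ • x) (r / ρ) (by positivity)
  rw [← lintegral_indicator measurableSet_ball] at h ⊢
  have e := lint_smul volume (f := (ball (ρ⁻¹ • x) (r / ρ)).indicator fun y => ENNReal.ofReal (v y ^ p))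
    ((by fun_prop : Measurable _).indicator measurableSet_ball) (c := ρ⁻¹) (by positivity)
  have e2 : ∀ y, (ball x r).indicator (fun y => ENNReal.ofReal (v (ρ⁻¹ • y) ^ p)) y =
      (ball (ρ⁻¹ • x) (r / ρ)).indicator (fun y => ENNReal.ofReal (v y ^ p)) (ρ⁻¹ • y) := by
    intro y
    have : ρ⁻¹ • y ∈ ball (ρ⁻¹ • x) (r / ρ) ↔ y ∈ ball x r := by
      rw [mem_ball, mem_ball, dist_smul₀, norm_inv, Real.norm_eq_abs, abs_of_pos hρ, inv_mul_eq_div, div_lt_div_iff_of_pos_right hρ]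
    by_cases hy : y ∈ ball x r
    · rw [Set.indicator_of_mem hy, Set.indicator_of_mem (this.2 hy)]
    · rw [Set.indicator_of_notMem hy, Set.indicator_of_notMem (fun h => hy (this.1 h))]
  simp_rw [e2]
  rw [e]
  refine (mul_le_mul_right h _).trans ?_
  rw [← ENNReal.ofReal_mul (by positivity)]
  apply ENNReal.ofReal_le_ofReal
  apply le_of_eq
  rw [finrank_euclideanSpace_fin, abs_of_pos (by positivity), inv_pow, inv_inv, Real.div_rpow hr.le hρ.le, Real.mul_rpow (by positivity) hN,
    Real.rpow_sub hρ, Real.rpow_natCast, ← Real.rpow_natCast, ← Real.rpow_natCast, ← Real.rpow_mul hρ.le]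
  push_cast
  field_simp

lemma fourier_t {h : ℝ → ℂ} (hh : Integrable h) {e : ℝ} (he : |e| = 1) :
    ∫⁻ t : ℝ, ‖∫ ρ, Complex.exp ((e * t * ρ : ℝ) * I) * h ρ‖ₑ ^ 2 ≤ ENNReal.ofReal (2 * Real.pi) * ∫⁻ ρ, ‖h ρ‖ₑ ^ 2 := by
  have he0 : e ≠ 0 := by intro h; rw [h] at he; simp at he
  have hpi := Real.pi_pos
  have h1 : ∀ t : ℝ, ∫ ρ, Complex.exp ((e * t * ρ : ℝ) * I) * h ρ = 𝓕 h ((-e / (2 * Real.pi)) • t) := by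
    intro t
    rw [Real.fourier_real_eq_integral_exp_smul]
    refine integral_congr_ae ?_
    filter_upwards with ρ
    rw [smul_eq_mul]
    congr 3
    rw [smul_eq_mul]
    push_cast
    field_simp
  simp_rw [h1]
  rw [lint_smul volume (f := fun t => ‖𝓕 h t‖ₑ ^ 2) ?_ (by simp [he0, hpi.ne'])]
  · have : ENNReal.ofReal (|(-e / (2 * Real.pi))| ^ Module.finrank ℝ ℝ)⁻¹ = ENNReal.ofReal (2 * Real.pi) := by
      congr 1
      rw [Module.finrank_self, pow_one, abs_div, abs_neg, he, one_div, inv_inv, abs_of_pos (by positivity)]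
    rw [this]
    exact mul_le_mul_right (plancherel_le hh) _
  · have := (continuous_fourier_of_integrable hh).measurable
    fun_prop

lemma ext_meas {a : EuclideanSpace ℝ (Fin n) → ℂ} (ham : Measurable a) :
    Measurable (fun z : ℝ × EuclideanSpace ℝ (Fin n) => extE n (fun ω => a (z.1 • ω)) (z.1 • z.2)) := by
  unfold extE
  refine StronglyMeasurable.measurable ?_
  refine StronglyMeasurable.integral_prod_right' (ν := sph n) (f := fun w : (ℝ × EuclideanSpace ℝ (Fin n)) × EuclideanSpace ℝ (Fin n) =>
      Complex.exp (2 * Real.pi * (inner ℝ (w.1.1 • w.1.2) w.2 : ℝ) * I) * a (w.1.1 • w.2)) ?_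
  refine Measurable.stronglyMeasurable ?_
  exact (by fun_prop : Continuous _).measurable.mul (ham.comp (by fun_prop))

set_option maxHeartbeats 1000000 in
lemma smooth_est (hn : 3 ≤ n) {p : ℝ} (hp : ((n:ℝ) - 1) / 2 < p) : ∃ C : ℝ, 0 < C ∧ ∀ (v : EuclideanSpace ℝ (Fin n) → ℝ) (N : ℝ),
    Measurable v → (∀ x, 0 ≤ v x) → 0 ≤ N → Mor p N v → ∀ a : EuclideanSpace ℝ (Fin n) → ℂ, Measurable a → Integrable a → ∀ e : ℝ, |e| = 1 →
    ∫⁻ t : ℝ, ∫⁻ x, ‖∫ ξ, Complex.exp (2 * Real.pi * (inner ℝ x ξ : ℝ) * I) * (Complex.exp ((e * t * ‖ξ‖ : ℝ) * I) * a ξ)‖ₑ ^ 2 * ENNReal.ofReal (v x) ≤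
      ENNReal.ofReal (C * N) * ∫⁻ ξ, ENNReal.ofReal ‖ξ‖ * ‖a ξ‖ₑ ^ 2 := by
  obtain ⟨C, hC, H⟩ := extension hn hp
  have hn' : (3:ℝ) ≤ n := by exact_mod_cast hn
  have hn0 : 0 < n := by omega
  have hp0 : 0 < p := by linarith
  have hpi := Real.pi_pos
  refine ⟨2 * Real.pi * C, by positivity, fun v N hvm hv0 hN hM a ham hai e he => ?_⟩
  set U : EuclideanSpace ℝ (Fin n) → ℝ → ℂ := fun x t => ∫ ξ, Complex.exp (2 * Real.pi * (inner ℝ x ξ : ℝ) * I) * (Complex.exp ((e * t * ‖ξ‖ : ℝ) * I) * a ξ) with hU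
  have hUc : Continuous (fun z : ℝ × EuclideanSpace ℝ (Fin n) => U z.2 z.1) := by
    rw [hU]
    refine continuous_of_dominated (bound := fun ω => ‖a ω‖) ?_ ?_ hai.norm ?_
    · intro x
      exact (by fun_prop : Continuous _).aestronglyMeasurable.mul ((by fun_prop : Continuous _).aestronglyMeasurable.mul hai.1)
    · intro x
      filter_upwards with ω
      rw [norm_mul, norm_e, one_mul, norm_mul, Complex.norm_exp_ofReal_mul_I, one_mul]
    · filter_upwards with ω
      fun_prop
  -- polar
  set hx : EuclideanSpace ℝ (Fin n) → ℝ → ℂ := fun x ρ => ((ρ ^ (n-1) : ℝ) : ℂ) * extE n (fun ω => a (ρ • ω)) (ρ • x) with hhx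
  have hmE := ext_meas ham
  have hmh : Measurable (fun z : ℝ × EuclideanSpace ℝ (Fin n) => hx z.2 z.1) := by
    rw [hhx]
    fun_prop
  have hai' := integrable_polar hn0 hai
  have hae : ∀ᵐ ρ ∂(volume.restrict (Set.Ioi (0:ℝ))), Integrable (fun ω => a (ρ • ω)) (sph n) := by
    have h1 := hai'.prod_right_ae
    unfold radM at h1
    rw [ae_withDensity_iff (by fun_prop)] at h1
    filter_upwards [h1, ae_restrict_mem measurableSet_Ioi] with ρ hρ hρ0
    have : (0:ℝ) < ρ := hρ0
    exact hρ (by rw [ne_eq, ENNReal.ofReal_eq_zero, not_le]; positivity)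
  have hh_int : ∀ x, IntegrableOn (hx x) (Set.Ioi 0) := by
    intro x
    have h1 : Integrable (fun ξ => Complex.exp (2 * Real.pi * (inner ℝ x ξ : ℝ) * I) * a ξ) :=
      hai.bdd_mul (c := 1) (by exact (by fun_prop : Continuous _).aestronglyMeasurable) (by filter_upwards with ξ; rw [norm_e])
    have h2 := (integrable_polar hn0 h1).integral_prod_left
    unfold radM at h2
    rw [integrable_withDensity_iff_integrable_smul' (by fun_prop) (by filter_upwards with ρ; exact ENNReal.ofReal_lt_top)] at h2
    refine h2.congr ?_
    filter_upwards [ae_restrict_mem measurableSet_Ioi] with ρ hρ0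
    have : (0:ℝ) < ρ := hρ0
    rw [hhx, ENNReal.toReal_ofReal (by positivity), Complex.real_smul]
    simp only [extE, inner_smul_left, inner_smul_right]
    rfl
  have hUh : ∀ x t, U x t = ∫ ρ, Complex.exp ((e * t * ρ : ℝ) * I) * (Set.Ioi (0:ℝ)).indicator (hx x) ρ := by
    intro x t
    have h1 : Integrable (fun ξ => Complex.exp (2 * Real.pi * (inner ℝ x ξ : ℝ) * I) * (Complex.exp ((e * t * ‖ξ‖ : ℝ) * I) * a ξ)) :=
      (hai.bdd_mul (c := 1) (f := fun ξ => Complex.exp ((e * t * ‖ξ‖ : ℝ) * I)) (by exact (by fun_prop : Continuous _).aestronglyMeasurable)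
        (by filter_upwards with ξ; rw [Complex.norm_exp_ofReal_mul_I])).bdd_mul (c := 1)
        (by exact (by fun_prop : Continuous _).aestronglyMeasurable) (by filter_upwards with ξ; rw [norm_e])
    rw [hU]
    simp only []
    rw [integral_polar hn0 h1]
    have : ∀ ρ : ℝ, Complex.exp ((e * t * ρ : ℝ) * I) * (Set.Ioi (0:ℝ)).indicator (hx x) ρ =
       (Set.Ioi (0:ℝ)).indicator (fun ρ => Complex.exp ((e * t * ρ : ℝ) * I) * hx x ρ) ρ := by
      intro ρ
      by_cases h : ρ ∈ Set.Ioi (0:ℝ) <;> simp [h]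
    simp_rw [this]
    rw [integral_indicator measurableSet_Ioi]
    refine setIntegral_congr_fun measurableSet_Ioi fun ρ hρ => ?_
    have hρ' : (0:ℝ) < ρ := hρ
    simp only [hhx, extE]
    rw [← integral_const_mul, ← integral_const_mul, ← integral_const_mul]
    refine integral_congr_ae ?_
    filter_upwards [ae_sph_norm n] with ω hω
    rw [norm_smul, hω, Real.norm_eq_abs, abs_of_pos hρ', mul_one, inner_smul_left, inner_smul_right]
    simp only [conj_trivial]
    ring
  change ∫⁻ t : ℝ, ∫⁻ x, ‖U x t‖ₑ ^ 2 * ENNReal.ofReal (v x) ≤ _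
  clear_value U hx
  have hme : Measurable (fun z : ℝ × EuclideanSpace ℝ (Fin n) => ‖U z.2 z.1‖ₑ ^ 2 * ENNReal.ofReal (v z.2)) := by
    exact (hUc.measurable.enorm.pow_const 2).mul (by fun_prop)
  calc ∫⁻ t : ℝ, ∫⁻ x, ‖U x t‖ₑ ^ 2 * ENNReal.ofReal (v x) 
      = ∫⁻ x, ENNReal.ofReal (v x) * ∫⁻ t : ℝ, ‖U x t‖ₑ ^ 2 := by
        rw [lintegral_lintegral_swap hme.aemeasurable]
        refine lintegral_congr fun x => ?_
        have : Measurable (fun t => ‖U x t‖ₑ ^ 2) := by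
          have : Continuous (fun t => U x t) := hUc.comp (by fun_prop : Continuous fun t : ℝ => (t, x))
          exact this.measurable.enorm.pow_const 2
        rw [lintegral_mul_const _ this, mul_comm]
    _ ≤ ∫⁻ x, ENNReal.ofReal (v x) * (ENNReal.ofReal (2 * Real.pi) * ∫⁻ ρ in Set.Ioi 0, ‖hx x ρ‖ₑ ^ 2) := by
        refine lintegral_mono fun x => ?_
        dsimp only
        gcongr
        simp_rw [hUh]
        refine (fourier_t ((integrable_indicator_iff measurableSet_Ioi).2 (hh_int x)) he).trans (le_of_eq ?_)
        congr 1
        rw [← lintegral_indicator measurableSet_Ioi]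
        refine lintegral_congr fun ρ => ?_
        by_cases h : ρ ∈ Set.Ioi (0:ℝ) <;> simp [h]
    _ = ∫⁻ ρ in Set.Ioi 0, ENNReal.ofReal (2 * Real.pi) * ∫⁻ x, ENNReal.ofReal (v x) * ‖hx x ρ‖ₑ ^ 2 := by
        have e1 : ∀ x, ENNReal.ofReal (v x) * (ENNReal.ofReal (2 * Real.pi) * ∫⁻ ρ in Set.Ioi 0, ‖hx x ρ‖ₑ ^ 2) =
            ∫⁻ ρ in Set.Ioi 0, ENNReal.ofReal (2 * Real.pi) * (ENNReal.ofReal (v x) * ‖hx x ρ‖ₑ ^ 2) := by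
          intro x
          have : Measurable (fun t => ‖hx x t‖ₑ ^ 2) := by
            have : Measurable (fun t => hx x t) := hmh.comp (by fun_prop : Measurable fun t : ℝ => (t, x))
            fun_prop
          rw [lintegral_const_mul _ (by fun_prop), lintegral_const_mul _ this]
          ring
        simp_rw [e1]
        rw [lintegral_lintegral_swap]
        · refine lintegral_congr fun ρ => ?_
          have : Measurable (fun x => hx x ρ) := hmh.comp (by fun_prop : Measurable fun x : EuclideanSpace ℝ (Fin n) => (ρ, x))
          rw [lintegral_const_mul _ (by fun_prop)]
        · refine Measurable.aemeasurable ?_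
          have : Measurable (fun z : EuclideanSpace ℝ (Fin n) × ℝ => hx z.1 z.2) := hmh.comp measurable_swap
          simp only [Function.uncurry_def]
          fun_prop
    _ ≤ ∫⁻ ρ in Set.Ioi 0, ENNReal.ofReal (2 * Real.pi * C * N) * (ENNReal.ofReal (ρ ^ (n-1)) * ∫⁻ ω, ENNReal.ofReal ‖ρ • ω‖ * ‖a (ρ • ω)‖ₑ ^ 2 ∂(sph n)) := by
        refine lintegral_mono_ae ?_
        filter_upwards [hae, ae_restrict_mem measurableSet_Ioi] with ρ hρi hρ0
        have hρ : (0:ℝ) < ρ := hρ0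
        have hM' := hM.scale hp0 hvm hN hρ
        have h1 := H _ (ρ ^ 2 * N) (by fun_prop) (fun x => hv0 _) (by positivity) hM' _ hρi
        have h2 : ∫⁻ x, ENNReal.ofReal (v x) * ‖hx x ρ‖ₑ ^ 2 = ENNReal.ofReal ((ρ ^ (n-1)) ^ 2 * (ρ ^ n)⁻¹) * 
            ∫⁻ x, ENNReal.ofReal (v (ρ⁻¹ • x)) * ‖extE n (fun ω => a (ρ • ω)) x‖ₑ ^ 2 := by
          have hmE' := (ext_cont hρi).measurable
          have h3 := lint_smul volume (f := fun x => ENNReal.ofReal (v (ρ⁻¹ • x)) * ‖extE n (fun ω => a (ρ • ω)) x‖ₑ ^ 2) (by fun_prop) hρ.ne'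
          rw [finrank_euclideanSpace_fin, abs_of_pos hρ] at h3
          rw [ENNReal.ofReal_mul (by positivity), mul_assoc, ← h3, ← lintegral_const_mul _ (by fun_prop)]
          refine lintegral_congr fun x => ?_
          rw [smul_smul, inv_mul_cancel₀ hρ.ne', one_smul]
          simp only [hhx, enorm_mul, mul_pow]
          have : ‖((ρ ^ (n-1) : ℝ) : ℂ)‖ₑ ^ 2 = ENNReal.ofReal ((ρ ^ (n-1)) ^ 2) := by
            rw [← ofReal_norm_eq_enorm, Complex.norm_real, Real.norm_eq_abs, abs_of_pos (by positivity), ← ENNReal.ofReal_pow (by positivity)]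
          rw [this]
          ring
        have h4 : ∫⁻ ω, ENNReal.ofReal ‖ρ • ω‖ * ‖a (ρ • ω)‖ₑ ^ 2 ∂(sph n) = ENNReal.ofReal ρ * ∫⁻ ω, ‖a (ρ • ω)‖ₑ ^ 2 ∂(sph n) := by
          rw [← lintegral_const_mul _ (by fun_prop)]
          refine lintegral_congr_ae ?_
          filter_upwards [ae_sph_norm n] with ω hω
          rw [norm_smul, hω, Real.norm_eq_abs, abs_of_pos hρ, mul_one]
        rw [h2, h4]
        set B := ∫⁻ ω, ‖a (ρ • ω)‖ₑ ^ 2 ∂(sph n)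
        calc _ ≤ ENNReal.ofReal (2 * Real.pi) * (ENNReal.ofReal ((ρ ^ (n-1)) ^ 2 * (ρ ^ n)⁻¹) * (ENNReal.ofReal (C * (ρ ^ 2 * N)) * B)) := by gcongr
          _ = _ := by
            simp only [← mul_assoc]
            rw [← ENNReal.ofReal_mul (by positivity), ← ENNReal.ofReal_mul (by positivity), ← ENNReal.ofReal_mul (by positivity),
              ← ENNReal.ofReal_mul (by positivity)]
            congr 2
            obtain ⟨m, rfl⟩ : ∃ m, n = m + 1 := ⟨n - 1, by omega⟩
            simp only [Nat.add_sub_cancel]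
            field_simp
            ring
    _ = _ := by
        have hmm : Measurable (fun ρ : ℝ => ∫⁻ ω, ENNReal.ofReal ‖ρ • ω‖ * ‖a (ρ • ω)‖ₑ ^ 2 ∂(sph n)) := by
          refine Measurable.lintegral_prod_right' (ν := sph n) (f := fun z : ℝ × EuclideanSpace ℝ (Fin n) => ENNReal.ofReal ‖z.1 • z.2‖ * ‖a (z.1 • z.2)‖ₑ ^ 2) ?_
          fun_prop
        rw [lintegral_const_mul _ (by fun_prop), lintegral_polar hn0 _ (by fun_prop), lintegral_radM _ _ hmm]

end ext6

section ret

open Filter Topology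

variable {n : ℕ}

lemma NiceG.hat {G : EuclideanSpace ℝ (Fin n) → ℝ → ℂ} (hG : NiceG G) : ∃ R K : ℝ, 0 ≤ K ∧
    ∀ ξ s, ‖𝓕 (fun x => G x s) ξ‖ ≤ (Set.Icc (-R) R).indicator (fun _ => K) s := by
  obtain ⟨b, hb, hGb⟩ := hG.bdd
  obtain ⟨R, hR⟩ := hG.2
  refine ⟨R, ∫ x, b x, integral_nonneg fun x => (norm_nonneg _).trans (hGb x 0), ?_⟩
  intro ξ s
  by_cases hs : s ∈ Set.Icc (-R) R
  · rw [Set.indicator_of_mem hs]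
    exact (norm_fourier_le ξ).trans (integral_mono_of_nonneg (ae_of_all _ fun _ => norm_nonneg _) hb (ae_of_all _ fun x => hGb x s))
  · rw [Set.indicator_of_notMem hs]
    have : (fun x => G x s) = fun _ => 0 := by
      ext x
      refine hR x s (Or.inr ?_)
      by_contra h3
      push Not at h3
      exact hs (abs_le.1 h3)
    rw [this, Real.fourier_eq']
    simp

/-- half wave pieces -/
def Phi (G : EuclideanSpace ℝ (Fin n) → ℝ → ℂ) (m : EuclideanSpace ℝ (Fin n) → ℂ) (e : ℝ) (y : ℝ × EuclideanSpace ℝ (Fin n)) (s : ℝ) : ℂ :=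
  ∫ ξ, Complex.exp (2 * Real.pi * (inner ℝ y.2 ξ : ℝ) * I) * (Complex.exp ((e * y.1 * ‖ξ‖ : ℝ) * I) *
    (m ξ * (Complex.exp ((-e * s * ‖ξ‖ : ℝ) * I) * 𝓕 (fun x => G x s) ξ)))

lemma Phi_meas_aux {G : EuclideanSpace ℝ (Fin n) → ℝ → ℂ} (hG : NiceG G) {m : EuclideanSpace ℝ (Fin n) → ℂ} (hm : Measurable m) (e : ℝ)
    {X : Type} [MeasurableSpace X] {a c : X → ℝ} {b d : X → EuclideanSpace ℝ (Fin n)} (ha : Measurable a) (hb : Measurable b)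
    (hc : Measurable c) (hd : Measurable d) : StronglyMeasurable (fun w : X =>
    Complex.exp (2 * Real.pi * (inner ℝ (b w) (d w) : ℝ) * I) * (Complex.exp ((e * a w * ‖d w‖ : ℝ) * I) *
    (m (d w) * (Complex.exp ((-e * c w * ‖d w‖ : ℝ) * I) * 𝓕 (fun x => G x (c w)) (d w))))) := by
  refine Measurable.stronglyMeasurable ?_
  have h1 := (meas_fourier hG.1).measurable
  have h2 : Measurable (fun w => 𝓕 (fun x => G x (c w)) (d w)) := by
    generalize hF : (fun z : EuclideanSpace ℝ (Fin n) × ℝ => 𝓕 (fun x => G x z.2) z.1) = F at h1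
    have hF' : (fun w => 𝓕 (fun x => G x (c w)) (d w)) = fun w => F (d w, c w) := by
      rw [← hF]
    rw [hF']
    exact h1.comp (hd.prodMk hc)
  have h3 : Measurable (fun w => Complex.exp (2 * Real.pi * (inner ℝ (b w) (d w) : ℝ) * I)) := by
    have h := hb.inner (𝕜 := ℝ) hd
    fun_prop
  have h4 : Measurable (fun w => Complex.exp ((e * a w * ‖d w‖ : ℝ) * I)) := by fun_prop
  have h5 : Measurable (fun w => Complex.exp ((-e * c w * ‖d w‖ : ℝ) * I)) := by fun_prop
  have h6 : Measurable (fun w => m (d w)) := hm.comp hd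
  exact h3.mul (h4.mul (h6.mul (h5.mul h2)))

lemma Phi_meas {G : EuclideanSpace ℝ (Fin n) → ℝ → ℂ} (hG : NiceG G) {m : EuclideanSpace ℝ (Fin n) → ℂ} (hm : Measurable m) (e : ℝ) :
    StronglyMeasurable (fun z : (ℝ × EuclideanSpace ℝ (Fin n)) × ℝ => Phi G m e z.1 z.2) :=
  StronglyMeasurable.integral_prod_right' (ν := volume)
    (Phi_meas_aux hG hm e (X := ((ℝ × EuclideanSpace ℝ (Fin n)) × ℝ) × EuclideanSpace ℝ (Fin n)) (a := fun w => w.1.1.1)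
      (b := fun w => w.1.1.2) (c := fun w => w.1.2) (d := fun w => w.2) (by fun_prop) (by fun_prop) (by fun_prop) (by fun_prop))

lemma Phi_bd {G : EuclideanSpace ℝ (Fin n) → ℝ → ℂ} {m : EuclideanSpace ℝ (Fin n) → ℂ} (hmi : Integrable m) (e : ℝ) 
    {R K : ℝ} (hK : 0 ≤ K) (hb : ∀ ξ s, ‖𝓕 (fun x => G x s) ξ‖ ≤ (Set.Icc (-R) R).indicator (fun _ => K) s) (y) (s) :
    ‖Phi G m e y s‖ ≤ (Set.Icc (-R) R).indicator (fun _ => K * ∫ ξ, ‖m ξ‖) s := by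
  have : (Set.Icc (-R) R).indicator (fun _ => K * ∫ ξ, ‖m ξ‖) s = ∫ ξ, ‖m ξ‖ * (Set.Icc (-R) R).indicator (fun _ => K) s := by
    rw [integral_mul_const]
    by_cases hs : s ∈ Set.Icc (-R) R
    · rw [Set.indicator_of_mem hs, Set.indicator_of_mem hs, mul_comm]
    · rw [Set.indicator_of_notMem hs, Set.indicator_of_notMem hs, mul_zero]
  rw [this]
  unfold Phi
  refine (norm_integral_le_integral_norm _).trans (integral_mono_of_nonneg (ae_of_all _ fun _ => norm_nonneg _) (hmi.norm.mul_const _) ?_)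
  filter_upwards with ξ
  simp only [norm_mul, norm_e, Complex.norm_exp_ofReal_mul_I, one_mul]
  gcongr
  exact hb ξ s

lemma ind_int (R K : ℝ) : Integrable ((Set.Icc (-R) R).indicator (fun _ => K)) :=
  ((integrableOn_const (hs := isCompact_Icc.measure_lt_top.ne)).integrable_indicator measurableSet_Icc)

lemma Phi_integrable {G : EuclideanSpace ℝ (Fin n) → ℝ → ℂ} (hG : NiceG G) {m : EuclideanSpace ℝ (Fin n) → ℂ} (hm : Measurable m)
    (hmi : Integrable m) (e : ℝ) (y) : Integrable (Phi G m e y) := by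
  obtain ⟨R, K, hK, hb⟩ := hG.hat
  refine (ind_int R (K * ∫ ξ, ‖m ξ‖)).mono' ?_ ?_
  · exact ((Phi_meas hG hm e).comp_measurable (by fun_prop : Measurable fun s : ℝ => (y, s))).aestronglyMeasurable
  · filter_upwards with s using Phi_bd hmi e hK hb y s

lemma AS_meas {G : EuclideanSpace ℝ (Fin n) → ℝ → ℂ} (hG : NiceG G) (e : ℝ) (S : Set ℝ) : Measurable (AS G e S) := by
  unfold AS
  refine StronglyMeasurable.measurable ?_
  refine StronglyMeasurable.integral_prod_right' (ν := volume.restrict S) (f := fun z : EuclideanSpace ℝ (Fin n) × ℝ => 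
    Complex.exp ((e * z.2 * ‖z.1‖ : ℝ) * I) * 𝓕 (fun x => G x z.2) z.1) ?_
  exact StronglyMeasurable.mul (Continuous.stronglyMeasurable (by fun_prop)) (meas_fourier hG.1)

lemma AS_bd {G : EuclideanSpace ℝ (Fin n) → ℝ → ℂ} (hG : NiceG G) (e : ℝ) (S : Set ℝ) : ∃ B, ∀ ξ, ‖AS G e S ξ‖ ≤ B := by
  obtain ⟨R, K, hK, hb⟩ := hG.hat
  refine ⟨∫ s in S, (Set.Icc (-R) R).indicator (fun _ => K) s, fun ξ => ?_⟩
  unfold AS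
  refine (norm_integral_le_integral_norm _).trans (integral_mono_of_nonneg (ae_of_all _ fun _ => norm_nonneg _) (ind_int R K).restrict ?_)
  filter_upwards with s
  simp only [norm_mul, Complex.norm_exp_ofReal_mul_I, one_mul]
  exact hb ξ s

lemma Phi_swap {G : EuclideanSpace ℝ (Fin n) → ℝ → ℂ} (hG : NiceG G) {m : EuclideanSpace ℝ (Fin n) → ℂ} (hm : Measurable m)
    (hmi : Integrable m) (e : ℝ) (y) (S : Set ℝ) : ∫ s in S, Phi G m e y s = ∫ ξ, Complex.exp (2 * Real.pi * (inner ℝ y.2 ξ : ℝ) * I) *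
    (Complex.exp ((e * y.1 * ‖ξ‖ : ℝ) * I) * (m ξ * AS G (-e) S ξ)) := by
  obtain ⟨R, K, hK, hb⟩ := hG.hat
  unfold Phi
  rw [integral_integral_swap (f := fun s ξ => Complex.exp (2 * Real.pi * (inner ℝ y.2 ξ : ℝ) * I) * (Complex.exp ((e * y.1 * ‖ξ‖ : ℝ) * I) *
    (m ξ * (Complex.exp ((-e * s * ‖ξ‖ : ℝ) * I) * 𝓕 (fun x => G x s) ξ))))]
  · refine integral_congr_ae ?_
    filter_upwards with ξ
    rw [integral_const_mul, integral_const_mul, integral_const_mul]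
    rfl
  · have h1 : Integrable (fun z : ℝ × EuclideanSpace ℝ (Fin n) => (Set.Icc (-R) R).indicator (fun _ => K) z.1 * ‖m z.2‖)
      ((volume.restrict S).prod volume) := ((ind_int R K).restrict).mul_prod hmi.norm
    refine h1.mono' ?_ ?_
    · exact (Phi_meas_aux hG hm e (X := ℝ × EuclideanSpace ℝ (Fin n)) (a := fun w => y.1)
        (b := fun w => y.2) (c := fun w => w.1) (d := fun w => w.2) (by fun_prop) (by fun_prop) (by fun_prop) (by fun_prop)).aestronglyMeasurable
    · filter_upwards with z
      simp only [Function.uncurry, norm_mul, norm_e, Complex.norm_exp_ofReal_mul_I, one_mul]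
      rw [mul_comm]
      gcongr
      exact hb z.2 z.1

/-- the full sine propagator piece -/
def Psi (G : EuclideanSpace ℝ (Fin n) → ℝ → ℂ) (m : EuclideanSpace ℝ (Fin n) → ℂ) (x : EuclideanSpace ℝ (Fin n)) (t s : ℝ) : ℂ :=
  ∫ ξ, Complex.exp (2 * Real.pi * (inner ℝ x ξ : ℝ) * I) * (m ξ * (Real.sin ((t - s) * ‖ξ‖) : ℂ) * 𝓕 (fun x => G x s) ξ)

lemma Psi_eq {G : EuclideanSpace ℝ (Fin n) → ℝ → ℂ} (hG : NiceG G) {m : EuclideanSpace ℝ (Fin n) → ℂ}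
    (hmi : Integrable m) (x) (t s) : Psi G m x t s = (2 * I)⁻¹ * (Phi G m 1 (t, x) s - Phi G m (-1) (t, x) s) := by
  have hFi : ∀ e : ℝ, Integrable (fun ξ => Complex.exp (2 * Real.pi * (inner ℝ x ξ : ℝ) * I) * (Complex.exp ((e * t * ‖ξ‖ : ℝ) * I) *
    (m ξ * (Complex.exp ((-e * s * ‖ξ‖ : ℝ) * I) * 𝓕 (fun x => G x s) ξ)))) := by
    intro e
    obtain ⟨R, K, hK, hb⟩ := hG.hat
    have hFc := continuous_fourier_of_integrable (hG.integrable s)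
    have h1 : Integrable (fun ξ => m ξ * (Complex.exp ((-e * s * ‖ξ‖ : ℝ) * I) * 𝓕 (fun x => G x s) ξ)) := by
      refine hmi.mul_bdd (c := (Set.Icc (-R) R).indicator (fun _ => K) s) (by exact (by fun_prop : Continuous _).aestronglyMeasurable) ?_
      filter_upwards with ξ
      rw [norm_mul, Complex.norm_exp_ofReal_mul_I, one_mul]
      exact hb ξ s
    exact (h1.bdd_mul (c := 1) (by exact (by fun_prop : Continuous _).aestronglyMeasurable)
      (by filter_upwards with ξ; rw [Complex.norm_exp_ofReal_mul_I])).bdd_mul (c := 1)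
      (by exact (by fun_prop : Continuous _).aestronglyMeasurable) (by filter_upwards with ξ; rw [norm_e])
  unfold Psi Phi
  dsimp only
  rw [← integral_sub (hFi 1) (hFi (-1)), ← integral_const_mul]
  refine integral_congr_ae ?_
  filter_upwards with ξ
  rw [Complex.ofReal_sin]
  unfold Complex.sin
  have e1 : Complex.exp (↑((t - s) * ‖ξ‖) * I) = Complex.exp ((1 * t * ‖ξ‖ : ℝ) * I) * Complex.exp ((-1 * s * ‖ξ‖ : ℝ) * I) := by
    rw [← Complex.exp_add]; congr 1; push_cast; ring
  have e2 : Complex.exp (-↑((t - s) * ‖ξ‖) * I) = Complex.exp ((-1 * t * ‖ξ‖ : ℝ) * I) * Complex.exp ((- -1 * s * ‖ξ‖ : ℝ) * I) := by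
    rw [← Complex.exp_add]; congr 1; push_cast; ring
  rw [e1, e2, mul_inv, Complex.inv_I]
  ring

lemma Psi_meas {G : EuclideanSpace ℝ (Fin n) → ℝ → ℂ} (hG : NiceG G) {m : EuclideanSpace ℝ (Fin n) → ℂ} (hm : Measurable m)
    (hmi : Integrable m) (e : ℝ) : Measurable (fun y : ℝ × EuclideanSpace ℝ (Fin n) => ∫ s in Set.Ici y.1, Phi G m e y s) := by
  have : (fun y : ℝ × EuclideanSpace ℝ (Fin n) => ∫ s in Set.Ici y.1, Phi G m e y s) =
     fun y => ∫ s, {z : (ℝ × EuclideanSpace ℝ (Fin n)) × ℝ | z.1.1 ≤ z.2}.indicator (fun z => Phi G m e z.1 z.2) (y, s) := by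
    ext y
    rw [← integral_indicator measurableSet_Ici]
    rfl
  rw [this]
  refine StronglyMeasurable.measurable ?_
  refine StronglyMeasurable.integral_prod_right' (ν := volume) (f := {z : (ℝ × EuclideanSpace ℝ (Fin n)) × ℝ | z.1.1 ≤ z.2}.indicator (fun z => Phi G m e z.1 z.2)) ?_
  exact (Phi_meas hG hm e).indicator (measurableSet_le (by fun_prop) (by fun_prop))

end ret

section ret2

open Filter Topology

variable {n : ℕ}

/-- the dual-Strichartz density -/
def gS (ρ q' : ℝ) (G : EuclideanSpace ℝ (Fin n) → ℝ → ℂ) (s : ℝ) : ℝ≥0∞ := (∫⁻ x, ‖G x s‖ₑ ^ ρ) ^ (q' / ρ)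

lemma gS_meas {ρ q' : ℝ} {G : EuclideanSpace ℝ (Fin n) → ℝ → ℂ} (hG : Continuous (fun z : EuclideanSpace ℝ (Fin n) × ℝ => G z.1 z.2)) :
    Measurable (gS ρ q' G) := by
  unfold gS
  refine Measurable.pow_const ?_ _
  have h : Measurable (fun z : ℝ × EuclideanSpace ℝ (Fin n) => ‖G z.2 z.1‖ₑ ^ ρ) :=
    (Continuous.measurable (hG.comp continuous_swap)).enorm.pow_const ρ
  exact Measurable.lintegral_prod_right' (ν := volume) h

lemma gS_fin {ρ q' : ℝ} (hρ : 0 < ρ) (hq' : 0 < q') {G : EuclideanSpace ℝ (Fin n) → ℝ → ℂ} (hG : NiceG G) :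
    ∫⁻ s, gS ρ q' G s ≠ ⊤ := by
  obtain ⟨R, hR⟩ := hG.2
  have hc : HasCompactSupport (fun z : EuclideanSpace ℝ (Fin n) × ℝ => G z.1 z.2) := by
    refine HasCompactSupport.intro ((isCompact_closedBall (0:EuclideanSpace ℝ (Fin n)) R).prod (isCompact_closedBall (0:ℝ) R)) fun z hz => hR _ _ ?_
    by_contra hh
    push Not at hh
    exact hz ⟨by simpa using hh.1, by simpa using hh.2⟩
  obtain ⟨M, hM⟩ := hG.1.bounded_above_of_compact_support hc
  have hM0 : 0 ≤ M := (norm_nonneg _).trans (hM (0, 0))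
  set D : ℝ≥0∞ := (ENNReal.ofReal M ^ ρ * volume (closedBall (0:EuclideanSpace ℝ (Fin n)) R)) ^ (q' / ρ) with hD
  have hDf : D ≠ ⊤ := by
    refine ENNReal.rpow_ne_top_of_nonneg (by positivity) (ENNReal.mul_ne_top ?_ (isCompact_closedBall _ _).measure_lt_top.ne)
    exact ENNReal.rpow_ne_top_of_nonneg hρ.le ENNReal.ofReal_ne_top
  have hle : ∀ s, gS ρ q' G s ≤ (closedBall (0:ℝ) R).indicator (fun _ => D) s := by
    intro s
    unfold gS
    by_cases hs : s ∈ closedBall (0:ℝ) R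
    · rw [Set.indicator_of_mem hs]
      refine ENNReal.rpow_le_rpow ?_ (by positivity)
      calc ∫⁻ x, ‖G x s‖ₑ ^ ρ ≤ ∫⁻ x, (closedBall (0:EuclideanSpace ℝ (Fin n)) R).indicator (fun _ => ENNReal.ofReal M ^ ρ) x := by
            refine lintegral_mono fun x => ?_
            by_cases hx : x ∈ closedBall (0:EuclideanSpace ℝ (Fin n)) R
            · rw [Set.indicator_of_mem hx]
              refine ENNReal.rpow_le_rpow ?_ hρ.le
              rw [← ofReal_norm_eq_enorm]
              exact ENNReal.ofReal_le_ofReal (hM (x, s))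
            · rw [Set.indicator_of_notMem hx, hR x s (Or.inl (by simpa using hx)), enorm_zero, ENNReal.zero_rpow_of_pos hρ]
        _ = _ := by rw [lintegral_indicator_const measurableSet_closedBall]
    · rw [Set.indicator_of_notMem hs]
      have : ∀ x, ‖G x s‖ₑ ^ ρ = 0 := fun x => by
        rw [hR x s (Or.inr (by simpa using hs)), enorm_zero, ENNReal.zero_rpow_of_pos hρ]
      simp only [this, lintegral_zero]
      rw [ENNReal.zero_rpow_of_pos (by positivity)]
  refine ((lintegral_mono hle).trans_lt ?_).ne
  rw [lintegral_indicator_const measurableSet_closedBall]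
  exact ENNReal.mul_lt_top hDf.lt_top (isCompact_closedBall _ _).measure_lt_top

lemma gS_zero {ρ q' : ℝ} (hρ : 0 < ρ) (hq' : 0 < q') {G : EuclideanSpace ℝ (Fin n) → ℝ → ℂ}
    (hG : Continuous (fun z : EuclideanSpace ℝ (Fin n) × ℝ => G z.1 z.2)) {s : ℝ} (h : gS ρ q' G s = 0) (ξ) : 𝓕 (fun x => G x s) ξ = 0 := by
  unfold gS at h
  have hc : Continuous (fun x => G x s) := hG.comp (by fun_prop : Continuous fun x : EuclideanSpace ℝ (Fin n) => (x, s))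
  rw [ENNReal.rpow_eq_zero_iff_of_pos (by positivity), lintegral_eq_zero_iff (hc.measurable.enorm.pow_const ρ)] at h
  rw [Real.fourier_eq']
  refine integral_eq_zero_of_ae ?_
  filter_upwards [h] with x hx
  simp only [Pi.zero_apply] at hx ⊢
  rw [ENNReal.rpow_eq_zero_iff_of_pos hρ, enorm_eq_zero] at hx
  rw [hx, smul_zero]

/-- the retarded (advanced) estimate for nice data -/
lemma retarded (hn : 3 ≤ n) {p β θ ρ q q' α : ℝ} (hp : ((n : ℝ) - 1) / 2 < p) (hβ : ((n : ℝ) + 1) / 2 ≤ β) (hβn : β < n)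
    (hθ0 : 0 < θ) (hθ1 : θ < 1) (hρ : ρ * (1 + θ) = 2) (hq : 2 < q) (hq' : 1 / q + 1 / q' = 1)
    (hβq : (β - n) * θ = -(2 / q)) (hα : 1 - 2 * α = -(β * θ)) :
    ∃ C : ℝ, 0 < C ∧ ∀ (v : EuclideanSpace ℝ (Fin n) → ℝ) (N : ℝ), Measurable v → (∀ x, 0 ≤ v x) → 0 ≤ N → Mor p N v →
      ∀ (m : EuclideanSpace ℝ (Fin n) → ℂ) (c : ℝ), Measurable m → Integrable m → 0 ≤ c →
      (∀ ξ, ξ ≠ 0 → ‖m ξ‖ ≤ c * ‖ξ‖ ^ (-α)) → ∀ G, NiceG G →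
      ∫⁻ y : ℝ × EuclideanSpace ℝ (Fin n), ‖∫ s in Set.Ici y.1, Psi G m y.2 y.1 s‖ₑ ^ 2 * ENNReal.ofReal (v y.2) ≤
        ENNReal.ofReal (C * c ^ 2 * N) * (∫⁻ s, gS ρ q' G s) ^ (2 / q') := by
  obtain ⟨C1, hC1, H1⟩ := strichartz_dual hn hβ hβn hθ0 hθ1 hρ hq hq' hβq
  obtain ⟨C2, hC2, H2⟩ := smooth_est hn hp
  have hq0 : 0 < 1 / q := by positivity
  have hq2 : 1 / q < 1 / 2 := one_div_lt_one_div_of_lt (by norm_num) hq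
  have hq'0 : 0 < q' := by
    have : 0 < 1 / q' := by linarith
    exact one_div_pos.1 this
  have hκ : 1 < 2 / q' := by
    have : 2 / q' = 2 * (1 / q') := by ring
    rw [this]; linarith
  have hρ0 : 0 < ρ := by
    by_contra h; push Not at h; nlinarith
  obtain ⟨C3, hC3, H3⟩ := christ_kiselev hκ
  refine ⟨C1 * C2 * C3, by positivity, ?_⟩
  intro v N hv hv0 hN hM m c hm hmi hc hmc G hG
  have hn0 : Nonempty (Fin n) := ⟨⟨0, by omega⟩⟩
  have hw : Measurable (fun y : ℝ × EuclideanSpace ℝ (Fin n) => ENNReal.ofReal (v y.2)) := (hv.comp measurable_snd).ennreal_ofReal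
  have key : ∀ e : ℝ, |e| = 1 → ∫⁻ y : ℝ × EuclideanSpace ℝ (Fin n), ‖∫ s in Set.Ici y.1, Phi G m e y s‖ₑ ^ 2 * ENNReal.ofReal (v y.2) ≤
        ENNReal.ofReal (C1 * C2 * C3 * c ^ 2 * N) * (∫⁻ s, gS ρ q' G s) ^ (2 / q') := by
    intro e he
    have h := H3 (Y := ℝ × EuclideanSpace ℝ (Fin n)) (volume.withDensity (fun y => ENNReal.ofReal (v y.2))) Prod.fst (Phi G m e)
      (gS ρ q' G) (ENNReal.ofReal (C1 * C2 * c ^ 2 * N)) (gS_meas hG.1) (gS_fin hρ0 hq'0 hG) (Phi_integrable hG hm hmi e) ?_ ?_ ?_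
    · rw [lintegral_withDensity_eq_lintegral_mul _ hw ((Psi_meas hG hm hmi e).enorm.pow_const 2)] at h
      refine (le_of_eq ?_).trans (h.trans (le_of_eq ?_))
      · refine lintegral_congr fun y => ?_
        simp only [Pi.mul_apply]
        rw [mul_comm]
      · rw [← ENNReal.ofReal_mul hC3.le]
        congr 2
        ring
    · intro y s hs
      unfold Phi
      simp only [gS_zero hρ0 hq'0 hG.1 hs, mul_zero, integral_zero]
    · intro S hS
      refine StronglyMeasurable.measurable ?_
      exact StronglyMeasurable.integral_prod_right' (ν := volume.restrict S) (Phi_meas hG hm e)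
    · intro S hS
      have hSm : Measurable (fun y : ℝ × EuclideanSpace ℝ (Fin n) => ∫ s in S, Phi G m e y s) :=
        StronglyMeasurable.measurable (StronglyMeasurable.integral_prod_right' (ν := volume.restrict S) (Phi_meas hG hm e))
      rw [lintegral_withDensity_eq_lintegral_mul _ hw (hSm.enorm.pow_const 2)]
      have hSm2 : Measurable ((fun y : ℝ × EuclideanSpace ℝ (Fin n) => ENNReal.ofReal (v y.2)) *
        fun y => ‖∫ s in S, Phi G m e y s‖ₑ ^ 2) := hw.mul (hSm.enorm.pow_const 2)
      rw [Measure.volume_eq_prod, lintegral_prod _ hSm2.aemeasurable]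
      obtain ⟨B, hB⟩ := AS_bd hG (-e) S
      have ham : Measurable (fun ξ => m ξ * AS G (-e) S ξ) := hm.mul (AS_meas hG (-e) S)
      have hai : Integrable (fun ξ => m ξ * AS G (-e) S ξ) :=
        hmi.mul_bdd (c := B) (AS_meas hG (-e) S).aestronglyMeasurable (ae_of_all _ hB)
      have h4 := H2 v N hv hv0 hN hM _ ham hai e he
      have h5 := H1 G hG (-e) (by rw [abs_neg, he]) S hS
      calc ∫⁻ t : ℝ, ∫⁻ x : EuclideanSpace ℝ (Fin n), ((fun y : ℝ × EuclideanSpace ℝ (Fin n) => ENNReal.ofReal (v y.2)) *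
            fun y => ‖∫ s in S, Phi G m e y s‖ₑ ^ 2) (t, x)
          = ∫⁻ t : ℝ, ∫⁻ x, ‖∫ ξ, Complex.exp (2 * Real.pi * (inner ℝ x ξ : ℝ) * I) *
            (Complex.exp ((e * t * ‖ξ‖ : ℝ) * I) * (m ξ * AS G (-e) S ξ))‖ₑ ^ 2 * ENNReal.ofReal (v x) := by
            refine lintegral_congr fun t => lintegral_congr fun x => ?_
            simp only [Pi.mul_apply]
            rw [Phi_swap hG hm hmi e (t, x) S, mul_comm]
        _ ≤ _ := h4
        _ ≤ ENNReal.ofReal (C2 * N) * (ENNReal.ofReal (c ^ 2) * ∫⁻ ξ, ENNReal.ofReal (‖ξ‖ ^ (-(β * θ))) * ‖AS G (-e) S ξ‖ₑ ^ 2) := by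
            gcongr
            rw [← lintegral_const_mul' _ _ ENNReal.ofReal_ne_top]
            refine lintegral_mono_ae ?_
            have h0 : ∀ᵐ ξ : EuclideanSpace ℝ (Fin n), ξ ≠ 0 := by
              haveI : Nontrivial (EuclideanSpace ℝ (Fin n)) := by infer_instance
              exact (measure_eq_zero_iff_ae_notMem.1 (measure_singleton (0 : EuclideanSpace ℝ (Fin n)))).mono fun x hx => by simpa using hx
            filter_upwards [h0] with ξ hξ
            rw [enorm_mul, mul_pow, ← mul_assoc, ← mul_assoc]
            refine mul_le_mul_left ?_ _
            rw [← ofReal_norm_eq_enorm, ← ENNReal.ofReal_pow (norm_nonneg _), ← ENNReal.ofReal_mul (norm_nonneg _),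
              ← ENNReal.ofReal_mul (sq_nonneg c)]
            refine ENNReal.ofReal_le_ofReal ?_
            have hξ0 : 0 < ‖ξ‖ := norm_pos_iff.2 hξ
            have e1 : ‖ξ‖ ^ (-(β * θ)) = ‖ξ‖ * (‖ξ‖ ^ (-α)) ^ 2 := by
              rw [← hα, ← Real.rpow_natCast, ← Real.rpow_mul hξ0.le]
              nth_rewrite 2 [← Real.rpow_one ‖ξ‖]
              rw [← Real.rpow_add hξ0]
              congr 1; push_cast; ring
            rw [e1]
            calc ‖ξ‖ * ‖m ξ‖ ^ 2 ≤ ‖ξ‖ * (c * ‖ξ‖ ^ (-α)) ^ 2 := by gcongr; exact hmc ξ hξ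
              _ = _ := by ring
        _ ≤ ENNReal.ofReal (C2 * N) * (ENNReal.ofReal (c ^ 2) * (ENNReal.ofReal C1 * (∫⁻ s in S, gS ρ q' G s) ^ (2 / q'))) := by
            gcongr
            exact h5
        _ = _ := by
            rw [← mul_assoc, ← mul_assoc, ← ENNReal.ofReal_mul (by positivity), ← ENNReal.ofReal_mul (by positivity)]
            congr 2
            ring
  have k1 := key 1 (by simp)
  have k2 := key (-1) (by simp)
  have hsum : ∀ y : ℝ × EuclideanSpace ℝ (Fin n), ‖∫ s in Set.Ici y.1, Psi G m y.2 y.1 s‖ₑ ^ 2 * ENNReal.ofReal (v y.2) ≤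
      2⁻¹ * (‖∫ s in Set.Ici y.1, Phi G m 1 y s‖ₑ ^ 2 * ENNReal.ofReal (v y.2)) +
      2⁻¹ * (‖∫ s in Set.Ici y.1, Phi G m (-1) y s‖ₑ ^ 2 * ENNReal.ofReal (v y.2)) := by
    intro y
    have e1 : ∫ s in Set.Ici y.1, Psi G m y.2 y.1 s = (2 * I)⁻¹ * ((∫ s in Set.Ici y.1, Phi G m 1 y s) - ∫ s in Set.Ici y.1, Phi G m (-1) y s) := by
      rw [← integral_sub (Phi_integrable hG hm hmi 1 y).restrict (Phi_integrable hG hm hmi (-1) y).restrict, ← integral_const_mul]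
      refine integral_congr_ae (ae_of_all _ fun s => ?_)
      exact Psi_eq hG hmi y.2 y.1 s
    rw [e1, ← mul_assoc, ← mul_assoc, ← add_mul]
    refine mul_le_mul_left ?_ _
    generalize (∫ s in Set.Ici y.1, Phi G m 1 y s) = a
    generalize (∫ s in Set.Ici y.1, Phi G m (-1) y s) = b
    have h2 : (2⁻¹ : ℝ≥0∞) = ENNReal.ofReal (2⁻¹) := by
      rw [ENNReal.ofReal_inv_of_pos (by norm_num)]; norm_num
    rw [h2, ← ofReal_norm_eq_enorm, ← ofReal_norm_eq_enorm, ← ofReal_norm_eq_enorm, ← ENNReal.ofReal_pow (norm_nonneg _),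
      ← ENNReal.ofReal_pow (norm_nonneg _), ← ENNReal.ofReal_pow (norm_nonneg _), ← ENNReal.ofReal_mul (by norm_num),
      ← ENNReal.ofReal_mul (by norm_num), ← ENNReal.ofReal_add (by positivity) (by positivity)]
    refine ENNReal.ofReal_le_ofReal ?_
    have h3 : ‖(2 * I)⁻¹ * (a - b)‖ = 2⁻¹ * ‖a - b‖ := by simp
    rw [h3]
    have h4 := norm_sub_le a b
    have h5 : (2⁻¹ * ‖a - b‖) ^ 2 ≤ (2⁻¹ * (‖a‖ + ‖b‖)) ^ 2 := by gcongr
    refine h5.trans ?_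
    nlinarith [sq_nonneg (‖a‖ - ‖b‖)]
  refine (lintegral_mono hsum).trans ?_
  have hm3 : Measurable (fun y : ℝ × EuclideanSpace ℝ (Fin n) => (2⁻¹ : ℝ≥0∞) *
      (‖∫ s in Set.Ici y.1, Phi G m 1 y s‖ₑ ^ 2 * ENNReal.ofReal (v y.2))) :=
    ((((Psi_meas hG hm hmi 1).enorm.pow_const 2).mul hw)).const_mul _
  rw [lintegral_add_left hm3, lintegral_const_mul' _ _ (by simp),
    lintegral_const_mul' _ _ (by simp)]
  refine (add_le_add (mul_le_mul_right k1 _) (mul_le_mul_right k2 _)).trans (le_of_eq ?_)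
  rw [← add_mul, ENNReal.inv_two_add_inv_two, one_mul]

end ret2

section ml

open Filter Topology

variable {n : ℕ}

/-- a nonnegative radial decaying profile whose inverse Fourier transform has compact support -/
lemma exists_F : ∃ (F : EuclideanSpace ℝ (Fin n) → ℝ) (B L : ℝ), Continuous F ∧ (∀ ξ, 0 ≤ F ξ) ∧ 0 < F 0 ∧ 0 < B ∧ 0 < L ∧
    (∀ ξ η, ‖ξ‖ = ‖η‖ → F ξ = F η) ∧ (∀ ξ, F ξ ≤ B * (1 + ‖ξ‖) ^ (-((n:ℝ) + 1))) ∧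
    (∀ x, L < ‖x‖ → 𝓕⁻ (fun ξ => (F ξ : ℂ)) x = 0) := by
  set b : EuclideanSpace ℝ (Fin n) → ℝ := fun x => Real.smoothTransition (2 - ‖x‖ ^ 2) with hb
  have hb1 : ContDiff ℝ (⊤ : ℕ∞) b := Real.smoothTransition.contDiff.comp (contDiff_const.sub (contDiff_norm_sq ℝ))
  have hb2 : ∀ x, 2 < ‖x‖ → b x = 0 := fun x hx => Real.smoothTransition.zero_of_nonpos (by nlinarith)
  have hb3 : HasCompactSupport b := HasCompactSupport.intro (isCompact_closedBall 0 2) fun x hx => hb2 x (by simpa using hx)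
  have h1 : HasCompactSupport (fun x => (b x : ℂ)) := hb3.comp_left (g := fun x : ℝ => (x:ℂ)) (by simp)
  have h2 : ContDiff ℝ (⊤ : ℕ∞) (fun x => (b x : ℂ)) := Complex.ofRealCLM.contDiff.comp hb1
  set ψ : 𝓢(EuclideanSpace ℝ (Fin n), ℂ) := h1.toSchwartzMap h2 with hψ
  have hψb : ∀ x, ψ x = (b x : ℂ) := fun x => rfl
  have hψf : (ψ : EuclideanSpace ℝ (Fin n) → ℂ) = fun x => (b x : ℂ) := rfl
  obtain ⟨c, hc, hd⟩ := fourier_decay ψ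
  have hd1 : ∀ η, ‖𝓕 (ψ : EuclideanSpace ℝ (Fin n) → ℂ) η‖ ≤ c * (1 + ‖η‖) ^ (-((n:ℝ) + 1)) := by
    intro η
    have := hd 1 one_pos η
    simpa using this
  have hcont : Continuous (𝓕 (ψ : EuclideanSpace ℝ (Fin n) → ℂ)) := continuous_fourier_of_integrable ψ.integrable
  have hrad : ∀ ξ η, ‖ξ‖ = ‖η‖ → 𝓕 (ψ : EuclideanSpace ℝ (Fin n) → ℂ) ξ = 𝓕 (ψ : EuclideanSpace ℝ (Fin n) → ℂ) η := by
    intro ξ η h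
    have hA := Real.fourier_comp_linearIsometry (Submodule.reflection (Submodule.span ℝ {ξ - η})ᗮ) (ψ : EuclideanSpace ℝ (Fin n) → ℂ) ξ
    rw [Submodule.reflection_sub h] at hA
    rw [← hA]
    have h9 : (ψ : EuclideanSpace ℝ (Fin n) → ℂ) ∘ (Submodule.reflection (Submodule.span ℝ {ξ - η})ᗮ) = (ψ : EuclideanSpace ℝ (Fin n) → ℂ) := by
      ext x
      simp [hψb, hb]
    rw [h9]
  have hreal : ∀ ξ, (starRingEnd ℂ) (𝓕 (ψ : EuclideanSpace ℝ (Fin n) → ℂ) ξ) = 𝓕 (ψ : EuclideanSpace ℝ (Fin n) → ℂ) ξ := by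
    intro ξ
    rw [conj_fourier, Real.fourierInv_eq_fourier_neg]
    have : (fun x => (starRingEnd ℂ) (ψ x)) = (ψ : EuclideanSpace ℝ (Fin n) → ℂ) := by
      ext x; rw [hψb, Complex.conj_ofReal]
    rw [this]
    exact hrad _ _ (norm_neg _)
  have hsq : ∀ ξ, ((‖𝓕 (ψ : EuclideanSpace ℝ (Fin n) → ℂ) ξ‖ ^ 2 : ℝ) : ℂ) =
      𝓕 (ψ : EuclideanSpace ℝ (Fin n) → ℂ) ξ * 𝓕 (ψ : EuclideanSpace ℝ (Fin n) → ℂ) ξ := by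
    intro ξ
    have := Complex.mul_conj (𝓕 (ψ : EuclideanSpace ℝ (Fin n) → ℂ) ξ)
    rw [hreal] at this
    rw [this, Complex.normSq_eq_norm_sq]
  have hint : Integrable (fun ξ => 𝓕 (ψ : EuclideanSpace ℝ (Fin n) → ℂ) ξ) := by
    have := (𝓕 ψ).integrable (μ := volume)
    rwa [SchwartzMap.fourier_coe] at this
  refine ⟨fun ξ => ‖𝓕 (ψ : EuclideanSpace ℝ (Fin n) → ℂ) ξ‖ ^ 2, c ^ 2, 4, by fun_prop, fun ξ => by positivity, ?_, by positivity, by norm_num, ?_, ?_, ?_⟩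
  · have h0 : 𝓕 (ψ : EuclideanSpace ℝ (Fin n) → ℂ) 0 = ((∫ x, b x : ℝ) : ℂ) := by
      rw [Real.fourier_eq', ← integral_complex_ofReal]
      simp [hψb]
    have hpos : 0 < ∫ x, b x := by
      refine hb1.continuous.integral_pos_of_hasCompactSupport_nonneg_nonzero hb3 (fun x => Real.smoothTransition.nonneg _) (x := 0) ?_
      have : b 0 = 1 := Real.smoothTransition.one_of_one_le (by simp)
      rw [this]; norm_num
    simp only [h0, Complex.norm_real]
    have : ‖∫ x, b x‖ ≠ 0 := norm_ne_zero_iff.2 hpos.ne'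
    positivity
  · intro ξ η h
    simp only [hrad ξ η h]
  · intro ξ
    have h3 := hd1 ξ
    have h4 : (1 + ‖ξ‖) ^ (-((n:ℝ) + 1)) ≤ 1 := Real.rpow_le_one_of_one_le_of_nonpos (by linarith [norm_nonneg ξ]) (by linarith [Nat.cast_nonneg (α := ℝ) n])
    have h5 : 0 ≤ (1 + ‖ξ‖) ^ (-((n:ℝ) + 1)) := Real.rpow_nonneg (by linarith [norm_nonneg ξ]) _
    calc ‖𝓕 (ψ : EuclideanSpace ℝ (Fin n) → ℂ) ξ‖ ^ 2 ≤ (c * (1 + ‖ξ‖) ^ (-((n:ℝ) + 1))) ^ 2 := by gcongr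
      _ = c ^ 2 * ((1 + ‖ξ‖) ^ (-((n:ℝ) + 1)) * (1 + ‖ξ‖) ^ (-((n:ℝ) + 1))) := by ring
      _ ≤ c ^ 2 * ((1 + ‖ξ‖) ^ (-((n:ℝ) + 1)) * 1) := by gcongr
      _ = _ := by ring
  · intro x hx
    have e1 : (fun ξ => ((‖𝓕 (ψ : EuclideanSpace ℝ (Fin n) → ℂ) ξ‖ ^ 2 : ℝ) : ℂ)) =
        𝓕 (convolution (ψ : EuclideanSpace ℝ (Fin n) → ℂ) (ψ : EuclideanSpace ℝ (Fin n) → ℂ) (ContinuousLinearMap.mul ℂ ℂ) volume) := by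
      ext ξ
      rw [hsq, Real.fourier_mul_convolution_eq ψ.integrable ψ.integrable]
    have hci : Integrable (convolution (ψ : EuclideanSpace ℝ (Fin n) → ℂ) (ψ : EuclideanSpace ℝ (Fin n) → ℂ) (ContinuousLinearMap.mul ℂ ℂ) volume) :=
      ψ.integrable.integrable_convolution _ ψ.integrable
    have hcc : Continuous (convolution (ψ : EuclideanSpace ℝ (Fin n) → ℂ) (ψ : EuclideanSpace ℝ (Fin n) → ℂ) (ContinuousLinearMap.mul ℂ ℂ) volume) :=
      HasCompactSupport.continuous_convolution_right _ h1 ψ.integrable.locallyIntegrable ψ.continuous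
    rw [e1, hcc.fourierInv_fourier_eq hci ?_]
    · unfold convolution
      refine integral_eq_zero_of_ae (ae_of_all _ fun t => ?_)
      simp only [ContinuousLinearMap.mul_apply', Pi.zero_apply, mul_eq_zero]
      by_cases ht : 2 < ‖t‖
      · left; rw [hψb, hb2 t ht]; simp
      · right
        rw [hψb, hb2 _ ?_]
        · simp
        · have := norm_sub_norm_le x t
          linarith
    · rw [← e1]
      have : (fun ξ => ((‖𝓕 (ψ : EuclideanSpace ℝ (Fin n) → ℂ) ξ‖ ^ 2 : ℝ) : ℂ)) = fun ξ =>
          𝓕 (ψ : EuclideanSpace ℝ (Fin n) → ℂ) ξ * 𝓕 (ψ : EuclideanSpace ℝ (Fin n) → ℂ) ξ := funext hsq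
      rw [this]
      exact hint.mul_bdd (c := ∫ x, ‖ψ x‖) hcont.aestronglyMeasurable (ae_of_all _ fun ξ => norm_fourier_le ξ)

/-- smooth truncations of the Riesz multiplier with compactly supported kernels -/
lemma exists_ml (hn : 3 ≤ n) {α : ℝ} (hα : 0 < α) (hαn : α < n) : ∃ (c : ℝ) (m : ℕ → EuclideanSpace ℝ (Fin n) → ℂ), 0 < c ∧
    (∀ l, Continuous (m l)) ∧ (∀ l, Integrable (m l)) ∧ (∀ l, ∃ M, ∀ ξ, ‖m l ξ‖ ≤ M) ∧
    (∀ l, ∃ L, ∀ x, L < ‖x‖ → 𝓕⁻ (m l) x = 0) ∧ (∀ l ξ, ξ ≠ 0 → ‖m l ξ‖ ≤ c * ‖ξ‖ ^ (-α)) ∧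
    (∀ ξ, ξ ≠ 0 → Tendsto (fun l => m l ξ) atTop (𝓝 ((c * ‖ξ‖ ^ (-α) : ℝ) : ℂ))) := by
  obtain ⟨F, B, L, hFc, hF0, hF00, hB, hL, hrad, hdec, hsupp⟩ := exists_F (n := n)
  have hFB : ∀ ξ, F ξ ≤ B := fun ξ => by
    have h4 : (1 + ‖ξ‖) ^ (-((n:ℝ) + 1)) ≤ 1 := Real.rpow_le_one_of_one_le_of_nonpos (by linarith [norm_nonneg ξ]) (by linarith [Nat.cast_nonneg (α := ℝ) n])
    calc F ξ ≤ _ := hdec ξ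
      _ ≤ B * 1 := by gcongr
      _ = B := mul_one B
  have hFi : Integrable F := by
    refine ((integrable_one_add_norm (E := EuclideanSpace ℝ (Fin n)) (μ := volume) (r := (n:ℝ) + 1) (by simp)).const_mul B).mono' hFc.aestronglyMeasurable ?_
    filter_upwards with ξ
    rw [Real.norm_of_nonneg (hF0 ξ)]
    exact hdec ξ
  set e0 : EuclideanSpace ℝ (Fin n) := EuclideanSpace.single ⟨0, by omega⟩ 1 with he0
  have he0n : ‖e0‖ = 1 := by simp [he0]
  set f : ℝ → ℝ := fun s => s ^ (α - 1) * F (s • e0) with hf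
  have hfc : ContinuousOn f (Set.Ioi 0) := by
    refine ContinuousOn.mul ?_ (by fun_prop)
    exact fun s hs => (Real.continuousAt_rpow_const _ _ (Or.inl (ne_of_gt hs))).continuousWithinAt
  have hpow1 : IntegrableOn (fun s : ℝ => s ^ (α - 1)) (Set.Ioc 0 1) := by
    have := intervalIntegral.intervalIntegrable_rpow' (a := 0) (b := 1) (r := α - 1) (by linarith)
    rwa [intervalIntegrable_iff_integrableOn_Ioc_of_le zero_le_one] at this
  have hfi : IntegrableOn f (Set.Ioi 0) := by
    rw [← Set.Ioc_union_Ioi_eq_Ioi (zero_le_one (α := ℝ))]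
    refine IntegrableOn.union ?_ ?_
    · refine (hpow1.mul_const B).mono' ((hfc.mono Set.Ioc_subset_Ioi_self).aestronglyMeasurable measurableSet_Ioc) ?_
      filter_upwards [ae_restrict_mem measurableSet_Ioc] with s hs
      have : 0 ≤ s ^ (α - 1) := Real.rpow_nonneg hs.1.le _
      rw [Real.norm_of_nonneg (mul_nonneg this (hF0 _))]
      exact mul_le_mul_of_nonneg_left (hFB _) this
    · have h1 : IntegrableOn (fun s : ℝ => s ^ (α - 1 - (n + 1))) (Set.Ioi 1) := integrableOn_Ioi_rpow_of_lt (by linarith) one_pos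
      refine (h1.mul_const B).mono' ((hfc.mono (Set.Ioi_subset_Ioi zero_le_one)).aestronglyMeasurable measurableSet_Ioi) ?_
      filter_upwards [ae_restrict_mem measurableSet_Ioi] with s hs
      have hs0 : 0 < s := lt_trans one_pos hs
      have : 0 ≤ s ^ (α - 1) := Real.rpow_nonneg hs0.le _
      rw [Real.norm_of_nonneg (mul_nonneg this (hF0 _)), sub_eq_add_neg (α - 1), Real.rpow_add hs0, mul_assoc]
      refine mul_le_mul_of_nonneg_left ?_ this
      rw [mul_comm]
      refine (hdec _).trans ?_
      refine mul_le_mul_of_nonneg_left ?_ hB.le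
      have hn1 : -((n:ℝ) + 1) ≤ 0 := by linarith [Nat.cast_nonneg (α := ℝ) n]
      refine Real.rpow_le_rpow_of_nonpos hs0 ?_ hn1
      rw [norm_smul, he0n, mul_one, Real.norm_of_nonneg hs0.le]
      linarith
  set c : ℝ := ∫ s in Set.Ioi 0, f s with hc
  have hf0 : ∀ s, 0 < s → 0 ≤ f s := fun s hs => mul_nonneg (Real.rpow_nonneg hs.le _) (hF0 _)
  have hcpos : 0 < c := by
    rw [hc, setIntegral_pos_iff_support_of_nonneg_ae ?_ hfi]
    · obtain ⟨δ, hδ, hδF⟩ := Metric.continuousAt_iff.1 hFc.continuousAt (F 0) hF00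
      have hsub : Set.Ioo 0 δ ⊆ Function.support f ∩ Set.Ioi 0 := by
        intro s hs
        refine ⟨?_, hs.1⟩
        have h1 := hδF (x := s • e0) (by rw [dist_zero_right, norm_smul, he0n, mul_one, Real.norm_of_nonneg hs.1.le]; exact hs.2)
        rw [Real.dist_eq] at h1
        have h2 : 0 < F (s • e0) := by linarith [(abs_lt.1 h1).1]
        exact (mul_pos (Real.rpow_pos_of_pos hs.1 _) h2).ne'
      refine lt_of_lt_of_le ?_ (measure_mono hsub)
      simp [hδ]
    · filter_upwards [ae_restrict_mem measurableSet_Ioi] with s hs using hf0 s hs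
  have hscale : ∀ ξ, ξ ≠ 0 → IntegrableOn (fun s => s ^ (α - 1) * F (s • ξ)) (Set.Ioi 0) ∧
      ∫ s in Set.Ioi 0, s ^ (α - 1) * F (s • ξ) = c * ‖ξ‖ ^ (-α) := by
    intro ξ hξ
    have hξ0 : 0 < ‖ξ‖ := norm_pos_iff.2 hξ
    have e1 : ∀ s ∈ Set.Ioi (0:ℝ), s ^ (α - 1) * F (s • ξ) = ‖ξ‖ ^ (1 - α) * f (‖ξ‖ * s) := by
      intro s hs
      have hs0 : 0 < s := hs
      simp only [hf]
      rw [Real.mul_rpow hξ0.le hs0.le, hrad (s • ξ) ((‖ξ‖ * s) • e0) (by rw [norm_smul, norm_smul, he0n, norm_mul, norm_norm]; ring)]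
      rw [← mul_assoc, ← mul_assoc, ← Real.rpow_add hξ0]
      simp
    constructor
    · refine IntegrableOn.congr_fun ?_ (fun s hs => (e1 s hs).symm) measurableSet_Ioi
      refine Integrable.const_mul ?_ _
      have := (integrableOn_Ioi_comp_mul_left_iff f 0 hξ0).2 (by simpa using hfi)
      exact this
    · rw [setIntegral_congr_fun measurableSet_Ioi e1, integral_const_mul, integral_comp_mul_left_Ioi _ _ hξ0, mul_zero, smul_eq_mul, ← mul_assoc, mul_comm c]
      congr 1
      rw [← Real.rpow_neg_one, ← Real.rpow_add hξ0]
      congr 1; ring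
  set J : ℕ → Set ℝ := fun l => Set.Ioc (1 / ((l:ℝ) + 1)) ((l:ℝ) + 1) with hJ
  have hJ0 : ∀ l, J l ⊆ Set.Ioi 0 := fun l s hs => lt_trans (by positivity) hs.1
  have hJm : ∀ l, MeasurableSet (J l) := fun l => measurableSet_Ioc
  have hJmono : Monotone J := by
    intro a b hab
    have : (a:ℝ) ≤ b := by exact_mod_cast hab
    refine Set.Ioc_subset_Ioc ?_ (by linarith)
    exact one_div_le_one_div_of_le (by positivity) (by linarith)
  have hJU : ⋃ l, J l = Set.Ioi 0 := by
    refine Set.Subset.antisymm (Set.iUnion_subset hJ0) ?_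
    intro s hs
    have hs0 : 0 < s := hs
    obtain ⟨k, hk⟩ := exists_nat_gt (max s (1 / s))
    refine Set.mem_iUnion.2 ⟨k, ?_, ?_⟩
    · have h1 : 1 / s < k + 1 := (le_max_right _ _).trans_lt (hk.trans (by linarith))
      rw [div_lt_iff₀ hs0] at h1
      rw [div_lt_iff₀ (by positivity)]
      linarith
    · exact ((le_max_left _ _).trans_lt hk).le.trans (by linarith)
  have hJpow : ∀ l (γ : ℝ), IntegrableOn (fun s : ℝ => s ^ γ) (J l) := by
    intro l γ
    have : ContinuousOn (fun s : ℝ => s ^ γ) (Set.Icc (1 / ((l:ℝ) + 1)) ((l:ℝ) + 1)) := fun s hs =>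
      (Real.continuousAt_rpow_const _ _ (Or.inl (ne_of_gt (lt_of_lt_of_le (by positivity) hs.1)))).continuousWithinAt
    exact this.integrableOn_Icc.mono_set Set.Ioc_subset_Icc_self
  have hrm : Measurable (fun s : ℝ => s ^ (α - 1)) := by fun_prop
  set m : ℕ → EuclideanSpace ℝ (Fin n) → ℂ := fun l ξ => ∫ s in J l, ((s ^ (α - 1) * F (s • ξ) : ℝ) : ℂ) with hm
  have hmr : ∀ l ξ, m l ξ = ((∫ s in J l, s ^ (α - 1) * F (s • ξ) : ℝ) : ℂ) := fun l ξ => integral_complex_ofReal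
  have hpm : ∀ l, AEStronglyMeasurable (fun z : ℝ × EuclideanSpace ℝ (Fin n) => ((z.1 ^ (α - 1) * F (z.1 • z.2) : ℝ) : ℂ))
      ((volume.restrict (J l)).prod volume) := by
    intro l
    refine Measurable.aestronglyMeasurable ?_
    have h1 : Measurable (fun z : ℝ × EuclideanSpace ℝ (Fin n) => F (z.1 • z.2)) := (by fun_prop : Continuous _).measurable
    exact Complex.measurable_ofReal.comp ((hrm.comp measurable_fst).mul h1)
  have hpi : ∀ l, Integrable (fun z : ℝ × EuclideanSpace ℝ (Fin n) => ((z.1 ^ (α - 1) * F (z.1 • z.2) : ℝ) : ℂ))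
      ((volume.restrict (J l)).prod volume) := by
    intro l
    rw [integrable_prod_iff (hpm l)]
    constructor
    · filter_upwards [ae_restrict_mem (hJm l)] with s hs
      have hs0 : 0 < s := hJ0 l hs
      exact ((hFi.comp_smul hs0.ne').const_mul _).ofReal
    · refine ((hJpow l (α - 1 - n)).mul_const (∫ x, F x)).congr ?_
      filter_upwards [ae_restrict_mem (hJm l)] with s hs
      have hs0 : 0 < s := hJ0 l hs
      have e2 : ∀ y, ‖((s ^ (α - 1) * F (s • y) : ℝ) : ℂ)‖ = s ^ (α - 1) * F (s • y) := fun y => by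
        rw [Complex.norm_real, Real.norm_of_nonneg (mul_nonneg (Real.rpow_nonneg hs0.le _) (hF0 _))]
      simp only [e2]
      rw [integral_const_mul, Measure.integral_comp_smul, finrank_euclideanSpace_fin, abs_of_pos (by positivity), smul_eq_mul, ← mul_assoc,
        Real.rpow_sub hs0, Real.rpow_natCast, div_eq_mul_inv]
  refine ⟨c, m, hcpos, ?_, ?_, ?_, ?_, ?_, ?_⟩
  · intro l
    refine continuous_of_dominated (bound := fun s => s ^ (α - 1) * B) ?_ ?_ ((hJpow l _).mul_const B) ?_
    · intro ξ
      have h1 : Measurable (fun s : ℝ => F (s • ξ)) := (by fun_prop : Continuous _).measurable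
      exact (Complex.measurable_ofReal.comp (hrm.mul h1)).aestronglyMeasurable
    · intro ξ
      filter_upwards [ae_restrict_mem (hJm l)] with s hs
      have hs0 : 0 < s := hJ0 l hs
      rw [Complex.norm_real, Real.norm_of_nonneg (mul_nonneg (Real.rpow_nonneg hs0.le _) (hF0 _))]
      exact mul_le_mul_of_nonneg_left (hFB _) (Real.rpow_nonneg hs0.le _)
    · filter_upwards with s
      fun_prop
  · intro l
    exact (hpi l).integral_prod_right
  · intro l
    refine ⟨∫ s in J l, s ^ (α - 1) * B, fun ξ => ?_⟩
    refine norm_integral_le_of_norm_le ((hJpow l _).mul_const B) ?_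
    filter_upwards [ae_restrict_mem (hJm l)] with s hs
    have hs0 : 0 < s := hJ0 l hs
    rw [Complex.norm_real, Real.norm_of_nonneg (mul_nonneg (Real.rpow_nonneg hs0.le _) (hF0 _))]
    exact mul_le_mul_of_nonneg_left (hFB _) (Real.rpow_nonneg hs0.le _)
  · intro l
    refine ⟨L * (l + 1), fun x hx => ?_⟩
    rw [Real.fourierInv_eq']
    have e3 : ∀ ξ, Complex.exp (↑(2 * Real.pi * inner ℝ ξ x) * I) • m l ξ =
        ∫ s in J l, Complex.exp (↑(2 * Real.pi * inner ℝ ξ x) * I) * ((s ^ (α - 1) * F (s • ξ) : ℝ) : ℂ) := fun ξ => by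
      rw [smul_eq_mul, integral_const_mul]
    simp only [e3]
    rw [integral_integral_swap (f := fun ξ s => Complex.exp (↑(2 * Real.pi * inner ℝ ξ x) * I) * ((s ^ (α - 1) * F (s • ξ) : ℝ) : ℂ))]
    · refine integral_eq_zero_of_ae ?_
      filter_upwards [ae_restrict_mem (hJm l)] with s hs
      have hs0 : 0 < s := hJ0 l hs
      have h5 := Measure.integral_comp_smul (volume : Measure (EuclideanSpace ℝ (Fin n)))
        (fun η => Complex.exp (↑(2 * Real.pi * inner ℝ η (s⁻¹ • x)) * I) • (F η : ℂ)) s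
      rw [← Real.fourierInv_eq' (fun η => (F η : ℂ)) (s⁻¹ • x), hsupp, smul_zero] at h5
      · have e4 : ∀ ξ, Complex.exp (↑(2 * Real.pi * inner ℝ ξ x) * I) * ((s ^ (α - 1) * F (s • ξ) : ℝ) : ℂ) =
           ((s ^ (α - 1) : ℝ) : ℂ) * (Complex.exp (↑(2 * Real.pi * inner ℝ (s • ξ) (s⁻¹ • x)) * I) • (F (s • ξ) : ℂ)) := by
          intro ξ
          rw [inner_smul_left, inner_smul_right]
          simp only [conj_trivial]
          rw [mul_inv_cancel_left₀ hs0.ne', smul_eq_mul]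
          push_cast
          ring
        simp only [e4]
        rw [integral_const_mul, h5, mul_zero]
        rfl
      · rw [norm_smul, norm_inv, Real.norm_of_nonneg hs0.le, inv_mul_eq_div, lt_div_iff₀ hs0]
        calc L * s ≤ L * (l + 1) := by gcongr; exact hs.2
          _ < _ := hx
    · have h6 : Integrable (fun z : EuclideanSpace ℝ (Fin n) × ℝ => ((z.2 ^ (α - 1) * F (z.2 • z.1) : ℝ) : ℂ))
          (volume.prod (volume.restrict (J l))) := (hpi l).swap
      refine h6.bdd_mul (c := 1) ?_ ?_
      · exact (by fun_prop : Continuous fun z : EuclideanSpace ℝ (Fin n) × ℝ => Complex.exp (↑(2 * Real.pi * inner ℝ z.1 x) * I)).aestronglyMeasurable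
      · filter_upwards with z
        rw [Complex.norm_exp_ofReal_mul_I]
  · intro l ξ hξ
    obtain ⟨h1, h2⟩ := hscale ξ hξ
    rw [hmr, Complex.norm_real, Real.norm_of_nonneg, ← h2]
    · refine setIntegral_mono_set h1 ?_ (ae_of_all _ (hJ0 l))
      filter_upwards [ae_restrict_mem measurableSet_Ioi] with s hs using mul_nonneg (Real.rpow_nonneg (le_of_lt hs) _) (hF0 _)
    · refine setIntegral_nonneg (hJm l) fun s hs => mul_nonneg (Real.rpow_nonneg (le_of_lt (hJ0 l hs)) _) (hF0 _)
  · intro ξ hξ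
    obtain ⟨h1, h2⟩ := hscale ξ hξ
    simp only [hmr]
    have h3 := tendsto_setIntegral_of_monotone hJm hJmono (by rw [hJU]; exact h1)
    rw [hJU, h2] at h3
    exact (Complex.continuous_ofReal.tendsto _).comp h3

end ml

section far

open Filter Topology

variable {n : ℕ}

lemma mul_shift {k h : EuclideanSpace ℝ (Fin n) → ℂ} (hk : Integrable k) (hh : Integrable h) (x : EuclideanSpace ℝ (Fin n)) :
    𝓕⁻ (fun ξ => k ξ * 𝓕 h ξ) x = ∫ y, 𝓕⁻ k (x - y) * h y := by
  have hki : Integrable (fun ξ : EuclideanSpace ℝ (Fin n) => Complex.exp (↑(2 * Real.pi * inner ℝ ξ x) * I) * k ξ) :=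
    hk.bdd_mul (c := 1) (by exact (by fun_prop : Continuous _).aestronglyMeasurable)
      (by filter_upwards with ξ; rw [Complex.norm_exp_ofReal_mul_I])
  have h1 := fourier_mul_flip hki hh
  rw [Real.fourierInv_eq']
  simp only [smul_eq_mul, ← mul_assoc]
  rw [← h1]
  refine integral_congr_ae (ae_of_all _ fun y => ?_)
  simp only
  congr 1
  rw [Real.fourier_eq', Real.fourierInv_eq']
  refine integral_congr_ae (ae_of_all _ fun ξ => ?_)
  simp only [smul_eq_mul]
  rw [← mul_assoc, ← Complex.exp_add, inner_sub_right]
  congr 2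
  push_cast
  ring

lemma norm_fourierInv_le {f : EuclideanSpace ℝ (Fin n) → ℂ} (x : EuclideanSpace ℝ (Fin n)) : ‖𝓕⁻ f x‖ ≤ ∫ ξ, ‖f ξ‖ := by
  rw [Real.fourierInv_eq_fourier_neg]; exact norm_fourier_le _

/-- off-diagonal decay of the regularised half wave kernel -/
lemma halfwave_decay (hn : 3 ≤ n) : ∃ C : ℝ, 0 < C ∧ ∀ (ε τ : ℝ), 0 < ε → ε ≤ 1 → ∀ z : EuclideanSpace ℝ (Fin n), z ≠ 0 → |τ| ≤ ‖z‖ →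
    ‖𝓕⁻ (fun ξ : EuclideanSpace ℝ (Fin n) => Complex.exp (-((ε:ℂ) + τ * I) * ‖ξ‖)) z‖ ≤ C * (1 + |τ|) * ‖z‖ ^ (-((n:ℝ) + 1)) := by
  obtain ⟨C, hC, H⟩ := poisson hn
  refine ⟨C, hC, ?_⟩
  intro ε τ hε hε1 z hz hτ
  obtain ⟨c, hc, h⟩ := H z
  have hz0 : 0 < ‖z‖ := norm_pos_iff.2 hz
  rw [h _ (by simpa using hε)]
  have hpi := Real.pi_gt_three
  have hexp : (-(((n:ℂ) + 1) / 2)) = ((-(((n:ℝ) + 1) / 2) : ℝ) : ℂ) := by push_cast; ring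
  have hw : ‖(ε:ℂ) + τ * I‖ ≤ 1 + |τ| := by
    refine (norm_add_le _ _).trans ?_
    rw [norm_mul, Complex.norm_I, mul_one, Complex.norm_real, Complex.norm_real, Real.norm_of_nonneg hε.le, Real.norm_eq_abs]
    linarith
  have key : ∀ a : ℝ, |a| = 2 * Real.pi * ‖z‖ → ‖((ε:ℂ) + τ * I + (a:ℝ) * I) ^ (-(((n:ℂ) + 1) / 2))‖ ≤ ‖z‖ ^ (-(((n:ℝ) + 1) / 2)) := by
    intro a ha
    have h1 : ‖z‖ ≤ ‖(ε:ℂ) + τ * I + (a:ℝ) * I‖ := by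
      have h2 := Complex.abs_im_le_norm ((ε:ℂ) + τ * I + (a:ℝ) * I)
      simp at h2
      have h3 : |a| - |τ| ≤ |τ + a| := by
        have := abs_sub_abs_le_abs_sub a (-τ)
        rw [abs_neg] at this
        rwa [sub_neg_eq_add, add_comm] at this
      have h4 : 2 * ‖z‖ ≤ |a| := by rw [ha]; nlinarith
      linarith
    have hne : (ε:ℂ) + τ * I + (a:ℝ) * I ≠ 0 := norm_pos_iff.1 (lt_of_lt_of_le hz0 h1)
    rw [hexp, Complex.norm_cpow_real]
    exact Real.rpow_le_rpow_of_nonpos hz0 h1 (by have := Nat.cast_nonneg (α := ℝ) n; linarith)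
  rw [norm_mul, norm_mul, norm_mul]
  have k1 := key (2 * Real.pi * ‖z‖) (abs_of_nonneg (by positivity))
  have k2 := key (-(2 * Real.pi * ‖z‖)) (by rw [abs_neg, abs_of_nonneg (by positivity)])
  calc _ ≤ C * (1 + |τ|) * ‖z‖ ^ (-(((n:ℝ) + 1) / 2)) * ‖z‖ ^ (-(((n:ℝ) + 1) / 2)) := by gcongr
    _ = _ := by
      rw [mul_assoc, ← Real.rpow_add hz0]
      congr 2; ring

lemma far_bound (hn : 3 ≤ n) : ∃ C : ℝ, 0 < C ∧ ∀ (Λ τ : ℝ), 1 ≤ Λ → |τ| ≤ Λ → ∀ h : EuclideanSpace ℝ (Fin n) → ℂ, Integrable h → Integrable (𝓕 h) →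
    (∀ y, ‖y‖ < 2 * Λ → h y = 0) → ∀ x, ‖x‖ ≤ Λ →
    ‖𝓕⁻ (fun ξ => (Real.sin (τ * ‖ξ‖) : ℂ) * 𝓕 h ξ) x‖ ≤ C * (1 + |τ|) * ∫ y, (1 + ‖y‖) ^ (-((n:ℝ) + 1)) * ‖h y‖ := by
  obtain ⟨C, hC, H⟩ := halfwave_decay hn
  refine ⟨C * 4 ^ ((n:ℝ) + 1), by positivity, ?_⟩
  intro Λ τ hΛ hτ h hh hhf hsupp x hx
  have hfc := continuous_fourier_of_integrable hh
  have hwi : Integrable (fun y => (1 + ‖y‖) ^ (-((n:ℝ) + 1)) * ‖h y‖) := by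
    refine hh.norm.bdd_mul (c := 1) ?_ ?_
    · refine Continuous.aestronglyMeasurable ?_
      exact Continuous.rpow_const (by fun_prop) fun y => Or.inl (by positivity)
    · filter_upwards with y
      rw [Real.norm_of_nonneg (Real.rpow_nonneg (by positivity) _)]
      exact Real.rpow_le_one_of_one_le_of_nonpos (by linarith [norm_nonneg y]) (by linarith [Nat.cast_nonneg (α := ℝ) n])
  have hei : ∀ (ε τ : ℝ), 0 < ε → Integrable (fun ξ : EuclideanSpace ℝ (Fin n) => Complex.exp (-((ε:ℂ) + τ * I) * ‖ξ‖)) := fun ε τ hε =>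
    integrable_exp_norm (by omega) (by simpa using hε)
  have hker : ∀ ε : ℝ, 0 < ε → ε ≤ 1 → ‖𝓕⁻ (fun ξ => ((Real.exp (-ε * ‖ξ‖) : ℂ) * (Real.sin (τ * ‖ξ‖) : ℂ)) * 𝓕 h ξ) x‖ ≤
      C * 4 ^ ((n:ℝ) + 1) * (1 + |τ|) * ∫ y, (1 + ‖y‖) ^ (-((n:ℝ) + 1)) * ‖h y‖ := by
    intro ε hε hε1
    have e1 : (fun ξ : EuclideanSpace ℝ (Fin n) => ((Real.exp (-ε * ‖ξ‖) : ℂ) * (Real.sin (τ * ‖ξ‖) : ℂ))) =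
       fun ξ => (2 * I)⁻¹ * (Complex.exp (-((ε:ℂ) + (-τ:ℝ) * I) * ‖ξ‖) - Complex.exp (-((ε:ℂ) + τ * I) * ‖ξ‖)) := by
      ext ξ
      have a1 : Complex.exp (-((ε:ℂ) + (-τ:ℝ) * I) * ‖ξ‖) = Complex.exp (-ε * ‖ξ‖) * Complex.exp (↑τ * ↑‖ξ‖ * I) := by
        rw [← Complex.exp_add]; congr 1; push_cast; ring
      have a2 : Complex.exp (-((ε:ℂ) + τ * I) * ‖ξ‖) = Complex.exp (-ε * ‖ξ‖) * Complex.exp (-(↑τ * ↑‖ξ‖) * I) := by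
        rw [← Complex.exp_add]; congr 1; push_cast; ring
      rw [a1, a2, Complex.ofReal_sin, Complex.sin]
      push_cast
      rw [mul_inv, Complex.inv_I]
      ring
    have hki : Integrable (fun ξ : EuclideanSpace ℝ (Fin n) => ((Real.exp (-ε * ‖ξ‖) : ℂ) * (Real.sin (τ * ‖ξ‖) : ℂ))) := by
      rw [e1]
      exact ((hei ε (-τ) hε).sub (hei ε τ hε)).const_mul _
    have hK : ∀ z : EuclideanSpace ℝ (Fin n), z ≠ 0 → |τ| ≤ ‖z‖ →
        ‖𝓕⁻ (fun ξ : EuclideanSpace ℝ (Fin n) => ((Real.exp (-ε * ‖ξ‖) : ℂ) * (Real.sin (τ * ‖ξ‖) : ℂ))) z‖ ≤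
        C * (1 + |τ|) * ‖z‖ ^ (-((n:ℝ) + 1)) := by
      intro z hz hτz
      have e2 : 𝓕⁻ (fun ξ : EuclideanSpace ℝ (Fin n) => ((Real.exp (-ε * ‖ξ‖) : ℂ) * (Real.sin (τ * ‖ξ‖) : ℂ))) z =
         (2 * I)⁻¹ * (𝓕⁻ (fun ξ : EuclideanSpace ℝ (Fin n) => Complex.exp (-((ε:ℂ) + (-τ:ℝ) * I) * ‖ξ‖)) z -
          𝓕⁻ (fun ξ : EuclideanSpace ℝ (Fin n) => Complex.exp (-((ε:ℂ) + τ * I) * ‖ξ‖)) z) := by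
        rw [e1]
        simp only [Real.fourierInv_eq']
        have hb : ∀ τ : ℝ, Integrable (fun v : EuclideanSpace ℝ (Fin n) =>
            Complex.exp (↑(2 * Real.pi * inner ℝ v z) * I) • Complex.exp (-((ε:ℂ) + τ * I) * ‖v‖)) := fun τ =>
          (hei ε τ hε).bdd_mul (c := 1) (by exact (by fun_prop : Continuous _).aestronglyMeasurable)
            (by filter_upwards with ξ; rw [Complex.norm_exp_ofReal_mul_I])
        rw [← integral_sub (hb (-τ)) (hb τ), ← integral_const_mul]
        refine integral_congr_ae (ae_of_all _ fun ξ => ?_)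
        simp only [smul_eq_mul]
        ring
      rw [e2]
      have b1 := H ε (-τ) hε hε1 z hz (by rwa [abs_neg])
      have b2 := H ε τ hε hε1 z hz hτz
      rw [abs_neg] at b1
      rw [norm_mul]
      have : ‖(2 * I)⁻¹‖ = 2⁻¹ := by simp
      rw [this]
      have := norm_sub_le (𝓕⁻ (fun ξ : EuclideanSpace ℝ (Fin n) => Complex.exp (-((ε:ℂ) + (-τ:ℝ) * I) * ‖ξ‖)) z)
        (𝓕⁻ (fun ξ : EuclideanSpace ℝ (Fin n) => Complex.exp (-((ε:ℂ) + τ * I) * ‖ξ‖)) z)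
      linarith
    rw [mul_shift hki hh, ← integral_const_mul]
    refine norm_integral_le_of_norm_le (hwi.const_mul _) (ae_of_all _ fun y => ?_)
    by_cases hy : ‖y‖ < 2 * Λ
    · rw [hsupp y hy]; simp
    push Not at hy
    rw [norm_mul, ← mul_assoc]
    gcongr
    have h1 : ‖y‖ - ‖x‖ ≤ ‖x - y‖ := by rw [norm_sub_rev]; exact norm_sub_norm_le y x
    have h2 : (1 + ‖y‖) / 4 ≤ ‖x - y‖ := by linarith
    refine (hK (x - y) (norm_pos_iff.1 (by linarith)) (by linarith)).trans ?_
    have h3 : ‖x - y‖ ^ (-((n:ℝ) + 1)) ≤ ((1 + ‖y‖) / 4) ^ (-((n:ℝ) + 1)) :=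
      Real.rpow_le_rpow_of_nonpos (by positivity) h2 (by linarith [Nat.cast_nonneg (α := ℝ) n])
    have h4 : ((1 + ‖y‖) / 4) ^ (-((n:ℝ) + 1)) = 4 ^ ((n:ℝ) + 1) * (1 + ‖y‖) ^ (-((n:ℝ) + 1)) := by
      rw [Real.div_rpow (by positivity) (by norm_num), Real.rpow_neg (by norm_num : (0:ℝ) ≤ 4), div_inv_eq_mul, mul_comm]
    rw [h4] at h3
    calc _ ≤ C * (1 + |τ|) * (4 ^ ((n:ℝ) + 1) * (1 + ‖y‖) ^ (-((n:ℝ) + 1))) := by gcongr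
      _ = _ := by ring
  have hlim : Tendsto (fun k : ℕ => 𝓕⁻ (fun ξ => ((Real.exp (-(1 / ((k:ℝ) + 1)) * ‖ξ‖) : ℂ) * (Real.sin (τ * ‖ξ‖) : ℂ)) * 𝓕 h ξ) x) atTop
      (𝓝 (𝓕⁻ (fun ξ => (Real.sin (τ * ‖ξ‖) : ℂ) * 𝓕 h ξ) x)) := by
    simp only [Real.fourierInv_eq']
    refine tendsto_integral_of_dominated_convergence (fun ξ => ‖𝓕 h ξ‖) ?_ hhf.norm ?_ ?_
    · intro k
      exact (by fun_prop : Continuous _).aestronglyMeasurable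
    · intro k
      filter_upwards with ξ
      rw [norm_smul, Complex.norm_exp_ofReal_mul_I, one_mul, norm_mul, norm_mul, Complex.norm_real, Complex.norm_real]
      have h1 : ‖Real.exp (-(1 / ((k:ℝ) + 1)) * ‖ξ‖)‖ ≤ 1 := by
        rw [Real.norm_of_nonneg (Real.exp_nonneg _), Real.exp_le_one_iff]
        have : 0 ≤ (1 / ((k:ℝ) + 1)) * ‖ξ‖ := by positivity
        linarith
      have h2 : ‖Real.sin (τ * ‖ξ‖)‖ ≤ 1 := Real.abs_sin_le_one _
      calc _ ≤ 1 * 1 * ‖𝓕 h ξ‖ := by gcongr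
        _ = _ := by ring
    · filter_upwards with ξ
      refine Tendsto.const_smul ?_ _
      refine Tendsto.mul_const _ ?_
      have h1 : Tendsto (fun k : ℕ => Real.exp (-(1 / ((k:ℝ) + 1)) * ‖ξ‖)) atTop (𝓝 1) := by
        have h2 := (tendsto_one_div_add_atTop_nhds_zero_nat (𝕜 := ℝ)).neg.mul_const ‖ξ‖
        have h3 := (Real.continuous_exp.tendsto _).comp h2
        simpa [Function.comp_def] using h3
      have h4 := ((Complex.continuous_ofReal.tendsto _).comp h1).mul_const ((Real.sin (τ * ‖ξ‖) : ℂ))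
      simpa using h4
  refine le_of_tendsto hlim.norm (Eventually.of_forall fun k => hker _ (by positivity) ?_)
  rw [div_le_one (by positivity)]
  linarith [Nat.cast_nonneg (α := ℝ) k]

end far

section locfin

open Filter Topology

variable {n : ℕ}

lemma fourier_add_fun {f g : EuclideanSpace ℝ (Fin n) → ℂ} (hf : Integrable f) (hg : Integrable g) (ξ) :
    𝓕 (fun x => f x + g x) ξ = 𝓕 f ξ + 𝓕 g ξ := by
  simp only [Real.fourier_eq']
  have h : ∀ {f : EuclideanSpace ℝ (Fin n) → ℂ}, Integrable f → Integrable (fun v => Complex.exp (↑(-2 * Real.pi * inner ℝ v ξ) * I) • f v) := fun hf =>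
    hf.bdd_mul (c := 1) (by exact (by fun_prop : Continuous _).aestronglyMeasurable)
            (by filter_upwards with ξ; rw [Complex.norm_exp_ofReal_mul_I])
  rw [← integral_add (h hf) (h hg)]
  simp only [smul_add]

lemma fourierInv_add_fun {f g : EuclideanSpace ℝ (Fin n) → ℂ} (hf : Integrable f) (hg : Integrable g) (ξ) :
    𝓕⁻ (fun x => f x + g x) ξ = 𝓕⁻ f ξ + 𝓕⁻ g ξ := by
  simp only [Real.fourierInv_eq_fourier_neg]
  exact fourier_add_fun hf hg _

lemma schwartz_int {h : EuclideanSpace ℝ (Fin n) → ℂ} (hS : ∃ φ : 𝓢(EuclideanSpace ℝ (Fin n), ℂ), ∀ x, h x = φ x) :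
    Integrable h ∧ Integrable (𝓕 h) := by
  obtain ⟨φ, hφ⟩ := hS
  have : h = φ := funext hφ
  subst this
  refine ⟨φ.integrable, ?_⟩
  rw [← SchwartzMap.fourier_coe]
  exact (𝓕 φ).integrable

lemma weight_holder {ρ : ℝ} (hρ : 1 < ρ) : ∃ K : ℝ≥0∞, K ≠ ⊤ ∧ ∀ h : EuclideanSpace ℝ (Fin n) → ℂ, Measurable h →
    ∫⁻ y, ENNReal.ofReal ((1 + ‖y‖) ^ (-((n:ℝ) + 1))) * ‖h y‖ₑ ≤ K * (∫⁻ y, ‖h y‖ₑ ^ ρ) ^ (1 / ρ) := by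
  have hc : (Real.conjExponent ρ).HolderConjugate ρ := (Real.HolderConjugate.conjExponent hρ).symm
  set r := Real.conjExponent ρ
  have hr1 : 1 < r := hc.lt
  have hwm : Measurable (fun y : EuclideanSpace ℝ (Fin n) => ENNReal.ofReal ((1 + ‖y‖) ^ (-((n:ℝ) + 1)))) := by fun_prop
  refine ⟨(∫⁻ y : EuclideanSpace ℝ (Fin n), ENNReal.ofReal ((1 + ‖y‖) ^ (-((n:ℝ) + 1))) ^ r) ^ (1 / r), ?_, ?_⟩
  · refine ENNReal.rpow_ne_top_of_nonneg (by positivity) ?_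
    have h1 : Integrable (fun y : EuclideanSpace ℝ (Fin n) => (1 + ‖y‖) ^ (-((n:ℝ) + 1))) :=
      integrable_one_add_norm (by simp)
    refine ne_top_of_le_ne_top (h1.lintegral_lt_top).ne (lintegral_mono fun y => ?_)
    refine ENNReal.rpow_le_self_of_le_one ?_ hr1.le
    rw [← ENNReal.ofReal_one]
    refine ENNReal.ofReal_le_ofReal ?_
    exact Real.rpow_le_one_of_one_le_of_nonpos (by linarith [norm_nonneg y]) (by linarith [Nat.cast_nonneg (α := ℝ) n])
  · intro h hh
    exact ENNReal.lintegral_mul_le_Lp_mul_Lq volume hc hwm.aemeasurable hh.enorm.aemeasurable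

lemma rpow_le_one_add {a : ℝ≥0∞} {x y : ℝ} (hx : 0 ≤ x) (hxy : x ≤ y) : a ^ x ≤ 1 + a ^ y := by
  rcases le_total a 1 with h | h
  · exact (ENNReal.rpow_le_one h hx).trans le_self_add
  · exact (ENNReal.rpow_le_rpow_of_exponent_le h hxy).trans le_add_self

/-- the free evolution -/
def uu (G : EuclideanSpace ℝ (Fin n) → ℝ → ℂ) (t s : ℝ) (y : EuclideanSpace ℝ (Fin n)) : ℂ :=
  𝓕⁻ (fun ξ => (Real.sin ((t - s) * ‖ξ‖) : ℂ) * 𝓕 (fun x => G x s) ξ) y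

lemma sin_mul_int {f : EuclideanSpace ℝ (Fin n) → ℂ} (τ : ℝ) (hf : Integrable f) :
    Integrable (fun ξ => (Real.sin (τ * ‖ξ‖) : ℂ) * f ξ) :=
  hf.bdd_mul (c := 1) (by exact (by fun_prop : Continuous _).aestronglyMeasurable)
    (by filter_upwards with ξ; rw [Complex.norm_real]; exact Real.abs_sin_le_one _)

lemma loc_bound (hn : 3 ≤ n) {ρ q' R : ℝ} (hρ : 1 < ρ) (hq' : 1 ≤ q') {G : EuclideanSpace ℝ (Fin n) → ℝ → ℂ}
    (hS : ∀ s, ∃ φ : 𝓢(EuclideanSpace ℝ (Fin n), ℂ), ∀ x, G x s = φ x)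
    (hG : Continuous (fun z : EuclideanSpace ℝ (Fin n) × ℝ => G z.1 z.2))
    (hR : ∀ x, ∀ s : ℝ, R < |s| → G x s = 0) (t L : ℝ) : ∃ A B : ℝ≥0∞, A ≠ ⊤ ∧ B ≠ ⊤ ∧ ∀ s,
      ∫⁻ y in closedBall 0 L, ‖uu G t s y‖ₑ ≤ (Set.Icc (-R) R).indicator (fun _ => A) s + B * gS ρ q' G s := by
  obtain ⟨K, hK, hKh⟩ := weight_holder (n := n) hρ
  obtain ⟨C, hC, hfar⟩ := far_bound hn
  set Λ := max 1 (max L (|t| + |R|)) with hΛ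
  have hΛ1 : 1 ≤ Λ := le_max_left _ _
  have hΛL : L ≤ Λ := (le_max_left _ _).trans (le_max_right _ _)
  have hΛt : |t| + |R| ≤ Λ := (le_max_right _ _).trans (le_max_right _ _)
  let b : ContDiffBump (0 : EuclideanSpace ℝ (Fin n)) := ⟨2 * Λ, 4 * Λ, by linarith, by linarith⟩
  obtain ⟨M, hM⟩ := ((isCompact_closedBall (0:EuclideanSpace ℝ (Fin n)) (4 * Λ)).prod (isCompact_Icc (a := -R) (b := R))).exists_bound_of_continuousOn hG.continuousOn
  set vL := volume (closedBall (0:EuclideanSpace ℝ (Fin n)) L) with hvL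
  have hvLt : vL ≠ ⊤ := measure_closedBall_lt_top.ne
  have hvΛt : volume (closedBall (0:EuclideanSpace ℝ (Fin n)) (4 * Λ)) ≠ ⊤ := measure_closedBall_lt_top.ne
  set D := ENNReal.ofReal (C * (1 + Λ)) with hD
  refine ⟨vL + ENNReal.ofReal M ^ 2 * volume (closedBall (0:EuclideanSpace ℝ (Fin n)) (4 * Λ)) + D * K * vL, D * K * vL, ?_, ?_, ?_⟩
  · finiteness
  · finiteness
  intro s
  by_cases hs : s ∈ Set.Icc (-R) R
  swap
  · have h0 : ∀ y, uu G t s y = 0 := by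
      intro y
      have : (fun x => G x s) = fun _ => 0 := by
        ext x
        refine hR x s ?_
        by_contra h3
        push Not at h3
        exact hs (abs_le.1 h3)
      unfold uu
      rw [this]
      simp [Real.fourierInv_eq', Real.fourier_eq']
    simp [h0]
  rw [Set.indicator_of_mem hs]
  have hτ : |t - s| ≤ Λ := by
    have h1 : |s| ≤ |R| := (abs_le.2 hs).trans (le_abs_self R)
    exact (abs_sub t s).trans (by linarith)
  obtain ⟨φ, hφ⟩ := hS s
  have hGφ : (fun x => G x s) = φ := funext hφ
  have hcs : HasCompactSupport (fun y => (b y : ℂ) * φ y) := by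
    have h1 : HasCompactSupport (fun x => (b x : ℂ)) := b.hasCompactSupport.comp_left (g := fun x : ℝ => (x:ℂ)) (by simp)
    exact h1.mul_right
  have hcd : ContDiff ℝ (⊤ : ℕ∞) (fun y => (b y : ℂ) * φ y) :=
    (Complex.ofRealCLM.contDiff.comp b.contDiff).mul (φ.smooth _)
  obtain ⟨f1, hf1v, i1⟩ : ∃ f1 : EuclideanSpace ℝ (Fin n) → ℂ, (∀ y, f1 y = (b y : ℂ) * φ y) ∧ Integrable f1 ∧ Integrable (𝓕 f1) :=
    ⟨fun y => (b y : ℂ) * φ y, fun _ => rfl, schwartz_int (h := fun y => (b y : ℂ) * φ y) ⟨hcs.toSchwartzMap hcd, fun _ => rfl⟩⟩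
  obtain ⟨f2, hf2v, i2⟩ : ∃ f2 : EuclideanSpace ℝ (Fin n) → ℂ, (∀ y, f2 y = (1 - (b y : ℂ)) * φ y) ∧ Integrable f2 ∧ Integrable (𝓕 f2) :=
    ⟨fun y => (1 - (b y : ℂ)) * φ y, fun _ => rfl, schwartz_int (h := fun y => (1 - (b y : ℂ)) * φ y) ⟨φ - hcs.toSchwartzMap hcd, fun y => by
      rw [SchwartzMap.sub_apply, HasCompactSupport.toSchwartzMap_toFun]; ring⟩⟩
  have hsplit : ∀ y, uu G t s y = 𝓕⁻ (fun ξ => (Real.sin ((t - s) * ‖ξ‖) : ℂ) * 𝓕 f1 ξ) y + 𝓕⁻ (fun ξ => (Real.sin ((t - s) * ‖ξ‖) : ℂ) * 𝓕 f2 ξ) y := by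
    intro y
    unfold uu
    rw [← fourierInv_add_fun (sin_mul_int _ i1.2) (sin_mul_int _ i2.2), hGφ]
    refine congrArg (fun F : EuclideanSpace ℝ (Fin n) → ℂ => 𝓕⁻ F y) (funext fun ξ => ?_)
    rw [← mul_add]
    congr 1
    have := fourier_add_fun i1.1 i2.1 ξ
    rw [← this]
    refine congrArg (fun F : EuclideanSpace ℝ (Fin n) → ℂ => 𝓕 F ξ) (funext fun x => ?_)
    rw [hf1v, hf2v]; ring
  have hb01 : ∀ y, 0 ≤ b y ∧ b y ≤ 1 := fun y => ⟨b.nonneg, b.le_one⟩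
  have hnear : ∫⁻ y in closedBall 0 L, ‖𝓕⁻ (fun ξ => (Real.sin ((t - s) * ‖ξ‖) : ℂ) * 𝓕 f1 ξ) y‖ₑ ≤
      vL + ENNReal.ofReal M ^ 2 * volume (closedBall (0:EuclideanSpace ℝ (Fin n)) (4 * Λ)) := by
    calc _ ≤ ∫⁻ y in closedBall 0 L, (1 + ‖𝓕⁻ (fun ξ => (Real.sin ((t - s) * ‖ξ‖) : ℂ) * 𝓕 f1 ξ) y‖ₑ ^ 2) := by
          refine lintegral_mono fun y => ?_
          have := rpow_le_one_add (a := ‖𝓕⁻ (fun ξ => (Real.sin ((t - s) * ‖ξ‖) : ℂ) * 𝓕 f1 ξ) y‖ₑ) (x := 1) (y := 2) (by norm_num) (by norm_num)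
          rw [ENNReal.rpow_one] at this
          exact_mod_cast this
      _ = vL + ∫⁻ y in closedBall 0 L, ‖𝓕⁻ (fun ξ => (Real.sin ((t - s) * ‖ξ‖) : ℂ) * 𝓕 f1 ξ) y‖ₑ ^ 2 := by
          rw [lintegral_add_left measurable_const, setLIntegral_const, one_mul]
      _ ≤ vL + ∫⁻ y, ‖𝓕⁻ (fun ξ => (Real.sin ((t - s) * ‖ξ‖) : ℂ) * 𝓕 f1 ξ) y‖ₑ ^ 2 :=
          add_le_add le_rfl (setLIntegral_le_lintegral _ _)
      _ ≤ vL + ∫⁻ ξ, ‖(Real.sin ((t - s) * ‖ξ‖) : ℂ) * 𝓕 f1 ξ‖ₑ ^ 2 :=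
          add_le_add le_rfl (plancherel_inv_le (sin_mul_int _ i1.2))
      _ ≤ vL + ∫⁻ ξ, ‖𝓕 f1 ξ‖ₑ ^ 2 := by
          refine add_le_add le_rfl (lintegral_mono fun ξ => ?_)
          refine pow_le_pow_left' (enorm_le_iff_norm_le.2 ?_) 2
          rw [norm_mul, Complex.norm_real]
          exact mul_le_of_le_one_left (norm_nonneg _) (Real.abs_sin_le_one _)
      _ ≤ vL + ∫⁻ y, ‖f1 y‖ₑ ^ 2 := add_le_add le_rfl (plancherel_le i1.1)
      _ ≤ vL + ∫⁻ y, (closedBall (0:EuclideanSpace ℝ (Fin n)) (4 * Λ)).indicator (fun _ => ENNReal.ofReal M ^ 2) y := by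
          refine add_le_add le_rfl (lintegral_mono fun y => ?_)
          by_cases hy : y ∈ closedBall (0:EuclideanSpace ℝ (Fin n)) (4 * Λ)
          · rw [Set.indicator_of_mem hy]
            refine pow_le_pow_left' ?_ 2
            rw [← ofReal_norm_eq_enorm]
            refine ENNReal.ofReal_le_ofReal ?_
            rw [hf1v, norm_mul, Complex.norm_real, Real.norm_of_nonneg (hb01 y).1, ← hφ]
            exact (mul_le_of_le_one_left (norm_nonneg _) (hb01 y).2).trans (hM (y, s) ⟨hy, hs⟩)
          · rw [Set.indicator_of_notMem hy]
            have : b y = 0 := b.zero_of_le_dist (by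
              simp only [mem_closedBall, not_le] at hy
              exact hy.le)
            simp [hf1v, this]
      _ = _ := by rw [lintegral_indicator measurableSet_closedBall, setLIntegral_const]
  have hfar' : ∀ y ∈ closedBall (0:EuclideanSpace ℝ (Fin n)) L, ‖𝓕⁻ (fun ξ => (Real.sin ((t - s) * ‖ξ‖) : ℂ) * 𝓕 f2 ξ) y‖ₑ ≤
      D * K * (1 + gS ρ q' G s) := by
    intro y hy
    have h1 := hfar Λ (t - s) hΛ1 hτ f2 i2.1 i2.2 (fun y hy => by
      have : b y = 1 := b.one_of_mem_closedBall (by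
        rw [mem_closedBall, dist_zero_right]
        exact hy.le)
      rw [hf2v, this]; simp) y (by
        rw [mem_closedBall, dist_zero_right] at hy
        linarith)
    have h2 : ‖𝓕⁻ (fun ξ => (Real.sin ((t - s) * ‖ξ‖) : ℂ) * 𝓕 f2 ξ) y‖ ≤ C * (1 + Λ) * ∫ y, (1 + ‖y‖) ^ (-((n:ℝ) + 1)) * ‖f2 y‖ := by
      refine h1.trans ?_
      have : 0 ≤ ∫ y, (1 + ‖y‖) ^ (-((n:ℝ) + 1)) * ‖f2 y‖ := integral_nonneg fun y => by positivity
      gcongr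
    rw [← ofReal_norm_eq_enorm]
    refine (ENNReal.ofReal_le_ofReal h2).trans ?_
    rw [ENNReal.ofReal_mul (by positivity), mul_assoc]
    refine mul_le_mul_right ?_ _
    have h3 : ENNReal.ofReal (∫ y, (1 + ‖y‖) ^ (-((n:ℝ) + 1)) * ‖f2 y‖) ≤ ∫⁻ y, ENNReal.ofReal ((1 + ‖y‖) ^ (-((n:ℝ) + 1))) * ‖G y s‖ₑ := by
      have := enorm_integral_le_lintegral_enorm (μ := volume) (fun y => (1 + ‖y‖) ^ (-((n:ℝ) + 1)) * ‖f2 y‖)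
      refine (le_of_eq_of_le (Real.enorm_of_nonneg (integral_nonneg fun y => by positivity)).symm this).trans (lintegral_mono fun y => ?_)
      rw [enorm_mul, Real.enorm_of_nonneg (by positivity), enorm_norm]
      refine mul_le_mul_right (enorm_le_iff_norm_le.2 ?_) _
      rw [hf2v, norm_mul, hφ]
      refine mul_le_of_le_one_left (norm_nonneg _) ?_
      rw [← Complex.ofReal_one, ← Complex.ofReal_sub, Complex.norm_real, Real.norm_of_nonneg (by linarith [(hb01 y).2])]
      linarith [(hb01 y).1]
    refine (h3.trans (hKh (fun y => G y s) ?_)).trans (mul_le_mul_right ?_ _)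
    · rw [hGφ]; exact φ.continuous.measurable
    · unfold gS
      exact rpow_le_one_add (by positivity) (by gcongr)
  calc _ ≤ ∫⁻ y in closedBall 0 L, (‖𝓕⁻ (fun ξ => (Real.sin ((t - s) * ‖ξ‖) : ℂ) * 𝓕 f1 ξ) y‖ₑ + D * K * (1 + gS ρ q' G s)) := by
        refine setLIntegral_mono' measurableSet_closedBall fun y hy => ?_
        rw [hsplit]
        exact (enorm_add_le _ _).trans (add_le_add le_rfl (hfar' y hy))
    _ = (∫⁻ y in closedBall 0 L, ‖𝓕⁻ (fun ξ => (Real.sin ((t - s) * ‖ξ‖) : ℂ) * 𝓕 f1 ξ) y‖ₑ) + D * K * (1 + gS ρ q' G s) * vL := by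
        rw [lintegral_add_right _ measurable_const, setLIntegral_const]
    _ ≤ _ := by
        refine (add_le_add hnear le_rfl).trans (le_of_eq ?_)
        ring

lemma uu_meas {G : EuclideanSpace ℝ (Fin n) → ℝ → ℂ} (hG : Continuous (fun z : EuclideanSpace ℝ (Fin n) × ℝ => G z.1 z.2)) (t : ℝ) :
    StronglyMeasurable (fun z : ℝ × EuclideanSpace ℝ (Fin n) => uu G t z.1 z.2) := by
  unfold uu
  simp only [Real.fourierInv_eq']
  refine StronglyMeasurable.integral_prod_right' (ν := volume) (f := fun w : (ℝ × EuclideanSpace ℝ (Fin n)) × EuclideanSpace ℝ (Fin n) =>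
    Complex.exp (↑(2 * Real.pi * inner ℝ w.2 w.1.2) * I) • ((Real.sin ((t - w.1.1) * ‖w.2‖) : ℂ) * 𝓕 (fun x => G x w.1.1) w.2)) ?_
  have h1 := (meas_fourier hG).measurable
  have h2 : Measurable (fun w : (ℝ × EuclideanSpace ℝ (Fin n)) × EuclideanSpace ℝ (Fin n) => 𝓕 (fun x => G x w.1.1) w.2) := by
    generalize hF : (fun z : EuclideanSpace ℝ (Fin n) × ℝ => 𝓕 (fun x => G x z.2) z.1) = F at h1
    have hF' : (fun w : (ℝ × EuclideanSpace ℝ (Fin n)) × EuclideanSpace ℝ (Fin n) => 𝓕 (fun x => G x w.1.1) w.2) = fun w => F (w.2, w.1.1) := by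
      rw [← hF]
    rw [hF']
    exact h1.comp (by fun_prop)
  have h3 : Continuous (fun w : (ℝ × EuclideanSpace ℝ (Fin n)) × EuclideanSpace ℝ (Fin n) => Complex.exp (↑(2 * Real.pi * inner ℝ w.2 w.1.2) * I)) := by fun_prop
  have h4 : Continuous (fun w : (ℝ × EuclideanSpace ℝ (Fin n)) × EuclideanSpace ℝ (Fin n) => (Real.sin ((t - w.1.1) * ‖w.2‖) : ℂ)) := by fun_prop
  exact (h3.measurable.smul (h4.measurable.mul h2)).stronglyMeasurable

lemma loc_fin (hn : 3 ≤ n) {ρ q' : ℝ} (hρ : 1 < ρ) (hq' : 1 ≤ q') {G : EuclideanSpace ℝ (Fin n) → ℝ → ℂ}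
    (hS : ∀ s, ∃ φ : 𝓢(EuclideanSpace ℝ (Fin n), ℂ), ∀ x, G x s = φ x)
    (hG : Continuous (fun z : EuclideanSpace ℝ (Fin n) × ℝ => G z.1 z.2))
    (hR : ∃ R : ℝ, ∀ x, ∀ s : ℝ, R < |s| → G x s = 0) (hfin : ∫⁻ s, gS ρ q' G s ≠ ⊤) (t L : ℝ) :
    Integrable (fun z : ℝ × EuclideanSpace ℝ (Fin n) => uu G t z.1 z.2) ((volume.restrict (Set.Ici t)).prod (volume.restrict (closedBall 0 L))) := by
  obtain ⟨R, hR⟩ := hR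
  obtain ⟨A, B, hA, hB, hAB⟩ := loc_bound hn hρ hq' hS hG hR t L
  refine ⟨(uu_meas hG t).aestronglyMeasurable, ?_⟩
  rw [hasFiniteIntegral_iff_enorm, lintegral_prod _ (uu_meas hG t).enorm.aemeasurable]
  refine lt_of_le_of_lt (setLIntegral_le_lintegral _ _) ?_
  refine lt_of_le_of_lt (lintegral_mono hAB) ?_
  rw [lintegral_add_left (measurable_const.indicator measurableSet_Icc), lintegral_const_mul _ (gS_meas hG), lintegral_indicator measurableSet_Icc, setLIntegral_const]
  have : volume (Set.Icc (-R) R) ≠ ⊤ := measure_Icc_lt_top.ne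
  finiteness

end locfin

section mainid

open Filter Topology

variable {n : ℕ}

lemma continuous_fourierInv {f : EuclideanSpace ℝ (Fin n) → ℂ} (hf : Integrable f) : Continuous (𝓕⁻ f) := by
  have h := (continuous_fourier_of_integrable hf).comp continuous_neg
  have e : 𝓕⁻ f = 𝓕 f ∘ fun x => -x := by
    ext x; rw [Real.fourierInv_eq_fourier_neg]; rfl
  rw [e]; exact h

lemma Psi_fourierInv (G : EuclideanSpace ℝ (Fin n) → ℝ → ℂ) (m : EuclideanSpace ℝ (Fin n) → ℂ) (x) (t s : ℝ) :
    Psi G m x t s = 𝓕⁻ (fun ξ => m ξ * (Real.sin ((t - s) * ‖ξ‖) : ℂ) * 𝓕 (fun x => G x s) ξ) x := by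
  unfold Psi
  rw [Real.fourierInv_eq']
  refine integral_congr_ae (ae_of_all _ fun ξ => ?_)
  simp only [smul_eq_mul]
  rw [real_inner_comm]
  push_cast
  rfl

lemma Psi_conv {G : EuclideanSpace ℝ (Fin n) → ℝ → ℂ} (hS : ∀ s, ∃ φ : 𝓢(EuclideanSpace ℝ (Fin n), ℂ), ∀ x, G x s = φ x)
    {m : EuclideanSpace ℝ (Fin n) → ℂ} (hmc : Continuous m) (hmi : Integrable m) (hQ : Integrable (𝓕⁻ m)) (x) (t s : ℝ) :
    ∫ y, 𝓕⁻ m (x - y) * uu G t s y = Psi G m x t s := by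
  have hg := sin_mul_int (t - s) (schwartz_int (hS s)).2
  have h1 := mul_shift hg hQ x
  have hQ' : Integrable (𝓕 m) := by
    have e : 𝓕 m = fun x => 𝓕⁻ m (-x) := by
      ext x; rw [Real.fourierInv_eq_fourier_neg, neg_neg]
    rw [e]; exact hQ.comp_neg
  rw [hmc.fourier_fourierInv_eq hmi hQ'] at h1
  rw [Psi_fourierInv, ← integral_sub_left_eq_self _ volume x]
  simp only [sub_sub_cancel]
  unfold uu
  simp only [mul_comm (𝓕⁻ m _)]
  rw [← h1]
  refine congrArg (fun F : EuclideanSpace ℝ (Fin n) → ℂ => 𝓕⁻ F x) (funext fun ξ => ?_)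
  ring

lemma U_conv (hn : 3 ≤ n) {ρ q' : ℝ} (hρ : 1 < ρ) (hq' : 1 ≤ q') {G : EuclideanSpace ℝ (Fin n) → ℝ → ℂ}
    (hS : ∀ s, ∃ φ : 𝓢(EuclideanSpace ℝ (Fin n), ℂ), ∀ x, G x s = φ x)
    (hG : Continuous (fun z : EuclideanSpace ℝ (Fin n) × ℝ => G z.1 z.2))
    (hR : ∃ R : ℝ, ∀ x, ∀ s : ℝ, R < |s| → G x s = 0) (hfin : ∫⁻ s, gS ρ q' G s ≠ ⊤) (t : ℝ)
    {m : EuclideanSpace ℝ (Fin n) → ℂ} (hmc : Continuous m) (hmi : Integrable m) (hL : ∃ L, ∀ x, L < ‖x‖ → 𝓕⁻ m x = 0)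
    (hU : Integrable (fun y => ∫ s in Set.Ici t, uu G t s y)) (x) :
    𝓕⁻ (fun ξ => m ξ * 𝓕 (fun y => ∫ s in Set.Ici t, uu G t s y) ξ) x = ∫ s in Set.Ici t, Psi G m x t s := by
  obtain ⟨L, hL⟩ := hL
  have hQc := continuous_fourierInv hmi
  have hQ : Integrable (𝓕⁻ m) := hQc.integrable_of_hasCompactSupport
    (HasCompactSupport.intro (isCompact_closedBall 0 L) fun x hx => hL x (by simpa using hx))
  rw [mul_shift hmi hU]
  have hint : Integrable (fun z : ℝ × EuclideanSpace ℝ (Fin n) => 𝓕⁻ m (x - z.2) * uu G t z.1 z.2) ((volume.restrict (Set.Ici t)).prod volume) := by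
    have h1 := loc_fin hn hρ hq' hS hG hR hfin t (‖x‖ + L)
    have h2 : Integrable (fun z : ℝ × EuclideanSpace ℝ (Fin n) => 𝓕⁻ m (x - z.2) * uu G t z.1 z.2)
        ((volume.restrict (Set.Ici t)).prod (volume.restrict (closedBall 0 (‖x‖ + L)))) := by
      refine h1.bdd_mul (c := ∫ ξ, ‖m ξ‖) ?_ (ae_of_all _ fun z => norm_fourierInv_le _)
      exact (hQc.comp (by fun_prop : Continuous fun z : ℝ × EuclideanSpace ℝ (Fin n) => x - z.2)).aestronglyMeasurable
    have h3 : (volume.restrict (Set.Ici t)).prod (volume.restrict (closedBall (0:EuclideanSpace ℝ (Fin n)) (‖x‖ + L))) =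
        ((volume.restrict (Set.Ici t)).prod volume).restrict (Set.univ ×ˢ closedBall 0 (‖x‖ + L)) := by
      rw [← Measure.prod_restrict, Measure.restrict_univ]
    rw [h3] at h2
    refine (integrableOn_iff_integrable_of_support_subset ?_).1 h2
    intro z hz
    rw [Function.mem_support] at hz
    refine ⟨Set.mem_univ _, ?_⟩
    rw [mem_closedBall, dist_zero_right]
    by_contra h
    push Not at h
    refine hz ?_
    rw [hL, zero_mul]
    have := norm_sub_norm_le z.2 x
    rw [norm_sub_rev] at this
    linarith
  have h4 := integral_integral_swap (f := fun (s : ℝ) (y : EuclideanSpace ℝ (Fin n)) => 𝓕⁻ m (x - y) * uu G t s y) hint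
  simp only [Psi_conv hS hmc hmi hQ] at h4
  rw [h4]
  simp only [integral_const_mul]

lemma W_lim (hn : 3 ≤ n) {ρ q' α c : ℝ} (hρ : 1 < ρ) (hq' : 1 ≤ q') {G : EuclideanSpace ℝ (Fin n) → ℝ → ℂ}
    (hS : ∀ s, ∃ φ : 𝓢(EuclideanSpace ℝ (Fin n), ℂ), ∀ x, G x s = φ x)
    (hG : Continuous (fun z : EuclideanSpace ℝ (Fin n) × ℝ => G z.1 z.2))
    (hR : ∃ R : ℝ, ∀ x, ∀ s : ℝ, R < |s| → G x s = 0) (hfin : ∫⁻ s, gS ρ q' G s ≠ ⊤) (t : ℝ) (hc : 0 < c)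
    {m : ℕ → EuclideanSpace ℝ (Fin n) → ℂ} (hmc : ∀ l, Continuous (m l)) (hmi : ∀ l, Integrable (m l))
    (hL : ∀ l, ∃ L, ∀ x, L < ‖x‖ → 𝓕⁻ (m l) x = 0) (hb : ∀ l ξ, ξ ≠ 0 → ‖m l ξ‖ ≤ c * ‖ξ‖ ^ (-α))
    (hlim : ∀ ξ, ξ ≠ 0 → Tendsto (fun l => m l ξ) atTop (𝓝 ((c * ‖ξ‖ ^ (-α) : ℝ) : ℂ))) (x) :
    𝓕⁻ (fun ξ : EuclideanSpace ℝ (Fin n) => ((‖ξ‖ ^ (-α) : ℝ) : ℂ) * 𝓕 (fun y => ∫ s in Set.Ici t, uu G t s y) ξ) x = 0 ∨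
    Tendsto (fun l => ∫ s in Set.Ici t, Psi G (m l) x t s) atTop
      (𝓝 (c * 𝓕⁻ (fun ξ : EuclideanSpace ℝ (Fin n) => ((‖ξ‖ ^ (-α) : ℝ) : ℂ) * 𝓕 (fun y => ∫ s in Set.Ici t, uu G t s y) ξ) x)) := by
  by_cases hU : Integrable (fun y => ∫ s in Set.Ici t, uu G t s y)
  swap
  · left
    have h0 : ∀ ξ, 𝓕 (fun y => ∫ s in Set.Ici t, uu G t s y) ξ = 0 := by
      intro ξ
      rw [Real.fourier_eq]
      refine integral_undef fun h => hU ?_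
      exact (Real.fourierIntegral_convergent_iff ξ).1 h
    simp [h0, Real.fourierInv_eq']
  simp only [← U_conv hn hρ hq' hS hG hR hfin t (hmc _) (hmi _) (hL _) hU]
  have hFc := continuous_fourier_of_integrable hU
  set F := 𝓕 (fun y => ∫ s in Set.Ici t, uu G t s y) with hF
  clear_value F
  by_cases hM : Integrable (fun ξ : EuclideanSpace ℝ (Fin n) => ((‖ξ‖ ^ (-α) : ℝ) : ℂ) * F ξ)
  swap
  · left
    rw [Real.fourierInv_eq_fourier_neg, Real.fourier_eq]
    refine integral_undef fun h => hM ?_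
    exact (Real.fourierIntegral_convergent_iff (-x)).1 h
  right
  haveI : NullSingletonClass (volume : Measure (EuclideanSpace ℝ (Fin n))) := by
    haveI : Nonempty (Fin n) := ⟨⟨0, by omega⟩⟩
    infer_instance
  have hne : ∀ᵐ ξ : EuclideanSpace ℝ (Fin n), ξ ≠ 0 := by
    rw [ae_iff]; simp
  simp only [Real.fourierInv_eq']
  rw [← integral_const_mul]
  refine tendsto_integral_of_dominated_convergence (fun ξ => c * ‖((‖ξ‖ ^ (-α) : ℝ) : ℂ) * F ξ‖) ?_ (hM.norm.const_mul c) ?_ ?_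
  · intro l
    have := hmc l
    exact (by fun_prop : Continuous _).aestronglyMeasurable
  · intro l
    filter_upwards [hne] with ξ hξ
    rw [norm_smul, Complex.norm_exp_ofReal_mul_I, one_mul, norm_mul, norm_mul, Complex.norm_real, Real.norm_of_nonneg (by positivity), ← mul_assoc]
    exact mul_le_mul_of_nonneg_right (hb l ξ hξ) (norm_nonneg _)
  · filter_upwards [hne] with ξ hξ
    have := ((hlim ξ hξ).mul_const (F ξ)).const_smul (Complex.exp (↑(2 * Real.pi * inner ℝ ξ x) * I))
    convert this using 2
    simp only [smul_eq_mul]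
    push_cast
    ring

end mainid

section trunc

open Filter Topology

variable {n : ℕ}

/-- kernel -/
def kk (m : EuclideanSpace ℝ (Fin n) → ℂ) (τ : ℝ) (z : EuclideanSpace ℝ (Fin n)) : ℂ :=
  𝓕⁻ (fun ξ => m ξ * (Real.sin (τ * ‖ξ‖) : ℂ)) z

lemma mul_sin_int {f : EuclideanSpace ℝ (Fin n) → ℂ} (τ : ℝ) (hf : Integrable f) :
    Integrable (fun ξ => f ξ * (Real.sin (τ * ‖ξ‖) : ℂ)) := by
  simp only [mul_comm (f _)]
  exact sin_mul_int τ hf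

lemma norm_mul_sin_le (m : EuclideanSpace ℝ (Fin n) → ℂ) (τ : ℝ) (ξ) : ‖m ξ * (Real.sin (τ * ‖ξ‖) : ℂ)‖ ≤ ‖m ξ‖ := by
  rw [norm_mul, Complex.norm_real]
  exact mul_le_of_le_one_right (norm_nonneg _) (Real.abs_sin_le_one _)

lemma kk_bd {m : EuclideanSpace ℝ (Fin n) → ℂ} (hmi : Integrable m) (τ z) : ‖kk m τ z‖ ≤ ∫ ξ, ‖m ξ‖ := by
  refine (norm_fourierInv_le z).trans ?_
  exact integral_mono (mul_sin_int τ hmi).norm hmi.norm fun ξ => norm_mul_sin_le m τ ξ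

lemma kk_L2 {m : EuclideanSpace ℝ (Fin n) → ℂ} (hmi : Integrable m) (τ) : ∫⁻ z, ‖kk m τ z‖ₑ ^ 2 ≤ ∫⁻ ξ, ‖m ξ‖ₑ ^ 2 := by
  refine (plancherel_inv_le (mul_sin_int τ hmi)).trans (lintegral_mono fun ξ => ?_)
  exact pow_le_pow_left' (enorm_le_iff_norm_le.2 (norm_mul_sin_le m τ ξ)) 2

lemma kk_meas {m : EuclideanSpace ℝ (Fin n) → ℂ} (hm : Measurable m) :
    StronglyMeasurable (fun w : ℝ × EuclideanSpace ℝ (Fin n) => kk m w.1 w.2) := by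
  unfold kk
  simp only [Real.fourierInv_eq']
  refine StronglyMeasurable.integral_prod_right' (ν := volume) (f := fun w : (ℝ × EuclideanSpace ℝ (Fin n)) × EuclideanSpace ℝ (Fin n) =>
    Complex.exp (↑(2 * Real.pi * inner ℝ w.2 w.1.2) * I) • (m w.2 * (Real.sin (w.1.1 * ‖w.2‖) : ℂ))) ?_
  have h3 : Continuous (fun w : (ℝ × EuclideanSpace ℝ (Fin n)) × EuclideanSpace ℝ (Fin n) => Complex.exp (↑(2 * Real.pi * inner ℝ w.2 w.1.2) * I)) := by fun_prop
  have h4 : Continuous (fun w : (ℝ × EuclideanSpace ℝ (Fin n)) × EuclideanSpace ℝ (Fin n) => (Real.sin (w.1.1 * ‖w.2‖) : ℂ)) := by fun_prop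
  exact (h3.measurable.smul ((hm.comp measurable_snd).mul h4.measurable)).stronglyMeasurable

lemma Psi_kk {G : EuclideanSpace ℝ (Fin n) → ℝ → ℂ} {m : EuclideanSpace ℝ (Fin n) → ℂ} (hmi : Integrable m) (x) (t s : ℝ)
    (hGi : Integrable (fun y => G y s)) : Psi G m x t s = ∫ y, kk m (t - s) (x - y) * G y s := by
  rw [Psi_fourierInv, mul_shift (mul_sin_int (t - s) hmi) hGi]
  rfl

attribute [irreducible] kk

lemma kkG_int {ρ q' : ℝ} (hρ : 1 < ρ) (hρ2 : ρ ≤ 2) (hq' : 1 ≤ q') {G : EuclideanSpace ℝ (Fin n) → ℝ → ℂ}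
    (hG : Continuous (fun z : EuclideanSpace ℝ (Fin n) × ℝ => G z.1 z.2))
    (hR : ∃ R : ℝ, ∀ x, ∀ s : ℝ, R < |s| → G x s = 0) (hfin : ∫⁻ s, gS ρ q' G s ≠ ⊤)
    {m : EuclideanSpace ℝ (Fin n) → ℂ} (hm : Measurable m) (hmi : Integrable m) (hmb : ∃ M, ∀ ξ, ‖m ξ‖ ≤ M) (t : ℝ) (x) :
    Integrable (fun z : ℝ × EuclideanSpace ℝ (Fin n) => kk m (t - z.1) (x - z.2) * G z.2 z.1) ((volume.restrict (Set.Ici t)).prod volume) := by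
  obtain ⟨R, hR⟩ := hR
  obtain ⟨M, hM⟩ := hmb
  have hM0 : 0 ≤ M := (norm_nonneg _).trans (hM 0)
  have hc : (Real.conjExponent ρ).HolderConjugate ρ := (Real.HolderConjugate.conjExponent hρ).symm
  set r := Real.conjExponent ρ with hr
  have hr2 : 2 ≤ r := by
    rw [hr, Real.conjExponent, le_div_iff₀ (by linarith)]; linarith
  have hm2 : ∫⁻ ξ, ‖m ξ‖ₑ ^ 2 ≠ ⊤ := by
    have h1 : ∫⁻ ξ, ‖m ξ‖ₑ ^ 2 ≤ ∫⁻ ξ, ENNReal.ofReal M * ‖m ξ‖ₑ := by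
      refine lintegral_mono fun ξ => ?_
      rw [pow_two]
      refine mul_le_mul_left ?_ _
      rw [← ofReal_norm_eq_enorm]
      exact ENNReal.ofReal_le_ofReal (hM ξ)
    refine ne_top_of_le_ne_top ?_ h1
    rw [lintegral_const_mul _ hm.enorm]
    exact ENNReal.mul_ne_top ENNReal.ofReal_ne_top hmi.2.ne
  set E := ENNReal.ofReal (∫ ξ, ‖m ξ‖) with hE
  set B := (E ^ (r - 2) * ∫⁻ ξ, ‖m ξ‖ₑ ^ 2) ^ (1 / r) with hB
  have hBt : B ≠ ⊤ := by
    refine ENNReal.rpow_ne_top_of_nonneg (by positivity) (ENNReal.mul_ne_top ?_ hm2)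
    exact ENNReal.rpow_ne_top_of_nonneg (by linarith) ENNReal.ofReal_ne_top
  have hkm : Measurable (fun z : ℝ × EuclideanSpace ℝ (Fin n) => kk m (t - z.1) (x - z.2)) := by
    have h := (kk_meas hm).measurable
    exact h.comp (by fun_prop : Measurable fun z : ℝ × EuclideanSpace ℝ (Fin n) => (t - z.1, x - z.2))
  have hGm : Measurable (fun z : ℝ × EuclideanSpace ℝ (Fin n) => G z.2 z.1) :=
    hG.measurable.comp (by fun_prop : Measurable fun z : ℝ × EuclideanSpace ℝ (Fin n) => (z.2, z.1))
  have hks : ∀ s, ∫⁻ y, ‖kk m (t - s) (x - y) * G y s‖ₑ ≤ (Set.Icc (-R) R).indicator (fun _ => B) s + B * gS ρ q' G s := by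
    intro s
    by_cases hs : s ∈ Set.Icc (-R) R
    swap
    · have : ∀ x, G x s = 0 := by
        intro x
        refine hR x s ?_
        by_contra h3
        push Not at h3
        exact hs (abs_le.1 h3)
      simp [this]
    rw [Set.indicator_of_mem hs]
    simp only [enorm_mul]
    have hk1 : Measurable (fun y => kk m (t - s) (x - y)) := hkm.comp (measurable_prodMk_left (x := s))
    have hG1 : Measurable (fun y => G y s) := hGm.comp (measurable_prodMk_left (x := s))
    refine (ENNReal.lintegral_mul_le_Lp_mul_Lq volume hc hk1.enorm.aemeasurable hG1.enorm.aemeasurable).trans ?_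
    have h1 : (∫⁻ y, ‖kk m (t - s) (x - y)‖ₑ ^ r) ^ (1 / r) ≤ B := by
      refine ENNReal.rpow_le_rpow ?_ (by positivity)
      rw [lintegral_sub_left_eq_self (fun y => ‖kk m (t - s) y‖ₑ ^ r) x]
      have hk2 : Measurable (fun y => kk m (t - s) y) := (kk_meas hm).measurable.comp (measurable_prodMk_left (x := t - s))
      calc _ ≤ ∫⁻ y, E ^ (r - 2) * ‖kk m (t - s) y‖ₑ ^ 2 := by
            refine lintegral_mono fun y => ?_
            have e : ‖kk m (t - s) y‖ₑ ^ r = ‖kk m (t - s) y‖ₑ ^ (r - 2) * ‖kk m (t - s) y‖ₑ ^ 2 := by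
              rw [← ENNReal.rpow_natCast, ← ENNReal.rpow_add_of_nonneg _ _ (by linarith) (by norm_num)]
              congr 1; push_cast; ring
            rw [e]
            refine mul_le_mul_left (ENNReal.rpow_le_rpow ?_ (by linarith)) _
            rw [← ofReal_norm_eq_enorm]
            exact ENNReal.ofReal_le_ofReal (kk_bd hmi _ _)
        _ = E ^ (r - 2) * ∫⁻ y, ‖kk m (t - s) y‖ₑ ^ 2 := lintegral_const_mul _ (hk2.enorm.pow_const 2)
        _ ≤ _ := mul_le_mul_right (kk_L2 hmi _) _
    have h2 : (∫⁻ y, ‖G y s‖ₑ ^ ρ) ^ (1 / ρ) ≤ 1 + gS ρ q' G s := by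
      unfold gS
      exact rpow_le_one_add (by positivity) (by gcongr)
    calc _ ≤ B * (1 + gS ρ q' G s) := mul_le_mul' h1 h2
      _ = _ := by ring
  have hprod : Measurable (fun z : ℝ × EuclideanSpace ℝ (Fin n) => kk m (t - z.1) (x - z.2) * G z.2 z.1) := hkm.mul hGm
  refine ⟨hprod.aestronglyMeasurable, ?_⟩
  rw [hasFiniteIntegral_iff_enorm, lintegral_prod _ hprod.enorm.aemeasurable]
  refine lt_of_le_of_lt (setLIntegral_le_lintegral _ _) ?_
  refine lt_of_le_of_lt (lintegral_mono hks) ?_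
  rw [lintegral_add_left (measurable_const.indicator measurableSet_Icc), lintegral_const_mul _ (gS_meas hG), lintegral_indicator measurableSet_Icc, setLIntegral_const]
  have : volume (Set.Icc (-R) R) ≠ ⊤ := measure_Icc_lt_top.ne
  finiteness

/-- cutoff -/
def cut (k : ℕ) (x : EuclideanSpace ℝ (Fin n)) : ℝ := max 0 (min 1 ((k:ℝ) + 1 - ‖x‖))

lemma cut_cont (k : ℕ) : Continuous (cut (n := n) k) := by unfold cut; fun_prop
lemma cut_nonneg (k : ℕ) (x : EuclideanSpace ℝ (Fin n)) : 0 ≤ cut k x := le_max_left _ _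
lemma cut_le (k : ℕ) (x : EuclideanSpace ℝ (Fin n)) : cut k x ≤ 1 := max_le zero_le_one (min_le_left _ _)
lemma cut_zero (k : ℕ) (x : EuclideanSpace ℝ (Fin n)) (h : (k:ℝ) + 1 < ‖x‖) : cut k x = 0 :=
  max_eq_left ((min_le_right _ _).trans (by linarith))
lemma cut_one (k : ℕ) (x : EuclideanSpace ℝ (Fin n)) (h : ‖x‖ ≤ k) : cut k x = 1 := by
  unfold cut; rw [min_eq_left (by linarith)]; norm_num
lemma cut_norm (k : ℕ) (x : EuclideanSpace ℝ (Fin n)) (w : ℂ) : ‖(cut k x : ℂ) * w‖ ≤ ‖w‖ := by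
  rw [norm_mul, Complex.norm_real, Real.norm_of_nonneg (cut_nonneg k x)]
  exact mul_le_of_le_one_left (norm_nonneg _) (cut_le k x)

lemma cut_nice {G : EuclideanSpace ℝ (Fin n) → ℝ → ℂ}
    (hG : Continuous (fun z : EuclideanSpace ℝ (Fin n) × ℝ => G z.1 z.2))
    (hR : ∃ R : ℝ, ∀ x, ∀ s : ℝ, R < |s| → G x s = 0) (k : ℕ) : NiceG (fun x s => (cut k x : ℂ) * G x s) := by
  obtain ⟨R, hR⟩ := hR
  refine ⟨?_, max ((k:ℝ) + 1) R, ?_⟩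
  · exact (Complex.continuous_ofReal.comp ((cut_cont k).comp continuous_fst)).mul hG
  · rintro x s (h | h)
    · simp only [cut_zero k x (lt_of_le_of_lt (le_max_left _ _) h), Complex.ofReal_zero, zero_mul]
    · simp only [hR x s (lt_of_le_of_lt (le_max_right _ _) h), mul_zero]

lemma cut_lim {ρ q' : ℝ} (hρ : 1 < ρ) (hρ2 : ρ ≤ 2) (hq' : 1 ≤ q') {G : EuclideanSpace ℝ (Fin n) → ℝ → ℂ}
    (hS : ∀ s, ∃ φ : 𝓢(EuclideanSpace ℝ (Fin n), ℂ), ∀ x, G x s = φ x)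
    (hG : Continuous (fun z : EuclideanSpace ℝ (Fin n) × ℝ => G z.1 z.2))
    (hR : ∃ R : ℝ, ∀ x, ∀ s : ℝ, R < |s| → G x s = 0) (hfin : ∫⁻ s, gS ρ q' G s ≠ ⊤)
    {m : EuclideanSpace ℝ (Fin n) → ℂ} (hm : Measurable m) (hmi : Integrable m) (hmb : ∃ M, ∀ ξ, ‖m ξ‖ ≤ M) (t : ℝ) (x) :
    Tendsto (fun k : ℕ => ∫ s in Set.Ici t, Psi (fun x s => (cut k x : ℂ) * G x s) m x t s) atTop (𝓝 (∫ s in Set.Ici t, Psi G m x t s)) := by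
  have hI := kkG_int hρ hρ2 hq' hG hR hfin hm hmi hmb t x
  have e1 : ∫ s in Set.Ici t, Psi G m x t s = ∫ z : ℝ × EuclideanSpace ℝ (Fin n), kk m (t - z.1) (x - z.2) * G z.2 z.1 ∂((volume.restrict (Set.Ici t)).prod volume) := by
    rw [integral_prod _ hI]
    simp only [Psi_kk hmi x t _ (schwartz_int (hS _)).1]
  have hcm : ∀ k : ℕ, Continuous (fun z : ℝ × EuclideanSpace ℝ (Fin n) => (cut k z.2 : ℂ)) := fun k =>
    Complex.continuous_ofReal.comp ((cut_cont k).comp continuous_snd)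
  have hIk : ∀ k : ℕ, Integrable (fun z : ℝ × EuclideanSpace ℝ (Fin n) => kk m (t - z.1) (x - z.2) * ((cut k z.2 : ℂ) * G z.2 z.1))
      ((volume.restrict (Set.Ici t)).prod volume) := by
    intro k
    have := hI.bdd_mul (c := 1) (hcm k).aestronglyMeasurable (ae_of_all _ fun z => by
      rw [Complex.norm_real, Real.norm_of_nonneg (cut_nonneg k _)]; exact cut_le k _)
    refine this.congr (ae_of_all _ fun z => ?_)
    simp only
    ring
  have e2 : ∀ k : ℕ, ∫ s in Set.Ici t, Psi (fun x s => (cut k x : ℂ) * G x s) m x t s =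
      ∫ z : ℝ × EuclideanSpace ℝ (Fin n), kk m (t - z.1) (x - z.2) * ((cut k z.2 : ℂ) * G z.2 z.1) ∂((volume.restrict (Set.Ici t)).prod volume) := by
    intro k
    rw [integral_prod _ (hIk k)]
    simp only [Psi_kk (G := fun x s => (cut k x : ℂ) * G x s) hmi x t _ ((cut_nice hG hR k).integrable _)]
  rw [e1]
  simp only [e2]
  refine tendsto_integral_of_dominated_convergence (fun z : ℝ × EuclideanSpace ℝ (Fin n) => ‖kk m (t - z.1) (x - z.2) * G z.2 z.1‖) (fun k => (hIk k).1) hI.norm ?_ ?_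
  · intro k
    filter_upwards with z
    rw [norm_mul, norm_mul (kk m _ _) (G _ _)]
    exact mul_le_mul_of_nonneg_left (cut_norm k _ _) (norm_nonneg _)
  · filter_upwards with z
    refine tendsto_const_nhds.congr' ?_
    obtain ⟨K, hK⟩ := exists_nat_ge ‖z.2‖
    filter_upwards [eventually_ge_atTop K] with k hk
    rw [cut_one k z.2 (hK.trans (by exact_mod_cast hk))]
    simp

/-- estimate for non-compactly supported data -/
lemma retarded_full (hn : 3 ≤ n) {p β θ ρ q q' α : ℝ} (hp : ((n : ℝ) - 1) / 2 < p) (hβ : ((n : ℝ) + 1) / 2 ≤ β) (hβn : β < n)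
    (hθ0 : 0 < θ) (hθ1 : θ < 1) (hρ : ρ * (1 + θ) = 2) (hq : 2 < q) (hq' : 1 / q + 1 / q' = 1)
    (hβq : (β - n) * θ = -(2 / q)) (hα : 1 - 2 * α = -(β * θ)) (hρ1 : 1 < ρ) (hρ2 : ρ ≤ 2) (hq1 : 1 ≤ q') :
    ∃ C : ℝ, 0 < C ∧ ∀ (v : EuclideanSpace ℝ (Fin n) → ℝ) (N : ℝ), Measurable v → (∀ x, 0 ≤ v x) → 0 ≤ N → Mor p N v →
      ∀ (m : EuclideanSpace ℝ (Fin n) → ℂ) (c : ℝ), Measurable m → Integrable m → (∃ M, ∀ ξ, ‖m ξ‖ ≤ M) → 0 ≤ c →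
      (∀ ξ, ξ ≠ 0 → ‖m ξ‖ ≤ c * ‖ξ‖ ^ (-α)) → ∀ G : EuclideanSpace ℝ (Fin n) → ℝ → ℂ,
      (∀ s, ∃ φ : 𝓢(EuclideanSpace ℝ (Fin n), ℂ), ∀ x, G x s = φ x) →
      Continuous (fun z : EuclideanSpace ℝ (Fin n) × ℝ => G z.1 z.2) →
      (∃ R : ℝ, ∀ x, ∀ s : ℝ, R < |s| → G x s = 0) → ∫⁻ s, gS ρ q' G s ≠ ⊤ →
      Measurable (fun y : ℝ × EuclideanSpace ℝ (Fin n) => ∫ s in Set.Ici y.1, Psi G m y.2 y.1 s) ∧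
      ∫⁻ y : ℝ × EuclideanSpace ℝ (Fin n), ‖∫ s in Set.Ici y.1, Psi G m y.2 y.1 s‖ₑ ^ 2 * ENNReal.ofReal (v y.2) ≤
        ENNReal.ofReal (C * c ^ 2 * N) * (∫⁻ s, gS ρ q' G s) ^ (2 / q') := by
  obtain ⟨C, hC, H⟩ := retarded hn hp hβ hβn hθ0 hθ1 hρ hq hq' hβq hα
  refine ⟨C, hC, ?_⟩
  intro v N hv hv0 hN hMor m c hm hmi hmb hc hmc G hS hG hR hfin
  have hlim : ∀ y : ℝ × EuclideanSpace ℝ (Fin n), Tendsto (fun k : ℕ => ∫ s in Set.Ici y.1, Psi (fun x s => (cut k x : ℂ) * G x s) m y.2 y.1 s) atTop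
      (𝓝 (∫ s in Set.Ici y.1, Psi G m y.2 y.1 s)) := fun y => cut_lim hρ1 hρ2 hq1 hS hG hR hfin hm hmi hmb y.1 y.2
  have hmk : ∀ k : ℕ, Measurable (fun y : ℝ × EuclideanSpace ℝ (Fin n) => ∫ s in Set.Ici y.1, Psi (fun x s => (cut k x : ℂ) * G x s) m y.2 y.1 s) := by
    intro k
    have hN := cut_nice hG hR k
    have : (fun y : ℝ × EuclideanSpace ℝ (Fin n) => ∫ s in Set.Ici y.1, Psi (fun x s => (cut k x : ℂ) * G x s) m y.2 y.1 s) =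
       fun y => (2 * I)⁻¹ * ((∫ s in Set.Ici y.1, Phi (fun x s => (cut k x : ℂ) * G x s) m 1 y s) - ∫ s in Set.Ici y.1, Phi (fun x s => (cut k x : ℂ) * G x s) m (-1) y s) := by
      ext y
      simp only [Psi_eq hN hmi]
      rw [integral_const_mul, integral_sub]
      · exact (Phi_integrable hN hm hmi 1 y).integrableOn
      · exact (Phi_integrable hN hm hmi (-1) y).integrableOn
    rw [this]
    exact ((Psi_meas hN hm hmi 1).sub (Psi_meas hN hm hmi (-1))).const_mul _
  have hmeas := measurable_of_tendsto_metrizable hmk (tendsto_pi_nhds.2 hlim)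
  refine ⟨hmeas, ?_⟩
  refine fatou_le (f := fun k y => ‖∫ s in Set.Ici y.1, Psi (fun x s => (cut k x : ℂ) * G x s) m y.2 y.1 s‖ₑ ^ 2 * ENNReal.ofReal (v y.2)) ?_ ?_ ?_
  · intro k
    exact (((hmk k).enorm.pow_const 2).mul (hv.comp measurable_snd).ennreal_ofReal).aemeasurable
  · filter_upwards with y
    refine ENNReal.Tendsto.mul_const ?_ (Or.inr ENNReal.ofReal_ne_top)
    exact ((ENNReal.continuous_pow 2).tendsto _).comp (hlim y).enorm
  · intro k
    refine (H v N hv hv0 hN hMor m c hm hmi hc hmc _ (cut_nice hG hR k)).trans (mul_le_mul_right ?_ _)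
    have hq0 : 0 < q' := by linarith
    refine ENNReal.rpow_le_rpow (lintegral_mono fun s => ?_) (by positivity)
    unfold gS
    refine ENNReal.rpow_le_rpow (lintegral_mono fun y => ?_) (by positivity)
    exact ENNReal.rpow_le_rpow (enorm_le_iff_norm_le.2 (cut_norm k _ _)) (by linarith)

end trunc

section final

open Filter Topology

variable {n : ℕ}

lemma final_est (hn : 3 ≤ n) {p β θ ρ q q' α : ℝ} (hp : ((n : ℝ) - 1) / 2 < p) (hβ : ((n : ℝ) + 1) / 2 ≤ β) (hβn : β < n)
    (hθ0 : 0 < θ) (hθ1 : θ < 1) (hρ : ρ * (1 + θ) = 2) (hq : 2 < q) (hq' : 1 / q + 1 / q' = 1)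
    (hβq : (β - n) * θ = -(2 / q)) (hα : 1 - 2 * α = -(β * θ)) (hρ1 : 1 < ρ) (hρ2 : ρ ≤ 2) (hq1 : 1 ≤ q') (hα0 : 0 < α) (hαn : α < n) :
    ∃ C : ℝ, 0 < C ∧ ∀ (v : EuclideanSpace ℝ (Fin n) → ℝ) (N : ℝ), Measurable v → (∀ x, 0 ≤ v x) → 0 ≤ N → Mor p N v →
      ∀ G : EuclideanSpace ℝ (Fin n) → ℝ → ℂ,
      (∀ s, ∃ φ : 𝓢(EuclideanSpace ℝ (Fin n), ℂ), ∀ x, G x s = φ x) →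
      Continuous (fun z : EuclideanSpace ℝ (Fin n) × ℝ => G z.1 z.2) →
      (∃ R : ℝ, ∀ x, ∀ s : ℝ, R < |s| → G x s = 0) → ∫⁻ s, gS ρ q' G s ≠ ⊤ →
      ∫⁻ t : ℝ, ∫⁻ x : EuclideanSpace ℝ (Fin n),
        ‖𝓕⁻ (fun ξ : EuclideanSpace ℝ (Fin n) => ((‖ξ‖ ^ (-α) : ℝ) : ℂ) * 𝓕 (fun y => ∫ s in Set.Ici t, uu G t s y) ξ) x‖ₑ ^ 2 * ENNReal.ofReal (v x) ≤
        ENNReal.ofReal (C * N) * (∫⁻ s, gS ρ q' G s) ^ (2 / q') := by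
  obtain ⟨C, hC, H⟩ := retarded_full hn hp hβ hβn hθ0 hθ1 hρ hq hq' hβq hα hρ1 hρ2 hq1
  obtain ⟨c, m, hc, hmc, hmi, hmb, hmL, hmd, hml⟩ := exists_ml hn hα0 hαn
  refine ⟨C, hC, ?_⟩
  intro v N hv hv0 hN hMor G hS hG hR hfin
  have hA := fun l => H v N hv hv0 hN hMor (m l) c (hmc l).measurable (hmi l) (hmb l) hc.le (hmd l) G hS hG hR hfin
  have hW := fun (t : ℝ) (x : EuclideanSpace ℝ (Fin n)) => W_lim hn hρ1 hq1 hS hG hR hfin t hc hmc hmi hmL hmd hml x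
  generalize hWd : (fun (t : ℝ) (x : EuclideanSpace ℝ (Fin n)) =>
    𝓕⁻ (fun ξ : EuclideanSpace ℝ (Fin n) => ((‖ξ‖ ^ (-α) : ℝ) : ℂ) * 𝓕 (fun y => ∫ s in Set.Ici t, uu G t s y) ξ) x) = W
  have hWe : ∀ t x, 𝓕⁻ (fun ξ : EuclideanSpace ℝ (Fin n) => ((‖ξ‖ ^ (-α) : ℝ) : ℂ) * 𝓕 (fun y => ∫ s in Set.Ici t, uu G t s y) ξ) x = W t x := by
    intro t x; rw [← hWd]
  simp only [hWe] at hW ⊢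
  generalize hAd : (fun (l : ℕ) (y : ℝ × EuclideanSpace ℝ (Fin n)) => ∫ s in Set.Ici y.1, Psi G (m l) y.2 y.1 s) = A
  have hAe : ∀ l y, ∫ s in Set.Ici y.1, Psi G (m l) y.2 y.1 s = A l y := by
    intro l y; rw [← hAd]
  simp only [hAe] at hA
  have hW' : ∀ t x, W t x = 0 ∨ Tendsto (fun l => A l (t, x)) atTop (𝓝 (c * W t x)) := by
    intro t x
    have := hW t x
    simpa only [← hAe] using this
  set E := ENNReal.ofReal (c⁻¹) with hE
  have hmeasf : ∀ l, Measurable (fun y : ℝ × EuclideanSpace ℝ (Fin n) => E ^ 2 * (‖A l y‖ₑ ^ 2 * ENNReal.ofReal (v y.2))) := fun l =>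
    (((hA l).1.enorm.pow_const 2).mul (hv.comp measurable_snd).ennreal_ofReal).const_mul _
  have hpt : ∀ t x, ‖W t x‖ₑ ^ 2 * ENNReal.ofReal (v x) ≤ liminf (fun l => E ^ 2 * (‖A l (t, x)‖ₑ ^ 2 * ENNReal.ofReal (v x))) atTop := by
    intro t x
    rcases hW' t x with h | h
    · rw [h]; simp
    · have h1 : Tendsto (fun l => E ^ 2 * (‖A l (t, x)‖ₑ ^ 2 * ENNReal.ofReal (v x))) atTop (𝓝 (E ^ 2 * (‖c * W t x‖ₑ ^ 2 * ENNReal.ofReal (v x)))) := by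
        refine ENNReal.Tendsto.const_mul (ENNReal.Tendsto.mul_const ?_ (Or.inr ENNReal.ofReal_ne_top)) (Or.inr (by finiteness))
        exact ((ENNReal.continuous_pow 2).tendsto _).comp h.enorm
      rw [h1.liminf_eq]
      have h2 : ‖(c:ℂ)‖ₑ = ENNReal.ofReal c := by
        rw [← ofReal_norm_eq_enorm, Complex.norm_real, Real.norm_of_nonneg hc.le]
      rw [enorm_mul, mul_pow, h2, ← mul_assoc, ← mul_assoc, ← mul_pow, hE, ← ENNReal.ofReal_mul (by positivity), inv_mul_cancel₀ hc.ne']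
      simp
  calc _ ≤ ∫⁻ t : ℝ, ∫⁻ x : EuclideanSpace ℝ (Fin n), liminf (fun l => E ^ 2 * (‖A l (t, x)‖ₑ ^ 2 * ENNReal.ofReal (v x))) atTop :=
        lintegral_mono fun t => lintegral_mono fun x => hpt t x
    _ = ∫⁻ y : ℝ × EuclideanSpace ℝ (Fin n), liminf (fun l => E ^ 2 * (‖A l y‖ₑ ^ 2 * ENNReal.ofReal (v y.2))) atTop := by
        rw [Measure.volume_eq_prod, lintegral_prod _ (Measurable.liminf hmeasf).aemeasurable]
    _ ≤ liminf (fun l => ∫⁻ y : ℝ × EuclideanSpace ℝ (Fin n), E ^ 2 * (‖A l y‖ₑ ^ 2 * ENNReal.ofReal (v y.2))) atTop := lintegral_liminf_le hmeasf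
    _ ≤ liminf (fun _ : ℕ => ENNReal.ofReal (C * N) * (∫⁻ s, gS ρ q' G s) ^ (2 / q')) atTop := by
        refine liminf_le_liminf (Eventually.of_forall fun l => ?_)
        have hml : Measurable (fun y : ℝ × EuclideanSpace ℝ (Fin n) => ‖A l y‖ₑ ^ 2 * ENNReal.ofReal (v y.2)) :=
          ((hA l).1.enorm.pow_const 2).mul (hv.comp measurable_snd).ennreal_ofReal
        rw [lintegral_const_mul _ hml]
        refine (mul_le_mul_right (hA l).2 _).trans (le_of_eq ?_)
        rw [← mul_assoc, hE, ← ENNReal.ofReal_pow (by positivity), ← ENNReal.ofReal_mul (by positivity)]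
        congr 2
        field_simp
    _ = _ := by simp

end final

lemma fp_mor {n : ℕ} {p : ℝ} (hp : 0 < p) {V : EuclideanSpace ℝ (Fin n) → ℂ} (h : fpNorm n p V < ⊤) :
    Mor p (fpNorm n p V).toReal (fun x => ‖V x‖) := by
  intro x r hr
  set N := (fpNorm n p V).toReal with hN
  have hN0 : 0 ≤ N := ENNReal.toReal_nonneg
  have hNe : fpNorm n p V = ENNReal.ofReal N := (ENNReal.ofReal_toReal h.ne).symm
  have h1 : ENNReal.ofReal (r ^ (2 - n / p)) * (∫⁻ y in ball x r, ENNReal.ofReal (‖V y‖ ^ p)) ^ (1 / p) ≤ ENNReal.ofReal N := by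
    rw [← hNe]
    unfold fpNorm
    exact le_iSup_of_le x (le_iSup_of_le r (le_iSup_of_le hr le_rfl))
  set J := ∫⁻ y in ball x r, ENNReal.ofReal (‖V y‖ ^ p) with hJ
  have h2 : J ^ (1 / p) ≤ ENNReal.ofReal (r ^ ((n:ℝ) / p - 2) * N) := by
    have h3 := mul_le_mul_right h1 (ENNReal.ofReal (r ^ ((n:ℝ) / p - 2)))
    rw [← mul_assoc, ← ENNReal.ofReal_mul (by positivity), ← Real.rpow_add hr, ← ENNReal.ofReal_mul (by positivity)] at h3
    have h4 : (n:ℝ) / p - 2 + (2 - n / p) = 0 := by ring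
    rwa [h4, Real.rpow_zero, ENNReal.ofReal_one, one_mul] at h3
  have h5 := ENNReal.rpow_le_rpow h2 hp.le
  rw [← ENNReal.rpow_mul, one_div_mul_cancel hp.ne', ENNReal.rpow_one, ENNReal.ofReal_rpow_of_nonneg (by positivity) hp.le,
    Real.mul_rpow (by positivity) hN0, ← Real.rpow_mul hr.le, mul_comm] at h5
  have h6 : ((n:ℝ) / p - 2) * p = n - 2 * p := by field_simp
  rwa [h6] at h5

lemma mor_zero {n : ℕ} {p : ℝ} (hp : 0 < p) {V : EuclideanSpace ℝ (Fin n) → ℂ} (hV : Measurable V)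
    (h : Mor p 0 (fun x => ‖V x‖)) : ∀ᵐ x, V x = 0 := by
  have h1 : ∀ k : ℕ, ∀ᵐ x ∂(volume.restrict (ball (0:EuclideanSpace ℝ (Fin n)) ((k:ℝ) + 1))), V x = 0 := by
    intro k
    have h2 := h 0 ((k:ℝ) + 1) (by positivity)
    rw [Real.zero_rpow hp.ne', zero_mul, ENNReal.ofReal_zero, nonpos_iff_eq_zero, lintegral_eq_zero_iff (by fun_prop)] at h2
    filter_upwards [h2] with x hx
    simp only [Pi.zero_apply, ENNReal.ofReal_eq_zero] at hx
    have h3 : ‖V x‖ ^ p = 0 := le_antisymm hx (by positivity)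
    rw [Real.rpow_eq_zero (norm_nonneg _) hp.ne'] at h3
    exact norm_eq_zero.1 h3
  have h2 := (ae_restrict_iUnion_iff (μ := volume) (fun k : ℕ => ball (0:EuclideanSpace ℝ (Fin n)) ((k:ℝ) + 1)) (fun x => V x = 0)).2 h1
  have h3 : ⋃ k : ℕ, ball (0:EuclideanSpace ℝ (Fin n)) ((k:ℝ) + 1) = Set.univ := by
    refine Set.eq_univ_of_forall fun x => ?_
    obtain ⟨k, hk⟩ := exists_nat_ge ‖x‖
    refine Set.mem_iUnion.2 ⟨k, ?_⟩
    rw [mem_ball, dist_zero_right]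
    linarith
  rwa [h3, Measure.restrict_univ] at h2

set_option maxHeartbeats 1000000

/-- Weighted space-time `L²` estimate for the advanced
inhomogeneous wave term. -/
theorem weighted_L2_advanced (n : ℕ) (hn : 3 ≤ n) (p q r q' r' σ : ℝ)
    (hp : ((n : ℝ) - 1) / 2 < p) (hq : 2 < q) (hr : 2 ≤ r)
    (hadm : 2 / q + ((n : ℝ) - 1) / r ≤ ((n : ℝ) - 1) / 2)
    (hσ : σ = 1 / q + (n : ℝ) / r - ((n : ℝ) - 1) / 2)
    (hq' : 1 / q + 1 / q' = 1) (hr' : 1 / r + 1 / r' = 1) :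
    ∃ C > (0 : ℝ), ∀ V : EuclideanSpace ℝ (Fin n) → ℂ, Measurable V →
      fpNorm n p V < ⊤ →
      ∀ G : EuclideanSpace ℝ (Fin n) → ℝ → ℂ,
        (∀ s : ℝ, IsSchwartz (fun x => G x s)) →
        Continuous (fun z : EuclideanSpace ℝ (Fin n) × ℝ => G z.1 z.2) →
        (∃ R : ℝ, ∀ x, ∀ s : ℝ, R < |s| → G x s = 0) →
        wtNorm n (fun x => (‖V x‖₊ : ℝ≥0∞))
            (fun x t => mOp n (powMult (σ - 1))
              (fun y => ∫ s in Set.Ici t, mOp n (sinMult (t - s)) (fun z => G z s) y) x) ≤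
          ENNReal.ofReal C * fpNorm n p V ^ ((1 : ℝ) / 2) * mixedNorm n q' r' G := by
  have hn3 : (3:ℝ) ≤ n := by exact_mod_cast hn
  have hp0 : 0 < p := by linarith
  have hq0 : 0 < q := by linarith
  have hr0 : 0 < r := by linarith
  have hiq : 0 < 1 / q := by positivity
  have hir : 0 < 1 / r := by positivity
  have hiq2 : 1 / q < 1 / 2 := one_div_lt_one_div_of_lt (by norm_num) hq
  have ea : 2 / q = 2 * (1 / q) := by ring
  have eb : ((n:ℝ) - 1) / r = ((n:ℝ) - 1) * (1 / r) := by ring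
  have ec : (n:ℝ) / r = n * (1 / r) := by ring
  have ed : (2:ℝ) / r = 2 * (1 / r) := by ring
  rw [ea, eb] at hadm
  rw [ec] at hσ
  have hir2 : 1 / r < 1 / 2 := by
    by_contra hcon
    push Not at hcon
    have : ((n:ℝ) - 1) * (1 / 2) ≤ ((n:ℝ) - 1) * (1 / r) := mul_le_mul_of_nonneg_left hcon (by linarith)
    linarith
  set a := 1 / q with ha
  set b := 1 / r with hb
  have hq'i : 1 / q' = 1 - a := by linarith
  have hr'i : 1 / r' = 1 - b := by linarith
  have hq'0 : 0 < q' := one_div_pos.1 (by rw [hq'i]; linarith)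
  have hr'0 : 0 < r' := one_div_pos.1 (by rw [hr'i]; linarith)
  have hq'm : q' * (1 - a) = 1 := by rw [← hq'i]; field_simp
  have hr'm : r' * (1 - b) = 1 := by rw [← hr'i]; field_simp
  have hq'1 : 1 ≤ q' := by nlinarith
  have hr'1 : 1 < r' := by nlinarith
  have hr'2 : r' ≤ 2 := by nlinarith
  obtain ⟨θ, hθ⟩ : ∃ θ : ℝ, θ = 1 - 2 * b := ⟨_, rfl⟩
  have hθ0 : 0 < θ := by linarith
  have hθ1 : θ < 1 := by linarith
  obtain ⟨s0, hs0⟩ : ∃ s0 : ℝ, s0 = n / 2 - n * b - a := ⟨_, rfl⟩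
  obtain ⟨β, hβ⟩ : ∃ β : ℝ, β = 2 * s0 / θ := ⟨_, rfl⟩
  have hβθ : β * θ = 2 * s0 := by rw [hβ]; field_simp
  have hs0n : 2 * s0 = n * θ - 2 * a := by rw [hs0, hθ]; ring
  have hβ1 : ((n:ℝ) + 1) / 2 ≤ β := by
    rw [hβ, le_div_iff₀ hθ0, hs0n, hθ]; nlinarith
  have hβn : β < n := by
    rw [hβ, div_lt_iff₀ hθ0, hs0n]; linarith
  have hs0p : 0 < s0 := by nlinarith
  obtain ⟨C, hC, H⟩ := final_est (n := n) (p := p) (β := β) (θ := θ) (ρ := r') (q := q) (q' := q') (α := 1 - σ) hn hp hβ1 hβn hθ0 hθ1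
    (by rw [hθ]; linarith) hq hq' (by rw [sub_mul, hβθ, hs0n, ea]; ring) (by rw [hβθ, hs0, hσ]; ring) hr'1 hr'2 hq'1
    (by rw [hσ]; linarith) (by rw [hσ]; nlinarith)
  refine ⟨Real.sqrt C, Real.sqrt_pos.2 hC, ?_⟩
  intro V hV hfp G hS hG hR
  have hMor := fp_mor hp0 hfp
  set N := (fpNorm n p V).toReal with hN
  have hN0 : 0 ≤ N := ENNReal.toReal_nonneg
  have hNe : fpNorm n p V = ENNReal.ofReal N := (ENNReal.ofReal_toReal hfp.ne).symm
  have hmix : mixedNorm n q' r' G = (∫⁻ s, gS r' q' G s) ^ (1 / q') := rfl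
  rw [hmix, hNe]
  have hlhs : wtNorm n (fun x => (‖V x‖₊ : ℝ≥0∞))
            (fun x t => mOp n (powMult (σ - 1))
              (fun y => ∫ s in Set.Ici t, mOp n (sinMult (t - s)) (fun z => G z s) y) x) =
      (∫⁻ t : ℝ, ∫⁻ x : EuclideanSpace ℝ (Fin n),
        ‖𝓕⁻ (fun ξ : EuclideanSpace ℝ (Fin n) => ((‖ξ‖ ^ (-(1 - σ)) : ℝ) : ℂ) * 𝓕 (fun y => ∫ s in Set.Ici t, uu G t s y) ξ) x‖ₑ ^ 2 * ENNReal.ofReal ‖V x‖) ^ ((1:ℝ) / 2) := by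
    unfold wtNorm
    have e : σ - 1 = -(1 - σ) := by ring
    rw [e]
    congr 1
    refine lintegral_congr fun t => lintegral_congr fun x => ?_
    rw [ofReal_norm_eq_enorm, ENNReal.rpow_two]
    rfl
  by_cases hfin : ∫⁻ s, gS r' q' G s = ⊤
  · by_cases hN00 : N = 0
    · rw [hN00] at hMor
      have hV0 := mor_zero hp0 hV hMor
      have : wtNorm n (fun x => (‖V x‖₊ : ℝ≥0∞))
            (fun x t => mOp n (powMult (σ - 1))
              (fun y => ∫ s in Set.Ici t, mOp n (sinMult (t - s)) (fun z => G z s) y) x) = 0 := by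
        rw [hlhs]
        have h0 : ∀ t : ℝ, ∫⁻ x : EuclideanSpace ℝ (Fin n),
            ‖𝓕⁻ (fun ξ : EuclideanSpace ℝ (Fin n) => ((‖ξ‖ ^ (-(1 - σ)) : ℝ) : ℂ) * 𝓕 (fun y => ∫ s in Set.Ici t, uu G t s y) ξ) x‖ₑ ^ 2 * ENNReal.ofReal ‖V x‖ = 0 := by
          intro t
          refine lintegral_eq_zero_of_ae_eq_zero ?_
          filter_upwards [hV0] with x hx
          simp [hx]
        simp only [h0]
        simp
      rw [this]
      exact zero_le
    · have hNp : 0 < N := lt_of_le_of_ne hN0 (Ne.symm hN00)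
      have : ENNReal.ofReal (Real.sqrt C) * ENNReal.ofReal N ^ ((1:ℝ) / 2) * (∫⁻ s, gS r' q' G s) ^ (1 / q') = ⊤ := by
        rw [hfin, ENNReal.top_rpow_of_pos (by positivity), ENNReal.mul_top]
        refine mul_ne_zero ?_ ?_
        · simpa using hC
        · rw [Ne, ENNReal.rpow_eq_zero_iff_of_pos (by norm_num)]
          simpa using hNp
      rw [this]
      exact le_top
  · rw [hlhs]
    have hm := H (fun x => ‖V x‖) N hV.norm (fun x => norm_nonneg _) hN0 hMor G hS hG hR hfin
    refine (ENNReal.rpow_le_rpow hm (by norm_num)).trans (le_of_eq ?_)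
    rw [ENNReal.mul_rpow_of_nonneg _ _ (by norm_num), ENNReal.ofReal_mul hC.le, ENNReal.mul_rpow_of_nonneg _ _ (by norm_num),
      ← ENNReal.rpow_mul, ENNReal.ofReal_rpow_of_nonneg hC.le (by norm_num), Real.sqrt_eq_rpow]
    congr 2
    ring

end
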